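/- Let ∂G be piecewise analytic, with the smallest exterior angle λπ, 0 < λ < 2, at the junction points of its analytic arcs, and let √(φ'_ζ) denote an analytic branch on G of the square root of the derivative of the conformal map φ_ζ of G onto the unit disk D normalized at a point ζ in a compact set F ⊂ G. Then there exist a constant C > 0 (depending only on G and F) and, for each n ∈ ℕ, a polynomial Q_n of degree at most n, such that ‖√(φ'_ζ) − Q_n‖₂ ≤ C · n^{−λ/(4−2λ)}. -/

import Mathlib

open Complex MeasureTheory Set Filter Metric

noncomputable section

/-- A bounded Jordan domain `G ⊆ ℂ` whose boundary is a rectifiable Jordan curve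
of length `l`, given together with a unit-speed (arclength) parametrization `γ`
of the boundary curve `L = frontier G`. -/
structure JordanDomain where
  /-- the domain -/
  G : Set ℂ
  isOpen : IsOpen G
  nonempty : G.Nonempty
  bounded : Bornology.IsBounded G
  connected : IsConnected G
  simplyConnected : SimplyConnectedSpace ↥G
  /-- the length of the boundary curve -/
  l : ℝ
  l_pos : 0 < l
  /-- arclength parametrization of the boundary curve -/
  γ : ℝ → ℂ
  γ_cont : Continuous γ
  γ_periodic : Function.Periodic γ l
  γ_injOn : InjOn γ (Ico 0 l)
  γ_boundary : γ '' Ico 0 l = frontier G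
  /-- `γ` is a unit-speed (arclength) parametrization; in particular the boundary
  is rectifiable with length `l`. -/
  γ_unitSpeed : ∀ s t : ℝ, s ≤ t → t ≤ s + l →
    eVariationOn γ (Icc s t) = ENNReal.ofReal (t - s)

/-- The `E₂(G)`-norm of (the boundary trace of) a function, computed through the
arclength parametrization of the boundary: `‖g‖₂ = ((1/l) ∫₀^l ‖g(s)‖² ds)^{1/2}`. -/
def JordanDomain.bnorm (D : JordanDomain) (g : ℝ → ℂ) : ℝ :=
  Real.sqrt ((1 / D.l) * ∫ s in (0:ℝ)..D.l, ‖g s‖ ^ 2)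

/-- `p` is the sequence of orthonormal polynomials of `E₂(G)` obtained by Gram–Schmidt
orthonormalization of the monomials `1, z, z², …`: `deg p k = k`, the leading
coefficients are positive reals, and the polynomials are orthonormal with respect to
the arclength inner product `(f,g) = (1/l) ∫_L f conj(g) |dz|`. -/
def JordanDomain.IsONPolys (D : JordanDomain) (p : ℕ → Polynomial ℂ) : Prop :=
  (∀ k, (p k).natDegree = k) ∧
  (∀ k, ∃ c : ℝ, 0 < c ∧ (p k).leadingCoeff = (c : ℂ)) ∧
  (∀ j k, (1 / (D.l : ℂ)) * (∫ s in (0:ℝ)..D.l,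
      (p j).eval (D.γ s) * (starRingEnd ℂ) ((p k).eval (D.γ s))) =
    if j = k then 1 else 0)

/-- The `n`-th partial sum `Σ_{k=0}^n conj(p_k(ζ))·p_k(z)` of the Szegő kernel expansion. -/
def partialSum (p : ℕ → Polynomial ℂ) (ζ : ℂ) (n : ℕ) : ℂ → ℂ := fun z =>
  ∑ k ∈ Finset.range (n + 1), (starRingEnd ℂ) ((p k).eval ζ) * (p k).eval z

/-- The Szegő kernel `K(z,ζ) = Σ_{k=0}^∞ conj(p_k(ζ))·p_k(z)`. -/
def szegoKernel (p : ℕ → Polynomial ℂ) (ζ z : ℂ) : ℂ :=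
  ∑' k : ℕ, (starRingEnd ℂ) ((p k).eval ζ) * (p k).eval z

/-- The approximating polynomials
`J_{2n+1}(z) = (2π/l)·(∫_ζ^z (Σ_{k=0}^n conj(p_k(ζ))p_k(t))² dt) / (Σ_{k=0}^n |p_k(ζ)|²)`;
the (path-independent) integral of the polynomial integrand is written out explicitly,
using `∫_ζ^z t^i dt = (z^{i+1} - ζ^{i+1})/(i+1)`. -/
def Jfun (D : JordanDomain) (p : ℕ → Polynomial ℂ) (ζ : ℂ) (n : ℕ) : ℂ → ℂ := fun z =>
  let S : Polynomial ℂ :=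
    (∑ k ∈ Finset.range (n + 1), Polynomial.C ((starRingEnd ℂ) ((p k).eval ζ)) * p k) ^ 2
  (((2 * Real.pi / D.l : ℝ) : ℂ) / (∑ k ∈ Finset.range (n + 1), ((‖(p k).eval ζ‖ : ℂ)) ^ 2)) *
    ∑ i ∈ Finset.range (S.natDegree + 1),
      S.coeff i * ((z ^ (i + 1) - ζ ^ (i + 1)) / ((i : ℂ) + 1))

/-- `Q_n(z) = ((l/2π)·Σ_{k=0}^n |p_k(ζ)|²)^{-1/2} · Σ_{k=0}^n conj(p_k(ζ))·p_k(z)`,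
so that `J'_{2n+1} = Q_n²`. -/
def Qfun (D : JordanDomain) (p : ℕ → Polynomial ℂ) (ζ : ℂ) (n : ℕ) : ℂ → ℂ := fun z =>
  ((Real.sqrt ((D.l / (2 * Real.pi)) *
      ∑ k ∈ Finset.range (n + 1), ‖(p k).eval ζ‖ ^ 2) : ℝ) : ℂ)⁻¹ * partialSum p ζ n z

/-- The sup norm `⨆_{z ∈ K} ‖f(z)‖` on a set `K ⊆ ℂ`. -/
def supNormOn (K : Set ℂ) (f : ℂ → ℂ) : ℝ := ⨆ z : K, ‖f (z : ℂ)‖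

/-- `g` has nontangential limit `v` at the boundary point `w` of `G`:
`g(z) → v` as `z → w` inside every cone `{z ∈ G : ‖z - w‖ ≤ M·dist(z, ∂G)}`. -/
def NTLim (G : Set ℂ) (g : ℂ → ℂ) (w v : ℂ) : Prop :=
  ∀ M : ℝ, 1 < M →
    Tendsto g (nhdsWithin w {z | z ∈ G ∧ ‖z - w‖ ≤ M * infDist z (frontier G)}) (nhds v)

/-- `φ` is the conformal map of `G` onto the unit disk `D` normalized by
`φ(ζ) = 0` and `φ'(ζ) > 0`. -/
structure ConformalOnto (G : Set ℂ) (φ : ℂ → ℂ) (ζ : ℂ) : Prop where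
  differentiable : ∀ z ∈ G, DifferentiableAt ℂ φ z
  bijOn : BijOn φ G (ball (0 : ℂ) 1)
  map_center : φ ζ = 0
  deriv_center_pos : ∃ c : ℝ, 0 < c ∧ deriv φ ζ = (c : ℂ)

/-- `G` is a Smirnov domain: for any conformal map `ψ` of the unit disk onto `G`,
`log|ψ'|` is represented by the Poisson integral of its (radial) boundary values.
(By the Keldysh–Lavrentiev theorem this is equivalent to polynomials being dense
in the Smirnov classes `E_p(G)`.) -/
def IsSmirnovDomain (G : Set ℂ) : Prop :=
  ∀ ψ : ℂ → ℂ,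
    (∀ w ∈ ball (0 : ℂ) 1, DifferentiableAt ℂ ψ w) →
    BijOn ψ (ball (0 : ℂ) 1) G →
    ∃ h : ℝ → ℝ,
      IntervalIntegrable h volume 0 (2 * Real.pi) ∧
      (∀ᵐ (θ : ℝ) ∂(volume.restrict (Ioc (0 : ℝ) (2 * Real.pi))),
        Tendsto (fun r : ℝ => Real.log ‖deriv ψ ((r : ℂ) * Complex.exp ((θ : ℂ) * Complex.I))‖)
          (nhdsWithin 1 (Iio 1)) (nhds (h θ))) ∧
      (∀ w ∈ ball (0 : ℂ) 1,
        Real.log ‖deriv ψ w‖ =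
          (1 / (2 * Real.pi)) * ∫ θ in (0 : ℝ)..(2 * Real.pi),
            ((1 - ‖w‖ ^ 2) / ‖Complex.exp ((θ : ℂ) * Complex.I) - w‖ ^ 2) * h θ)

/-- The (interior) opening angle of `G` at the boundary point `z₀` equals `a`:
the angular measure of the set of directions in which `G` is seen from `z₀`
at distance `r` tends to `a` as `r → 0⁺`. -/
def HasCornerAngle (G : Set ℂ) (z₀ : ℂ) (a : ℝ) : Prop :=
  Tendsto (fun r : ℝ =>
      (volume {θ : ℝ | θ ∈ Ico 0 (2 * Real.pi) ∧
        z₀ + (r : ℂ) * Complex.exp ((θ : ℂ) * Complex.I) ∈ G}).toReal)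
    (nhdsWithin 0 (Ioi 0)) (nhds a)

/-- The boundary of the Jordan domain `D` is piecewise analytic: it is a union of
finitely many analytic arcs `τ i '' [0,1]` (each `τ i` is conformal, i.e. injective
and holomorphic, on an open neighborhood `U i` of the segment `[0,1]`), consecutive
arcs are joined at the junction points `τ i 1 = τ (i+1) 0`, and at the junction
point `τ i 1` the exterior angle of `G` is `extAngle i · π` (so the interior
opening angle there is `(2 - extAngle i) · π`). -/
structure PiecewiseAnalyticBoundary (D : JordanDomain) where
  /-- number of analytic arcs -/
  m : ℕ
  m_pos : 0 < m
  /-- conformal parametrizations of the arcs -/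
  τ : Fin m → ℂ → ℂ
  /-- neighborhoods of the segment `[0,1]` on which the `τ i` are conformal -/
  U : Fin m → Set ℂ
  U_open : ∀ i, IsOpen (U i)
  seg_sub : ∀ i, (Complex.ofReal '' Icc (0 : ℝ) 1) ⊆ U i
  analytic : ∀ i, DifferentiableOn ℂ (τ i) (U i)
  inj : ∀ i, InjOn (τ i) (U i)
  cover : (⋃ i, τ i '' (Complex.ofReal '' Icc (0 : ℝ) 1)) = frontier D.G
  junction : ∀ i : Fin m,
    τ i 1 = τ (Fin.mk ((i.val + 1) % m) (Nat.mod_lt _ m_pos)) 0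
  /-- `extAngle i · π` is the exterior angle at the junction point `τ i 1` -/
  extAngle : Fin m → ℝ
  extAngle_mem : ∀ i, extAngle i ∈ Ioo (0 : ℝ) 2
  extAngle_spec : ∀ i, HasCornerAngle D.G (τ i 1) ((2 - extAngle i) * Real.pi)

end

/-- estimate (3.17). Let `∂G` be piecewise analytic with smallest
exterior angle `λπ`, `0 < λ < 2`, and let `F ⊆ G` be compact. For `ζ ∈ F` let `φ ζ`
be the conformal map of `G` onto the unit disk normalized at `ζ`, `g ζ` an analytic
branch of `√((φ ζ)')` on `G` with `g ζ ζ > 0`, and `gb ζ` its nontangential boundary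
trace. Then there are a constant `C > 0` (depending only on `G` and `F`) and, for
each `n ≥ 1`, polynomials `Q_n` of degree at most `n`, with
`‖√((φ ζ)') - Q_n‖₂ ≤ C·n^{-λ/(4-2λ)}`. -/

lemma A_maxPrinciple {U : Set ℂ} (hU : IsOpen U) (hb : Bornology.IsBounded U) {f : ℂ → ℂ}
    (hf : DifferentiableOn ℂ f U) {M : ℝ}
    (hM : ∀ p ∈ frontier U, ∀ M' > M, ∀ᶠ z in nhdsWithin p U, ‖f z‖ < M') :
    ∀ z ∈ U, ‖f z‖ ≤ M := by
  intro a ha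
  by_contra! hlt
  set K : Set ℂ := {z | z ∈ U ∧ ‖f a‖ ≤ ‖f z‖} with hK
  have hKU : K ⊆ U := fun z hz => hz.1
  have hKc : IsClosed K := by
    rw [← closure_subset_iff_isClosed]
    intro p hp
    have hpU : p ∈ closure U := closure_mono hKU hp
    have hfr : ∃ᶠ z in nhds p, z ∈ K := mem_closure_iff_frequently.1 hp
    by_cases hpu : p ∈ U
    · refine ⟨hpu, ?_⟩
      by_contra! h
      have hc : ContinuousAt f p := (hf.differentiableAt (hU.mem_nhds hpu)).continuousAt
      exact (hfr.and_eventually (hc.norm.eventually (gt_mem_nhds h))).exists.elim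
        fun z hz => absurd hz.2 (not_lt.2 hz.1.2)
    · have hpf : p ∈ frontier U := by rw [hU.frontier_eq]; exact ⟨hpU, hpu⟩
      have := eventually_nhdsWithin_iff.1 (hM p hpf _ hlt)
      obtain ⟨z, hz, hz'⟩ := (hfr.and_eventually this).exists
      exact absurd (hz' hz.1) (not_lt.2 hz.2)
  have hKcomp : IsCompact K := isCompact_of_isClosed_isBounded hKc (hb.subset hKU)
  obtain ⟨b, hbK, hbmax⟩ := hKcomp.exists_isMaxOn ⟨a, ha, le_rfl⟩
    ((hf.continuousOn.mono hKU).norm)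
  have hmaxU : ∀ z ∈ U, ‖f z‖ ≤ ‖f b‖ := fun z hz => by
    by_cases h : ‖f a‖ ≤ ‖f z‖
    · exact hbmax (show z ∈ K from ⟨hz, h⟩)
    · exact (not_le.1 h).le.trans hbK.2
  set S : Set ℂ := {z | z ∈ U ∧ ‖f z‖ = ‖f b‖} with hS
  have hSK : S ⊆ K := fun z hz => ⟨hz.1, by rw [hz.2]; exact hbK.2⟩
  have hSo : IsOpen S := by
    rw [isOpen_iff_mem_nhds]
    intro z hz
    have hd : ∀ᶠ y in nhds z, DifferentiableAt ℂ f y := by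
      filter_upwards [hU.mem_nhds hz.1] with y hy using hf.differentiableAt (hU.mem_nhds hy)
    have hm : IsLocalMax (norm ∘ f) z := by
      filter_upwards [hU.mem_nhds hz.1] with y hy
      simpa [hz.2] using hmaxU y hy
    filter_upwards [Complex.norm_eventually_eq_of_isLocalMax hd hm, hU.mem_nhds hz.1] with y hy hyU
    exact ⟨hyU, hy.trans hz.2⟩
  have hSc : IsClosed S := by
    have : S = K ∩ (fun z => ‖f z‖) ⁻¹' {‖f b‖} := by
      ext z; constructor
      · exact fun h => ⟨hSK h, h.2⟩
      · exact fun h => ⟨h.1.1, h.2⟩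
    rw [this]
    exact ((hf.continuousOn.mono hKU).norm).preimage_isClosed_of_isClosed hKc isClosed_singleton
  have hne : S.Nonempty := ⟨b, hKU hbK, rfl⟩
  have huniv : S = univ := IsClopen.eq_univ ⟨hSc, hSo⟩ hne
  have : IsCompact (univ : Set ℂ) := huniv ▸ hKcomp.of_isClosed_subset hSc hSK
  exact noncompact_univ ℂ this

lemma A_deriv_ne_zero {U : Set ℂ} (hU : IsOpen U) {f : ℂ → ℂ}
    (hf : DifferentiableOn ℂ f U) (hinj : InjOn f U) {a : ℂ} (ha : a ∈ U) : deriv f a ≠ 0 := by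
  have han : AnalyticAt ℂ f a := hf.analyticAt (hU.mem_nhds ha)
  have hnc : analyticOrderAt (fun z => f z - f a) a ≠ ⊤ := by
    intro h
    rw [analyticOrderAt_eq_top] at h
    have h2 : ∀ᶠ z in nhdsWithin a {a}ᶜ, z ∈ U ∧ f z - f a = 0 ∧ z ≠ a := by
      filter_upwards [nhdsWithin_le_nhds (hU.mem_nhds ha), nhdsWithin_le_nhds h,
        self_mem_nhdsWithin] with z h1 h2 h3 using ⟨h1, h2, h3⟩
    obtain ⟨z, h1, h2, h3⟩ := h2.exists
    exact h3 (hinj h1 ha (sub_eq_zero.1 h2))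
  have hana : AnalyticAt ℂ (fun z => f z - f a) a := han.sub analyticAt_const
  obtain ⟨g, hg, hga, hfg⟩ := (hana.analyticOrderAt_ne_top).1 hnc
  set k := analyticOrderNatAt (fun z => f z - f a) a with hk
  have hk0 : k ≠ 0 := by
    intro h0
    have := hfg.self_of_nhds
    rw [h0] at this
    simp at this
    exact hga this.symm
  -- k-th root
  obtain ⟨c, hc⟩ := IsAlgClosed.exists_pow_nat_eq (g a) (Nat.pos_of_ne_zero hk0)
  have hc0 : c ≠ 0 := by rintro rfl; rw [zero_pow hk0] at hc; exact hga hc.symm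
  set r : ℂ → ℂ := fun z => c * exp (log (g z / g a) / k) with hr
  have hra : AnalyticAt ℂ r a := by
    refine analyticAt_const.mul (AnalyticAt.cexp' (AnalyticAt.div_const ?_))
    refine AnalyticAt.clog (hg.div_const) ?_
    rw [div_self hga]; simp
  have hrk : ∀ᶠ z in nhds a, r z ^ k = g z := by
    filter_upwards [hg.continuousAt.eventually_ne hga] with z hz
    have hkc : (k : ℂ) ≠ 0 := Nat.cast_ne_zero.2 hk0
    simp only [hr, mul_pow, hc, ← Complex.exp_nat_mul]
    rw [mul_div_cancel₀ _ hkc, exp_log (div_ne_zero hz hga), mul_div_cancel₀ _ hga]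
  set s : ℂ → ℂ := fun z => (z - a) * r z with hs
  have hsa : AnalyticAt ℂ s a := (analyticAt_id.sub analyticAt_const).mul hra
  have hrane : r a ≠ 0 := by
    simp [hr, div_self hga, hc0]
  have hsd : HasStrictDerivAt s (r a) a := by
    have h1 : HasStrictDerivAt (fun z : ℂ => z - a) 1 a := (hasStrictDerivAt_id a).sub_const a
    have h2 : HasStrictDerivAt r (deriv r a) a := hra.hasStrictDerivAt
    have h3 := h1.mul h2
    simp only [sub_self, zero_mul, add_zero, one_mul] at h3
    exact h3
  have hmap := hsd.map_nhds_eq hrane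
  have hs0 : s a = 0 := by simp [hs]
  have hfs : ∀ᶠ z in nhds a, f z - f a = s z ^ k := by
    filter_upwards [hfg, hrk] with z h1 h2
    rw [h1, hs, mul_pow, h2, smul_eq_mul]
  by_cases hk1 : k = 1
  · have h3 : HasDerivAt (fun z => f z - f a) (r a) a := by
      have := hsd.hasDerivAt
      refine this.congr_of_eventuallyEq ?_
      filter_upwards [hfs] with z hz
      rw [hz, hk1, pow_one]
    have h4 : deriv f a = r a := by
      have := h3.deriv
      rwa [deriv_sub_const] at this
    rw [h4]; exact hrane
  · exfalso
    have hk2 : 2 ≤ k := by omega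
    set W : Set ℂ := {z | z ∈ U ∧ f z - f a = s z ^ k}
    have hW : W ∈ nhds a := by filter_upwards [hU.mem_nhds ha, hfs] with z h1 h2 using ⟨h1, h2⟩
    have hsW : s '' W ∈ nhds (0:ℂ) := by
      rw [← hs0, ← hmap]; exact image_mem_map hW
    obtain ⟨ω, hω⟩ : ∃ ω : ℂ, IsPrimitiveRoot ω k := ⟨_, Complex.isPrimitiveRoot_exp k hk0⟩
    have hω1 : ω ≠ 1 := hω.ne_one (by omega)
    have hev : ∀ᶠ v in nhdsWithin (0:ℂ) {0}ᶜ, v ∈ s '' W ∧ ω * v ∈ s '' W ∧ v ≠ 0 := by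
      have hcont : Tendsto (fun v : ℂ => ω * v) (nhds 0) (nhds 0) := by
        have : Continuous (fun v : ℂ => ω * v) := by fun_prop
        simpa using this.tendsto 0
      filter_upwards [nhdsWithin_le_nhds hsW, nhdsWithin_le_nhds (hcont hsW),
        self_mem_nhdsWithin] with v h1 h2 h3 using ⟨h1, h2, h3⟩
    obtain ⟨v, ⟨z1, hz1, hv1⟩, ⟨z2, hz2, hv2⟩, hv0⟩ := hev.exists
    have : f z1 = f z2 := by
      have e1 := hz1.2
      have e2 := hz2.2
      rw [hv1] at e1
      rw [hv2, mul_pow, hω.pow_eq_one, one_mul, ← e1] at e2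
      exact (sub_left_inj.1 e2).symm
    have := hinj hz1.1 hz2.1 this
    rw [this, hv2] at hv1
    exact hω1 (mul_right_cancel₀ hv0 (by rw [hv1, one_mul]))

lemma A_morera {V : Set ℂ} (hV : IsOpen V) {f : ℂ → ℂ} (hc : ContinuousOn f V)
    (hd : ∀ z ∈ V, z.im ≠ 0 → DifferentiableAt ℂ f z) : DifferentiableOn ℂ f V := by
  have key : ∀ z w : ℂ, ((uIcc z.re w.re) ×ℂ (uIcc z.im w.im)) ⊆ V →
      (∀ y ∈ Ioo (min z.im w.im) (max z.im w.im), y ≠ 0) →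
      (∫ x : ℝ in z.re..w.re, f (x + z.im * I)) - (∫ x : ℝ in z.re..w.re, f (x + w.im * I)) +
      I • (∫ y : ℝ in z.im..w.im, f (re w + y * I)) -
      I • (∫ y : ℝ in z.im..w.im, f (re z + y * I)) = 0 := by
    intro z w h h0
    refine integral_boundary_rect_eq_zero_of_continuousOn_of_differentiableOn f z w (hc.mono h) ?_
    intro x hx
    refine (hd x (h ⟨Ioo_subset_Icc_self hx.1, Ioo_subset_Icc_self hx.2⟩)
      (h0 _ hx.2)).differentiableWithinAt
  have cons : IsConservativeOn f V := by
    intro z w hzw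
    have hzw' : ((uIcc z.re w.re) ×ℂ (uIcc z.im w.im)) ⊆ V := hzw
    rw [← add_eq_zero_iff_eq_neg, wedgeIntegral_add_wedgeIntegral_eq]
    by_cases h0 : (0:ℝ) ∈ Ioo (min z.im w.im) (max z.im w.im)
    · have hm : (0:ℝ) ∈ uIcc z.im w.im := Ioo_subset_Icc_self h0
      have s1 : uIcc z.im (0:ℝ) ⊆ uIcc z.im w.im := uIcc_subset_uIcc left_mem_uIcc hm
      have s2 : uIcc (0:ℝ) w.im ⊆ uIcc z.im w.im := uIcc_subset_uIcc hm right_mem_uIcc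
      have e1 := key z (⟨w.re, 0⟩) (fun x hx => hzw' ⟨hx.1, s1 hx.2⟩) (by
        rintro y hy rfl
        simp only at hy
        rcases le_total z.im 0 with h | h
        · rw [max_eq_right h] at hy; exact lt_irrefl _ hy.2
        · rw [min_eq_right h] at hy; exact lt_irrefl _ hy.1)
      have e2 := key (⟨z.re, 0⟩) w (fun x hx => hzw' ⟨hx.1, s2 hx.2⟩) (by
        rintro y hy rfl
        simp only at hy
        rcases le_total 0 w.im with h | h
        · rw [min_eq_left h] at hy; exact lt_irrefl _ hy.1
        · rw [max_eq_left h] at hy; exact lt_irrefl _ hy.2)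
      have ci : ∀ a : ℝ, a ∈ uIcc z.re w.re → ∀ c d : ℝ, uIcc c d ⊆ uIcc z.im w.im →
          IntervalIntegrable (fun y : ℝ => f (a + y * I)) volume c d := by
        intro a ha c d hcd
        apply ContinuousOn.intervalIntegrable
        refine hc.comp (by fun_prop) ?_
        intro y hy
        exact hzw' ⟨by simpa using ha, by simpa using hcd hy⟩
      rw [← intervalIntegral.integral_add_adjacent_intervals (ci w.re right_mem_uIcc _ _ s1)
        (ci w.re right_mem_uIcc _ _ s2),
        ← intervalIntegral.integral_add_adjacent_intervals (ci z.re left_mem_uIcc _ _ s1)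
        (ci z.re left_mem_uIcc _ _ s2)]
      simp only [smul_eq_mul] at e1 e2 ⊢
      linear_combination e1 + e2
    · exact key z w hzw' (fun y hy h => h0 (h ▸ hy))
  intro z hz
  obtain ⟨r, hr, hb⟩ := Metric.isOpen_iff.1 hV z hz
  have h1 := (cons.mono hb).isExactOn_ball (hc.mono hb)
  exact ((h1.differentiableOn isOpen_ball).differentiableAt
    (ball_mem_nhds z hr)).differentiableWithinAt

/-- derivative bound from Borel–Carathéodory -/
lemma A_deriv_bound {f : ℂ → ℂ} {w : ℂ} {R M : ℝ} (hR : 0 < R) (hM : 0 ≤ M)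
    (hf : DifferentiableOn ℂ f (ball w R))
    (hb : ∀ z ∈ ball w R, (f z).im - (f w).im ≥ - M) : ‖deriv f w‖ ≤ 2 * M / R := by
  have hfw : HasDerivAt f (deriv f w) w :=
    (hf.differentiableAt (ball_mem_nhds w hR)).hasDerivAt
  refine le_of_forall_gt_imp_ge_of_dense fun C hC => ?_
  obtain ⟨M', hM'1, hM'2⟩ : ∃ M', M < M' ∧ 2 * M' / R < C := by
    refine ⟨(M + C * R / 2) / 2, ?_, ?_⟩
    · rw [div_lt_iff₀ hR] at hC; linarith
    · rw [div_lt_iff₀ hR] at hC ⊢; linarith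
  have hM'0 : 0 < M' := lt_of_le_of_lt hM hM'1
  set h : ℂ → ℂ := fun z => I * (f (w + z) - f w) with hh
  have hh0 : h 0 = 0 := by simp [hh]
  have hmem : ∀ z ∈ ball (0:ℂ) R, w + z ∈ ball w R := by
    intro z hz; simpa using hz
  have hhd : DifferentiableOn ℂ h (ball 0 R) := by
    refine (DifferentiableOn.sub_const ?_ _).const_mul I
    exact hf.comp (by fun_prop) hmem
  have hbd : ∀ z ∈ ball (0:ℂ) R, ‖h z‖ ≤ 2 * M' * ‖z‖ / (R - ‖z‖) := by
    intro z hz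
    refine borelCaratheodory_zero hM'0 hhd ?_ hR hz hh0
    intro y hy
    have := hb _ (hmem y hy)
    simp only [mem_ofPred_eq, hh, mul_re, I_re, I_im, zero_mul, one_mul, sub_im]
    linarith
  have hder : HasDerivAt h (I * deriv f w) 0 := by
    have h1 : HasDerivAt (fun z => f (w + z)) (deriv f w) 0 := by
      have : HasDerivAt f (deriv f w) (w + 0) := by simpa using hfw
      simpa using this.comp_const_add w 0
    exact (h1.sub_const (f w)).const_mul I
  have hlim : Tendsto (fun z => ‖z⁻¹ * h z‖) (nhdsWithin 0 {0}ᶜ) (nhds ‖deriv f w‖) := by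
    have := (hasDerivAt_iff_tendsto_slope_zero.1 hder).norm
    simpa [hh0] using this
  have hlim2 : Tendsto (fun z : ℂ => 2 * M' / (R - ‖z‖)) (nhdsWithin 0 {0}ᶜ)
      (nhds (2 * M' / R)) := by
    have : ContinuousAt (fun z : ℂ => 2 * M' / (R - ‖z‖)) 0 := by
      refine ContinuousAt.div (by fun_prop) (by fun_prop) (by simpa using hR.ne')
    have h2 := this.tendsto
    simp only [norm_zero, sub_zero] at h2
    exact h2.mono_left nhdsWithin_le_nhds
  refine (le_of_tendsto_of_tendsto hlim hlim2 ?_).trans hM'2.le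
  filter_upwards [nhdsWithin_le_nhds (ball_mem_nhds (0:ℂ) hR), self_mem_nhdsWithin] with z hz hz0
  have hz0' : 0 < ‖z‖ := norm_pos_iff.2 hz0
  rw [norm_mul, norm_inv]
  calc ‖z‖⁻¹ * ‖h z‖ ≤ ‖z‖⁻¹ * (2 * M' * ‖z‖ / (R - ‖z‖)) := by
        gcongr; exact hbd z hz
    _ = 2 * M' / (R - ‖z‖) := by field_simp

lemma A_barrier {f : ℂ → ℂ} {t δ M : ℝ} (hδ : 0 < δ) (hM : 0 ≤ M)
    (hf : DifferentiableOn ℂ f (ball (t:ℂ) δ ∩ {w | 0 < w.im}))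
    (hb : ∀ w ∈ ball (t:ℂ) δ ∩ {w | 0 < w.im}, (f w).im ≤ M)
    (h0 : ∀ p ∈ closedBall (t:ℂ) δ, p.im = 0 →
      Tendsto (fun w => (f w).im) (nhdsWithin p (ball (t:ℂ) δ ∩ {w | 0 < w.im})) (nhds 0)) :
    ∀ y : ℝ, 0 < y → y < δ → (f (t + y * I)).im ≤ 2 * M / δ * y := by
  set U : Set ℂ := ball (t:ℂ) δ ∩ {w | 0 < w.im} with hU
  have hUo : IsOpen U := isOpen_ball.inter (isOpen_lt continuous_const continuous_im)
  set B : ℝ := M / δ ^ 2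
  set A : ℝ := 2 * M / δ
  have hB : 0 ≤ B := by positivity
  have hA : A = 2 * B * δ := by simp only [A, B]; field_simp
  set V : ℂ → ℂ := fun w => -I * A * (w - t) + B * (w - t) ^ 2 with hV
  have hVre : ∀ w : ℂ, (V w).re = A * w.im + B * ((w.re - t) ^ 2 - w.im ^ 2) := by
    intro w; simp [hV, sq]
  have hVc : Continuous V := by fun_prop
  have hn : ∀ w, ‖exp (-I * f w - V w)‖ = Real.exp ((f w).im - (V w).re) := by
    intro w; rw [norm_exp]; simp
  have key : ∀ z ∈ U, ‖exp (-I * f z - V z)‖ ≤ 1 := by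
    refine A_maxPrinciple hUo (isBounded_ball.subset inter_subset_left) ?_ ?_
    · have : DifferentiableOn ℂ V U := by fun_prop
      exact ((hf.const_mul _).sub this).cexp
    · intro p hp M' hM'
      have hpU : p ∈ closure U := frontier_subset_closure hp
      have hpb : p ∈ closedBall (t:ℂ) δ :=
        closure_ball_subset_closedBall (closure_mono inter_subset_left hpU)
      have hpim : 0 ≤ p.im := by
        have h1 : closure U ⊆ {w : ℂ | 0 ≤ w.im} :=
          closure_minimal (fun w hw => le_of_lt (show 0 < w.im from hw.2)) (isClosed_le continuous_const continuous_im)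
        exact h1 hpU
      have hVt : Tendsto (fun w => (V w).re) (nhdsWithin p U) (nhds (V p).re) :=
        ((continuous_re.comp hVc).tendsto p).mono_left nhdsWithin_le_nhds
      have hM'e : ∀ x : ℝ, x < Real.log M' → Real.exp x < M' := fun x hx => by
        rwa [Real.lt_log_iff_exp_lt (by linarith)] at hx
      have hlog : 0 < Real.log M' := Real.log_pos hM'
      simp only [hn]
      rcases hpim.eq_or_lt with h | h
      · have h1 := (h0 p hpb h.symm).sub hVt
        have h2 : (0:ℝ) - (V p).re < Real.log M' := by
          rw [hVre, ← h]
          have : 0 ≤ B * (p.re - t) ^ 2 := by positivity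
          simp; linarith
        filter_upwards [h1.eventually (gt_mem_nhds h2)] with z hz using hM'e _ hz
      · have hpn : p ∉ ball (t:ℂ) δ := by
          intro hpb'
          rw [hUo.frontier_eq] at hp
          exact hp.2 ⟨hpb', h⟩
        have hd : (p.re - t) ^ 2 + p.im ^ 2 = δ ^ 2 := by
          have e : dist p t = δ := le_antisymm hpb (not_lt.1 hpn)
          rw [dist_eq, ← Real.sqrt_sq hδ.le, norm_def, Real.sqrt_inj (normSq_nonneg _) (sq_nonneg _),
            normSq_apply] at e
          simp at e; nlinarith
        have hpy : p.im ≤ δ := by nlinarith [sq_nonneg (p.re - t)]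
        have h2 : M ≤ (V p).re := by
          rw [hVre, hA]
          have e1 : (p.re - t) ^ 2 - p.im ^ 2 = δ ^ 2 - 2 * p.im ^ 2 := by linarith
          have e2 : M = B * δ ^ 2 := by simp only [B]; field_simp
          rw [e1, e2]
          nlinarith [mul_nonneg (mul_nonneg hB h.le) (sub_nonneg.2 hpy)]
        have h3 : M - (V p).re < Real.log M' := by linarith
        have h4 : Tendsto (fun w => M - (V w).re) (nhdsWithin p U) (nhds (M - (V p).re)) :=
          tendsto_const_nhds.sub hVt
        filter_upwards [h4.eventually (gt_mem_nhds h3), self_mem_nhdsWithin] with z hz hzU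
        exact hM'e _ (lt_of_le_of_lt (by linarith [hb z hzU]) hz)
  intro y hy0 hyδ
  have hm : (t + y * I : ℂ) ∈ U := by
    refine ⟨?_, by simpa using hy0⟩
    simp [abs_of_pos hy0, hyδ]
  have := key _ hm
  rw [hn, Real.exp_le_one_iff, hVre] at this
  simp at this
  nlinarith [mul_nonneg hB (sq_nonneg y)]

lemma A_local_lip {f : ℂ → ℂ} {V : Set ℂ} (hV : IsOpen V)
    (hf : DifferentiableOn ℂ f (V ∩ {w | 0 < w.im}))
    (hpos : ∀ w ∈ V ∩ {w | 0 < w.im}, 0 < (f w).im)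
    (h0 : ∀ p ∈ V, p.im = 0 →
      Tendsto (fun w => (f w).im) (nhdsWithin p (V ∩ {w | 0 < w.im})) (nhds 0))
    {p : ℂ} (hp : p ∈ V) (hp0 : p.im = 0) :
    ∃ y : ℂ, Tendsto f (nhdsWithin p (V ∩ {w | 0 < w.im})) (nhds y) := by
  have hVo : IsOpen (V ∩ {w : ℂ | 0 < w.im}) :=
    hV.inter (isOpen_lt continuous_const continuous_im)
  obtain ⟨r, hr, hrV, hru⟩ : ∃ r > 0, ball p r ⊆ V ∧
      ∀ w ∈ ball p r, 0 < w.im → (f w).im ≤ 1 := by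
    have h1 := (h0 p hp hp0).eventually (gt_mem_nhds (zero_lt_one))
    rw [eventually_nhdsWithin_iff] at h1
    obtain ⟨r, hr, h⟩ := Metric.mem_nhds_iff.1 (inter_mem (hV.mem_nhds hp) h1)
    exact ⟨r, hr, fun w hw => (h hw).1, fun w hw h' => ((h hw).2 ⟨(h hw).1, h'⟩).le⟩
  set δ := r / 4 with hδ
  have hδ0 : 0 < δ := by positivity
  set H : Set ℂ := ball p δ ∩ {w | 0 < w.im} with hH
  have hHsub : H ⊆ V ∩ {w | 0 < w.im} := fun w hw =>
    ⟨hrV (ball_subset_ball (by linarith) hw.1), hw.2⟩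
  have hbound : ∀ w ∈ H, ‖deriv f w‖ ≤ 4 / δ := by
    intro w hw
    have hwim : 0 < w.im := hw.2
    have hdw : dist w p < δ := hw.1
    have habs : |(w - p).im| ≤ ‖w - p‖ := abs_im_le_norm _
    have habs2 : |(w - p).re| ≤ ‖w - p‖ := abs_re_le_norm _
    rw [dist_eq] at hdw
    have hwy : w.im < δ := by
      rw [sub_im, hp0, sub_zero, abs_of_pos hwim] at habs; linarith
    have hsub : ball (w.re : ℂ) δ ⊆ ball p r := by
      refine ball_subset_ball' ?_
      have : dist (w.re : ℂ) p ≤ ‖w - p‖ := by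
        have hpe : p = (p.re : ℂ) := by apply Complex.ext <;> simp [hp0]
        rw [hpe, dist_eq, ← ofReal_sub, norm_real, ← hpe]
        simpa using habs2
      linarith
    have hsub' : closedBall (w.re : ℂ) δ ⊆ V := by
      intro q hq
      refine hrV (mem_ball.2 ?_)
      have : dist (w.re : ℂ) p ≤ ‖w - p‖ := by
        have hpe : p = (p.re : ℂ) := by apply Complex.ext <;> simp [hp0]
        rw [hpe, dist_eq, ← ofReal_sub, norm_real, ← hpe]
        simpa using habs2
      have h2 := dist_triangle q (w.re : ℂ) p
      have h3 : dist q (w.re:ℂ) ≤ δ := hq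
      linarith
    have hb := A_barrier (f := f) (t := w.re) hδ0 zero_le_one
      (hf.mono fun q hq => ⟨hrV (hsub hq.1), hq.2⟩)
      (fun q hq => hru q (hsub hq.1) hq.2)
      (fun q hq hq0 => (h0 q (hsub' hq) hq0).mono_left
        (nhdsWithin_mono _ fun x hx => ⟨hrV (hsub hx.1), hx.2⟩)) w.im hwim hwy
    rw [re_add_im] at hb
    have hball : ball w w.im ⊆ V ∩ {w | 0 < w.im} := by
      intro q hq
      have hq' : ‖q - w‖ < w.im := by rw [← dist_eq]; exact hq
      have h1 := abs_le.1 ((abs_im_le_norm (q - w)))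
      refine ⟨hrV (mem_ball.2 ?_), ?_⟩
      · have h2 := dist_triangle q w p
        rw [dist_eq q w, dist_eq w p] at h2
        linarith
      · show 0 < q.im
        have := h1.1; rw [sub_im] at this; linarith
    have := A_deriv_bound (f := f) (w := w) (M := (f w).im) hwim (hpos w (hHsub hw)).le
      (hf.mono hball) (fun z hz => by linarith [hpos z (hball hz)])
    refine this.trans ?_
    rw [div_le_iff₀ hwim]
    calc 2 * (f w).im ≤ 2 * (2 * 1 / δ * w.im) := by linarith
      _ = 4 / δ * w.im := by ring
  have hHc : Convex ℝ H := (convex_ball p δ).inter (convex_halfSpace_im_gt 0)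
  have hlip : LipschitzOnWith (Real.toNNReal (4 / δ)) f H := by
    refine hHc.lipschitzOnWith_of_nnnorm_deriv_le
      (fun w hw => hf.differentiableAt (hVo.mem_nhds (hHsub hw))) (fun w hw => ?_)
    rw [← NNReal.coe_le_coe, Real.coe_toNNReal _ (by positivity), coe_nnnorm]
    exact hbound w hw
  obtain ⟨g, hg, hfg⟩ := hlip.extend_finite_dimension
  refine ⟨g p, ?_⟩
  have h1 : Tendsto g (nhdsWithin p (V ∩ {w | 0 < w.im})) (nhds (g p)) :=
    (hg.continuous.tendsto p).mono_left nhdsWithin_le_nhds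
  refine h1.congr' ?_
  filter_upwards [nhdsWithin_le_nhds (ball_mem_nhds p hδ0), self_mem_nhdsWithin] with w hw hw'
  exact (hfg ⟨hw, hw'.2⟩).symm

lemma A_reflect {f : ℂ → ℂ} {V : Set ℂ} (hV : IsOpen V)
    (hVs : ∀ w ∈ V, (starRingEnd ℂ) w ∈ V)
    (hf : DifferentiableOn ℂ f (V ∩ {w | 0 < w.im}))
    (hpos : ∀ w ∈ V ∩ {w | 0 < w.im}, 0 < (f w).im)
    (h0 : ∀ p ∈ V, p.im = 0 →
      Tendsto (fun w => (f w).im) (nhdsWithin p (V ∩ {w | 0 < w.im})) (nhds 0)) :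
    ∃ g : ℂ → ℂ, DifferentiableOn ℂ g V ∧ (∀ w ∈ V, 0 < w.im → g w = f w) ∧
      (∀ w ∈ V, g ((starRingEnd ℂ) w) = (starRingEnd ℂ) (g w)) := by
  set A : Set ℂ := V ∩ {w | 0 < w.im} with hA
  set B : Set ℂ := V ∩ {w | 0 ≤ w.im} with hB
  have hAo : IsOpen A := hV.inter (isOpen_lt continuous_const continuous_im)
  have hBA : B ⊆ closure A := by
    rintro w ⟨hw, hw0⟩
    rw [hA, mem_closure_iff_frequently]
    have ht : Tendsto (fun y : ℝ => w + y * I) (nhdsWithin 0 (Ioi 0)) (nhds w) := by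
      have : Continuous (fun y : ℝ => w + y * I) := by fun_prop
      have h2 := this.tendsto 0
      simp only [ofReal_zero, zero_mul, add_zero] at h2
      exact h2.mono_left nhdsWithin_le_nhds
    refine ht.frequently (Eventually.frequently ?_)
    filter_upwards [ht (hV.mem_nhds hw), self_mem_nhdsWithin] with y hy hy0
    refine ⟨hy, ?_⟩
    have h0' : 0 ≤ w.im := hw0
    have h1 : (0:ℝ) < y := hy0
    simp; linarith
  have hlim : ∀ x ∈ B, ∃ y, Tendsto f (nhdsWithin x A) (nhds y) := by
    rintro w ⟨hw, hw0⟩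
    have hw0' : 0 ≤ w.im := hw0
    rcases hw0'.eq_or_lt with h | h
    · exact A_local_lip hV hf hpos h0 hw h.symm
    · exact ⟨f w, ((hf.differentiableAt (hAo.mem_nhds ⟨hw, h⟩)).continuousAt).tendsto.mono_left
        nhdsWithin_le_nhds⟩
  set E := extendFrom A f with hE
  have hEc : ContinuousOn E B := continuousOn_extendFrom hBA hlim
  have hEA : ∀ w ∈ A, E w = f w := fun w hw =>
    extendFrom_eq (subset_closure hw)
      (((hf.differentiableAt (hAo.mem_nhds hw)).continuousAt).tendsto.mono_left nhdsWithin_le_nhds)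
  have hEim : ∀ w ∈ V, w.im = 0 → (E w).im = 0 := by
    intro w hw hw0
    have h1 := tendsto_extendFrom (hlim w ⟨hw, hw0.ge⟩)
    have h2 := (continuous_im.tendsto _).comp h1
    have : (nhdsWithin w A).NeBot := mem_closure_iff_nhdsWithin_neBot.1 (hBA ⟨hw, hw0.ge⟩)
    exact tendsto_nhds_unique h2 (h0 w hw hw0)
  set g : ℂ → ℂ := fun w => if 0 ≤ w.im then E w else (starRingEnd ℂ) (E ((starRingEnd ℂ) w))
    with hg
  have hgs : ∀ w ∈ V, g ((starRingEnd ℂ) w) = (starRingEnd ℂ) (g w) := by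
    intro w hw
    simp only [hg, conj_im, conj_conj]
    rcases lt_trichotomy w.im 0 with h | h | h
    · rw [if_pos (by linarith), if_neg (by linarith), conj_conj]
    · have hc : (starRingEnd ℂ) w = w := conj_eq_iff_im.2 h
      rw [if_pos (by linarith), if_pos h.ge, hc, eq_comm, conj_eq_iff_im]
      exact hEim w hw h
    · rw [if_neg (by linarith), if_pos h.le]
  have hgB : EqOn g E B := fun w hw => if_pos hw.2
  have hgcB : ContinuousOn g B := hEc.congr hgB
  have hgB' : ContinuousOn g (V ∩ {w | w.im ≤ 0}) := by
    have : ContinuousOn (fun w => (starRingEnd ℂ) (g ((starRingEnd ℂ) w))) (V ∩ {w | w.im ≤ 0}) := by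
      refine continuous_conj.comp_continuousOn (hgcB.comp continuous_conj.continuousOn ?_)
      intro w hw
      refine ⟨hVs w hw.1, ?_⟩
      have : w.im ≤ 0 := hw.2
      simpa using this
    refine this.congr fun w hw => ?_
    show g w = (starRingEnd ℂ) (g ((starRingEnd ℂ) w))
    rw [hgs w hw.1, conj_conj]
  have hgc : ContinuousOn g V := by
    intro w hw
    have hu : V = B ∪ (V ∩ {w | w.im ≤ 0}) := by
      ext z; constructor
      · intro hz
        rcases le_total 0 z.im with h | h
        · exact Or.inl ⟨hz, h⟩
        · exact Or.inr ⟨hz, h⟩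
      · rintro (h | h) <;> exact h.1
    have h1 : ContinuousWithinAt g B w := by
      by_cases h : 0 ≤ w.im
      · exact hgcB w ⟨hw, h⟩
      · refine continuousWithinAt_of_notMem_closure fun hcl => h ?_
        exact (closure_minimal inter_subset_right (isClosed_le continuous_const continuous_im)) hcl
    have h2 : ContinuousWithinAt g (V ∩ {w | w.im ≤ 0}) w := by
      by_cases h : w.im ≤ 0
      · exact hgB' w ⟨hw, h⟩
      · refine continuousWithinAt_of_notMem_closure fun hcl => h ?_
        exact (closure_minimal inter_subset_right (isClosed_le continuous_im continuous_const)) hcl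
    rw [hu]
    exact h1.union h2
  have hup : ∀ w ∈ V, 0 < w.im → DifferentiableAt ℂ g w := by
    intro w hw h
    refine (hf.differentiableAt (hAo.mem_nhds ⟨hw, h⟩)).congr_of_eventuallyEq ?_
    filter_upwards [hAo.mem_nhds ⟨hw, h⟩] with z hz
    rw [← hEA z hz]; exact hgB ⟨hz.1, le_of_lt (show 0 < z.im from hz.2)⟩
  refine ⟨g, A_morera hV hgc ?_, ?_, hgs⟩
  · intro w hw h
    rcases lt_or_gt_of_ne h with h | h
    · have h1 := hup _ (hVs w hw) (by simpa using h)
      have h2 : DifferentiableAt ℂ ((starRingEnd ℂ) ∘ g ∘ (starRingEnd ℂ)) w := by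
        simpa using h1.conj_conj
      refine h2.congr_of_eventuallyEq ?_
      filter_upwards [hV.mem_nhds hw] with z hz
      simp [hgs z hz]
    · exact hup w hw h
  · intro w hw h
    rw [← hEA w ⟨hw, h⟩]; exact hgB ⟨hw, h.le⟩

lemma A_log {V : Set ℂ} (hV : IsOpen V) (hc : Convex ℝ V) (hne : V.Nonempty) {q : ℂ → ℂ}
    (hq : DifferentiableOn ℂ q V) (h0 : ∀ z ∈ V, q z ≠ 0) :
    ∃ f : ℂ → ℂ, DifferentiableOn ℂ f V ∧ ∀ z ∈ V, exp (f z) = q z := by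
  have hs : IsSimplyConnected V := by
    have := hc.contractibleSpace hne
    exact (inferInstance : SimplyConnectedSpace V)
  obtain ⟨f, hf, he⟩ := exists_continuousOn_eqOn_exp_comp hs hV hq.continuousOn
    (by rintro ⟨z, hz, h⟩; exact h0 z hz h)
  refine ⟨f, fun z hz => DifferentiableAt.differentiableWithinAt ?_, he⟩
  have hcz : ContinuousAt f z := hf.continuousAt (hV.mem_nhds hz)
  have h1 : DifferentiableAt ℂ (fun w => f z + log (q w / q z)) z := by
    refine (DifferentiableAt.clog ((hq.differentiableAt (hV.mem_nhds hz)).div_const _) ?_).const_add _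
    rw [div_self (h0 z hz)]; simp
  refine h1.congr_of_eventuallyEq ?_
  have h2 : ∀ᶠ w in nhds z, ‖f w - f z‖ < 1 := by
    have : Tendsto (fun w => ‖f w - f z‖) (nhds z) (nhds 0) := by
      simpa using (hcz.sub (continuousAt_const (y := f z))).norm.tendsto
    exact this.eventually (gt_mem_nhds one_pos)
  filter_upwards [h2, hV.mem_nhds hz] with w hw hwV
  have e1 : exp (f w) = q w := he hwV
  have e2 : exp (f z) = q z := he hz
  have h3 := abs_lt.1 (lt_of_le_of_lt (abs_im_le_norm (f w - f z)) hw)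
  rw [← e1, ← e2, ← exp_sub, log_exp (by linarith [h3.1, Real.pi_gt_three])
    (by linarith [h3.2, Real.pi_gt_three])]
  ring

lemma A_nhds_im (N : Set ℂ) (p : ℂ) (hN : N ∈ nhds p) (hp : 0 ≤ p.im) : ∃ q ∈ N, 0 < q.im := by
  have ht : Tendsto (fun y : ℝ => p + y * I) (nhdsWithin 0 (Ioi 0)) (nhds p) := by
    have : Continuous (fun y : ℝ => p + y * I) := by fun_prop
    have h2 := this.tendsto 0
    simp only [ofReal_zero, zero_mul, add_zero] at h2
    exact h2.mono_left nhdsWithin_le_nhds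
  obtain ⟨y, hy, hy0⟩ := ((ht.eventually hN).and self_mem_nhdsWithin).exists
  refine ⟨_, hy, ?_⟩
  have h1 : (0:ℝ) < y := hy0
  simp; linarith

lemma A_reflect_deriv {f g : ℂ → ℂ} {V : Set ℂ} (hV : IsOpen V)
    (hVs : ∀ w ∈ V, (starRingEnd ℂ) w ∈ V)
    (hpos : ∀ w ∈ V ∩ {w | 0 < w.im}, 0 < (f w).im)
    (hinj : InjOn f (V ∩ {w | 0 < w.im}))
    (hg : DifferentiableOn ℂ g V) (hgf : ∀ w ∈ V, 0 < w.im → g w = f w)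
    (hgs : ∀ w ∈ V, g ((starRingEnd ℂ) w) = (starRingEnd ℂ) (g w)) :
    ∀ w ∈ V, deriv g w ≠ 0 := by
  have p1 : ∀ w ∈ V, 0 < w.im → 0 < (g w).im := fun w hw h => by
    rw [hgf w hw h]; exact hpos w ⟨hw, h⟩
  have p2 : ∀ w ∈ V, w.im < 0 → (g w).im < 0 := fun w hw h => by
    have := p1 _ (hVs w hw) (by simpa using h)
    rw [hgs w hw] at this; simpa using this
  have p3 : ∀ w ∈ V, w.im = 0 → (g w).im = 0 := fun w hw h => by
    have := hgs w hw
    rw [conj_eq_iff_im.2 h] at this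
    exact conj_eq_iff_im.1 this.symm
  have i1 : ∀ a ∈ V, ∀ b ∈ V, 0 < a.im → 0 < b.im → g a = g b → a = b := by
    intro a ha b hb h1 h2 h
    rw [hgf a ha h1, hgf b hb h2] at h
    exact hinj ⟨ha, h1⟩ ⟨hb, h2⟩ h
  have hginj : InjOn g V := by
    intro a ha b hb hab
    rcases lt_trichotomy a.im 0 with h | h | h
    · have hb0 : b.im < 0 := by
        have := p2 a ha h
        rcases lt_trichotomy b.im 0 with h' | h' | h'
        · exact h'
        · have := p3 b hb h'; rw [← hab] at this; linarith
        · have := p1 b hb h'; rw [← hab] at this; linarith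
      have := i1 _ (hVs a ha) _ (hVs b hb) (by simpa using h) (by simpa using hb0)
        (by rw [hgs a ha, hgs b hb, hab])
      simpa using congrArg (starRingEnd ℂ) this
    · have hb0 : b.im = 0 := by
        have := p3 a ha h
        rcases lt_trichotomy b.im 0 with h' | h' | h'
        · have := p2 b hb h'; rw [← hab] at this; linarith
        · exact h'
        · have := p1 b hb h'; rw [← hab] at this; linarith
      by_contra hne
      obtain ⟨N1, N2, hN1, hN2, ha1, hb2, hdis⟩ := t2_separation hne
      have om : ∀ p ∈ V, p.im = 0 → nhds (g p) ≤ map g (nhds p) := by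
        intro p hp hp0
        rcases (hg.analyticAt (hV.mem_nhds hp)).eventually_constant_or_nhds_le_map_nhds with h | h
        · exfalso
          obtain ⟨q, hq, hq0⟩ := A_nhds_im _ p (inter_mem h (hV.mem_nhds hp)) hp0.ge
          have e1 := p1 q hq.2 hq0
          have e2 : g q = g p := hq.1
          rw [e2, p3 p hp hp0] at e1
          exact lt_irrefl _ e1
        · exact h
      have m1 : g '' (N1 ∩ V) ∈ nhds (g a) := om a ha h
        (image_mem_map (inter_mem (hN1.mem_nhds ha1) (hV.mem_nhds ha)))
      have m2 : g '' (N2 ∩ V) ∈ nhds (g a) := hab ▸ om b hb hb0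
        (image_mem_map (inter_mem (hN2.mem_nhds hb2) (hV.mem_nhds hb)))
      obtain ⟨v, ⟨⟨q1, hq1, e1⟩, ⟨q2, hq2, e2⟩⟩, hv⟩ := A_nhds_im _ _ (inter_mem m1 m2) (p3 a ha h).ge
      have up : ∀ q ∈ V, g q = v → 0 < q.im := by
        intro q hq e
        by_contra hn
        rcases (not_lt.1 hn).lt_or_eq with h' | h'
        · have := p2 q hq h'; rw [e] at this; linarith
        · have := p3 q hq h'; rw [e] at this; linarith
      have := i1 q1 hq1.2 q2 hq2.2 (up q1 hq1.2 e1) (up q2 hq2.2 e2) (e1.trans e2.symm)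
      exact hdis.le_bot ⟨hq1.1, this ▸ hq2.1⟩
    · have hb0 : 0 < b.im := by
        have := p1 a ha h
        rcases lt_trichotomy b.im 0 with h' | h' | h'
        · have := p2 b hb h'; rw [← hab] at this; linarith
        · have := p3 b hb h'; rw [← hab] at this; linarith
        · exact h'
      exact i1 a ha b hb h hb0 hab
  exact fun w hw => A_deriv_ne_zero hV hg hginj hw

lemma A_ext {V : Set ℂ} (hV : IsOpen V) (hc : Convex ℝ V) (hne : (V ∩ {w | 0 < w.im}).Nonempty)
    (hVs : ∀ w ∈ V, (starRingEnd ℂ) w ∈ V) {T F r : ℂ → ℂ}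
    (hT : DifferentiableOn ℂ T V) (hT' : ∀ w ∈ V, deriv T w ≠ 0)
    (hF : DifferentiableOn ℂ F (V ∩ {w | 0 < w.im})) (hFinj : InjOn F (V ∩ {w | 0 < w.im}))
    (hF1 : ∀ w ∈ V ∩ {w | 0 < w.im}, F w ≠ 0 ∧ ‖F w‖ < 1)
    (hF0 : ∀ p ∈ V, p.im = 0 →
      Tendsto (fun w => ‖F w‖) (nhdsWithin p (V ∩ {w | 0 < w.im})) (nhds 1))
    (hr : ContinuousOn r (V ∩ {w | 0 < w.im}))
    (hrF : ∀ w ∈ V ∩ {w | 0 < w.im}, r w ^ 2 * deriv T w = deriv F w) :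
    ∃ s fl : ℂ → ℂ, DifferentiableOn ℂ s V ∧ DifferentiableOn ℂ fl V ∧
      (∀ w ∈ V, 0 < w.im → s w = r w) ∧
      (∀ w ∈ V, 0 < w.im → (fl w).im = - Real.log ‖F w‖) ∧
      (∀ w ∈ V, fl ((starRingEnd ℂ) w) = (starRingEnd ℂ) (fl w)) ∧
      (∀ w ∈ V, ‖s w‖ ^ 2 * ‖deriv T w‖ = ‖deriv fl w‖ * Real.exp (-(fl w).im)) := by
  set A : Set ℂ := V ∩ {w | 0 < w.im} with hA
  have hAo : IsOpen A := hV.inter (isOpen_lt continuous_const continuous_im)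
  have hAc : Convex ℝ A := hc.inter (convex_halfSpace_im_gt 0)
  obtain ⟨ℓ, hℓ, hℓe⟩ := A_log hAo hAc hne hF (fun z hz => (hF1 z hz).1)
  have hlogF : ∀ w ∈ A, Real.log ‖F w‖ = (ℓ w).re := by
    intro w hw; rw [← hℓe w hw, norm_exp, Real.log_exp]
  obtain ⟨fl, hfl, hflA, hfls⟩ := A_reflect (f := fun w => -I * ℓ w) hV hVs (hℓ.const_mul _)
    (by
      intro w hw
      have h1 : Real.log ‖F w‖ < 0 := Real.log_neg (norm_pos_iff.2 (hF1 w hw).1) (hF1 w hw).2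
      rw [hlogF w hw] at h1
      simpa using h1)
    (by
      intro p hp hp0
      have h1 := ((Real.continuousAt_log one_ne_zero).tendsto.comp (hF0 p hp hp0)).neg
      simp only [Real.log_one, neg_zero] at h1
      refine h1.congr' ?_
      filter_upwards [self_mem_nhdsWithin] with w hw
      simp [hlogF w hw])
  have hflpos : ∀ w ∈ A, 0 < (-I * ℓ w).im := by
    intro w hw
    have h1 : Real.log ‖F w‖ < 0 := Real.log_neg (norm_pos_iff.2 (hF1 w hw).1) (hF1 w hw).2
    rw [hlogF w hw] at h1
    simpa using h1
  have hd := A_reflect_deriv (f := fun w => -I * ℓ w) hV hVs hflpos (by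
    intro a ha b hb hab
    refine hFinj ha hb ?_
    rw [← hℓe a ha, ← hℓe b hb]
    have : ℓ a = ℓ b := mul_left_cancel₀ (neg_ne_zero.2 I_ne_zero) hab
    rw [this]) hfl hflA hfls
  have hFe : ∀ w ∈ A, F w = exp (I * fl w) := by
    intro w hw
    rw [hflA w hw.1 hw.2, ← hℓe w hw]
    congr 1
    rw [← mul_assoc, mul_neg, I_mul_I]; ring
  set q : ℂ → ℂ := fun w => I * deriv fl w * exp (I * fl w) / deriv T w with hq
  have hqd : DifferentiableOn ℂ q V :=
    ((((hfl.deriv hV).const_mul I).mul (hfl.const_mul I).cexp)).div (hT.deriv hV) hT'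
  have hq0 : ∀ w ∈ V, q w ≠ 0 := fun w hw =>
    div_ne_zero (mul_ne_zero (mul_ne_zero I_ne_zero (hd w hw)) (exp_ne_zero _)) (hT' w hw)
  obtain ⟨m, hm, hme⟩ := A_log hV hc (hne.mono inter_subset_left) hqd hq0
  set s₀ : ℂ → ℂ := fun w => exp (m w / 2) with hs₀
  have hs₀d : DifferentiableOn ℂ s₀ V := (hm.div_const 2).cexp
  have hs₀2 : ∀ w ∈ V, s₀ w ^ 2 = q w := by
    intro w hw
    rw [hs₀, ← hme w hw, ← exp_nat_mul]; congr 1; push_cast; ring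
  have hrq : ∀ w ∈ A, r w ^ 2 = q w := by
    intro w hw
    rw [hq, eq_div_iff (hT' w hw.1), hrF w hw]
    have h1 : HasDerivAt (fun z => exp (I * fl z)) (exp (I * fl w) * (I * deriv fl w)) w :=
      ((hfl.differentiableAt (hV.mem_nhds hw.1)).hasDerivAt.const_mul I).cexp
    have h2 : F =ᶠ[nhds w] fun z => exp (I * fl z) := by
      filter_upwards [hAo.mem_nhds hw] with z hz using hFe z hz
    rw [h2.deriv_eq, h1.deriv]; ring
  have hsgn : ∃ ε : ℂ, ε ^ 2 = 1 ∧ ∀ w ∈ A, ε * s₀ w = r w := by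
    rcases (hAc.isPreconnected).eq_or_eq_neg_of_sq_eq hr (hs₀d.continuousOn.mono inter_subset_left)
      (fun w hw => by simp only [Pi.pow_apply]; rw [hrq w hw, hs₀2 w hw.1])
      (fun {w} _ => exp_ne_zero _) with h | h
    · exact ⟨1, by norm_num, fun w hw => by rw [h hw, one_mul]⟩
    · exact ⟨-1, by norm_num, fun w hw => by rw [h hw]; simp⟩
  obtain ⟨ε, hε, hεr⟩ := hsgn
  refine ⟨fun w => ε * s₀ w, fl, hs₀d.const_mul ε, hfl, fun w hw h => hεr w ⟨hw, h⟩, ?_, hfls, ?_⟩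
  · intro w hw h
    rw [hflA w hw h, hlogF w ⟨hw, h⟩]; simp
  · intro w hw
    have h1 : (ε * s₀ w) ^ 2 * deriv T w = I * deriv fl w * exp (I * fl w) := by
      rw [mul_pow, hε, one_mul, hs₀2 w hw, hq]
      exact div_mul_cancel₀ _ (hT' w hw)
    rw [← norm_pow, ← norm_mul, h1, norm_mul, norm_mul, norm_I, one_mul, norm_exp]
    simp

/-- the Wirtinger operator -/
noncomputable def dbar (f : ℂ → ℂ) (z : ℂ) : ℂ := (fderiv ℝ f z 1 + I * fderiv ℝ f z I) / 2

lemma A_pompeiu0 {f : ℂ → ℂ} (hf : ContDiff ℝ 1 f) (hc : HasCompactSupport f) :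
    ∫ z, dbar f z / z = -(Real.pi : ℂ) * f 0 := by
  have hdc : Continuous (fderiv ℝ f) := hf.continuous_fderiv one_ne_zero
  have hdiff : Differentiable ℝ f := hf.differentiable one_ne_zero
  obtain ⟨R, hR0, hR⟩ : ∃ R : ℝ, 0 < R ∧ tsupport f ⊆ ball 0 R := by
    obtain ⟨R, hR⟩ := hc.isCompact.isBounded.subset_ball 0
    exact ⟨max R 1, by positivity, hR.trans (ball_subset_ball (le_max_left _ _))⟩
  have hz : ∀ z : ℂ, R ≤ ‖z‖ → f z = 0 ∧ fderiv ℝ f z = 0 := by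
    intro z h
    have h1 : z ∉ tsupport f := fun h2 => by
      have := hR h2; rw [mem_ball_zero_iff] at this; linarith
    exact ⟨image_eq_zero_of_notMem_tsupport h1, fderiv_of_notMem_tsupport ℝ h1⟩
  set e : ℝ → ℂ := fun θ => exp (θ * I) with he
  have hec : Continuous e := by fun_prop
  have hen : ∀ θ, ‖e θ‖ = 1 := fun θ => norm_exp_ofReal_mul_I θ
  set P : ℝ × ℝ → ℂ := fun p => fderiv ℝ f (p.1 * e p.2) (e p.2) with hP
  set Q : ℝ × ℝ → ℂ := fun p => fderiv ℝ f (p.1 * e p.2) (I * e p.2) with hQ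
  have hPc : Continuous P := by
    simp only [hP]
    exact (hdc.comp (by fun_prop)).clm_apply (by fun_prop)
  have hQc : Continuous Q := by
    simp only [hQ]
    exact (hdc.comp (by fun_prop)).clm_apply (by fun_prop)
  have hint : ∀ H : ℝ × ℝ → ℂ, Continuous H → (∀ p, R ≤ p.1 → H p = 0) →
      IntegrableOn H (Ioi (0:ℝ) ×ˢ Ioo (-Real.pi) Real.pi) := by
    intro H hH h0
    have h1 : IntegrableOn H (Icc 0 R ×ˢ Icc (-Real.pi) Real.pi) :=
      hH.continuousOn.integrableOn_compact (isCompact_Icc.prod isCompact_Icc)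
    refine h1.of_forall_sdiff_eq_zero (measurableSet_Ioi.prod measurableSet_Ioo) ?_
    rintro ⟨r, θ⟩ ⟨⟨h2, h3⟩, h4⟩
    apply h0
    by_contra hcon
    push Not at hcon
    exact h4 ⟨⟨le_of_lt h2, hcon.le⟩, ⟨h3.1.le, h3.2.le⟩⟩
  have hn : ∀ r θ : ℝ, R ≤ r → R ≤ ‖(r:ℂ) * e θ‖ := by
    intro r θ h
    rw [norm_mul, hen, mul_one, norm_real, Real.norm_eq_abs]
    exact h.trans (le_abs_self r)
  have hPi := hint P hPc (fun p hp => by simp only [hP]; rw [(hz _ (hn _ _ hp)).2]; rfl)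
  have hQi := hint Q hQc (fun p hp => by simp only [hQ]; rw [(hz _ (hn _ _ hp)).2]; rfl)
  rw [← Complex.integral_comp_polarCoord_symm]
  have h1 : ∀ p ∈ polarCoord.target, p.1 • (dbar f (Complex.polarCoord.symm p) / Complex.polarCoord.symm p)
      = (1/2 : ℂ) * P p + (I/2) * Q p := by
    rintro ⟨r, θ⟩ hp
    rw [polarCoord_target] at hp
    have hr : (0:ℝ) < r := hp.1
    have hs : Complex.polarCoord.symm (r, θ) = r * e θ := by
      rw [Complex.polarCoord_symm_apply, he]; simp only [exp_mul_I]; push_cast; rfl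
    rw [hs]
    simp only [hP, hQ, dbar]
    set Dd := fderiv ℝ f (r * e θ)
    have e1 : e θ = Real.cos θ • (1:ℂ) + Real.sin θ • I := by
      simp only [he, exp_mul_I, real_smul, mul_one]; push_cast; rfl
    have e2 : I * e θ = (-Real.sin θ) • (1:ℂ) + Real.cos θ • I := by
      rw [e1]; simp only [real_smul]; push_cast
      linear_combination (sin θ) * I_mul_I
    have h3 : e θ * (Dd (e θ) + I * Dd (I * e θ)) = Dd 1 + I * Dd I := by
      rw [e2, e1]
      rw [map_add, map_add, map_smul, map_smul, map_smul, map_smul]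
      simp only [real_smul]
      push_cast
      have := cos_sq_add_sin_sq (θ:ℂ)
      linear_combination (Dd 1 + I * Dd I) * this + (-(sin (θ:ℂ))^2 * Dd 1 +cos (θ:ℂ) *sin (θ:ℂ) * Dd I) * I_mul_I
    have hne : e θ ≠ 0 := exp_ne_zero _
    have hrc : (r:ℂ) ≠ 0 := by exact_mod_cast hr.ne'
    rw [← h3, real_smul]
    field_simp
  rw [setIntegral_congr_fun polarCoord.open_target.measurableSet h1, polarCoord_target]
  rw [integral_add (hPi.const_mul _) (hQi.const_mul _)]
  rw [integral_const_mul, integral_const_mul]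
  have hPv : ∫ p in Ioi (0:ℝ) ×ˢ Ioo (-Real.pi) Real.pi, P p = -(2 * Real.pi : ℂ) * f 0 := by
    have hsw : IntegrableOn (fun p : ℝ × ℝ => P p.swap) (Ioo (-Real.pi) Real.pi ×ˢ Ioi (0:ℝ)) :=
      hPi.swap
    have : ∫ p in Ioi (0:ℝ) ×ˢ Ioo (-Real.pi) Real.pi, P p =
        ∫ p in Ioo (-Real.pi) Real.pi ×ˢ Ioi (0:ℝ), P p.swap := by
      exact (setIntegral_prod_swap _ _ _).symm
    rw [this, Measure.volume_eq_prod, setIntegral_prod _ hsw]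
    have h4 : ∀ θ : ℝ, ∫ r in Ioi (0:ℝ), P (Prod.swap (θ, r)) = - f 0 := by
      intro θ
      have h5 : ∀ r ∈ Ici (0:ℝ), HasDerivAt (fun r : ℝ => f (r * e θ)) (P (r, θ)) r := by
        intro r _
        have a : HasDerivAt (fun r : ℝ => (r:ℂ) * e θ) (e θ) r := by
          simpa using (ofRealCLM.hasDerivAt (x := r)).mul_const (e θ)
        exact (hdiff _).hasFDerivAt.comp_hasDerivAt r a
      have h6 := integral_Ioi_of_hasDerivAt_of_tendsto' (m := 0) h5 (by
        have h7 : IntegrableOn (fun r : ℝ => P (r, θ)) (Icc 0 R) :=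
          (hPc.comp (by fun_prop)).continuousOn.integrableOn_compact isCompact_Icc
        refine h7.of_forall_sdiff_eq_zero measurableSet_Ioi ?_
        intro r hr
        simp only [hP]
        rw [(hz _ (hn r θ ?_)).2]; rfl
        by_contra hcon
        push Not at hcon
        exact hr.2 ⟨le_of_lt hr.1, hcon.le⟩) (by
        refine tendsto_const_nhds.congr' ?_
        filter_upwards [eventually_ge_atTop R] with r hr
        exact (hz _ (hn r θ hr)).1.symm)
      simpa using h6
    simp only [h4]
    rw [setIntegral_const, measureReal_def, Real.volume_Ioo, ENNReal.toReal_ofReal (by linarith [Real.pi_pos]), real_smul]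
    push_cast; ring
  have hQv : ∫ p in Ioi (0:ℝ) ×ˢ Ioo (-Real.pi) Real.pi, Q p = 0 := by
    rw [Measure.volume_eq_prod, setIntegral_prod _ hQi]
    refine setIntegral_eq_zero_of_forall_eq_zero ?_
    intro r hr
    have hr : 0 < r := hr
    show ∫ θ in Ioo (-Real.pi) Real.pi, Q (r, θ) = 0
    rw [← integral_Ioc_eq_integral_Ioo, ← intervalIntegral.integral_of_le (by linarith [Real.pi_pos])]
    have h5 : ∀ θ ∈ uIcc (-Real.pi) Real.pi, HasDerivAt (fun θ : ℝ => (r:ℂ)⁻¹ * f (r * e θ)) (Q (r, θ)) θ := by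
      intro θ _
      have a : HasDerivAt (fun θ : ℝ => (r:ℂ) * e θ) (r * (I * e θ)) θ := by
        have := ((ofRealCLM.hasDerivAt (x := θ)).mul_const I).cexp.const_mul (r:ℂ)
        simp only [ofRealCLM_apply, ofReal_one, one_mul] at this
        rw [mul_comm I]; exact this
      have b := ((hdiff _).hasFDerivAt.comp_hasDerivAt θ a).const_mul (r:ℂ)⁻¹
      have c : fderiv ℝ f (r * e θ) (r * (I * e θ)) = r * Q (r, θ) := by
        simp only [hQ]
        have := map_smul (fderiv ℝ f (r * e θ)) r (I * e θ)
        rwa [real_smul, real_smul] at this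
      rw [c, inv_mul_cancel_left₀ (by exact_mod_cast hr.ne')] at b
      exact b
    rw [intervalIntegral.integral_eq_sub_of_hasDerivAt h5 ((hQc.comp (by fun_prop)).intervalIntegrable _ _)]
    have : e Real.pi = e (-Real.pi) := by
      simp only [he]; push_cast
      rw [neg_mul, exp_neg, exp_pi_mul_I]; norm_num
    rw [this]; ring
  rw [hPv, hQv]; ring

lemma A_pompeiu {f : ℂ → ℂ} (hf : ContDiff ℝ 1 f) (hc : HasCompactSupport f) (z : ℂ) :
    ∫ w, dbar f w / (w - z) = -(Real.pi : ℂ) * f z := by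
  have h1 := A_pompeiu0 (f := fun w => f (w + z)) (hf.comp (by fun_prop))
    (hc.comp_homeomorph (Homeomorph.addRight z))
  rw [← integral_add_right_eq_self _ z]
  simp only [zero_add] at h1
  rw [← h1]
  congr 1; ext w
  simp only [dbar, add_sub_cancel_right]
  rw [fderiv_comp_add_right]

lemma A_three {f : ℂ → ℂ} {z : ℂ} {r R R' M a : ℝ} (hr : 0 < r) (hrR : r < R) (hR' : R < R')
    (hf : DifferentiableOn ℂ f (ball z R')) (hM : ∀ w ∈ closedBall z R, ‖f w‖ ≤ M)
    (ha : ∀ w ∈ closedBall z r, ‖f w‖ ≤ a) {w : ℂ} (h1 : r ≤ ‖w - z‖) (h2 : ‖w - z‖ ≤ R) :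
    ‖f w‖ ≤ a ^ (1 - (Real.log ‖w - z‖ - Real.log r) / (Real.log R - Real.log r)) *
      M ^ ((Real.log ‖w - z‖ - Real.log r) / (Real.log R - Real.log r)) := by
  have hl : Real.log r < Real.log R := Real.log_lt_log hr hrR
  have hR : 0 < R := hr.trans hrR
  have hn : ∀ x : ℂ, ‖z + exp x - z‖ = Real.exp x.re := fun x => by
    rw [add_sub_cancel_left, norm_exp]
  have hmem : ∀ x : ℂ, x.re ≤ Real.log R → z + exp x ∈ closedBall z R := by
    intro x hx
    rw [mem_closedBall, dist_eq_norm, hn]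
    exact (Real.exp_le_exp.2 hx).trans (Real.exp_log hR).le
  have hw0 : w - z ≠ 0 := norm_pos_iff.1 (hr.trans_le h1)
  have := HadamardThreeLines.norm_le_interp_of_mem_verticalClosedStrip' (f := fun x => f (z + exp x))
    (z := log (w - z)) (a := a) (b := M) hl
    (by
      rw [HadamardThreeLines.verticalClosedStrip, mem_preimage, log_re]
      exact ⟨Real.log_le_log hr h1, Real.log_le_log (hr.trans_le h1) h2⟩)
    (by
      refine DifferentiableOn.diffContOnCl ?_
      intro x hx
      have hx2 : x.re ≤ Real.log R := by
        have : x ∈ HadamardThreeLines.verticalClosedStrip (Real.log r) (Real.log R) :=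
          closure_minimal (preimage_mono Ioo_subset_Icc_self)
            (isClosed_Icc.preimage continuous_re) hx
        exact this.2
      have h3 := hmem x hx2
      have h4 : DifferentiableAt ℂ f (z + exp x) :=
        hf.differentiableAt (isOpen_ball.mem_nhds (closedBall_subset_ball hR' h3))
      exact (h4.comp x (by fun_prop)).differentiableWithinAt)
    ⟨M, by
      rintro _ ⟨x, hx, rfl⟩
      exact hM _ (hmem x hx.2)⟩
    (by
      intro x hx
      apply ha
      rw [mem_closedBall, dist_eq_norm, hn, show x.re = Real.log r from hx, Real.exp_log hr])
    (fun x hx => hM _ (hmem x (le_of_eq hx)))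
  simpa [exp_log hw0, log_re] using this

lemma A_propagate {Y : Set ℂ} (hY : IsOpen Y) (hc : IsPreconnected Y) (𝓕 : Set ((ℂ → ℂ) × ℕ))
    (hd : ∀ p ∈ 𝓕, DifferentiableOn ℂ p.1 Y)
    (hb : ∀ K ⊆ Y, IsCompact K → ∃ M : ℝ, ∀ p ∈ 𝓕, ∀ z ∈ K, ‖p.1 z‖ ≤ M)
    (h0 : ∃ z ∈ Y, ∃ r > 0, ∃ C : ℝ, ∃ q ∈ Ioo (0:ℝ) 1, ∀ p ∈ 𝓕, ∀ w ∈ ball z r, ‖p.1 w‖ ≤ C * q ^ p.2) :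
    ∀ K ⊆ Y, IsCompact K → ∃ C : ℝ, 0 < C ∧ ∃ q ∈ Ioo (0:ℝ) 1, ∀ p ∈ 𝓕, ∀ w ∈ K, ‖p.1 w‖ ≤ C * q ^ p.2 := by
  set S : Set ℂ := {z | ∃ r > 0, ∃ C : ℝ, ∃ q ∈ Ioo (0:ℝ) 1, ∀ p ∈ 𝓕, ∀ w ∈ ball z r, ‖p.1 w‖ ≤ C * q ^ p.2} with hS
  have hSo : IsOpen S := by
    rw [Metric.isOpen_iff]
    rintro z ⟨r, hr, C, q, hq, h⟩
    refine ⟨r / 2, by positivity, fun z' hz' => ⟨r / 2, by positivity, C, q, hq, fun p hp w hw => h p hp w ?_⟩⟩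
    rw [mem_ball] at *
    linarith [dist_triangle w z' z]
  have hYS : Y ⊆ S := by
    refine hc.subset_of_closure_inter_subset hSo ?_ ?_
    · obtain ⟨z, hz, h⟩ := h0; exact ⟨z, hz, h⟩
    rintro z ⟨hzS, hzY⟩
    obtain ⟨R5, hR5, hball⟩ := Metric.isOpen_iff.1 hY z hzY
    obtain ⟨R, hR, hRe⟩ : ∃ R : ℝ, 0 < R ∧ R5 = 5 * R := ⟨R5 / 5, by positivity, by ring⟩
    obtain ⟨z1, ⟨r0, hr0, C, q, hq, h⟩, hz1⟩ := Metric.mem_closure_iff.1 hzS R hR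
    have hsub : ball z1 (4 * R) ⊆ Y := by
      intro w hw
      apply hball
      rw [mem_ball] at *
      linarith [dist_triangle w z1 z, dist_comm z z1]
    obtain ⟨M0, hM0⟩ := hb (closedBall z1 (3 * R))
      ((closedBall_subset_ball (by linarith)).trans hsub) (isCompact_closedBall _ _)
    set M := max M0 1
    set C1 := max C 1
    have hM1 : 1 ≤ M := le_max_right _ _
    have hC1 : 1 ≤ C1 := le_max_right _ _
    set r := min (r0 / 2) R
    have hr : 0 < r := by positivity
    have hrR : r ≤ R := min_le_right _ _
    have hl1 : Real.log r < Real.log (3 * R) := Real.log_lt_log hr (by linarith)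
    have hl2 : Real.log (2 * R) < Real.log (3 * R) := Real.log_lt_log (by linarith) (by linarith)
    have hl3 : Real.log r < Real.log (2 * R) := Real.log_lt_log hr (by linarith)
    set t0 := (Real.log (2 * R) - Real.log r) / (Real.log (3 * R) - Real.log r)
    have hpos : 0 < Real.log (3 * R) - Real.log r := by linarith
    have ht0 : t0 < 1 := by rw [div_lt_one hpos]; linarith
    have ht00 : 0 < t0 := div_pos (by linarith) hpos
    have hq' : q ^ (1 - t0) ∈ Ioo (0:ℝ) 1 :=
      ⟨Real.rpow_pos_of_pos hq.1 _, Real.rpow_lt_one hq.1.le hq.2 (by linarith)⟩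
    refine ⟨R, hR, C1 * M, q ^ (1 - t0), hq', ?_⟩
    intro p hp w hw
    have hqn : 0 < q ^ p.2 := pow_pos hq.1 _
    have hqn1 : q ^ p.2 ≤ 1 := pow_le_one₀ hq.1.le hq.2.le
    have hqe : (q ^ (1 - t0)) ^ p.2 = (q ^ p.2) ^ (1 - t0) := by
      rw [← Real.rpow_natCast, ← Real.rpow_mul hq.1.le, mul_comm, Real.rpow_mul hq.1.le, Real.rpow_natCast]
    rw [hqe]
    have hsm : ∀ w ∈ closedBall z1 r, ‖p.1 w‖ ≤ C1 * q ^ p.2 := by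
      intro w hw
      refine (h p hp w ?_).trans (by gcongr; exact le_max_left _ _)
      refine closedBall_subset_ball ?_ hw
      linarith [min_le_left (r0 / 2) R]
    by_cases hcase : ‖w - z1‖ ≤ r
    · refine (hsm w (by rwa [mem_closedBall, dist_eq_norm])).trans ?_
      have : q ^ p.2 ≤ (q ^ p.2) ^ (1 - t0) := by
        conv_lhs => rw [← Real.rpow_one (q ^ p.2)]
        exact Real.rpow_le_rpow_of_exponent_ge hqn hqn1 (by linarith)
      calc C1 * q ^ p.2 ≤ C1 * (q ^ p.2) ^ (1 - t0) := by gcongr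
        _ ≤ C1 * M * (q ^ p.2) ^ (1 - t0) := by
          gcongr; nlinarith
    push Not at hcase
    have hw2 : ‖w - z1‖ ≤ 2 * R := by
      rw [← dist_eq_norm]; rw [mem_ball] at hw; linarith [dist_triangle w z z1]
    have h3 := A_three hr (by linarith : r < 3 * R) (by linarith : 3 * R < 4 * R)
      ((hd p hp).mono hsub) (M := M) (fun w hw => (hM0 p hp w hw).trans (le_max_left _ _)) hsm hcase.le (by linarith)
    set t := (Real.log ‖w - z1‖ - Real.log r) / (Real.log (3 * R) - Real.log r)
    have htt : t ≤ t0 := by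
      simp only [t, t0]; gcongr
      exact hr.trans hcase
    have ht : 0 ≤ t := div_nonneg (sub_nonneg.2 (Real.log_le_log hr hcase.le)) hpos.le
    refine h3.trans ?_
    rw [Real.mul_rpow (by positivity) hqn.le]
    have e1 : C1 ^ (1 - t) ≤ C1 := by
      conv_rhs => rw [← Real.rpow_one C1]
      exact Real.rpow_le_rpow_of_exponent_le hC1 (by linarith)
    have e2 : M ^ t ≤ M := by
      conv_rhs => rw [← Real.rpow_one M]
      exact Real.rpow_le_rpow_of_exponent_le hM1 (by linarith)
    have e3 : (q ^ p.2) ^ (1 - t) ≤ (q ^ p.2) ^ (1 - t0) :=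
      Real.rpow_le_rpow_of_exponent_ge hqn hqn1 (by linarith)
    calc C1 ^ (1 - t) * (q ^ p.2) ^ (1 - t) * M ^ t ≤ C1 * (q ^ p.2) ^ (1 - t0) * M := by
          gcongr
      _ = _ := by ring
  intro K hK hKc
  refine hKc.induction_on (p := fun K => ∃ C : ℝ, 0 < C ∧ ∃ q ∈ Ioo (0:ℝ) 1, ∀ p ∈ 𝓕, ∀ w ∈ K, ‖p.1 w‖ ≤ C * q ^ p.2) ?_ ?_ ?_ ?_
  · exact ⟨1, one_pos, 1/2, by norm_num, by simp⟩
  · rintro s t hst ⟨C, hC, q, hq, h⟩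
    exact ⟨C, hC, q, hq, fun p hp w hw => h p hp w (hst hw)⟩
  · rintro s t ⟨C, hC, q, hq, h⟩ ⟨C', hC', q', hq', h'⟩
    refine ⟨max C C', by positivity, max q q', ⟨lt_max_of_lt_left hq.1, max_lt hq.2 hq'.2⟩, ?_⟩
    rintro p hp w (hw | hw)
    · refine (h p hp w hw).trans ?_
      have := hq.1
      gcongr
      · exact le_max_left _ _
      · exact le_max_left _ _
    · refine (h' p hp w hw).trans ?_
      have := hq'.1
      gcongr
      · exact le_max_right _ _
      · exact le_max_right _ _
  · intro z hz
    obtain ⟨r, hr, C, q, hq, h⟩ := hYS (hK hz)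
    refine ⟨ball z r, mem_nhdsWithin_of_mem_nhds (ball_mem_nhds z hr), max C 1, by positivity, q, hq, ?_⟩
    intro p hp w hw
    refine (h p hp w hw).trans ?_
    have := hq.1
    gcongr
    exact le_max_left _ _

lemma abs_cos_sub_le (a b : ℝ) : |Real.cos a - Real.cos b| ≤ |a - b| := by
  rw [Real.cos_sub_cos]
  have h1 := Real.abs_sin_le_one ((a + b) / 2)
  have h2 : |Real.sin ((a - b) / 2)| ≤ |(a - b) / 2| := Real.abs_sin_le_abs
  rw [abs_mul, abs_mul]
  rw [abs_div] at h2
  norm_num at h2 ⊢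
  nlinarith [abs_nonneg (Real.sin ((a - b) / 2)), abs_nonneg (Real.sin ((a + b) / 2))]

/-- distance to `L` inside a curved sector -/
lemma A_sector_dist {Y L : Set ℂ} {z0 : ℂ} {c E A ρ : ℝ} (hA : 0 < A) (hE : E ≤ 2 * Real.pi)
    (hsec : ∀ w : ℂ, Real.exp w.re < ρ → |w.im| < E / 2 - A * Real.exp w.re →
      z0 + exp (c * I) * exp w ∈ Y) (hYL : Disjoint Y L) (hL : L.Nonempty)
    {w : ℂ} (h1 : 3 * Real.exp w.re ≤ ρ) (h2 : 4 * A * Real.exp w.re ≤ E / 2 - |w.im|) :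
    (E / 2 - |w.im|) / 8 * Real.exp w.re ≤ infDist (z0 + exp (c * I) * exp w) L := by
  set μ := E / 2 - |w.im|
  have hX := Real.exp_pos w.re
  have hμ : 0 < μ := lt_of_lt_of_le (by positivity) h2
  have hμ2 : μ < 3.2 := by
    have := Real.pi_lt_d2; have := abs_nonneg w.im; simp only [μ]; linarith
  rw [le_infDist hL]
  intro p hp
  by_contra hcon
  push Not at hcon
  set v := exp (-(c * I)) * (p - z0) with hv
  have hev : exp (c * I) * v = p - z0 := by
    rw [hv, ← mul_assoc, ← exp_add, add_neg_cancel, exp_zero, one_mul]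
  have hcI : ‖exp (c * I)‖ = 1 := norm_exp_ofReal_mul_I c
  have h3 : ‖exp w - v‖ < μ / 8 * Real.exp w.re := by
    rw [dist_eq_norm] at hcon
    have : z0 + exp (c * I) * exp w - p = exp (c * I) * (exp w - v) := by
      rw [mul_sub, hev]; ring
    rwa [this, norm_mul, hcI, one_mul] at hcon
  set u := v / exp w - 1 with hu
  have hvu : v = exp w * (1 + u) := by
    rw [hu]; field_simp [exp_ne_zero]; ring
  have hun : ‖u‖ < μ / 8 := by
    have : exp w - v = - (exp w * u) := by rw [hvu]; ring
    rw [this, norm_neg, norm_mul, norm_exp] at h3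
    rw [mul_comm] at h3
    exact lt_of_mul_lt_mul_right h3 hX.le
  have hlog : ‖log (1 + u)‖ ≤ 3 / 2 * ‖u‖ := norm_log_one_add_half_le_self (by linarith)
  have h1u : 1 + u ≠ 0 := by
    intro h
    have : u = -1 := by linear_combination h
    rw [this] at hun; simp at hun; linarith
  set w' := w + log (1 + u) with hw'
  have hpw : z0 + exp (c * I) * exp w' = p := by
    rw [hw', exp_add, exp_log h1u, ← hvu, hev]; ring
  have hl : ‖log (1 + u)‖ < μ / 4 := by linarith
  have hre : w'.re ≤ w.re + μ / 4 := by
    have := (abs_le.1 (abs_re_le_norm (log (1 + u)))).2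
    simp only [hw', add_re]; linarith
  have him : |w'.im| ≤ |w.im| + μ / 4 := by
    have := (abs_im_le_norm (log (1 + u)))
    simp only [hw', add_im]
    linarith [abs_add_le w.im (log (1+u)).im]
  have hexp : Real.exp (μ / 4) < 3 := by
    calc Real.exp (μ / 4) < Real.exp 1 := Real.exp_lt_exp.2 (by linarith)
      _ < 3 := by linarith [Real.exp_one_lt_d9]
  have hX' : Real.exp w'.re ≤ Real.exp w.re * Real.exp (μ / 4) := by
    rw [← Real.exp_add]; exact Real.exp_le_exp.2 hre
  have hX'' : Real.exp w'.re < 3 * Real.exp w.re := by nlinarith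
  have hmem := hsec w' (by linarith) (by
    have : |w.im| = E / 2 - μ := by simp only [μ]; ring
    have h5 : A * Real.exp w'.re < A * (3 * Real.exp w.re) := by gcongr
    nlinarith)
  rw [hpw] at hmem
  exact hYL.le_bot ⟨hmem, hp⟩

/-- the function `h = Re E` -/
lemma A_hbound {ℓ K s X V y : ℝ} (hℓ : 0 < ℓ) (hK : 0 ≤ K) (hs : s = Real.sin (ℓ * Real.pi / 2))
    (hX : 0 < X) (hV : 0 < V) (hKV : K * V * (1 + ℓ) ≤ 1) (hy : |y| ≤ Real.pi / 2) :
    X * Real.cos y + K * (X * V * Real.cos ((1 + ℓ) * y)) ≤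
      X * (2 * (Real.pi / 2 - |y|) - K * s * V) := by
  set ψ := Real.pi / 2 - |y|
  have hψ : 0 ≤ ψ := by simp only [ψ]; linarith
  have h1 : Real.cos y ≤ ψ := by
    rw [← Real.cos_abs, show |y| = Real.pi / 2 - ψ by simp only [ψ]; ring, Real.cos_pi_div_two_sub]
    exact Real.sin_le hψ
  have h2 : Real.cos ((1 + ℓ) * y) ≤ -s + (1 + ℓ) * ψ := by
    have e : Real.cos ((1 + ℓ) * y) = Real.cos ((1 + ℓ) * |y|) := by
      rw [← Real.cos_abs ((1 + ℓ) * y), abs_mul, abs_of_pos (by linarith : 0 < 1 + ℓ)]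
    have h3 := (abs_le.1 (abs_cos_sub_le ((1 + ℓ) * |y|) ((1 + ℓ) * (Real.pi / 2)))).2
    have h4 : Real.cos ((1 + ℓ) * (Real.pi / 2)) = -s := by
      rw [hs, show (1 + ℓ) * (Real.pi / 2) = ℓ * Real.pi / 2 + Real.pi / 2 by ring, Real.cos_add_pi_div_two]
    have h5 : |(1 + ℓ) * |y| - (1 + ℓ) * (Real.pi / 2)| = (1 + ℓ) * ψ := by
      rw [show (1 + ℓ) * |y| - (1 + ℓ) * (Real.pi / 2) = -((1 + ℓ) * ψ) by simp only [ψ]; ring, abs_neg,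
        abs_of_nonneg (by positivity)]
    rw [e]; linarith
  have h6 : K * (X * V * Real.cos ((1 + ℓ) * y)) ≤ K * (X * V * (-s + (1 + ℓ) * ψ)) := by gcongr
  have h7 : X * Real.cos y ≤ X * ψ := by gcongr
  have h8 : X * ψ * (K * V * (1 + ℓ)) ≤ X * ψ * 1 := by gcongr
  nlinarith

set_option maxHeartbeats 1600000 in
lemma A_corner_ext {Y L : Set ℂ} {z0 : ℂ} {c ℓ A ρ : ℝ} (hℓ : 0 < ℓ) (hℓ2 : ℓ < 2)
    (hA : 0 < A) (hρ : 0 < ρ) (hYo : IsOpen Y)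
    (hsec : ∀ w : ℂ, Real.exp w.re < ρ → |w.im| < ℓ * Real.pi / 2 - A * Real.exp w.re →
      z0 + exp (c * I) * exp w ∈ Y) (hYL : Disjoint Y L) (hL : L.Nonempty)
    (𝓕 : Set ((ℂ → ℂ) × ℕ))
    (hd : ∀ p ∈ 𝓕, DifferentiableOn ℂ p.1 Y)
    (hb : ∀ p ∈ 𝓕, ∀ z ∈ Y, ‖p.1 z‖ ≤ infDist z L ^ (-(1/2) : ℝ))
    (hK : ∀ K ⊆ Y, IsCompact K → ∃ C : ℝ, 0 < C ∧ ∃ q ∈ Ioo (0:ℝ) 1, ∀ p ∈ 𝓕, ∀ w ∈ K, ‖p.1 w‖ ≤ C * q ^ p.2)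
    (ψ0 : ℝ) (hψ0 : 0 < ψ0) :
    ∃ C > 0, ∃ c' > 0, ∃ ρ' > 0, ∀ p ∈ 𝓕, 0 < p.2 → ∀ w : ℂ, Real.exp w.re < ρ' →
      |w.im| ≤ ℓ * Real.pi / 2 - ψ0 →
      ‖p.1 (z0 + exp (c * I) * exp w)‖ ≤ C * Real.exp w.re ^ (-(1/2) : ℝ) *
        Real.exp (- c' * p.2 * Real.exp w.re ^ (1 / ℓ)) := by
  have hpi := Real.pi_pos
  set s := Real.sin (ℓ * Real.pi / 2) with hs
  have hs0 : 0 < s := Real.sin_pos_of_pos_of_lt_pi (by positivity) (by nlinarith)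
  set K := 8 * A / (ℓ * s) with hKdef
  have hK0 : 0 < K := by positivity
  -- the radius
  obtain ⟨V1, hV1, hV1ρ, hV1K⟩ : ∃ V1 : ℝ, 0 < V1 ∧ 3 * V1 < ρ ∧ K * V1 * (1 + ℓ) ≤ 1 := by
    refine ⟨min (ρ / 4) (1 / (K * (1 + ℓ))), by positivity, ?_, ?_⟩
    · linarith [min_le_left (ρ / 4) (1 / (K * (1 + ℓ)))]
    · have := min_le_right (ρ / 4) (1 / (K * (1 + ℓ)))
      rw [le_div_iff₀ (by positivity)] at this
      linarith
  set x1 := Real.log V1 / ℓ with hx1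
  have hVx : ∀ w : ℂ, w.re ≤ x1 → Real.exp (ℓ * w.re) ≤ V1 := by
    intro w hw
    rw [← Real.exp_log hV1]
    apply Real.exp_le_exp.2
    rw [hx1, le_div_iff₀ hℓ] at hw; linarith
  set E : ℂ → ℂ := fun w => exp w + K * exp ((1 + ℓ) * w) with hE
  have hEc : Continuous E := by simp only [hE]; fun_prop
  have hEre : ∀ w : ℂ, (E w).re = Real.exp w.re * Real.cos w.im +
      K * (Real.exp w.re * Real.exp (ℓ * w.re) * Real.cos ((1 + ℓ) * w.im)) := by
    intro w
    have : ((1:ℂ) + ℓ) * w = (((1 + ℓ) * w.re : ℝ) : ℂ) + ((1 + ℓ) * w.im : ℝ) * I := by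
      apply Complex.ext <;> simp
    simp only [hE, add_re, re_ofReal_mul, exp_re, this]
    simp only [ofReal_re, ofReal_mul, add_im, ofReal_im, mul_re, mul_im, I_re, I_im]
    rw [← Real.exp_add]
    congr 3
    · congr 1; simp; ring
    · congr 1; simp
  -- upper bound for h
  have hup : ∀ w : ℂ, w.re ≤ x1 → |w.im| ≤ Real.pi / 2 →
      (E w).re ≤ Real.exp w.re * (2 * (Real.pi / 2 - |w.im|) - K * s * Real.exp (ℓ * w.re)) := by
    intro w h1 h2
    rw [hEre]
    refine A_hbound hℓ hK0.le hs (Real.exp_pos _) (Real.exp_pos _) ?_ h2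
    have := hVx w h1
    calc K * Real.exp (ℓ * w.re) * (1 + ℓ) ≤ K * V1 * (1 + ℓ) := by gcongr
      _ ≤ 1 := hV1K
  have hmul : ∀ w : ℂ, ((ℓ:ℂ) * w).re = ℓ * w.re ∧ ((ℓ:ℂ) * w).im = ℓ * w.im := by
    intro w; simp
  -- key consequences of h ≥ 0
  have hkey : ∀ w : ℂ, w.re ≤ x1 → |w.im| ≤ Real.pi / 2 → 0 ≤ (E w).re →
      4 * A * Real.exp (ℓ * w.re) ≤ ℓ * (Real.pi / 2 - |w.im|) ∧
      (E w).re ≤ 2 * (Real.pi / 2 - |w.im|) * Real.exp w.re := by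
    intro w h1 h2 h3
    have h4 := hup w h1 h2
    have hX := Real.exp_pos w.re
    have hV := Real.exp_pos (ℓ * w.re)
    have h5 : 0 ≤ 2 * (Real.pi / 2 - |w.im|) - K * s * Real.exp (ℓ * w.re) := by
      by_contra hcon
      push Not at hcon
      linarith [mul_neg_of_neg_of_pos hcon hX]
    constructor
    · have : K * s * ℓ = 8 * A := by rw [hKdef]; field_simp
      linarith [mul_nonneg hℓ.le h5, congrArg (Real.exp (ℓ * w.re) * ·) this]
    · have : 0 ≤ K * s * Real.exp (ℓ * w.re) := by positivity
      linarith [mul_nonneg this hX.le]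
  set Zm : ℂ → ℂ := fun w => z0 + exp (c * I) * exp (ℓ * w) with hZm
  have hZc : Continuous Zm := by simp only [hZm]; fun_prop
  have hmemY : ∀ w : ℂ, w.re ≤ x1 → |w.im| ≤ Real.pi / 2 → 0 ≤ (E w).re → Zm w ∈ Y := by
    intro w h1 h2 h3
    obtain ⟨h4, -⟩ := hkey w h1 h2 h3
    have hV := Real.exp_pos (ℓ * w.re)
    have := hVx w h1
    refine hsec (ℓ * w) ?_ ?_
    · rw [(hmul w).1]; linarith
    · rw [(hmul w).1, (hmul w).2, abs_mul, abs_of_pos hℓ]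
      linarith [mul_pos hA hV]
  have hdist : ∀ w : ℂ, w.re ≤ x1 → |w.im| ≤ Real.pi / 2 → 0 ≤ (E w).re →
      ℓ * (Real.pi / 2 - |w.im|) / 8 * Real.exp (ℓ * w.re) ≤ infDist (Zm w) L := by
    intro w h1 h2 h3
    obtain ⟨h4, -⟩ := hkey w h1 h2 h3
    have := hVx w h1
    have h6 := A_sector_dist (E := ℓ * Real.pi) hA (by linarith [mul_lt_mul_of_pos_right hℓ2 hpi]) hsec hYL hL (w := ℓ * w)
      (by rw [(hmul w).1]; linarith)
      (by rw [(hmul w).1, (hmul w).2, abs_mul, abs_of_pos hℓ]; linarith)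
    rw [(hmul w).1, (hmul w).2, abs_mul, abs_of_pos hℓ] at h6
    refine le_trans (le_of_eq ?_) h6
    ring
  -- compact side
  set K1 : Set ℂ := {w : ℂ | w.re = x1 ∧ |w.im| ≤ Real.pi / 2 ∧ 0 ≤ (E w).re} with hK1
  have hK1c : IsCompact K1 := by
    refine (isCompact_closedBall (0:ℂ) (|x1| + Real.pi / 2)).of_isClosed_subset ?_ ?_
    · exact (isClosed_eq continuous_re continuous_const).inter
        ((isClosed_le (continuous_im.abs) continuous_const).inter
          (isClosed_le continuous_const (continuous_re.comp hEc)))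
    · rintro w ⟨h1, h2, -⟩
      rw [mem_closedBall_zero_iff]
      refine (norm_le_abs_re_add_abs_im w).trans ?_
      rw [h1]; linarith
  obtain ⟨C2, hC2, q, hq, hdec⟩ := hK (Zm '' K1)
    (by rintro _ ⟨w, ⟨h1, h2, h3⟩, rfl⟩; exact hmemY w h1.le h2 h3) (hK1c.image hZc)
  set H := Real.pi * Real.exp x1 with hH
  have hH0 : 0 < H := by positivity
  set ε := -Real.log q / H with hε
  have hε0 : 0 < ε := div_pos (by linarith [Real.log_neg hq.1 hq.2]) hH0
  have hεq : q * Real.exp (ε * H) = 1 := by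
    rw [hε, div_mul_cancel₀ _ hH0.ne', Real.exp_neg, Real.exp_log hq.1, mul_inv_cancel₀ hq.1.ne']
  set C3 := C2 * Real.exp ((ℓ - 1) / 2 * x1) + (16 / ℓ) ^ (1/2 : ℝ) * Real.exp ε with hC3
  have hC30 : 0 < C3 := by positivity
  set ψ1 := min (ψ0 / ℓ) (Real.pi / 2)
  have hψ1 : 0 < ψ1 := by positivity
  set s1 := Real.sin ψ1 with hs1
  have hs10 : 0 < s1 := Real.sin_pos_of_pos_of_lt_pi hψ1 (by linarith [min_le_right (ψ0 / ℓ) (Real.pi / 2)])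
  have hdirect : ∀ p ∈ 𝓕, ∀ w : ℂ, w.re ≤ x1 → |w.im| ≤ Real.pi / 2 → 0 ≤ (E w).re → ∀ a > 0,
      a ≤ ℓ * (Real.pi / 2 - |w.im|) / 8 * Real.exp (ℓ * w.re) → ‖p.1 (Zm w)‖ ≤ a ^ (-(1/2) : ℝ) := by
    intro p hp w h1 h2 h3 a ha h4
    refine (hb p hp _ (hmemY w h1 h2 h3)).trans ?_
    exact Real.rpow_le_rpow_of_nonpos ha (h4.trans (hdist w h1 h2 h3)) (by norm_num)
  -- max principle
  have hMP : ∀ p ∈ 𝓕, 0 < p.2 → ∀ w : ℂ, w.re < x1 → |w.im| < Real.pi / 2 → 1 / (p.2 : ℝ) < (E w).re →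
      ‖p.1 (Zm w)‖ * Real.exp ((ℓ - 1) / 2 * w.re) * Real.exp (ε * p.2 * (E w).re) ≤
        C3 * (p.2 : ℝ) ^ (1/2 : ℝ) := by
    intro p hp hn
    set n : ℝ := (p.2 : ℝ) with hnd
    have hn0 : 0 < n := Nat.cast_pos.2 hn
    have hn1 : 1 ≤ n := Nat.one_le_cast.2 hn
    set Φ : ℂ → ℂ := fun w => p.1 (Zm w) * exp (((ℓ - 1) / 2 : ℝ) * w) * exp ((ε * n : ℝ) * E w) with hΦ
    have hΦn : ∀ w, ‖Φ w‖ = ‖p.1 (Zm w)‖ * Real.exp ((ℓ - 1) / 2 * w.re) * Real.exp (ε * n * (E w).re) := by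
      intro w
      simp only [hΦ, norm_mul, norm_exp, re_ofReal_mul]
    set O : Set ℂ := {w : ℂ | w.re < x1 ∧ |w.im| < Real.pi / 2 ∧ 1 / n < (E w).re} with hO
    have hOo : IsOpen O := (isOpen_lt continuous_re continuous_const).inter
      ((isOpen_lt continuous_im.abs continuous_const).inter
        (isOpen_lt continuous_const (continuous_re.comp hEc)))
    have hOcl : closure O ⊆ {w : ℂ | w.re ≤ x1 ∧ |w.im| ≤ Real.pi / 2 ∧ 1 / n ≤ (E w).re} := by
      refine closure_minimal (fun w h => ⟨h.1.le, h.2.1.le, h.2.2.le⟩) ?_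
      exact (isClosed_le continuous_re continuous_const).inter
        ((isClosed_le continuous_im.abs continuous_const).inter
          (isClosed_le continuous_const (continuous_re.comp hEc)))
    have hinv : 0 < 1 / n := by positivity
    have hOb : Bornology.IsBounded O := by
      refine (isBounded_closedBall (x := (0:ℂ)) (r := |x1| + |Real.log (1 / (n * Real.pi))| + Real.pi / 2)).subset ?_
      rintro w ⟨h1, h2, h3⟩
      have h4 := (hkey w h1.le h2.le (hinv.le.trans h3.le)).2
      have h5 : 1 / (n * Real.pi) ≤ Real.exp w.re := by
        rw [div_le_iff₀ (by positivity)]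
        have h6 : 1 / n < Real.pi * Real.exp w.re := by
          have := abs_nonneg w.im
          have := Real.exp_pos w.re
          linarith [mul_nonneg (abs_nonneg w.im) this.le]
        rw [div_lt_iff₀ hn0] at h6
        linarith
      have h6 : Real.log (1 / (n * Real.pi)) ≤ w.re := by
        rw [← Real.log_exp w.re]; exact Real.log_le_log (by positivity) h5
      rw [mem_closedBall_zero_iff]
      refine (norm_le_abs_re_add_abs_im w).trans ?_
      have : |w.re| ≤ |x1| + |Real.log (1 / (n * Real.pi))| := by
        rw [abs_le]
        constructor
        · linarith [neg_abs_le (Real.log (1 / (n * Real.pi))), abs_nonneg x1]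
        · linarith [le_abs_self x1, abs_nonneg (Real.log (1 / (n * Real.pi)))]
      linarith
    have hΦd : DiffContOnCl ℂ Φ O := by
      refine DifferentiableOn.diffContOnCl fun w hw => ?_
      obtain ⟨h1, h2, h3⟩ := hOcl hw
      have h4 : DifferentiableAt ℂ p.1 (Zm w) :=
        (hd p hp).differentiableAt (hYo.mem_nhds (hmemY w h1 h2 (hinv.le.trans h3)))
      have h5 : DifferentiableAt ℂ (fun w => p.1 (Zm w)) w :=
        h4.comp w (by simp only [hZm]; fun_prop)
      have h6 : DifferentiableAt ℂ E w := by simp only [hE]; fun_prop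
      exact ((h5.mul (by fun_prop)).mul ((h6.const_mul _).cexp)).differentiableWithinAt
    intro w h1 h2 h3
    rw [← hΦn]
    refine norm_le_of_forall_mem_frontier_norm_le hOb hΦd ?_ (subset_closure (show w ∈ O from ⟨h1, h2, h3⟩))
    intro w hw
    obtain ⟨h1, h2, h3⟩ := hOcl (frontier_subset_closure hw)
    have h0 : 0 ≤ (E w).re := hinv.le.trans h3
    have hnot : w ∉ O := by rw [frontier, hOo.interior_eq] at hw; exact hw.2
    rw [hΦn]
    have hnh : 1 ≤ n ^ (1/2 : ℝ) := Real.one_le_rpow hn1 (by norm_num)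
    obtain ⟨h4, h5⟩ := hkey w h1 h2 h0
    have hX := Real.exp_pos w.re
    by_cases hre : w.re = x1
    · have h6 := hdec p hp (Zm w) ⟨w, ⟨hre, h2, h0⟩, rfl⟩
      have h7 : (E w).re ≤ H := by
        rw [hre] at h5
        have := abs_nonneg w.im
        have := Real.exp_pos x1
        simp only [hH]; linarith [mul_nonneg (abs_nonneg w.im) this.le]
      have h8 : Real.exp (ε * n * (E w).re) ≤ Real.exp (ε * H) ^ p.2 := by
        rw [← Real.exp_nat_mul]
        apply Real.exp_le_exp.2
        have : ε * n * (E w).re ≤ ε * n * H := by gcongr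
        rw [← hnd]; linarith
      rw [hre]
      have hq0 := hq.1
      calc _ ≤ C2 * q ^ p.2 * Real.exp ((ℓ - 1) / 2 * x1) * Real.exp (ε * H) ^ p.2 := by gcongr
        _ = C2 * Real.exp ((ℓ - 1) / 2 * x1) * (q * Real.exp (ε * H)) ^ p.2 := by rw [mul_pow]; ring
        _ = C2 * Real.exp ((ℓ - 1) / 2 * x1) * 1 := by rw [hεq, one_pow]
        _ ≤ C3 * n ^ (1/2 : ℝ) := by
          gcongr
          rw [hC3]
          have : 0 < (16 / ℓ) ^ (1/2 : ℝ) * Real.exp ε := by positivity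
          linarith
    · have hψ : 0 < Real.pi / 2 - |w.im| := by
        rcases h2.lt_or_eq with h | h
        · linarith
        · rw [h] at h5; simp at h5; linarith
      have hEe : (E w).re = 1 / n := by
        by_contra hne
        exact hnot ⟨lt_of_le_of_ne h1 hre, by linarith, lt_of_le_of_ne h3 (Ne.symm hne)⟩
      have h6 := hdirect p hp w h1 h2 h0 (ℓ / (16 * n) * (Real.exp (ℓ * w.re) / Real.exp w.re)) (by positivity) (by
        rw [hEe, div_le_iff₀ hn0] at h5
        rw [← mul_div_assoc, div_le_iff₀ hX]
        have hV := Real.exp_pos (ℓ * w.re)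
        rw [div_mul_eq_mul_div, div_le_iff₀ (by positivity)]
        have := mul_le_mul_of_nonneg_left h5 (mul_pos hℓ hV).le
        linarith)
      have h7 : (ℓ / (16 * n) * (Real.exp (ℓ * w.re) / Real.exp w.re)) ^ (-(1/2) : ℝ) =
          (16 / ℓ) ^ (1/2 : ℝ) * n ^ (1/2 : ℝ) * Real.exp (-((ℓ - 1) / 2 * w.re)) := by
        rw [← Real.exp_sub, Real.mul_rpow (by positivity) (by positivity), ← Real.exp_mul,
          Real.rpow_neg (by positivity), ← Real.inv_rpow (by positivity), inv_div,
          show 16 * n / ℓ = 16 / ℓ * n by ring, Real.mul_rpow (by positivity) (by positivity)]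
        congr 2; ring
      rw [h7] at h6
      have h8 : ε * n * (E w).re = ε := by rw [hEe]; field_simp
      rw [h8]
      calc _ ≤ ((16 / ℓ) ^ (1/2 : ℝ) * n ^ (1/2 : ℝ) * Real.exp (-((ℓ - 1) / 2 * w.re))) *
            Real.exp ((ℓ - 1) / 2 * w.re) * Real.exp ε := by gcongr
        _ = (16 / ℓ) ^ (1/2 : ℝ) * Real.exp ε * n ^ (1/2 : ℝ) *
            (Real.exp (-((ℓ - 1) / 2 * w.re)) * Real.exp ((ℓ - 1) / 2 * w.re)) := by ring
        _ = (16 / ℓ) ^ (1/2 : ℝ) * Real.exp ε * n ^ (1/2 : ℝ) := by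
          rw [← Real.exp_add, neg_add_cancel, Real.exp_zero, mul_one]
        _ ≤ C3 * n ^ (1/2 : ℝ) := by
          gcongr
          rw [hC3]
          have : 0 < C2 * Real.exp ((ℓ - 1) / 2 * x1) := by positivity
          linarith
  -- conclusion
  set k := ε * s1 / 4 with hk
  have hk0 : 0 < k := by positivity
  refine ⟨C3 * (1 + 1 / k) + (ψ0 / 8) ^ (-(1/2) : ℝ) * Real.exp (2 * k / s1), by positivity, k, hk0,
    min V1 (s1 / (2 * K)), by positivity, ?_⟩
  intro p hp hn w' hw1 hw2
  set n : ℝ := (p.2 : ℝ) with hnd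
  have hn0 : 0 < n := Nat.cast_pos.2 hn
  set w : ℂ := w' / ℓ with hw
  have hℓc : (ℓ : ℂ) ≠ 0 := by exact_mod_cast hℓ.ne'
  have hww : w' = ℓ * w := by rw [hw]; field_simp
  have hre : w'.re = ℓ * w.re := by rw [hww, (hmul w).1]
  have him : w'.im = ℓ * w.im := by rw [hww, (hmul w).2]
  have hZ : z0 + exp (c * I) * exp w' = Zm w := by rw [hww]
  rw [hZ, hre]
  rw [hre] at hw1
  rw [him, abs_mul, abs_of_pos hℓ] at hw2
  set X := Real.exp w.re with hX
  set V := Real.exp (ℓ * w.re) with hV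
  have hX0 : 0 < X := Real.exp_pos _
  have hV0 : 0 < V := Real.exp_pos _
  have hVX : V ^ (1 / ℓ) = X := by
    rw [hV, ← Real.exp_mul, hX]; congr 1; field_simp
  rw [hVX]
  have hVV1 : V < V1 := hw1.trans_le (min_le_left _ _)
  have hVs : V * (2 * K) ≤ s1 := by
    have := (hw1.trans_le (min_le_right _ _)).le
    rwa [le_div_iff₀ (by positivity)] at this
  have hwre : w.re < x1 := by
    rw [hx1, lt_div_iff₀ hℓ]
    have : Real.log V < Real.log V1 := Real.log_lt_log hV0 hVV1
    rw [hV, Real.log_exp] at this; linarith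
  have hψ : ψ0 ≤ ℓ * (Real.pi / 2 - |w.im|) := by linarith
  have hψ1' : ψ1 ≤ Real.pi / 2 - |w.im| := by
    refine (min_le_left _ _).trans ?_
    rw [div_le_iff₀ hℓ]; linarith
  have him2 : |w.im| < Real.pi / 2 := by linarith
  have hcos : s1 ≤ Real.cos w.im := by
    rw [hs1, ← Real.cos_pi_div_two_sub, ← Real.cos_abs w.im]
    apply Real.cos_le_cos_of_nonneg_of_le_pi (abs_nonneg _) <;> linarith
  have hlow : X * s1 / 2 ≤ (E w).re := by
    rw [hEre]
    have h1 : -1 ≤ Real.cos ((1 + ℓ) * w.im) := Real.neg_one_le_cos _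
    have h2 : K * (X * V * (-1)) ≤ K * (X * V * Real.cos ((1 + ℓ) * w.im)) := by gcongr
    have h3 : X * s1 ≤ X * Real.cos w.im := by gcongr
    have h4 : X * (V * (2 * K)) ≤ X * s1 := by gcongr
    change _ ≤ X * Real.cos w.im + K * (X * V * Real.cos ((1 + ℓ) * w.im))
    linarith
  have h0 : 0 ≤ (E w).re := le_trans (by positivity) hlow
  by_cases hc1 : 1 / n < (E w).re
  · have h1 := hMP p hp hn w hwre him2 hc1
    rw [← hnd] at h1
    have h2 : ‖p.1 (Zm w)‖ ≤ C3 * n ^ (1/2 : ℝ) * Real.exp (-((ℓ - 1) / 2 * w.re)) * Real.exp (-(ε * n * (E w).re)) := by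
      rw [Real.exp_neg, Real.exp_neg, ← div_eq_mul_inv, ← div_eq_mul_inv, le_div_iff₀ (Real.exp_pos _),
        le_div_iff₀ (Real.exp_pos _)]
      linarith
    have h3 : Real.exp (-((ℓ - 1) / 2 * w.re)) = X ^ (1/2 : ℝ) * V ^ (-(1/2) : ℝ) := by
      rw [hX, hV, ← Real.exp_mul, ← Real.exp_mul, ← Real.exp_add]; congr 1; ring
    have h4 : (n * X) ^ (1/2 : ℝ) ≤ (1 + 1 / k) * Real.exp (k * n * X) := by
      have ha : 0 < n * X := by positivity
      have h5 : (n * X) ^ (1/2 : ℝ) ≤ 1 + n * X := by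
        rw [← Real.sqrt_eq_rpow]
        apply Real.sqrt_le_iff.2 ⟨by positivity, by linarith [sq_nonneg (n * X)]⟩
      have h6 := Real.add_one_le_exp (k * n * X)
      have h7 : 1 + n * X ≤ (1 + 1 / k) * (k * n * X + 1) := by
        have : (1 + 1 / k) * (k * n * X + 1) = 1 + n * X + k * n * X + 1 / k := by field_simp; ring
        rw [this]
        have : 0 < k * n * X + 1 / k := by positivity
        linarith
      refine h5.trans (h7.trans ?_)
      gcongr
    have h5 : Real.exp (-(ε * n * (E w).re)) ≤ Real.exp (-(k * n * X) + -k * n * X) := by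
      apply Real.exp_le_exp.2
      have : ε * n * (X * s1 / 2) ≤ ε * n * (E w).re := by gcongr
      have : ε * n * (X * s1 / 2) = 2 * (k * n * X) := by rw [hk]; ring
      linarith
    calc ‖p.1 (Zm w)‖ ≤ C3 * n ^ (1/2 : ℝ) * (X ^ (1/2 : ℝ) * V ^ (-(1/2) : ℝ)) * Real.exp (-(k * n * X) + -k * n * X) := by
          rw [h3] at h2
          refine h2.trans ?_
          gcongr
      _ = C3 * (n * X) ^ (1/2 : ℝ) * V ^ (-(1/2) : ℝ) * (Real.exp (-(k * n * X)) * Real.exp (-k * n * X)) := by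
          rw [Real.mul_rpow hn0.le hX0.le, Real.exp_add]; ring
      _ ≤ C3 * ((1 + 1 / k) * Real.exp (k * n * X)) * V ^ (-(1/2) : ℝ) * (Real.exp (-(k * n * X)) * Real.exp (-k * n * X)) := by
          gcongr
      _ = C3 * (1 + 1 / k) * V ^ (-(1/2) : ℝ) * Real.exp (-k * n * X) * (Real.exp (k * n * X) * Real.exp (-(k * n * X))) := by ring
      _ = C3 * (1 + 1 / k) * V ^ (-(1/2) : ℝ) * Real.exp (-k * n * X) := by
          rw [← Real.exp_add, add_neg_cancel, Real.exp_zero, mul_one]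
      _ ≤ _ := by
          gcongr
          have : 0 < (ψ0 / 8) ^ (-(1/2) : ℝ) * Real.exp (2 * k / s1) := by positivity
          linarith
  · push Not at hc1
    have h1 := hdirect p hp w hwre.le him2.le h0 (ψ0 / 8 * V) (by positivity) (by
      change ψ0 / 8 * V ≤ ℓ * (Real.pi / 2 - |w.im|) / 8 * V
      gcongr)
    rw [Real.mul_rpow (by positivity) hV0.le] at h1
    have h2 : n * X ≤ 2 / s1 := by
      have h3 := hlow.trans hc1
      rw [le_div_iff₀ hn0] at h3
      rw [le_div_iff₀ hs10]; linarith
    have h3 : 1 ≤ Real.exp (2 * k / s1) * Real.exp (-k * n * X) := by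
      rw [← Real.exp_add]
      apply Real.one_le_exp
      have : k * (n * X) ≤ k * (2 / s1) := by gcongr
      have e : 2 * k / s1 = k * (2 / s1) := by ring
      rw [e]; linarith
    calc ‖p.1 (Zm w)‖ ≤ (ψ0 / 8) ^ (-(1/2) : ℝ) * V ^ (-(1/2) : ℝ) * 1 := by linarith
      _ ≤ (ψ0 / 8) ^ (-(1/2) : ℝ) * V ^ (-(1/2) : ℝ) * (Real.exp (2 * k / s1) * Real.exp (-k * n * X)) := by gcongr
      _ = ((ψ0 / 8) ^ (-(1/2) : ℝ) * Real.exp (2 * k / s1)) * V ^ (-(1/2) : ℝ) * Real.exp (-k * n * X) := by ring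
      _ ≤ _ := by
        gcongr
        have : 0 < C3 * (1 + 1 / k) := by positivity
        linarith

lemma A_trig {α A : ℝ} (hα : 0 < α) (hα2 : α < 2) (hA : 0 < A) :
    ∃ B > 0, ∃ ρ > 0, ρ ≤ 1 ∧ α * Real.pi / 2 + A * ρ < Real.pi ∧
      ∀ r y : ℝ, 0 < r → r < ρ → |y| ≤ α * Real.pi / 2 + A * r →
        r / 2 ≤ Real.cos (y / α) - B * r * Real.cos ((1 / α + 1) * y) := by
  have hpi := Real.pi_pos
  set y0 := α * Real.pi / 2 with hy0
  set s := Real.sin y0 with hs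
  have hs0 : 0 < s := Real.sin_pos_of_pos_of_lt_pi (by positivity) (by rw [hy0]; nlinarith)
  have hc0 : Real.cos ((1 / α + 1) * y0) = -s := by
    have : (1 / α + 1) * y0 = y0 + Real.pi / 2 := by rw [hy0]; field_simp; ring
    rw [this, Real.cos_add_pi_div_two]
  have hcont : ContinuousAt (fun y : ℝ => Real.cos ((1 / α + 1) * y)) y0 := by fun_prop
  have hev : ∀ᶠ y in nhds y0, Real.cos ((1 / α + 1) * y) < -s / 2 :=
    hcont.eventually_lt continuousAt_const (by simp only [hc0]; linarith)
  obtain ⟨δ, hδ, hδ2⟩ := Metric.eventually_nhds_iff.1 hev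
  have hy0p : 0 < y0 := by positivity
  set d := min (δ / 2) (y0 / 2) with hd
  have hd0 : 0 < d := by positivity
  set s2 := Real.sin (d / α) with hs2
  have hdα : d / α ≤ Real.pi / 2 := by
    have : d ≤ y0 / 2 := min_le_right _ _
    rw [div_le_iff₀ hα]; rw [hy0] at this; nlinarith
  have hs20 : 0 < s2 := Real.sin_pos_of_pos_of_lt_pi (by positivity) (by linarith)
  set B := 2 * (A / α + 1) / s with hB
  have hB0 : 0 < B := by positivity
  have hgap : 0 < Real.pi - y0 := by rw [hy0]; nlinarith
  refine ⟨B, hB0, min (min 1 (s2 / (2 * (B + 1)))) (min ((Real.pi - y0) / (2 * A)) (min (d / A) (α / A))),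
    by positivity, (min_le_left _ _).trans (min_le_left _ _), ?_, ?_⟩
  · have : min (min 1 (s2 / (2 * (B + 1)))) (min ((Real.pi - y0) / (2 * A)) (min (d / A) (α / A)))
      ≤ (Real.pi - y0) / (2 * A) := (min_le_right _ _).trans (min_le_left _ _)
    have h2 := mul_le_mul_of_nonneg_left this hA.le
    have : A * ((Real.pi - y0) / (2 * A)) = (Real.pi - y0) / 2 := by field_simp
    linarith
  intro r y hr hrρ hy
  rw [lt_min_iff, lt_min_iff, lt_min_iff, lt_min_iff] at hrρ
  obtain ⟨⟨h1, h2⟩, h3, h4, h5⟩ := hrρ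
  rw [lt_div_iff₀ (by positivity)] at h2 h3 h4 h5
  rw [← Real.cos_abs (y / α), ← Real.cos_abs ((1 / α + 1) * y), abs_div, abs_mul,
    abs_of_pos hα, abs_of_pos (by positivity : (0:ℝ) < 1 / α + 1)]
  have ht0 := abs_nonneg y
  generalize |y| = t at *
  by_cases ht : y0 - d ≤ t
  · have hct := @hδ2 t (by
      rw [Real.dist_eq, abs_lt]
      have : d ≤ δ / 2 := min_le_left _ _
      constructor <;> nlinarith)
    have hcos : -(A * r / α) ≤ Real.cos (t / α) := by
      by_cases hty : t ≤ y0
      · have : 0 ≤ Real.cos (t / α) := by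
          apply Real.cos_nonneg_of_neg_pi_div_two_le_of_le
          · have : 0 ≤ t := by have : d ≤ y0 / 2 := min_le_right _ _
                               linarith
            have : 0 ≤ t / α := by positivity
            linarith
          · rw [div_le_iff₀ hα]; rw [hy0] at hty; linarith
        have : 0 ≤ A * r / α := by positivity
        linarith
      · push Not at hty
        have e : t / α = (t - y0) / α + Real.pi / 2 := by rw [hy0]; field_simp; ring
        rw [e, Real.cos_add_pi_div_two, neg_le_neg_iff]
        have h0 : 0 ≤ (t - y0) / α := by apply div_nonneg <;> linarith
        calc _ ≤ (t - y0) / α := Real.sin_le h0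
          _ ≤ _ := by gcongr; linarith
    have e : B * r * (s / 2) = A * r / α + r := by rw [hB]; field_simp
    have : B * r * Real.cos ((1 / α + 1) * t) ≤ B * r * (-s / 2) := by gcongr
    linarith
  · push Not at ht
    have hcos : s2 ≤ Real.cos (t / α) := by
      rw [hs2, ← Real.cos_pi_div_two_sub]
      apply Real.cos_le_cos_of_nonneg_of_le_pi
      · positivity
      · have : 0 < d / α := by positivity
        linarith
      · rw [hy0] at ht
        have e : Real.pi / 2 - d / α = (α * Real.pi / 2 - d) / α := by field_simp
        rw [e]; gcongr
    have : B * r * Real.cos ((1 / α + 1) * t) ≤ B * r * 1 := by gcongr; exact Real.cos_le_one _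
    nlinarith

lemma A_corner_int {α A ρ c : ℝ} {z0 : ℂ} {G : Set ℂ} (hα : 0 < α) (hα2 : α < 2) (hA : 0 < A)
    (hρ : 0 < ρ) (hGo : IsOpen G) (hzG : z0 ∉ G)
    (hG : ∀ w : ℂ, Real.exp w.re < ρ → |w.im| < (2 - α) * Real.pi / 2 - A * Real.exp w.re →
      z0 + cexp (c * I) * cexp w ∉ G) (M : ℝ) (hM : 0 < M) :
    ∃ C > 0, ∃ ρ' > 0, ∀ φ : ℂ → ℂ, DifferentiableOn ℂ φ G →
      (∀ p ∈ frontier G, Tendsto (fun z => ‖φ z‖) (nhdsWithin p G) (nhds 1)) →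
      (∀ z ∈ G ∩ ball z0 ρ, Real.exp (-M) ≤ ‖φ z‖) →
      ∀ z ∈ G ∩ ball z0 ρ', -Real.log ‖φ z‖ ≤ C * ‖z - z0‖ ^ (1 / α) := by
  obtain ⟨B, hB, ρ1, hρ1, hρ1', hlt, htrig⟩ := A_trig hα hα2 hA
  set r0 := min ρ1 ρ with hr0
  have hr0p : 0 < r0 := by positivity
  have hr01 : r0 ≤ ρ1 := min_le_left _ _
  have hr02 : r0 ≤ ρ := min_le_right _ _
  set v : ℂ → ℂ := fun z => -(z - z0) * cexp (-(c * I)) with hv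
  have hvn : ∀ z, ‖v z‖ = ‖z - z0‖ := by
    intro z
    have : ‖cexp (-(c * I))‖ = 1 := by
      rw [show -(c * I : ℂ) = ((-c : ℝ) : ℂ) * I by push_cast; ring, norm_exp_ofReal_mul_I]
    simp [hv, this, norm_sub_rev]
  set U := G ∩ ball z0 r0 with hU
  have hz0 : z0 ∉ U := fun h => hzG h.1
  have hv0 : ∀ z ∈ U, v z ≠ 0 := by
    intro z hz h
    rw [← norm_eq_zero, hvn, norm_eq_zero, sub_eq_zero] at h
    exact hz0 (h ▸ hz)
  have harg : ∀ z ∈ U, |(v z).arg| ≤ α * Real.pi / 2 + A * ‖z - z0‖ := by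
    intro z hz
    by_contra! hcon
    have hzr : ‖z - z0‖ < r0 := by simpa [dist_eq_norm] using hz.2
    have hexp : Real.exp (Complex.log (v z)).re = ‖z - z0‖ := by
      rw [log_re, hvn, Real.exp_log]
      rw [← hvn]; exact norm_pos_iff.2 (hv0 z hz)
    have key : ∀ σ : ℝ, cexp (σ * Real.pi * I) = -1 → |(v z).arg + σ * Real.pi| < (2 - α) * Real.pi / 2 - A * ‖z - z0‖ → False := by
      intro σ hσ hlt'
      refine hG (Complex.log (v z) + σ * Real.pi * I) ?_ ?_ ?_
      · simp [hexp]; linarith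
      · simp only [add_re, mul_re, ofReal_re, ofReal_im, I_re, I_im, mul_im, add_im, log_im]
        simp [hexp]; exact hlt'
      · rw [Complex.exp_add, hσ, Complex.exp_log (hv0 z hz)]
        have : z0 + cexp (c * I) * (v z * -1) = z := by
          simp only [hv]
          rw [show cexp (c * I) * (-(z - z0) * cexp (-(c * I)) * -1) =
            (z - z0) * (cexp (c * I) * cexp (-(c * I))) by ring, ← Complex.exp_add]
          simp
        rw [this]; exact hz.1
    have h1 := (v z).arg_le_pi
    have h2 := (v z).neg_pi_lt_arg
    have h3 := mul_nonneg hA.le (norm_nonneg (z - z0))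
    have h4 := mul_pos hα Real.pi_pos
    rcases le_total 0 (v z).arg with h | h
    · rw [abs_of_nonneg h] at hcon
      apply key (-1)
      · rw [show ((-1:ℝ):ℂ) * Real.pi * I = -(Real.pi * I) by push_cast; ring, Complex.exp_neg, exp_pi_mul_I]; norm_num
      · rw [abs_lt]; constructor <;> linarith
    · rw [abs_of_nonpos h] at hcon
      apply key 1
      · rw [show ((1:ℝ):ℂ) * Real.pi * I = (Real.pi * I) by push_cast; ring, exp_pi_mul_I]
      · rw [abs_lt]; constructor <;> linarith
  have hslit : ∀ z ∈ U, v z ∈ slitPlane := by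
    intro z hz
    have hzr : ‖z - z0‖ < r0 := by simpa [dist_eq_norm] using hz.2
    rw [mem_slitPlane_iff_arg]
    refine ⟨fun h => ?_, hv0 z hz⟩
    have := harg z hz
    rw [h, abs_of_pos Real.pi_pos] at this
    nlinarith
  set q : ℂ → ℂ := fun z => cexp (Complex.log (v z) * ((1 / α : ℝ) : ℂ)) -
    B * cexp (Complex.log (v z) * ((1 / α + 1 : ℝ) : ℂ)) with hq
  have hqd : DifferentiableOn ℂ q U := by
    intro z hz
    have : DifferentiableAt ℂ v z := by simp only [hv]; fun_prop
    have hl := this.clog (hslit z hz)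
    exact ((hl.mul_const _).cexp.sub ((hl.mul_const _).cexp.const_mul _)).differentiableWithinAt
  have hqre : ∀ z ∈ U, (q z).re = ‖z - z0‖ ^ (1 / α) * (Real.cos ((v z).arg / α) -
      B * ‖z - z0‖ * Real.cos ((1 / α + 1) * (v z).arg)) := by
    intro z hz
    have hp : 0 < ‖z - z0‖ := by rw [← hvn]; exact norm_pos_iff.2 (hv0 z hz)
    simp only [hq, sub_re, re_ofReal_mul, exp_re, re_mul_ofReal, im_mul_ofReal, log_re, log_im, hvn]
    rw [← Real.rpow_def_of_pos hp, ← Real.rpow_def_of_pos hp, Real.rpow_add hp, Real.rpow_one,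
      mul_comm (v z).arg (1 / α + 1), mul_one_div]
    ring
  have hqlow : ∀ z ∈ U, ‖z - z0‖ ^ (1 / α) * (‖z - z0‖ / 2) ≤ (q z).re := by
    intro z hz
    have hp : 0 < ‖z - z0‖ := by rw [← hvn]; exact norm_pos_iff.2 (hv0 z hz)
    have hzr : ‖z - z0‖ < r0 := by simpa [dist_eq_norm] using hz.2
    rw [hqre z hz]
    gcongr
    exact htrig _ _ hp (hzr.trans_le hr01) (harg z hz)
  set h0 := (r0 / 2) ^ (1 / α) * (r0 / 2 / 2) with hh0
  have hh0p : 0 < h0 := by positivity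
  set N := M / h0 with hN
  have hNp : 0 < N := by positivity
  refine ⟨N * (1 + B), by positivity, r0, hr0p, ?_⟩
  intro φ hφ hφ1 hφM
  have hφ0 : ∀ z ∈ U, 0 < ‖φ z‖ := fun z hz =>
    (Real.exp_pos _).trans_le (hφM z ⟨hz.1, ball_subset_ball hr02 hz.2⟩)
  have hmax : ∀ z ∈ U, ‖cexp (-N * q z) / φ z‖ ≤ 1 := by
    apply A_maxPrinciple (hGo.inter isOpen_ball) (isBounded_ball.subset inter_subset_right)
    · intro z hz
      exact (((hqd z hz).const_mul _).cexp).div ((hφ z hz.1).mono inter_subset_left)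
        (norm_pos_iff.1 (hφ0 z hz))
    · intro p hp M' hM'
      have hpc : p ∈ closure G := closure_mono inter_subset_left hp.1
      have hgen : ∀ z ∈ U, ‖cexp (-N * q z) / φ z‖ = Real.exp (-(N * (q z).re)) / ‖φ z‖ := by
        intro z hz
        rw [norm_div, Complex.norm_exp]
        congr 2
        simp [mul_re]
      by_cases hpG : p ∈ G
      · have hpb : p ∉ ball z0 r0 := by
          intro h
          have : p ∈ interior U := by
            rw [(hGo.inter isOpen_ball).interior_eq]; exact ⟨hpG, h⟩
          exact hp.2 this
        have hd : r0 / 2 < ‖p - z0‖ := by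
          rw [mem_ball, dist_eq_norm] at hpb; linarith
        have hev : ∀ᶠ z in nhdsWithin p U, r0 / 2 < ‖z - z0‖ :=
          nhdsWithin_le_nhds (((continuous_id.sub continuous_const).norm.continuousAt).eventually
            (lt_mem_nhds hd))
        filter_upwards [hev, self_mem_nhdsWithin] with z hz hzU
        rw [hgen z hzU]
        refine lt_of_le_of_lt ?_ hM'
        rw [div_le_one (hφ0 z hzU)]
        refine le_trans ?_ (hφM z ⟨hzU.1, ball_subset_ball hr02 hzU.2⟩)
        rw [Real.exp_le_exp, neg_le_neg_iff]
        have : h0 ≤ (q z).re := le_trans (by rw [hh0]; gcongr) (hqlow z hzU)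
        calc M = N * h0 := by rw [hN]; field_simp
          _ ≤ _ := by gcongr
      · have hpf : p ∈ frontier G := ⟨hpc, by rwa [hGo.interior_eq]⟩
        have h1 : ∀ᶠ z in nhdsWithin p U, 1 / M' < ‖φ z‖ :=
          (nhdsWithin_mono p inter_subset_left) ((hφ1 p hpf).eventually
            (lt_mem_nhds (by rw [div_lt_one (by linarith)]; exact hM')))
        filter_upwards [h1, self_mem_nhdsWithin] with z hz hzU
        rw [hgen z hzU, div_lt_iff₀ (hφ0 z hzU)]
        have : Real.exp (-(N * (q z).re)) ≤ 1 := by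
          rw [Real.exp_le_one_iff, neg_nonpos]
          have : 0 ≤ (q z).re := le_trans (by positivity) (hqlow z hzU)
          positivity
        rw [div_lt_iff₀ (by linarith)] at hz
        linarith
  intro z hz
  have h := hmax z hz
  have hp := hφ0 z hz
  rw [norm_div, div_le_one hp, Complex.norm_exp] at h
  have h2 := Real.log_le_log (Real.exp_pos _) h
  rw [Real.log_exp] at h2
  have e : (-(N : ℂ) * q z).re = -(N * (q z).re) := by simp [mul_re]
  rw [e] at h2
  have hzr : ‖z - z0‖ < r0 := by simpa [dist_eq_norm] using hz.2
  have hup : (q z).re ≤ ‖z - z0‖ ^ (1 / α) * (1 + B) := by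
    rw [hqre z hz]
    gcongr
    have h1 := Real.cos_le_one ((v z).arg / α)
    have h2 := Real.neg_one_le_cos ((1 / α + 1) * (v z).arg)
    have : B * ‖z - z0‖ * (-1) ≤ B * ‖z - z0‖ * Real.cos ((1 / α + 1) * (v z).arg) := by gcongr
    have : B * ‖z - z0‖ ≤ B * 1 := by gcongr; linarith
    linarith
  have := mul_le_mul_of_nonneg_left hup hNp.le
  linarith

lemma A_radial {a c p : ℝ} (ha : -2 < a) (hc : 0 < c) (hp : 0 < p) : ∃ C > 0, ∀ (z0 : ℂ) (n : ℕ), 0 < n →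
    Integrable (fun z : ℂ => ‖z - z0‖ ^ a * Real.exp (-c * n * ‖z - z0‖ ^ p)) ∧
    ∫ z : ℂ, ‖z - z0‖ ^ a * Real.exp (-c * n * ‖z - z0‖ ^ p) ≤ C * (n : ℝ) ^ (-((a + 2) / p)) := by
  have hG : 0 < Real.Gamma ((a + 2) / p) := Real.Gamma_pos_of_pos (by apply div_pos <;> linarith)
  refine ⟨(2 * Real.pi / p) * c ^ (-(a + 2) / p) * Real.Gamma ((a + 2) / p), by positivity, ?_⟩
  intro z0 n hn
  have hn' : (0:ℝ) < n := Nat.cast_pos.2 hn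
  have key : ∫ z : ℂ, ‖z‖ ^ a * Real.exp (-(c * n) * ‖z‖ ^ p) =
      (2 * Real.pi / p) * (c * n) ^ (-(a + 2) / p) * Real.Gamma ((a + 2) / p) := by
    rw [integral_fun_norm_addHaar volume (fun r : ℝ => r ^ a * Real.exp (-(c * n) * r ^ p))]
    have h := integral_rpow_mul_exp_neg_mul_rpow (p := p) (q := a + 1) (b := c * n) hp (by linarith) (by positivity)
    have e : ∀ y ∈ Ioi (0:ℝ), y ^ (Module.finrank ℝ ℂ - 1) • (y ^ a * Real.exp (-(c * n) * y ^ p)) =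
        y ^ (a + 1) * Real.exp (-(c * n) * y ^ p) := by
      intro y hy
      rw [finrank_real_complex, Real.rpow_add hy, Real.rpow_one]; simp; ring
    rw [setIntegral_congr_fun measurableSet_Ioi e, h, finrank_real_complex, Measure.real, Complex.volume_ball]
    rw [show a + 1 + 1 = a + 2 by ring]
    simp; ring
  have e : ∫ z : ℂ, ‖z - z0‖ ^ a * Real.exp (-c * n * ‖z - z0‖ ^ p) =
      ∫ z : ℂ, ‖z‖ ^ a * Real.exp (-(c * n) * ‖z‖ ^ p) := by
    rw [← integral_sub_right_eq_self (fun z : ℂ => ‖z‖ ^ a * Real.exp (-(c * n) * ‖z‖ ^ p)) z0]; simp only [neg_mul]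
  constructor
  · by_contra h
    rw [integral_undef h, key] at e
    have : 0 < (2 * Real.pi / p) * (c * n) ^ (-(a + 2) / p) * Real.Gamma ((a + 2) / p) := by positivity
    linarith
  · rw [e, key, Real.mul_rpow hc.le hn'.le, neg_div]
    apply le_of_eq; ring

lemma A_radial_loc {a : ℝ} (ha : -2 < a) (z0 : ℂ) (R : ℝ) :
    IntegrableOn (fun z : ℂ => ‖z - z0‖ ^ a) (ball z0 R) := by
  obtain ⟨C, -, h⟩ := A_radial ha one_pos one_pos
  have := ((h z0 1 one_pos).1.const_mul (Real.exp R)).integrableOn (s := ball z0 R)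
  refine this.mono' ?_ ?_
  · have : Measurable (fun z : ℂ => ‖z - z0‖ ^ a) := by fun_prop
    exact this.aestronglyMeasurable
  · refine (ae_restrict_iff' measurableSet_ball).2 (ae_of_all _ fun z hz => ?_)
    rw [mem_ball, dist_eq_norm] at hz
    rw [Real.norm_of_nonneg (by positivity)]
    have : 1 ≤ Real.exp R * Real.exp (-1 * (1:ℕ) * ‖z - z0‖ ^ (1:ℝ)) := by
      rw [← Real.exp_add, Real.one_le_exp_iff]; simp; linarith
    calc ‖z - z0‖ ^ a = ‖z - z0‖ ^ a * 1 := by ring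
      _ ≤ ‖z - z0‖ ^ a * (Real.exp R * Real.exp (-1 * (1:ℕ) * ‖z - z0‖ ^ (1:ℝ))) := by gcongr
      _ = _ := by ring

lemma A_kernel {a b c d : ℝ} {γ : ℝ → ℂ} {ζ : ℂ} (hab : a ≤ b) (hγ : ContinuousOn γ (Icc a b)) (hc : 0 < c)
    (hd : 0 < d) (hch : ∀ s ∈ Icc a b, ∀ s' ∈ Icc a b, c * |s - s'| ≤ ‖γ s - γ s'‖)
    (hζ : ∀ s ∈ Icc a b, d ≤ ‖ζ - γ s‖) :
    ∫ s in Icc a b, (‖ζ - γ s‖ ^ 2)⁻¹ ≤ 4 * Real.pi / (c * d) := by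
  obtain ⟨s0, hs0, hmin⟩ := isCompact_Icc.exists_isMinOn (nonempty_Icc.2 hab)
    ((continuousOn_const (c := ζ)).sub hγ).norm
  have hint : Integrable (fun s : ℝ => (2 / d ^ 2) * (1 + ((c / (2 * d)) * (s - s0)) ^ 2)⁻¹) :=
    ((integrable_inv_one_add_sq.comp_mul_left' (by positivity : c / (2 * d) ≠ 0)).comp_sub_right s0).const_mul _
  calc ∫ s in Icc a b, (‖ζ - γ s‖ ^ 2)⁻¹
      ≤ ∫ s in Icc a b, (2 / d ^ 2) * (1 + ((c / (2 * d)) * (s - s0)) ^ 2)⁻¹ := by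
        apply setIntegral_mono_on _ hint.integrableOn measurableSet_Icc
        · intro s hs
          have h1 := hζ s hs
          have h2 : ‖ζ - γ s0‖ ≤ ‖ζ - γ s‖ := hmin hs
          have h3 := hch s hs s0 hs0
          have h4 : ‖γ s - γ s0‖ ≤ ‖ζ - γ s0‖ + ‖ζ - γ s‖ := by
            rw [show γ s - γ s0 = (ζ - γ s0) - (ζ - γ s) by ring]; exact norm_sub_le _ _
          have h5 : c / 2 * |s - s0| ≤ ‖ζ - γ s‖ := by linarith
          have h6 : (c / 2 * |s - s0|) ^ 2 ≤ ‖ζ - γ s‖ ^ 2 := by gcongr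
          have h7 : d ^ 2 ≤ ‖ζ - γ s‖ ^ 2 := by gcongr
          rw [mul_pow, sq_abs] at h6
          have e : (2 / d ^ 2) * (1 + ((c / (2 * d)) * (s - s0)) ^ 2)⁻¹ =
              ((d ^ 2 + (c / 2) ^ 2 * (s - s0) ^ 2) / 2)⁻¹ := by field_simp
          rw [e]
          apply inv_anti₀ (by positivity); linarith
        · apply ContinuousOn.integrableOn_Icc
          apply ContinuousOn.inv₀ (((continuousOn_const (c := ζ)).sub hγ).norm.pow 2)
          intro s hs
          have := hζ s hs
          exact (pow_pos (by linarith : 0 < ‖ζ - γ s‖) 2).ne'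
    _ ≤ ∫ s, (2 / d ^ 2) * (1 + ((c / (2 * d)) * (s - s0)) ^ 2)⁻¹ :=
        setIntegral_le_integral hint (ae_of_all _ fun s => by positivity)
    _ = 4 * Real.pi / (c * d) := by
        rw [integral_const_mul, integral_sub_right_eq_self (fun s => (1 + ((c / (2 * d)) * s) ^ 2)⁻¹) s0,
          Measure.integral_comp_mul_left (fun x : ℝ => (1 + x ^ 2)⁻¹), integral_univ_inv_one_add_sq,
          abs_of_pos (by positivity), smul_eq_mul]
        field_simp; ring

/-- local inverse of an injective holomorphic map -/
lemma A_inv {U : Set ℂ} {T : ℂ → ℂ} (hU : IsOpen U) (hT : DifferentiableOn ℂ T U) (hinj : InjOn T U) :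
    ∃ S : ℂ → ℂ, (∀ w ∈ U, S (T w) = w) ∧ IsOpen (T '' U) ∧
      ∀ w ∈ U, HasDerivAt S (deriv T w)⁻¹ (T w) := by
  have hS : ∀ w ∈ U, Function.invFunOn T U (T w) = w := fun w hw => hinj.leftInvOn_invFunOn hw
  have hnh : ∀ w ∈ U, ∀ V ∈ nhds w, T '' V ∈ nhds (T w) := by
    intro w hw V hV
    have han : AnalyticAt ℂ T w := hT.analyticAt (hU.mem_nhds hw)
    have hs : HasStrictDerivAt T (deriv T w) w := by
      exact han.hasStrictDerivAt
    have := hs.map_nhds_eq (A_deriv_ne_zero hU hT hinj hw)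
    rw [← this]; exact image_mem_map hV
  have hop : IsOpen (T '' U) := by
    rw [isOpen_iff_mem_nhds]
    rintro _ ⟨w, hw, rfl⟩
    exact hnh w hw U (hU.mem_nhds hw)
  refine ⟨Function.invFunOn T U, hS, hop, fun w hw => ?_⟩
  apply HasDerivAt.of_local_left_inverse
  · rw [ContinuousAt, hS w hw]
    intro V hV
    have := hnh w hw (V ∩ U) (inter_mem hV (hU.mem_nhds hw))
    refine mem_map.2 (mem_of_superset this ?_)
    rintro _ ⟨x, hx, rfl⟩
    simp only [mem_preimage, hS x hx.2]; exact hx.1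
  · rw [hS w hw]; exact ((hT w hw).differentiableAt (hU.mem_nhds hw)).hasDerivAt
  · exact A_deriv_ne_zero hU hT hinj hw
  · filter_upwards [hop.mem_nhds (mem_image_of_mem T hw)]
    rintro _ ⟨x, hx, rfl⟩
    rw [hS x hx]

/-- bilipschitz on compact convex sets -/
lemma A_bilip {U K : Set ℂ} {T : ℂ → ℂ} (hU : IsOpen U) (hT : DifferentiableOn ℂ T U) (hinj : InjOn T U)
    (hK : IsCompact K) (hKc : Convex ℝ K) (hKU : K ⊆ U) :
    ∃ c > 0, ∃ C > 0, ∀ z ∈ K, ∀ w ∈ K, c * ‖z - w‖ ≤ ‖T z - T w‖ ∧ ‖T z - T w‖ ≤ C * ‖z - w‖ := by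
  have hcd : ContinuousOn (deriv T) K := (hT.deriv hU).continuousOn.mono hKU
  have hCT : ContinuousOn T K := hT.continuousOn.mono hKU
  obtain ⟨C, hC⟩ := hK.exists_bound_of_continuousOn hcd
  have hup : ∀ z ∈ K, ∀ w ∈ K, ‖T z - T w‖ ≤ C * ‖z - w‖ := fun z hz w hw =>
    hKc.norm_image_sub_le_of_norm_deriv_le (fun x hx => (hT x (hKU hx)).differentiableAt (hU.mem_nhds (hKU hx)))
      hC hw hz
  -- lower bound via continuity of dslope on K × K
  have hlow : ∃ c > 0, ∀ z ∈ K, ∀ w ∈ K, c * ‖z - w‖ ≤ ‖T z - T w‖ := by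
    by_contra! hcon
    have h1 : ∀ n : ℕ, ∃ p : ℂ × ℂ, p ∈ K ×ˢ K ∧ ‖T p.1 - T p.2‖ < (1 / ((n:ℝ) + 1)) * ‖p.1 - p.2‖ := by
      intro n
      obtain ⟨z, hz, w, hw, h⟩ := hcon (1 / ((n:ℝ) + 1)) (by positivity)
      exact ⟨(z, w), ⟨hz, hw⟩, h⟩
    choose p hp hlt using h1
    obtain ⟨q, hq, ψ, hψ, hlim⟩ := (hK.prod hK).tendsto_subseq hp
    have hl1 : Tendsto (fun n => (p (ψ n)).1) atTop (nhds q.1) := (continuous_fst.tendsto q).comp hlim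
    have hl2 : Tendsto (fun n => (p (ψ n)).2) atTop (nhds q.2) := (continuous_snd.tendsto q).comp hlim
    have h0 : Tendsto (fun n => 1 / (((ψ n : ℕ) : ℝ) + 1)) atTop (nhds 0) :=
      tendsto_one_div_add_atTop_nhds_zero_nat.comp hψ.tendsto_atTop
    have hd0 : ∀ n, (p n).1 - (p n).2 ≠ 0 := by
      intro n h
      have := hlt n
      rw [h, norm_zero, mul_zero] at this
      exact absurd this (not_lt.2 (norm_nonneg _))
    have hTq : ∀ x ∈ K, ContinuousAt T x := fun x hx =>
      ((hT x (hKU hx)).differentiableAt (hU.mem_nhds (hKU hx))).continuousAt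
    have heq : T q.1 = T q.2 := by
      have a1 : Tendsto (fun n => ‖T (p (ψ n)).1 - T (p (ψ n)).2‖) atTop (nhds ‖T q.1 - T q.2‖) :=
        (((hTq _ hq.1).tendsto.comp hl1).sub ((hTq _ hq.2).tendsto.comp hl2)).norm
      have a2 : Tendsto (fun n => 1 / (((ψ n : ℕ) : ℝ) + 1) * ‖(p (ψ n)).1 - (p (ψ n)).2‖) atTop
          (nhds (0 * ‖q.1 - q.2‖)) := h0.mul (hl1.sub hl2).norm
      have := le_of_tendsto_of_tendsto' a1 a2 (fun n => (hlt (ψ n)).le)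
      rw [zero_mul] at this
      exact sub_eq_zero.1 (norm_le_zero_iff.1 this)
    have hqq : q.1 = q.2 := hinj (hKU hq.1) (hKU hq.2) heq
    have hst : HasStrictDerivAt T (deriv T q.1) q.1 :=
      (hT.analyticAt (hU.mem_nhds (hKU hq.1))).hasStrictDerivAt
    have hne := A_deriv_ne_zero hU hT hinj (hKU hq.1)
    have hlo := hst.isLittleO
    have hb := hlo.bound (by positivity : 0 < ‖deriv T q.1‖ / 2)
    have hlim' : Tendsto (fun n => p (ψ n)) atTop (nhds (q.1, q.1)) := by
      have : q = (q.1, q.1) := Prod.ext rfl hqq.symm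
      rw [← this]; exact hlim
    have hev := hlim'.eventually hb
    obtain ⟨n, hn1, hn2⟩ := (hev.and (h0.eventually (gt_mem_nhds (by positivity : 0 < ‖deriv T q.1‖ / 2)))).exists
    have hl := hlt (ψ n)
    set x := (p (ψ n)).1 - (p (ψ n)).2
    have hx : 0 < ‖x‖ := norm_pos_iff.2 (hd0 _)
    have h3 : ‖deriv T q.1‖ * ‖x‖ ≤ ‖T (p (ψ n)).1 - T (p (ψ n)).2 - x * deriv T q.1‖ + ‖T (p (ψ n)).1 - T (p (ψ n)).2‖ := by
      rw [mul_comm, ← norm_mul, ← norm_neg (x * _)]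
      have := norm_sub_le (T (p (ψ n)).1 - T (p (ψ n)).2 - x * deriv T q.1) (T (p (ψ n)).1 - T (p (ψ n)).2)
      simpa using this
    have h4 : ‖T (p (ψ n)).1 - T (p (ψ n)).2 - x * deriv T q.1‖ ≤ ‖deriv T q.1‖ / 2 * ‖x‖ := by
      simpa [mul_comm] using hn1
    have h5 := mul_lt_mul_of_pos_right hn2 hx
    linarith
  obtain ⟨c, hc, hlow⟩ := hlow
  refine ⟨c, hc, max C 1, by positivity, fun z hz w hw => ⟨hlow z hz w hw, (hup z hz w hw).trans ?_⟩⟩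
  gcongr; exact le_max_left _ _

lemma B_seq {P : Set ℝ} {l x y : ℝ} (hl : 0 < l) (hper : ∀ t, t + l ∈ P ↔ t ∈ P)
    (hfin : ∀ a b, (P ∩ Icc a b).Finite) (hx : x ∈ P) (hy : y ∈ P) (hxy : x < y) (hyl : y < x + l) :
    ∃ (s : ℕ → ℝ) (K : ℕ), 2 ≤ K ∧ StrictMono s ∧ (∀ k, s k ∈ P) ∧
      (∀ k t, s k < t → t < s (k + 1) → t ∉ P) ∧ ∀ k, s (k + K) = s k + l := by
  have hnx : ∀ a : ℝ, a ∈ P → ∃ b, b ∈ P ∧ a < b ∧ ∀ t, a < t → t < b → t ∉ P := by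
    intro a ha
    have hf : (P ∩ Ioc a (a + l)).Finite := (hfin a (a + l)).subset (inter_subset_inter_right _ Ioc_subset_Icc_self)
    obtain ⟨b, hb, hmin⟩ := hf.exists_minimal ⟨a + l, (hper a).2 ha, by simpa using hl, le_rfl⟩
    refine ⟨b, hb.1, hb.2.1, fun t h1 h2 ht => ?_⟩
    exact absurd (hmin ⟨ht, h1, (h2.le.trans hb.2.2)⟩ h2.le) (not_le.2 h2)
  choose! nx hnP hnlt hnmin using hnx
  set s : ℕ → ℝ := fun k => nx^[k] x with hs
  have hsucc : ∀ k, s (k + 1) = nx (s k) := fun k => Function.iterate_succ_apply' _ _ _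
  have hsP : ∀ k, s k ∈ P := by
    intro k
    induction k with
    | zero => exact hx
    | succ k ih => rw [hsucc]; exact hnP _ ih
  have hmono : StrictMono s := strictMono_nat_of_lt_succ fun k => by
    rw [hsucc]; exact hnlt _ (hsP k)
  have hgap : ∀ k t, s k < t → t < s (k + 1) → t ∉ P := fun k t h1 h2 =>
    hnmin _ (hsP k) t h1 (by rwa [← hsucc])
  have hall : ∀ t ∈ P, x ≤ t → ∃ k, s k = t := by
    intro t ht hxt
    have hex : ∃ k, t ≤ s k := by
      by_contra! hcon
      have : (range s).Finite := (hfin x t).subset (by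
        rintro _ ⟨k, rfl⟩
        exact ⟨hsP k, hmono.monotone (Nat.zero_le k), (hcon k).le⟩)
      exact (infinite_range_of_injective hmono.injective) this
    classical
    have h1 := Nat.find_spec hex
    rcases hk : Nat.find hex with _ | j
    · rw [hk] at h1
      exact ⟨0, le_antisymm hxt h1⟩
    · rw [hk] at h1
      have h2 : s j < t := by
        by_contra! h
        exact Nat.find_min hex (by rw [hk]; exact Nat.lt_succ_self j) h
      refine ⟨j + 1, le_antisymm ?_ h1⟩
      by_contra! h
      exact hgap j t h2 h ht
  have hadd : ∀ a ∈ P, nx (a + l) = nx a + l := by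
    intro a ha
    have h1 := hnP a ha; have h2 := hnlt a ha
    have ha' := (hper a).2 ha
    have h3 := hnP _ ha'; have h4 := hnlt _ ha'
    apply le_antisymm
    · by_contra! h
      exact hnmin _ ha' (nx a + l) (by linarith) h ((hper _).2 h1)
    · by_contra! h
      refine hnmin _ ha (nx (a + l) - l) (by linarith) (by linarith) ((hper _).1 (by simpa using h3))
  obtain ⟨K, hK⟩ := hall (x + l) ((hper x).2 hx) (by linarith)
  obtain ⟨j, hj⟩ := hall y hy hxy.le
  refine ⟨s, K, ?_, hmono, hsP, hgap, ?_⟩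
  · have h0 : s 0 = x := rfl
    have h1 : 0 < j := hmono.lt_iff_lt.1 (by rw [h0, hj]; exact hxy)
    have h2 : j < K := hmono.lt_iff_lt.1 (by rw [hK, hj]; exact hyl)
    omega
  · intro k
    induction k with
    | zero => rw [zero_add, hK]; rfl
    | succ k ih => rw [show k + 1 + K = (k + K) + 1 by ring, hsucc, ih, hadd _ (hsP k), hsucc]

namespace JordanDomain
variable (D : JordanDomain)

lemma eq_shift {s t : ℝ} (h : D.γ s = D.γ t) : ∃ n : ℤ, t = s + n * D.l := by
  obtain ⟨m, hm, -⟩ := existsUnique_sub_zsmul_mem_Ico D.l_pos s 0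
  obtain ⟨n, hn, -⟩ := existsUnique_sub_zsmul_mem_Ico D.l_pos t 0
  have h1 := D.γ_periodic.sub_zsmul_eq m (x := s)
  have h2 := D.γ_periodic.sub_zsmul_eq n (x := t)
  rw [zero_add] at hm hn
  have := D.γ_injOn hm hn (by rw [h1, h2, h])
  refine ⟨n - m, ?_⟩
  simp only [zsmul_eq_mul] at this
  push_cast; linarith

lemma inj_lt {s t : ℝ} (h : D.γ s = D.γ t) (h1 : |t - s| < D.l) : s = t := by
  obtain ⟨n, rfl⟩ := D.eq_shift h
  have hl := D.l_pos
  have : n = 0 := by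
    rw [add_sub_cancel_left, abs_mul, abs_of_pos hl, ← Int.cast_abs] at h1
    have : ((|n| : ℤ) : ℝ) < 1 := by
      by_contra! h; nlinarith
    have : |n| < 1 := by exact_mod_cast this
    simpa using this
  simp [this]

lemma mem_L (s : ℝ) : D.γ s ∈ frontier D.G := by
  obtain ⟨t, ht, h⟩ := D.γ_periodic.exists_mem_Ico₀ D.l_pos s
  rw [h, ← D.γ_boundary]; exact mem_image_of_mem _ ht

lemma exists_param {p : ℂ} (hp : p ∈ frontier D.G) (a : ℝ) : ∃ s ∈ Ico a (a + D.l), D.γ s = p := by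
  rw [← D.γ_boundary] at hp
  obtain ⟨t, -, rfl⟩ := hp
  obtain ⟨s, hs, h⟩ := D.γ_periodic.exists_mem_Ico D.l_pos t a
  exact ⟨s, hs, h.symm⟩

end JordanDomain

/-- enumeration of the corners along the curve -/
lemma B_corners (D : JordanDomain) (B : PiecewiseAnalyticBoundary D) :
    ∃ (s : ℕ → ℝ) (K : ℕ), 2 ≤ K ∧ StrictMono s ∧ (∀ k, ∃ i, D.γ (s k) = B.τ i 1) ∧
      (∀ k t, s k < t → t < s (k + 1) → ∀ i, D.γ t ≠ B.τ i 1) ∧ ∀ k, s (k + K) = s k + D.l := by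
  set Z : Set ℂ := range fun i => B.τ i 1 with hZ
  have hZf : Z.Finite := finite_range _
  have hmem1 : ∀ i, ∀ t ∈ Icc (0:ℝ) 1, B.τ i t ∈ frontier D.G := by
    intro i t ht
    rw [← B.cover]
    exact mem_iUnion.2 ⟨i, mem_image_of_mem _ (mem_image_of_mem _ ht)⟩
  set i0 : Fin B.m := ⟨0, B.m_pos⟩
  set i1 : Fin B.m := Fin.mk ((i0.val + 1) % B.m) (Nat.mod_lt _ B.m_pos)
  have hne : B.τ i0 1 ≠ B.τ i1 1 := by
    rw [B.junction i0]
    intro h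
    have a0 : (0:ℂ) ∈ B.U i1 := B.seg_sub i1 ⟨0, by simp, by simp⟩
    have a1 : (1:ℂ) ∈ B.U i1 := B.seg_sub i1 ⟨1, by simp, by simp⟩
    exact zero_ne_one (B.inj i1 a0 a1 h)
  have hm0 := hmem1 i0 1 (by simp)
  have hm1 := hmem1 i1 1 (by simp)
  rw [ofReal_one] at hm0 hm1
  obtain ⟨x, hx, hx'⟩ := D.exists_param hm0 0
  obtain ⟨y, hy, hy'⟩ := D.exists_param hm1 x
  have hxy : x ≠ y := by rintro rfl; exact hne (hx'.symm.trans hy')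
  obtain ⟨s, K, hK, hmono, hP, hgap, hsK⟩ := B_seq (P := D.γ ⁻¹' Z) (x := x) (y := y) D.l_pos
    (fun t => by simp [D.γ_periodic t]) (fun a b => by
      obtain ⟨N, hN⟩ := exists_nat_gt ((b - a) / D.l)
      have hN' : b - a < N * D.l := by rwa [div_lt_iff₀ D.l_pos] at hN
      have hsub : D.γ ⁻¹' Z ∩ Icc a b ⊆ ⋃ j ∈ Finset.range N, (D.γ ⁻¹' Z ∩ Ico (a + j * D.l) (a + (j + 1) * D.l)) := by
        rintro t ⟨ht, hta, htb⟩
        have h0 : 0 ≤ (t - a) / D.l := div_nonneg (by linarith) D.l_pos.le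
        have h1 := Nat.floor_le h0
        have h2 := Nat.lt_floor_add_one ((t - a) / D.l)
        rw [le_div_iff₀ D.l_pos] at h1
        rw [div_lt_iff₀ D.l_pos] at h2
        refine mem_biUnion (x := ⌊(t - a) / D.l⌋₊) ?_ ⟨ht, by linarith, by linarith⟩
        rw [Finset.mem_coe, Finset.mem_range]
        have : (⌊(t - a) / D.l⌋₊ : ℝ) < N := by
          by_contra! h
          have := mul_le_mul_of_nonneg_right h D.l_pos.le
          linarith
        exact_mod_cast this
      refine Set.Finite.subset (Set.Finite.biUnion (Finset.finite_toSet _) fun j _ => ?_) hsub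
      have hinj : InjOn D.γ (D.γ ⁻¹' Z ∩ Ico (a + j * D.l) (a + (j + 1) * D.l)) := by
        intro u hu v hv huv
        apply D.inj_lt huv
        rw [abs_lt]
        have h1 := hu.2.1; have h2 := hu.2.2; have h3 := hv.2.1; have h4 := hv.2.2
        constructor <;> linarith
      exact Set.Finite.of_finite_image (hZf.subset (by rintro _ ⟨u, hu, rfl⟩; exact hu.1)) hinj)
    ⟨i0, hx'.symm⟩ ⟨i1, hy'.symm⟩ (lt_of_le_of_ne hy.1 hxy) hy.2
  refine ⟨s, K, hK, hmono, fun k => ?_, fun k t h1 h2 i h => hgap k t h1 h2 ⟨i, h.symm⟩, hsK⟩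
  obtain ⟨i, hi⟩ := hP k
  exact ⟨i, hi.symm⟩

lemma B_chord {γ R : ℝ → ℂ} {a b c C : ℝ} (hab : a < b) (hγ : ContinuousOn γ (Icc a b)) (hinj : InjOn γ (Icc a b))
    (hvar : ∀ s t, a ≤ s → s ≤ t → t ≤ b → eVariationOn γ (Icc s t) = ENNReal.ofReal (t - s))
    (hsub : ∀ t ∈ Icc (0:ℝ) 1, R t ∈ γ '' Icc a b) (h0 : R 0 = γ a) (h1 : R 1 = γ b) (hc : 0 < c) (hC : 0 < C)
    (hR : ∀ s ∈ Icc (0:ℝ) 1, ∀ t ∈ Icc (0:ℝ) 1, c * |s - t| ≤ ‖R s - R t‖ ∧ ‖R s - R t‖ ≤ C * |s - t|) :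
    R '' Icc 0 1 = γ '' Icc a b ∧ ∀ s ∈ Icc a b, ∀ t ∈ Icc a b, c / C * |s - t| ≤ ‖γ s - γ t‖ := by
  have hRc : ContinuousOn R (Icc 0 1) := by
    have : LipschitzOnWith C.toNNReal R (Icc 0 1) := by
      apply LipschitzOnWith.of_dist_le_mul
      intro x hx y hy
      rw [dist_eq_norm, Real.dist_eq, Real.coe_toNNReal _ hC.le]; exact (hR x hx y hy).2
    exact this.continuousOn
  set σ := Function.invFunOn γ (Icc a b) with hσ
  have hσm : ∀ z ∈ γ '' Icc a b, σ z ∈ Icc a b ∧ γ (σ z) = z := fun z hz =>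
    ⟨Function.invFunOn_mem hz, Function.invFunOn_eq hz⟩
  have hσc : ContinuousOn σ (γ '' Icc a b) := by
    rw [continuousOn_iff_isClosed]
    intro t ht
    refine ⟨γ '' (t ∩ Icc a b), ((isCompact_Icc.inter_left ht).image_of_continuousOn (hγ.mono inter_subset_right)).isClosed, ?_⟩
    ext z
    constructor
    · rintro ⟨hz, hz'⟩
      exact ⟨⟨σ z, ⟨hz, (hσm z hz').1⟩, (hσm z hz').2⟩, hz'⟩
    · rintro ⟨⟨s, hs, rfl⟩, hz'⟩
      refine ⟨?_, hz'⟩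
      have := hσm _ hz'
      rw [mem_preimage, hinj this.1 hs.2 this.2]; exact hs.1
  set f : ℝ → ℝ := fun t => σ (R t) with hf
  have hfγ : ∀ t ∈ Icc (0:ℝ) 1, γ (f t) = R t := fun t ht => (hσm _ (hsub t ht)).2
  have hfm : ∀ t ∈ Icc (0:ℝ) 1, f t ∈ Icc a b := fun t ht => (hσm _ (hsub t ht)).1
  have hfc : ContinuousOn f (Icc 0 1) := hσc.comp hRc hsub
  have hRi : InjOn R (Icc 0 1) := by
    intro s hs t ht h
    have := (hR s hs t ht).1
    rw [h, sub_self, norm_zero] at this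
    have : |s - t| ≤ 0 := by
      by_contra! h'; nlinarith
    exact sub_eq_zero.1 (abs_nonpos_iff.1 this)
  have hfi : InjOn f (Icc 0 1) := by
    intro s hs t ht h
    apply hRi hs ht
    rw [← hfγ s hs, ← hfγ t ht, h]
  have m0 : (0:ℝ) ∈ Icc (0:ℝ) 1 := by simp
  have m1 : (1:ℝ) ∈ Icc (0:ℝ) 1 := by simp
  have hf0 : f 0 = a := hinj (hfm 0 m0) (left_mem_Icc.2 hab.le) (by rw [hfγ 0 m0, h0])
  have hf1 : f 1 = b := hinj (hfm 1 m1) (right_mem_Icc.2 hab.le) (by rw [hfγ 1 m1, h1])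
  have hmono : StrictMonoOn f (Icc 0 1) :=
    hfc.strictMonoOn_of_injOn_Icc zero_le_one (by rw [hf0, hf1]; exact hab.le) hfi
  have hsurj : ∀ u v, 0 ≤ u → u ≤ v → v ≤ 1 → f '' Icc u v = Icc (f u) (f v) := by
    intro u v h0 huv h1
    have hs : Icc u v ⊆ Icc 0 1 := Icc_subset_Icc h0 h1
    apply Subset.antisymm
    · rintro _ ⟨t, ht, rfl⟩
      exact ⟨hmono.monotoneOn (hs ⟨le_rfl, huv⟩) (hs ht) ht.1, hmono.monotoneOn (hs ht) (hs ⟨huv, le_rfl⟩) ht.2⟩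
    · exact intermediate_value_Icc huv (hfc.mono hs)
  have hall : f '' Icc 0 1 = Icc a b := by rw [hsurj 0 1 le_rfl zero_le_one le_rfl, hf0, hf1]
  refine ⟨?_, ?_⟩
  · rw [← hall, image_image]
    exact image_congr fun t ht => (hfγ t ht).symm
  have key : ∀ u v, 0 ≤ u → u ≤ v → v ≤ 1 → c / C * (f v - f u) ≤ ‖R v - R u‖ := by
    intro u v h0 huv h1
    have hs : Icc u v ⊆ Icc 0 1 := Icc_subset_Icc h0 h1
    have hmu : u ∈ Icc (0:ℝ) 1 := hs ⟨le_rfl, huv⟩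
    have hmv : v ∈ Icc (0:ℝ) 1 := hs ⟨huv, le_rfl⟩
    have e1 : eVariationOn γ (Icc (f u) (f v)) = eVariationOn R (Icc u v) := by
      rw [← hsurj u v h0 huv h1, ← eVariationOn.comp_eq_of_monotoneOn γ f (hmono.monotoneOn.mono hs)]
      apply eVariationOn.eq_of_eqOn
      intro t ht; exact hfγ t (hs ht)
    have hfuv : f u ≤ f v := hmono.monotoneOn hmu hmv huv
    rw [hvar _ _ (hfm u hmu).1 hfuv (hfm v hmv).2] at e1
    have hL : LipschitzOnWith C.toNNReal R (Icc u v) := by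
      apply LipschitzOnWith.of_dist_le_mul
      intro x hx y hy
      rw [dist_eq_norm, Real.dist_eq, Real.coe_toNNReal _ hC.le]; exact (hR x (hs hx) y (hs hy)).2
    have e2 := hL.comp_eVariationOn_le (g := id) (s := Icc u v) (mapsTo_id _)
    have e3 : eVariationOn (id : ℝ → ℝ) (Icc u v) ≤ ENNReal.ofReal (v - u) := by
      simp
    rw [Function.comp_id, ← e1] at e2
    have e4 : ENNReal.ofReal (f v - f u) ≤ ENNReal.ofReal (C * (v - u)) := by
      rw [ENNReal.ofReal_mul hC.le]
      exact e2.trans (mul_le_mul_right e3 _)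
    rw [ENNReal.ofReal_le_ofReal_iff (mul_nonneg hC.le (by linarith))] at e4
    have h3 := (hR v hmv u hmu).1
    rw [abs_of_nonneg (by linarith)] at h3
    calc c / C * (f v - f u) ≤ c / C * (C * (v - u)) := by gcongr
      _ = c * (v - u) := by field_simp
      _ ≤ _ := h3
  intro s hs t ht
  rw [← hall] at hs ht
  obtain ⟨u, hu, rfl⟩ := hs
  obtain ⟨v, hv, rfl⟩ := ht
  rw [hfγ u hu, hfγ v hv]
  rcases le_total u v with h | h
  · rw [abs_sub_comm, norm_sub_rev, abs_of_nonneg (sub_nonneg.2 (hmono.monotoneOn hu hv h))]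
    exact key u v hu.1 h hv.2
  · rw [abs_of_nonneg (sub_nonneg.2 (hmono.monotoneOn hv hu h))]
    exact key v u hv.1 h hu.2

/-- analytic arc data between consecutive corners -/
structure CleanArc (D : JordanDomain) (a b : ℝ) (T : ℂ → ℂ) (U : Set ℂ) : Prop where
  opn : IsOpen U
  seg : (Complex.ofReal '' Icc (0 : ℝ) 1) ⊆ U
  diff : DifferentiableOn ℂ T U
  inj : InjOn T U
  left : T 0 = D.γ a
  right : T 1 = D.γ b
  img : (fun t : ℝ => T t) '' Icc (0:ℝ) 1 = D.γ '' Icc a b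
  chord : ∃ c > 0, ∀ s ∈ Icc a b, ∀ t ∈ Icc a b, c * |s - t| ≤ ‖D.γ s - D.γ t‖

lemma B_seg_compact : IsCompact (Complex.ofReal '' Icc (0 : ℝ) 1) := isCompact_Icc.image continuous_ofReal

lemma B_seg_convex : Convex ℝ (Complex.ofReal '' Icc (0 : ℝ) 1) :=
  (convex_Icc 0 1).is_linear_image Complex.ofRealCLM.isLinear

lemma B_arc (D : JordanDomain) (B : PiecewiseAnalyticBoundary D) {a b : ℝ} (hab : a < b) (hbl : b < a + D.l)
    (ha : ∃ i, D.γ a = B.τ i 1) (hb : ∃ i, D.γ b = B.τ i 1)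
    (hgap : ∀ t, a < t → t < b → ∀ i, D.γ t ≠ B.τ i 1) : ∃ T U, CleanArc D a b T U := by
  set Z : Set ℂ := range fun i => B.τ i 1 with hZ
  have hZf : Z.Finite := finite_range _
  have hmem1 : ∀ i, ∀ t ∈ Icc (0:ℝ) 1, B.τ i t ∈ frontier D.G := by
    intro i t ht
    rw [← B.cover]
    exact mem_iUnion.2 ⟨i, mem_image_of_mem _ (mem_image_of_mem _ ht)⟩
  have hZ0 : ∀ i, B.τ i 0 ∈ Z := by
    intro i
    refine ⟨⟨(i.val + (B.m - 1)) % B.m, Nat.mod_lt _ B.m_pos⟩, ?_⟩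
    simp only
    rw [B.junction]
    congr 1
    ext
    have := i.isLt
    simp only [Nat.mod_add_mod]
    rw [show i.val + (B.m - 1) + 1 = i.val + B.m by omega, Nat.add_mod_right, Nat.mod_eq_of_lt this]
  have haZ : D.γ a ∈ Z := by obtain ⟨i, hi⟩ := ha; exact ⟨i, hi.symm⟩
  have hbZ : D.γ b ∈ Z := by obtain ⟨i, hi⟩ := hb; exact ⟨i, hi.symm⟩
  have hgZ : ∀ t, a < t → t < b → D.γ t ∉ Z := by
    rintro t h1 h2 ⟨i, hi⟩; exact hgap t h1 h2 i hi.symm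
  have hp := D.mem_L ((a + b) / 2)
  rw [← B.cover] at hp
  obtain ⟨i, _, ⟨t0, ht0, rfl⟩, hτ⟩ := mem_iUnion.1 hp
  have ht0Z : B.τ i t0 ∉ Z := by
    rw [hτ]; exact hgZ _ (by linarith) (by linarith)
  have hτc : ContinuousOn (fun t : ℝ => B.τ i t) (Icc 0 1) :=
    (B.analytic i).continuousOn.comp continuous_ofReal.continuousOn
      (fun t ht => B.seg_sub i (mem_image_of_mem _ ht))
  set P := Icc (0:ℝ) 1 ∩ (fun t : ℝ => B.τ i t) ⁻¹' Z with hP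
  have hPc : IsClosed P := hτc.preimage_isClosed_of_isClosed isClosed_Icc hZf.isClosed
  have hP0 : (0:ℝ) ∈ P := ⟨by simp, by simpa using hZ0 i⟩
  have hP1 : (1:ℝ) ∈ P := ⟨by simp, by simpa using ⟨i, rfl⟩⟩
  have hlt : ∀ t ∈ P, t ≠ t0 := by rintro t ht rfl; exact ht0Z ht.2
  obtain ⟨t1, ht1, hg1⟩ := ((isCompact_Icc (a := 0) (b := t0)).inter_left hPc).exists_isGreatest ⟨0, hP0, le_rfl, ht0.1⟩
  obtain ⟨t2, ht2, hl2⟩ := ((isCompact_Icc (a := t0) (b := 1)).inter_left hPc).exists_isLeast ⟨1, hP1, ht0.2, le_rfl⟩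
  have h10 : t1 < t0 := lt_of_le_of_ne ht1.2.2 (hlt _ ht1.1)
  have h02 : t0 < t2 := lt_of_le_of_ne ht2.2.1 (hlt _ ht2.1).symm
  have hfree : ∀ t, t1 < t → t < t2 → B.τ i t ∉ Z := by
    intro t h1 h2 ht
    have hm : t ∈ Icc (0:ℝ) 1 := ⟨by linarith [ht1.2.1], by linarith [ht2.2.2]⟩
    rcases le_total t t0 with h | h
    · exact absurd (hg1 ⟨⟨hm, ht⟩, hm.1, h⟩) (not_le.2 h1)
    · exact absurd (hl2 ⟨⟨hm, ht⟩, h, hm.2⟩) (not_le.2 h2)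
  have hsub12 : Icc t1 t2 ⊆ Icc 0 1 := Icc_subset_Icc ht1.2.1 ht2.2.2
  -- the open piece lies in the open arc
  have hpc : IsPreconnected ((fun t : ℝ => B.τ i t) '' Ioo t1 t2) :=
    isPreconnected_Ioo.image _ (hτc.mono (Ioo_subset_Icc_self.trans hsub12))
  have hcl1 : IsClosed (D.γ '' Icc a b) := (isCompact_Icc.image D.γ_cont).isClosed
  have hcl2 : IsClosed (D.γ '' Icc b (a + D.l)) := (isCompact_Icc.image D.γ_cont).isClosed
  have hsubγ : (fun t : ℝ => B.τ i t) '' Ioo t1 t2 ⊆ D.γ '' Icc a b := by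
    have hu : (fun t : ℝ => B.τ i t) '' Ioo t1 t2 ⊆ D.γ '' Icc a b ∪ D.γ '' Icc b (a + D.l) := by
      rintro _ ⟨t, ht, rfl⟩
      obtain ⟨s, hs, hs'⟩ := D.exists_param (hmem1 i t (hsub12 ⟨ht.1.le, ht.2.le⟩)) a
      rcases le_total s b with h | h
      · exact Or.inl ⟨s, ⟨hs.1, h⟩, hs'⟩
      · exact Or.inr ⟨s, ⟨h, hs.2.le⟩, hs'⟩
    have he : (fun t : ℝ => B.τ i t) '' Ioo t1 t2 ∩ (D.γ '' Icc a b ∩ D.γ '' Icc b (a + D.l)) = ∅ := by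
      rw [eq_empty_iff_forall_notMem]
      rintro _ ⟨⟨t, ht, rfl⟩, ⟨s, hs, hs1⟩, ⟨s', hs', hs2⟩⟩
      have hnZ := hfree t ht.1 ht.2
      simp only at hs1 hs2
      have has : a ≠ s := by rintro rfl; exact hnZ (hs1 ▸ haZ)
      have hbs : b ≠ s := by rintro rfl; exact hnZ (hs1 ▸ hbZ)
      have has' := lt_of_le_of_ne hs.1 has
      have hbs' := lt_of_le_of_ne hs.2 hbs.symm
      have := D.inj_lt (hs1.trans hs2.symm) (by rw [abs_lt]; constructor <;> linarith [hs'.1, hs'.2])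
      linarith [hs'.1]
    rcases isPreconnected_iff_subset_of_disjoint_closed.1 hpc _ _ hcl1 hcl2 hu he with h | h
    · exact h
    · exfalso
      obtain ⟨s, hs, hs'⟩ := h ⟨t0, ⟨h10, h02⟩, rfl⟩
      simp only at hτ hs'
      rw [hτ] at hs'
      have := D.inj_lt hs' (by rw [abs_lt]; constructor <;> linarith [hs.1, hs.2])
      linarith [hs.1]
  have hsubγ' : ∀ t ∈ Icc t1 t2, B.τ i t ∈ D.γ '' Icc a b := by
    intro t ht
    have h1 : Icc t1 t2 = closure (Ioo t1 t2) := (closure_Ioo (h10.trans h02).ne).symm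
    have h2 : ContinuousOn (fun t : ℝ => B.τ i t) (closure (Ioo t1 t2)) := by rw [← h1]; exact hτc.mono hsub12
    rw [h1] at ht
    exact closure_minimal hsubγ hcl1 (h2.image_closure ⟨t, ht, rfl⟩)
  have hinj : InjOn D.γ (Icc a b) := by
    intro s hs t ht h
    exact D.inj_lt h (by rw [abs_lt]; constructor <;> linarith [hs.1, hs.2, ht.1, ht.2])
  have hend : ∀ t ∈ Icc t1 t2, B.τ i t ∈ Z → B.τ i t = D.γ a ∨ B.τ i t = D.γ b := by
    intro t ht htZ
    obtain ⟨s, hs, hs'⟩ := hsubγ' t ht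
    rcases eq_or_lt_of_le hs.1 with h | h
    · left; rw [← hs', h]
    rcases eq_or_lt_of_le hs.2 with h' | h'
    · right; rw [← hs', h']
    · exact absurd (hs' ▸ htZ) (hgZ s h h')
  have h12 : t1 < t2 := h10.trans h02
  have hτinj : ∀ s ∈ Icc (0:ℝ) 1, ∀ t ∈ Icc (0:ℝ) 1, B.τ i s = B.τ i t → s = t := by
    intro s hs t ht h
    exact ofReal_injective (B.inj i (B.seg_sub i (mem_image_of_mem _ hs)) (B.seg_sub i (mem_image_of_mem _ ht)) h)
  -- general construction with affine parametrization from u to v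
  have main : ∀ u v : ℝ, u ∈ Icc t1 t2 → v ∈ Icc t1 t2 → u ≠ v → B.τ i u = D.γ a → B.τ i v = D.γ b →
      ∃ T U, CleanArc D a b T U := by
    intro u v hu hv huv hua hvb
    set m : ℂ → ℂ := fun w => u + w * (v - u) with hm
    have hmd : Differentiable ℂ m := by simp only [hm]; fun_prop
    have hvu : (v - u : ℂ) ≠ 0 := by
      rw [← ofReal_sub]; exact ofReal_ne_zero.2 (sub_ne_zero.2 huv.symm)
    have hminj : Function.Injective m := by
      intro x y h
      simp only [hm, add_right_inj] at h
      exact mul_right_cancel₀ hvu h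
    have hmr : ∀ t : ℝ, m t = ((u + t * (v - u) : ℝ) : ℂ) := by intro t; simp [hm]
    have hmI : ∀ t ∈ Icc (0:ℝ) 1, u + t * (v - u) ∈ Icc t1 t2 := by
      intro t ht
      have := (convex_Icc t1 t2) hu hv (sub_nonneg.2 ht.2) ht.1 (by ring)
      rwa [show u + t * (v - u) = (1 - t) • u + t • v by simp; ring]
    have hUo : IsOpen (m ⁻¹' B.U i) := (B.U_open i).preimage hmd.continuous
    have hseg : (Complex.ofReal '' Icc (0 : ℝ) 1) ⊆ m ⁻¹' B.U i := by
      rintro _ ⟨t, ht, rfl⟩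
      rw [mem_preimage, hmr]
      exact B.seg_sub i (mem_image_of_mem _ (hsub12 (hmI t ht)))
    have hTd : DifferentiableOn ℂ (fun w => B.τ i (m w)) (m ⁻¹' B.U i) :=
      (B.analytic i).comp hmd.differentiableOn (fun w hw => hw)
    have hTi : InjOn (fun w => B.τ i (m w)) (m ⁻¹' B.U i) := fun x hx y hy h =>
      hminj (B.inj i hx hy h)
    obtain ⟨c, hc, C, hC, hbl⟩ := A_bilip hUo hTd hTi B_seg_compact B_seg_convex hseg
    have h0 : B.τ i (m 0) = D.γ a := by rw [← hua]; simp [hm]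
    have h1 : B.τ i (m 1) = D.γ b := by rw [← hvb]; simp [hm]
    obtain ⟨e1, e2⟩ := B_chord (R := fun t : ℝ => B.τ i (m t)) hab D.γ_cont.continuousOn hinj
      (fun s t hs hst ht => D.γ_unitSpeed s t hst (by linarith))
      (fun t ht => by simp only [hmr]; exact hsubγ' _ (hmI t ht)) (by simpa using h0) (by simpa using h1) hc hC
      (fun s hs t ht => by
        have := hbl s (mem_image_of_mem _ hs) t (mem_image_of_mem _ ht)
        rw [← ofReal_sub, norm_real, Real.norm_eq_abs] at this
        exact this)
    exact ⟨fun w => B.τ i (m w), m ⁻¹' B.U i, hUo, hseg, hTd, hTi, h0, h1, e1, c / C, by positivity, e2⟩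
  have m1 : t1 ∈ Icc t1 t2 := ⟨le_rfl, h12.le⟩
  have m2 : t2 ∈ Icc t1 t2 := ⟨h12.le, le_rfl⟩
  have hne : B.τ i t1 ≠ B.τ i t2 := fun h => h12.ne (hτinj t1 (hsub12 m1) t2 (hsub12 m2) h)
  rcases hend t1 m1 ht1.1.2 with h | h <;> rcases hend t2 m2 ht2.1.2 with h' | h'
  · exact absurd (h.trans h'.symm) hne
  · exact main t1 t2 m1 m2 h12.ne h h'
  · exact main t2 t1 m2 m1 h12.ne' h' h
  · exact absurd (h.trans h'.symm) hne

lemma C_germ {S : ℂ → ℂ} {U : Set ℂ} (hU : IsOpen U) (h0 : (0:ℂ) ∈ U) (hS : DifferentiableOn ℂ S U) (ha : deriv S 0 ≠ 0) :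
    ∃ A > 0, ∃ r > 0, ∀ w, ‖w‖ < r → ∃ ε, ‖ε‖ ≤ A * ‖w‖ ∧ S w = S 0 + deriv S 0 * w * cexp ε := by
  have hd : DifferentiableOn ℂ (dslope S 0) U := (differentiableOn_dslope (hU.mem_nhds h0)).2 hS
  have hd0 : DifferentiableAt ℂ (dslope S 0) 0 := hd.differentiableAt (hU.mem_nhds h0)
  have he : dslope S 0 0 = deriv S 0 := dslope_same _ _
  have hq : DifferentiableAt ℂ (fun w => Complex.log (dslope S 0 w / deriv S 0)) 0 := by
    apply DifferentiableAt.clog (hd0.div_const _)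
    rw [he, div_self ha]; exact one_mem_slitPlane
  obtain ⟨A, hA⟩ := hq.isBigO_sub.bound
  have hne : ∀ᶠ w in nhds 0, dslope S 0 w ≠ 0 :=
    hd0.continuousAt.eventually_ne (by rw [he]; exact ha)
  obtain ⟨r, hr, h⟩ := Metric.eventually_nhds_iff.1 (hA.and hne)
  refine ⟨|A| + 1, by positivity, r, hr, fun w hw => ⟨Complex.log (dslope S 0 w / deriv S 0), ?_, ?_⟩⟩
  · have := (h (y := w) (by simpa using hw)).1
    simp only [he, div_self ha, Complex.log_one, sub_zero] at this
    nlinarith [norm_nonneg w, le_abs_self A]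
  · rw [Complex.exp_log (div_ne_zero (h (y := w) (by simpa using hw)).2 ha)]
    have := sub_smul_dslope S 0 w
    simp only [sub_zero, smul_eq_mul] at this
    rw [mul_assoc, mul_div_assoc', mul_comm (deriv S 0), div_mul_cancel₀ _ ha, this]; ring

lemma C_conv {A ρ p q : ℝ} (hA : 0 ≤ A) :
    Convex ℝ {w : ℂ | Real.exp w.re < ρ ∧ p + A * Real.exp w.re < w.im ∧ w.im < q - A * Real.exp w.re} := by
  intro x hx y hy s t hs ht hst
  have h := convexOn_exp.2 (mem_univ x.re) (mem_univ y.re) hs ht hst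
  simp only [smul_eq_mul] at h
  obtain ⟨h1, h2, h3⟩ := hx
  obtain ⟨h4, h5, h6⟩ := hy
  have hAh := mul_le_mul_of_nonneg_left h hA
  have comb : ∀ {a b c d : ℝ}, a < b → c < d → s * a + t * c < s * b + t * d := by
    intro a b c d hab hcd
    rcases hs.eq_or_lt with h | h
    · subst h; simp at hst; subst hst; linarith
    · have := mul_lt_mul_of_pos_left hab h
      have := mul_le_mul_of_nonneg_left hcd.le ht
      linarith
  have hc : ∀ u : ℝ, s * u + t * u = u := fun u => by rw [← add_mul, hst, one_mul]
  have e1 := comb h1 h4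
  have e2 := comb h2 h5
  have e3 := comb h3 h6
  have e4 := hc ρ
  have e5 := hc p
  have e6 := hc q
  refine ⟨?_, ?_, ?_⟩ <;> simp only [Complex.add_re, Complex.add_im, Complex.smul_re, Complex.smul_im, smul_eq_mul] <;> nlinarith

lemma C_dich {G : Set ℂ} (hG : IsOpen G) {z0 : ℂ} {A ρ p q : ℝ} (hA : 0 ≤ A)
    (hL : ∀ w : ℂ, Real.exp w.re < ρ → p + A * Real.exp w.re < w.im → w.im < q - A * Real.exp w.re → z0 + cexp w ∉ frontier G) :
    ∃ P : Prop, ∀ w : ℂ, Real.exp w.re < ρ → p + A * Real.exp w.re < w.im → w.im < q - A * Real.exp w.re →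
      (z0 + cexp w ∈ G ↔ P) ∧ (z0 + cexp w ∈ closure G ↔ P) := by
  set R : Set ℂ := {w | Real.exp w.re < ρ ∧ p + A * Real.exp w.re < w.im ∧ w.im < q - A * Real.exp w.re}
  have hR : Convex ℝ R := C_conv hA
  have hpc : IsPreconnected ((fun w => z0 + cexp w) '' R) :=
    hR.isPreconnected.image _ (by fun_prop)
  have hs : (fun w => z0 + cexp w) '' R ⊆ G ∪ (closure G)ᶜ := by
    rintro _ ⟨w, hw, rfl⟩
    by_contra h
    rw [mem_union, not_or, notMem_compl_iff] at h
    apply hL w hw.1 hw.2.1 hw.2.2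
    rw [frontier, hG.interior_eq]; exact ⟨h.2, h.1⟩
  rcases hpc.subset_or_subset hG isClosed_closure.isOpen_compl
    (disjoint_compl_right.mono_left subset_closure) hs with h | h
  · refine ⟨True, fun w h1 h2 h3 => ?_⟩
    have := h ⟨w, ⟨h1, h2, h3⟩, rfl⟩
    simp [this, subset_closure this]
  · refine ⟨False, fun w h1 h2 h3 => ?_⟩
    have := h ⟨w, ⟨h1, h2, h3⟩, rfl⟩
    simp only [iff_false]
    exact ⟨fun h => this (subset_closure h), this⟩

lemma C_meas {G : Set ℂ} (hG : IsOpen G) {z0 : ℂ} {A ρ p q : ℝ} (hρ : 0 < ρ) (hpq : p ≤ q) {P : Prop}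
    (hP : ∀ w : ℂ, Real.exp w.re < ρ → p + A * Real.exp w.re < w.im → w.im < q - A * Real.exp w.re →
      (z0 + cexp w ∈ G ↔ P) ∧ (z0 + cexp w ∈ closure G ↔ P)) [Decidable P] :
    Tendsto (fun r : ℝ => ∫ θ in p..q, indicator {θ : ℝ | z0 + (r:ℂ) * cexp (θ * I) ∈ G} (fun _ => (1:ℝ)) θ)
      (nhdsWithin 0 (Ioi 0)) (nhds (if P then q - p else 0)) := by
  have e : (if P then q - p else 0) = ∫ θ in p..q, (if P then (1:ℝ) else 0) := by
    split_ifs <;> simp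
  rw [e]
  apply intervalIntegral.tendsto_integral_filter_of_dominated_convergence (fun _ => 1)
  · filter_upwards with r
    apply Measurable.aestronglyMeasurable
    apply measurable_const.indicator
    exact (hG.preimage (by fun_prop)).measurableSet
  · filter_upwards with r
    filter_upwards with θ _
    exact (norm_indicator_le_norm_self _ _).trans (by simp)
  · simp
  · have : ∀ᵐ θ : ℝ, θ ≠ q := by simp [ae_iff]
    filter_upwards [this] with θ hne hθ
    rw [uIoc_of_le hpq] at hθ
    have hθ2 := lt_of_le_of_ne hθ.2 hne
    apply tendsto_const_nhds.congr'
    have t : Tendsto (fun r : ℝ => A * r) (nhdsWithin 0 (Ioi 0)) (nhds 0) := by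
      have : Tendsto (fun r : ℝ => A * r) (nhds 0) (nhds (A * 0)) := (continuous_const_mul A).tendsto 0
      rw [mul_zero] at this
      exact this.mono_left nhdsWithin_le_nhds
    filter_upwards [self_mem_nhdsWithin, t.eventually_lt_const (sub_pos.2 hθ.1), t.eventually_lt_const (sub_pos.2 hθ2),
      nhdsWithin_le_nhds (gt_mem_nhds hρ)] with r hr h1 h2 h3
    have hr : 0 < r := hr
    have := (hP (⟨Real.log r, θ⟩ : ℂ) (by simpa [Real.exp_log hr] using h3) (by simp only [Real.exp_log hr]; linarith)
      (by simp only [Real.exp_log hr]; linarith)).1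
    have e2 : cexp (⟨Real.log r, θ⟩ : ℂ) = (r:ℂ) * cexp (θ * I) := by
      rw [← Complex.re_add_im (⟨Real.log r, θ⟩ : ℂ), Complex.exp_add]
      simp only [← Complex.ofReal_exp, Real.exp_log hr]
    rw [e2] at this
    by_cases hp : P
    · simp [this.2 hp, hp]
    · simp [hp, mt this.1 hp]

lemma C_angle {G : Set ℂ} (hG : IsOpen G) {z0 : ℂ} {a : ℝ} (h : HasCornerAngle G z0 a) (θ0 : ℝ) :
    Tendsto (fun r : ℝ => ∫ θ in θ0..(θ0 + 2 * Real.pi), indicator {θ : ℝ | z0 + (r:ℂ) * cexp (θ * I) ∈ G} (fun _ => (1:ℝ)) θ)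
      (nhdsWithin 0 (Ioi 0)) (nhds a) := by
  refine Tendsto.congr (fun r => ?_) h
  have hm : MeasurableSet {θ : ℝ | z0 + (r:ℂ) * cexp (θ * I) ∈ G} := (hG.preimage (by fun_prop)).measurableSet
  have hper : Function.Periodic (indicator {θ : ℝ | z0 + (r:ℂ) * cexp (θ * I) ∈ G} (fun _ => (1:ℝ))) (2 * Real.pi) := by
    intro θ
    have : cexp (((θ + 2 * Real.pi : ℝ) : ℂ) * I) = cexp (θ * I) := by
      push_cast; rw [add_mul]; exact Complex.exp_periodic _
    by_cases hz : z0 + (r:ℂ) * cexp (θ * I) ∈ G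
    · rw [indicator_of_mem (by rw [mem_ofPred_eq, this]; exact hz), indicator_of_mem (by exact hz)]
    · rw [indicator_of_notMem (by rw [mem_ofPred_eq, this]; exact hz), indicator_of_notMem (by exact hz)]
  rw [hper.intervalIntegral_add_eq θ0 0, zero_add, intervalIntegral.integral_of_le (by positivity),
    integral_Ioc_eq_integral_Ioo, ← integral_Ico_eq_integral_Ioo, integral_indicator_const _ hm]
  simp only [Measure.real, smul_eq_mul, mul_one]
  rw [Measure.restrict_apply hm]
  congr 2; ext θ; simp [and_comm]

lemma C_sector {G : Set ℂ} (hG : IsOpen G) {z0 : ℂ} {A ρ θa θb ext : ℝ} (hA : 0 ≤ A) (hρ : 0 < ρ) (hab : θa ≤ θb)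
    (hba : θb ≤ θa + 2 * Real.pi) (h0 : 0 < ext) (h2 : ext < 2) (hang : HasCornerAngle G z0 ((2 - ext) * Real.pi))
    (hL : ∀ w : ℂ, Real.exp w.re < ρ → z0 + cexp w ∈ frontier G → ∃ n : ℤ,
      |w.im - θa - 2 * Real.pi * n| ≤ A * Real.exp w.re ∨ |w.im - θb - 2 * Real.pi * n| ≤ A * Real.exp w.re) :
    ∃ c σ : ℝ, (σ = 1 ∨ σ = -1) ∧
      (∀ w : ℂ, Real.exp w.re < ρ → |w.im| < ext * Real.pi / 2 - A * Real.exp w.re → z0 + cexp (c * I) * cexp w ∉ closure G) ∧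
      cexp (θa * I) = cexp ((c - σ * (ext * Real.pi / 2) : ℝ) * I) ∧
      cexp (θb * I) = cexp ((c + σ * (ext * Real.pi / 2) : ℝ) * I) := by
  classical
  have hpi := Real.pi_pos
  have hint : ∀ n : ℤ, ∀ u : ℝ, 0 < u + 2 * Real.pi * n → u + 2 * Real.pi * n < 2 * Real.pi → u = 0 → False := by
    rintro n u h1 h2 rfl
    have h3 : (0:ℝ) < n := by by_contra h; push Not at h; nlinarith
    have h4 : (n:ℝ) < 1 := by by_contra h; push Not at h; nlinarith
    have h5 : 0 < n := by exact_mod_cast h3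
    have h6 : n < 1 := by exact_mod_cast h4
    omega
  obtain ⟨P1, hP1⟩ := C_dich (p := θa) (q := θb) hG hA (ρ := ρ) (z0 := z0) (by
    intro w h1 h2 h3 h4
    have hx := mul_nonneg hA (Real.exp_pos w.re).le
    obtain ⟨n, h | h⟩ := hL w h1 h4 <;> rw [abs_le] at h
    · exact hint n 0 (by linarith) (by linarith) rfl
    · refine hint (n + 1) 0 ?_ ?_ rfl <;> push_cast <;> linarith)
  obtain ⟨P2, hP2⟩ := C_dich (p := θb) (q := θa + 2 * Real.pi) hG hA (ρ := ρ) (z0 := z0) (by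
    intro w h1 h2 h3 h4
    have hx := mul_nonneg hA (Real.exp_pos w.re).le
    obtain ⟨n, h | h⟩ := hL w h1 h4 <;> rw [abs_le] at h
    · exact hint n 0 (by linarith) (by linarith) rfl
    · exact hint n 0 (by linarith) (by linarith) rfl)
  have l1 := C_meas hG hρ hab hP1
  have l2 := C_meas hG hρ hba hP2
  have l3 := l1.add l2
  have l4 := C_angle hG hang θa
  have e := tendsto_nhds_unique (l4.congr (fun r => (intervalIntegral.integral_add_adjacent_intervals (b := θb) (by
      apply (intervalIntegrable_const (c := (1:ℝ))).mono_fun'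
      · exact (measurable_const.indicator (hG.preimage (by fun_prop)).measurableSet).aestronglyMeasurable
      · filter_upwards with θ
        exact (norm_indicator_le_norm_self _ _).trans (by simp)) (by
      apply (intervalIntegrable_const (c := (1:ℝ))).mono_fun'
      · exact (measurable_const.indicator (hG.preimage (by fun_prop)).measurableSet).aestronglyMeasurable
      · filter_upwards with θ
        exact (norm_indicator_le_norm_self _ _).trans (by simp))).symm)) l3
  have hk : ∀ c : ℝ, ∀ w : ℂ, cexp (c * I) * cexp w = cexp (c * I + w) := fun c w => (Complex.exp_add _ _).symm
  have hre : ∀ c : ℝ, ∀ w : ℂ, (c * I + w).re = w.re := fun c w => by simp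
  have him : ∀ c : ℝ, ∀ w : ℂ, (c * I + w).im = c + w.im := fun c w => by simp
  by_cases p1 : P1 <;> by_cases p2 : P2 <;> simp only [p1, p2, if_true, if_false] at e
  · nlinarith
  · refine ⟨θb + ext * Real.pi / 2, -1, Or.inr rfl, fun w h1 h2 => ?_, ?_, ?_⟩
    · rw [hk]
      rw [abs_lt] at h2
      rw [(hP2 ((θb + ext * Real.pi / 2 : ℝ) * I + w) (by rw [hre]; exact h1) (by rw [hre, him]; linarith)
        (by rw [hre, him]; linarith)).2]
      exact p2
    · rw [show θb + ext * Real.pi / 2 - -1 * (ext * Real.pi / 2) = θa + 2 * Real.pi by linarith]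
      push_cast; rw [add_mul]; exact (Complex.exp_periodic _).symm
    · congr 3; ring
  · refine ⟨θa + ext * Real.pi / 2, 1, Or.inl rfl, fun w h1 h2 => ?_, ?_, ?_⟩
    · rw [hk]
      rw [abs_lt] at h2
      rw [(hP1 ((θa + ext * Real.pi / 2 : ℝ) * I + w) (by rw [hre]; exact h1) (by rw [hre, him]; linarith)
        (by rw [hre, him]; linarith)).2]
      exact p1
    · congr 3; ring
    · congr 3; linarith
  · nlinarith

/-- a boundary germ `S` at `S 0`, together with the uniform expansion. -/
def Germ (S : ℂ → ℂ) (z0 a : ℂ) (A r : ℝ) : Prop :=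
  ∀ w, ‖w‖ < r → ∃ ε, ‖ε‖ ≤ A * ‖w‖ ∧ S w = z0 + a * w * cexp ε

lemma C_germ_angle {S : ℂ → ℂ} {z0 a : ℂ} {A r : ℝ} (hA : 0 < A) (h : Germ S z0 a A r) (ha : a ≠ 0) {t : ℝ} (ht : 0 < t)
    (htr : t < r) (htA : A * t < 1) {w : ℂ} (hw : z0 + cexp w = S t) :
    ∃ n : ℤ, |w.im - a.arg - 2 * Real.pi * n| ≤ A * (3 / ‖a‖) * Real.exp w.re := by
  have hna : 0 < ‖a‖ := norm_pos_iff.2 ha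
  obtain ⟨ε, h1, h2⟩ := h t (by rw [Complex.norm_real, Real.norm_of_nonneg ht.le]; exact htr)
  rw [Complex.norm_real, Real.norm_of_nonneg ht.le] at h1
  rw [h2, add_right_inj] at hw
  have e1 : a * t * cexp ε = cexp (Complex.log a + Complex.log t + ε) := by
    rw [Complex.exp_add, Complex.exp_add, Complex.exp_log ha, Complex.exp_log (by exact_mod_cast ht.ne')]
  have hn : ‖cexp w‖ = ‖a‖ * t * Real.exp ε.re := by
    rw [hw, norm_mul, norm_mul, Complex.norm_real, Real.norm_of_nonneg ht.le, Complex.norm_exp]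
  rw [Complex.norm_exp] at hn
  rw [e1] at hw
  obtain ⟨n, hn'⟩ := Complex.exp_eq_exp_iff_exists_int.1 hw
  have := congrArg Complex.im hn'
  rw [← Complex.ofReal_log ht.le] at this
  simp [Complex.log_im] at this
  refine ⟨n, ?_⟩
  rw [show w.im - a.arg - 2 * Real.pi * n = ε.im by rw [this]; ring]
  have hε : Real.exp (-1) ≤ Real.exp ε.re := by
    apply Real.exp_le_exp.2
    have := (Complex.abs_re_le_norm ε)
    have := neg_abs_le ε.re
    linarith
  have h3 : (1:ℝ)/3 ≤ Real.exp (-1) := by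
    rw [Real.exp_neg, ← one_div]
    apply one_div_le_one_div_of_le (Real.exp_pos 1)
    linarith [Real.exp_one_lt_d9]
  have h4 : t ≤ 3 / ‖a‖ * Real.exp w.re := by
    rw [hn]
    have : 3 / ‖a‖ * (‖a‖ * t * Real.exp ε.re) = t * (3 * Real.exp ε.re) := by field_simp
    rw [this]
    nlinarith
  calc |ε.im| ≤ ‖ε‖ := Complex.abs_im_le_norm ε
    _ ≤ A * t := h1
    _ ≤ A * (3 / ‖a‖ * Real.exp w.re) := by gcongr
    _ = _ := by ring

/-- The corner lemma. -/
lemma C_corner {G : Set ℂ} (hG : IsOpen G) {z0 : ℂ} {ext : ℝ} (h0 : 0 < ext) (h2 : ext < 2)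
    (hang : HasCornerAngle G z0 ((2 - ext) * Real.pi)) {Sa Sb : ℂ → ℂ} {a b : ℂ} {Aa Ab ra rb r : ℝ}
    (hAa : 0 < Aa) (hAb : 0 < Ab) (ha : a ≠ 0) (hb : b ≠ 0) (hga : Germ Sa z0 a Aa ra) (hgb : Germ Sb z0 b Ab rb) (hr : 0 < r)
    (hL : ∀ z ∈ frontier G, ‖z - z0‖ < r → z = z0 ∨ ∃ t : ℝ, 0 < t ∧ (t < ra ∧ Aa * t < 1 ∧ z = Sa t ∨ t < rb ∧ Ab * t < 1 ∧ z = Sb t)) :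
    ∃ A c σ : ℝ, 0 < A ∧ (σ = 1 ∨ σ = -1) ∧
      (∀ w : ℂ, Real.exp w.re < r → |w.im| < ext * Real.pi / 2 - A * Real.exp w.re → z0 + cexp (c * I) * cexp w ∉ closure G) ∧
      a = ‖a‖ * cexp ((c - σ * (ext * Real.pi / 2) : ℝ) * I) ∧
      b = ‖b‖ * cexp ((c + σ * (ext * Real.pi / 2) : ℝ) * I) := by
  have hna : 0 < ‖a‖ := norm_pos_iff.2 ha
  have hnb : 0 < ‖b‖ := norm_pos_iff.2 hb
  have key : ∀ w : ℂ, Real.exp w.re < r → z0 + cexp w ∈ frontier G → ∃ n : ℤ,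
      |w.im - a.arg - 2 * Real.pi * n| ≤ (Aa * (3 / ‖a‖) + Ab * (3 / ‖b‖)) * Real.exp w.re ∨
      |w.im - b.arg - 2 * Real.pi * n| ≤ (Aa * (3 / ‖a‖) + Ab * (3 / ‖b‖)) * Real.exp w.re := by
    intro w hw hf
    rcases hL _ hf (by simpa [Complex.norm_exp] using hw) with h | ⟨t, ht, ⟨h1, h2, h3⟩ | ⟨h1, h2, h3⟩⟩
    · simp at h
    · obtain ⟨n, hn⟩ := C_germ_angle hAa hga ha ht h1 h2 h3
      exact ⟨n, Or.inl (hn.trans (by gcongr; linarith [show 0 ≤ Ab * (3 / ‖b‖) by positivity]))⟩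
    · obtain ⟨n, hn⟩ := C_germ_angle hAb hgb hb ht h1 h2 h3
      exact ⟨n, Or.inr (hn.trans (by gcongr; linarith [show 0 ≤ Aa * (3 / ‖a‖) by positivity]))⟩
  have pa := Complex.arg_mem_Ioc a
  have pb := Complex.arg_mem_Ioc b
  have ea := Complex.norm_mul_exp_arg_mul_I a
  have eb := Complex.norm_mul_exp_arg_mul_I b
  have hpos : 0 < Aa * (3 / ‖a‖) + Ab * (3 / ‖b‖) := by positivity
  rcases le_total a.arg b.arg with h | h
  · obtain ⟨c, σ, h1, h3, h4, h5⟩ := C_sector hG hpos.le hr h (by linarith [pa.1, pb.2]) h0 h2 hang key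
    exact ⟨_, c, σ, hpos, h1, h3, by rw [← h4, ea], by rw [← h5, eb]⟩
  · obtain ⟨c, σ, h1, h3, h4, h5⟩ := C_sector hG hpos.le hr h (by linarith [pb.1, pa.2]) h0 h2 hang
      (fun w hw hf => (key w hw hf).imp fun n hn => hn.symm)
    refine ⟨_, c, -σ, hpos, by rcases h1 with rfl | rfl <;> simp, h3, ?_, ?_⟩
    · rw [show c - -σ * (ext * Real.pi / 2) = c + σ * (ext * Real.pi / 2) by ring, ← h5, ea]
    · rw [show c + -σ * (ext * Real.pi / 2) = c - σ * (ext * Real.pi / 2) by ring, ← h4, eb]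

/-- corner data at the end `S 0` of an arc germ `S`. -/
structure EndP (G : Set ℂ) (lam : ℝ) (S : ℂ → ℂ) (σ ext A c ρ : ℝ) : Prop where
  lam_le : lam ≤ ext
  lt_two : ext < 2
  A_pos : 0 < A
  ρ_pos : 0 < ρ
  sgn : σ = 1 ∨ σ = -1
  out : ∀ w : ℂ, Real.exp w.re < ρ → |w.im| < ext * Real.pi / 2 - A * Real.exp w.re → S 0 + cexp (c * I) * cexp w ∉ closure G
  germ : ∃ a A' r, a ≠ 0 ∧ 0 < A' ∧ 0 < r ∧ Germ S (S 0) a A' r ∧ a = ‖a‖ * cexp ((c - σ * (ext * Real.pi / 2) : ℝ) * I)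

lemma C_margin {G : Set ℂ} {lam : ℝ} {S : ℂ → ℂ} {σ ext A c ρ : ℝ} (h : EndP G lam S σ ext A c ρ) (hlam : 0 < lam) {μ ν : ℝ}
    (hμ : 0 < μ) (hν : ν ≤ Real.sin (min lam 1)) : ∃ ψ > 0, ∃ ε > 0, ∀ w : ℂ, 0 < w.re → ‖w‖ < ε → μ * w.re ≤ σ * w.im →
      σ * w.im ≤ ν * w.re → ∃ ω, S w = S 0 + cexp (c * I) * cexp ω ∧ |ω.im| ≤ ext * Real.pi / 2 - ψ := by
  obtain ⟨a, A', r, ha, hA', hr, hg, hae⟩ := h.germ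
  set m := Real.arcsin (μ / (1 + μ)) with hm
  have hm0 : 0 < m := Real.arcsin_pos.2 (by positivity)
  set ψ := min (m / 2) (lam / 2)
  have hψ : 0 < ψ := by positivity
  refine ⟨ψ, hψ, min r (ψ / A'), by positivity, fun w hw0 hw h1 h2 => ?_⟩
  have hw0' : w ≠ 0 := by rintro rfl; simp at hw0
  have hnw : 0 < ‖w‖ := norm_pos_iff.2 hw0'
  obtain ⟨ε, hε, hS⟩ := hg w (hw.trans_le (min_le_left _ _))
  have hε' : ‖ε‖ ≤ ψ := by
    refine hε.trans ?_
    have := hw.le.trans (min_le_right _ _)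
    rw [le_div_iff₀ hA'] at this; linarith
  refine ⟨(Real.log ‖a‖ : ℂ) + (-σ * (ext * Real.pi / 2) : ℝ) * I + Complex.log w + ε, ?_, ?_⟩
  · rw [hS, Complex.exp_add, Complex.exp_add, Complex.exp_add, Complex.exp_log hw0', ← Complex.ofReal_exp,
      Real.exp_log (norm_pos_iff.2 ha)]
    nth_rw 1 [hae]
    rw [show ((c - σ * (ext * Real.pi / 2) : ℝ) : ℂ) * I = c * I + (-σ * (ext * Real.pi / 2) : ℝ) * I by push_cast; ring, Complex.exp_add]
    ring
  have him : ((Real.log ‖a‖ : ℂ) + (-σ * (ext * Real.pi / 2) : ℝ) * I + Complex.log w + ε).im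
      = -σ * (ext * Real.pi / 2) + w.arg + ε.im := by
    simp [Complex.log_im]
  rw [him]
  have harg : σ * w.arg = Real.arcsin (σ * w.im / ‖w‖) := by
    rw [Complex.arg_of_re_nonneg hw0.le]
    rcases h.sgn with rfl | rfl
    · simp
    · rw [neg_one_mul, neg_one_mul, neg_div, Real.arcsin_neg]
  have b0 : 0 < σ * w.im := lt_of_lt_of_le (by positivity) h1
  have hwn : ‖w‖ ≤ w.re + σ * w.im := by
    have := Complex.norm_le_abs_re_add_abs_im w
    rw [abs_of_pos hw0] at this
    have e : |w.im| = σ * w.im := by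
      rcases h.sgn with rfl | rfl
      · rw [one_mul] at *; exact abs_of_pos b0
      · rw [neg_one_mul] at *; exact abs_of_neg (by linarith)
    linarith
  have b1 : m ≤ σ * w.arg := by
    rw [harg, hm]
    apply Real.monotone_arcsin
    rw [div_le_div_iff₀ (by positivity) hnw]
    nlinarith
  have b2 : σ * w.arg ≤ lam := by
    rw [harg]
    refine le_trans ?_ (min_le_left lam 1)
    rw [Real.arcsin_le_iff_le_sin']
    · rw [div_le_iff₀ hnw]
      have : w.re ≤ ‖w‖ := Complex.re_le_norm w
      have h5 : 0 < Real.sin (min lam 1) := Real.sin_pos_of_pos_of_lt_pi (by positivity) (by linarith [min_le_right lam 1, Real.pi_gt_three])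
      nlinarith
    · constructor
      · have : 0 < min lam 1 := by positivity
        linarith [Real.pi_pos]
      · linarith [min_le_right lam 1, Real.pi_gt_three]
  have b3 := (Complex.abs_im_le_norm ε).trans hε'
  rw [abs_le] at b3
  have p1 : ψ ≤ m / 2 := min_le_left _ _
  have p2 : ψ ≤ lam / 2 := min_le_right _ _
  have p3 : 3 * ext ≤ Real.pi * ext := mul_le_mul_of_nonneg_right Real.pi_gt_three.le (hlam.le.trans h.lam_le)
  have p4 := h.lam_le
  rw [abs_le]
  rcases h.sgn with hσ | hσ <;> rw [hσ] at b1 b2 ⊢ <;> constructor <;> linarith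

lemma C_bound {S : ℂ → ℂ} {z0 a : ℂ} {A r : ℝ} (h : Germ S z0 a A r) {w : ℂ} (h1 : ‖w‖ < r) (h2 : A * ‖w‖ ≤ 1) :
    ‖S w - z0 - a * w‖ ≤ 2 * A * ‖a‖ * ‖w‖ ^ 2 := by
  obtain ⟨ε, h3, h4⟩ := h w h1
  rw [h4, show z0 + a * w * cexp ε - z0 - a * w = a * w * (cexp ε - 1) by ring, norm_mul, norm_mul]
  have := Complex.norm_exp_sub_one_le (h3.trans h2)
  calc ‖a‖ * ‖w‖ * ‖cexp ε - 1‖ ≤ ‖a‖ * ‖w‖ * (2 * (A * ‖w‖)) := by gcongr; linarith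
    _ = _ := by ring

lemma C_sep {Sa Sb : ℂ → ℂ} {z0 a b : ℂ} {Aa Ab ra rb : ℝ} (hga : Germ Sa z0 a Aa ra) (hgb : Germ Sb z0 b Ab rb)
    (hra : 0 < ra) (hrb : 0 < rb) (hAa : 0 < Aa) (hAb : 0 < Ab) (hne : ∀ t ∈ Icc (0:ℝ) 1, a * t ≠ b * (1 - t : ℝ)) :
    ∃ c > 0, ∃ r > 0, ∀ t t' : ℝ, 0 ≤ t → 0 ≤ t' → t < r → t' < r → c * (t + t') ≤ ‖Sa t - Sb t'‖ := by
  obtain ⟨u, hu, hmin⟩ := isCompact_Icc.exists_isMinOn (nonempty_Icc.2 zero_le_one)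
    (f := fun t : ℝ => ‖a * t - b * (1 - t : ℝ)‖) (s := Icc (0:ℝ) 1) (by fun_prop)
  set c := ‖a * u - b * (1 - u : ℝ)‖
  have hc : 0 < c := norm_pos_iff.2 (sub_ne_zero.2 (hne u hu))
  have hlin : ∀ t t' : ℝ, 0 ≤ t → 0 ≤ t' → c * (t + t') ≤ ‖a * t - b * t'‖ := by
    intro t t' ht ht'
    rcases (add_nonneg ht ht').eq_or_lt with h | h
    · rw [← h]; simp
    · have := hmin (show t / (t + t') ∈ Icc (0:ℝ) 1 from ⟨by positivity, by rw [div_le_one h]; linarith⟩)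
      have e : a * t - b * t' = (a * (t / (t + t') : ℝ) - b * (1 - t / (t + t') : ℝ)) * (t + t' : ℝ) := by
        have : ((t:ℂ) + t') ≠ 0 := by exact_mod_cast h.ne'
        push_cast; field_simp; ring
      rw [e, norm_mul, Complex.norm_real, Real.norm_of_nonneg h.le]
      exact mul_le_mul_of_nonneg_right this h.le
  set M := 2 * Aa * ‖a‖ + 2 * Ab * ‖b‖ + 1
  have hM : 0 < M := by positivity
  refine ⟨c / 2, by positivity, min (min ra rb) (min (c / (2 * M)) (min (1 / Aa) (1 / Ab))), by positivity, ?_⟩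
  intro t t' ht ht' h1 h2
  rw [lt_min_iff, lt_min_iff, lt_min_iff, lt_min_iff, lt_div_iff₀ (by positivity), lt_div_iff₀ hAa, lt_div_iff₀ hAb] at h1 h2
  have n1 : ‖(t:ℂ)‖ = t := by rw [Complex.norm_real, Real.norm_of_nonneg ht]
  have n2 : ‖(t':ℂ)‖ = t' := by rw [Complex.norm_real, Real.norm_of_nonneg ht']
  have e1 := C_bound hga (w := t) (by rw [n1]; exact h1.1.1) (by rw [n1]; linarith [h1.2.2.1])
  have e2 := C_bound hgb (w := t') (by rw [n2]; exact h2.1.2) (by rw [n2]; linarith [h2.2.2.2])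
  rw [n1] at e1; rw [n2] at e2
  have e3 := hlin t t' ht ht'
  have e4 : a * t - b * t' = (Sa t - Sb t') - (Sa t - z0 - a * t) + (Sb t' - z0 - b * t') := by ring
  have e5 : ‖a * t - b * t'‖ ≤ ‖Sa t - Sb t'‖ + ‖Sa t - z0 - a * t‖ + ‖Sb t' - z0 - b * t'‖ := by
    rw [e4]; exact (norm_add_le _ _).trans (add_le_add_left (norm_sub_le _ _) _)
  have e6 : 2 * Aa * ‖a‖ * t ^ 2 ≤ c / 2 * t := by
    have : 2 * Aa * ‖a‖ * t ^ 2 ≤ M * t ^ 2 := by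
      gcongr; simp only [M]; linarith [show 0 ≤ 2 * Ab * ‖b‖ by positivity]
    nlinarith [h1.2.1]
  have e7 : 2 * Ab * ‖b‖ * t' ^ 2 ≤ c / 2 * t' := by
    have : 2 * Ab * ‖b‖ * t' ^ 2 ≤ M * t' ^ 2 := by
      gcongr; simp only [M]; linarith [show 0 ≤ 2 * Aa * ‖a‖ by positivity]
    nlinarith [h2.2.1]
  linarith

structure Arc (T : ℂ → ℂ) (U : Set ℂ) : Prop where
  opn : IsOpen U
  seg : (Complex.ofReal '' Icc (0 : ℝ) 1) ⊆ U
  diff : DifferentiableOn ℂ T U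
  inj : InjOn T U

lemma Arc.flip {T : ℂ → ℂ} {U : Set ℂ} (h : Arc T U) : Arc (fun w => T (1 - w)) ((fun w => 1 - w) ⁻¹' U) where
  opn := h.opn.preimage (by fun_prop)
  seg := by
    rintro _ ⟨t, ht, rfl⟩
    exact h.seg ⟨1 - t, ⟨by linarith [ht.2], by linarith [ht.1]⟩, by push_cast; rfl⟩
  diff := h.diff.comp (by fun_prop) (fun w hw => hw)
  inj := by
    intro z hz w hw hzw
    have := h.inj hz hw hzw
    simpa using this

lemma Arc.mem {T : ℂ → ℂ} {U : Set ℂ} (h : Arc T U) {t : ℝ} (ht : t ∈ Icc (0:ℝ) 1) : (t : ℂ) ∈ U := h.seg ⟨t, ht, rfl⟩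

lemma Arc.bil {T : ℂ → ℂ} {U : Set ℂ} (h : Arc T U) : ∃ δ > 0, ∃ c > 0, ∃ C > 0, cthickening δ (Complex.ofReal '' Icc (0 : ℝ) 1) ⊆ U ∧
    ∀ z ∈ cthickening δ (Complex.ofReal '' Icc (0 : ℝ) 1), ∀ w ∈ cthickening δ (Complex.ofReal '' Icc (0 : ℝ) 1),
      c * ‖z - w‖ ≤ ‖T z - T w‖ ∧ ‖T z - T w‖ ≤ C * ‖z - w‖ := by
  obtain ⟨δ, hδ, hδU⟩ := B_seg_compact.exists_cthickening_subset_open h.opn h.seg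
  obtain ⟨c, hc, C, hC, hb⟩ := A_bilip h.opn h.diff h.inj B_seg_compact.cthickening (B_seg_convex.cthickening δ) hδU
  exact ⟨δ, hδ, c, hc, C, hC, hδU, hb⟩

def SepEnd (L : Set ℂ) (S : ℂ → ℂ) : Prop := ∃ c > 0, ∃ r > 0, ∀ t : ℝ, 0 ≤ t → t < r → ∀ p ∈ L,
  (∃ t' ∈ Icc (0:ℝ) 1, p = S t') ∨ c * t ≤ ‖S t - p‖

lemma C_sepEnd {L : Set ℂ} {Sa Sb : ℂ → ℂ} {U V : Set ℂ} (ha : Arc Sa U) (hb : Arc Sb V) {z0 : ℂ} (ha0 : Sa 0 = z0) (hb0 : Sb 0 = z0)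
    {r : ℝ} (hr : 0 < r) (hL : ∀ z ∈ L, ‖z - z0‖ < r → ∃ t ∈ Icc (0:ℝ) 1, z = Sa t ∨ z = Sb t)
    (hs : ∃ c > 0, ∃ r > 0, ∀ t t' : ℝ, 0 ≤ t → 0 ≤ t' → t < r → t' < r → c * (t + t') ≤ ‖Sa t - Sb t'‖) : SepEnd L Sa := by
  obtain ⟨c, hc, r', hr', hsep⟩ := hs
  obtain ⟨δ, hδ, ca, hca, Ca, hCa, -, hba⟩ := ha.bil
  obtain ⟨δ', hδ', cb, hcb, Cb, hCb, -, hbb⟩ := hb.bil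
  set r1 := min r (cb * r')
  have hr1 : 0 < r1 := by positivity
  refine ⟨min c (r1 / 2), by positivity, min (min r' 1) (r1 / (2 * Ca)), by positivity, fun t ht0 ht p hp => ?_⟩
  rw [lt_min_iff, lt_min_iff, lt_div_iff₀ (by positivity)] at ht
  by_cases hpz : ‖p - z0‖ < r1
  · obtain ⟨t', ht', h | h⟩ := hL p hp (hpz.trans_le (min_le_left _ _))
    · exact Or.inl ⟨t', ht', h⟩
    · right
      have h1 := (hbb t' (self_subset_cthickening _ ⟨t', ht', rfl⟩) 0 (self_subset_cthickening _ ⟨0, by simp, by simp⟩)).1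
      rw [hb0, ← h, sub_zero, Complex.norm_real, Real.norm_of_nonneg ht'.1] at h1
      have h2 : t' < r' := by
        have := hpz.trans_le (min_le_right _ _)
        by_contra h3; push Not at h3; nlinarith
      have := hsep t t' ht0 ht'.1 ht.1.1 h2
      rw [h]
      refine le_trans ?_ this
      have : min c (r1 / 2) ≤ c := min_le_left _ _
      nlinarith [ht'.1]
  · right
    push Not at hpz
    have h1 := (hba t (self_subset_cthickening _ ⟨t, ⟨ht0, ht.1.2.le⟩, rfl⟩) 0 (self_subset_cthickening _ ⟨0, by simp, by simp⟩)).2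
    rw [ha0, sub_zero, Complex.norm_real, Real.norm_of_nonneg ht0] at h1
    have h2 : ‖p - z0‖ ≤ ‖Sa t - p‖ + ‖Sa t - z0‖ := by
      rw [norm_sub_rev (Sa t) p]
      exact norm_sub_le_norm_sub_add_norm_sub _ _ _
    have h3 : min c (r1 / 2) ≤ r1 / 2 := min_le_right _ _
    nlinarith [ht.1.2]

lemma C_junction {G : Set ℂ} (hG : IsOpen G) {z0 : ℂ} {lam ext : ℝ} (hl : lam ≤ ext) (h0 : 0 < ext) (h2 : ext < 2)
    (hang : HasCornerAngle G z0 ((2 - ext) * Real.pi)) {Sa Sb : ℂ → ℂ} {U V : Set ℂ} (ha : Arc Sa U) (hb : Arc Sb V)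
    (ha0 : Sa 0 = z0) (hb0 : Sb 0 = z0) {r : ℝ} (hr : 0 < r)
    (hL : ∀ z ∈ frontier G, ‖z - z0‖ < r → ∃ t ∈ Icc (0:ℝ) 1, z = Sa t ∨ z = Sb t) :
    ∃ A c ρ σ, EndP G lam Sa σ ext A c ρ ∧ EndP G lam Sb (-σ) ext A c ρ ∧ SepEnd (frontier G) Sa ∧ SepEnd (frontier G) Sb := by
  have mz : (0:ℂ) = ((0:ℝ):ℂ) := by simp
  have hU0 : (0:ℂ) ∈ U := by rw [mz]; exact ha.mem (by simp)
  have hV0 : (0:ℂ) ∈ V := by rw [mz]; exact hb.mem (by simp)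
  have da := A_deriv_ne_zero ha.opn ha.diff ha.inj hU0
  have db := A_deriv_ne_zero hb.opn hb.diff hb.inj hV0
  obtain ⟨Aa, hAa, ra, hra, hga⟩ := C_germ ha.opn hU0 ha.diff da
  obtain ⟨Ab, hAb, rb, hrb, hgb⟩ := C_germ hb.opn hV0 hb.diff db
  rw [ha0] at hga; rw [hb0] at hgb
  obtain ⟨δ, hδ, ca, hca, Ca, hCa, -, hba⟩ := ha.bil
  obtain ⟨δ', hδ', cb, hcb, Cb, hCb, -, hbb⟩ := hb.bil
  have z0m : ∀ δ : ℝ, (0:ℂ) ∈ cthickening δ (Complex.ofReal '' Icc (0 : ℝ) 1) := fun δ => self_subset_cthickening _ ⟨0, by simp, by simp⟩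
  set ρ := min r (min (min (ca * ra) (ca / Aa)) (min (cb * rb) (cb / Ab)))
  have hρ : 0 < ρ := by positivity
  obtain ⟨A, c, σ, hA, hσ, hout, hea, heb⟩ := C_corner hG h0 h2 hang hAa hAb da db hga hgb hρ (by
    intro z hz hzr
    simp only [ρ, lt_min_iff] at hzr
    obtain ⟨hz1, ⟨hz2, hz3⟩, hz4, hz5⟩ := hzr
    rw [lt_div_iff₀ (by assumption)] at hz3 hz5
    by_cases hzz : z = z0
    · exact Or.inl hzz
    right
    obtain ⟨t, ht, h | h⟩ := hL z hz hz1
    · have h1 := (hba t (self_subset_cthickening _ ⟨t, ht, rfl⟩) 0 (z0m _)).1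
      rw [ha0, ← h, sub_zero, Complex.norm_real, Real.norm_of_nonneg ht.1] at h1
      have ht0 : 0 < t := lt_of_le_of_ne ht.1 (by rintro rfl; apply hzz; rw [h, ← ha0]; simp)
      refine ⟨t, ht0, Or.inl ⟨?_, ?_, h⟩⟩
      · exact lt_of_mul_lt_mul_left (h1.trans_lt hz2) hca.le
      · have : ca * (Aa * t) < ca * 1 := by nlinarith
        exact lt_of_mul_lt_mul_left this hca.le
    · have h1 := (hbb t (self_subset_cthickening _ ⟨t, ht, rfl⟩) 0 (z0m _)).1
      rw [hb0, ← h, sub_zero, Complex.norm_real, Real.norm_of_nonneg ht.1] at h1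
      have ht0 : 0 < t := lt_of_le_of_ne ht.1 (by rintro rfl; apply hzz; rw [h, ← hb0]; simp)
      refine ⟨t, ht0, Or.inr ⟨?_, ?_, h⟩⟩
      · exact lt_of_mul_lt_mul_left (h1.trans_lt hz4) hcb.le
      · have : cb * (Ab * t) < cb * 1 := by nlinarith
        exact lt_of_mul_lt_mul_left this hcb.le)
  have hpi := Real.pi_pos
  have hne : ∀ t ∈ Icc (0:ℝ) 1, deriv Sa 0 * t ≠ deriv Sb 0 * (1 - t : ℝ) := by
    intro t ht he
    have hn := congrArg norm he
    rw [norm_mul, norm_mul, Complex.norm_real, Complex.norm_real, Real.norm_of_nonneg ht.1, Real.norm_of_nonneg (by linarith [ht.2])] at hn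
    have hna := norm_pos_iff.2 da
    have hnb := norm_pos_iff.2 db
    have hk : ‖deriv Sa 0‖ * t ≠ 0 := by
      intro h
      have h1 : t = 0 := by simpa [hna.ne'] using h
      rw [h1] at hn; simp at hn; exact hnb.ne hn
    have h4 : ((‖deriv Sa 0‖ * t : ℝ) : ℂ) * cexp ((c - σ * (ext * Real.pi / 2) : ℝ) * I)
        = ((‖deriv Sa 0‖ * t : ℝ) : ℂ) * cexp ((c + σ * (ext * Real.pi / 2) : ℝ) * I) := by
      nth_rw 2 [hn]
      rw [hea, heb] at he
      push_cast at he ⊢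
      linear_combination he
    have h5 := mul_left_cancel₀ (by exact_mod_cast hk) h4
    obtain ⟨n, hn⟩ := Complex.exp_eq_exp_iff_exists_int.1 h5
    have h6 := congrArg Complex.im hn
    simp at h6
    have h7 : Real.pi * (ext * (-σ)) = Real.pi * (2 * n) := by linarith
    have h8 := mul_left_cancel₀ hpi.ne' h7
    rcases hσ with rfl | rfl
    · have h9 : (-1:ℝ) < n := by linarith
      have h10 : (n:ℝ) < 0 := by linarith
      have h9 : -1 < n := by exact_mod_cast h9
      have h10 : n < 0 := by exact_mod_cast h10
      omega
    · have h9 : (0:ℝ) < n := by linarith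
      have h10 : (n:ℝ) < 1 := by linarith
      have h9 : 0 < n := by exact_mod_cast h9
      have h10 : n < 1 := by exact_mod_cast h10
      omega
  obtain ⟨c1, hc1, r1, hr1, hsep⟩ := C_sep hga hgb hra hrb hAa hAb hne
  refine ⟨A, c, ρ, σ, ⟨hl, h2, hA, hρ, hσ, by rw [ha0]; exact hout, _, Aa, ra, da, hAa, hra, by rw [ha0]; exact hga, hea⟩,
    ⟨hl, h2, hA, hρ, by rcases hσ with rfl | rfl <;> simp, by rw [hb0]; exact hout, _, Ab, rb, db, hAb, hrb, by rw [hb0]; exact hgb, ?_⟩,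
    C_sepEnd ha hb ha0 hb0 hr hL ⟨c1, hc1, r1, hr1, hsep⟩,
    C_sepEnd hb ha hb0 ha0 hr (fun z hz hzr => (hL z hz hzr).imp fun t ht => ⟨ht.1, ht.2.symm⟩)
      ⟨c1, hc1, r1, hr1, fun t t' h1 h2 h3 h4 => by rw [norm_sub_rev, add_comm]; exact hsep t' t h2 h1 h4 h3⟩⟩
  rw [show c - -σ * (ext * Real.pi / 2) = c + σ * (ext * Real.pi / 2) by ring]; exact heb

def lens (η : ℝ) : Set ℂ := {w | 0 < w.re ∧ w.re < 1 ∧ |w.im| < η * (w.re * (1 - w.re))}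

lemma lens_sub {η δ : ℝ} (hη : 0 < η) (h : η ≤ δ) : lens η ⊆ cthickening δ (Complex.ofReal '' Icc (0 : ℝ) 1) := by
  rintro w ⟨h1, h2, h3⟩
  refine mem_cthickening_of_dist_le w (w.re : ℂ) δ _ ⟨w.re, ⟨h1.le, h2.le⟩, rfl⟩ ?_
  rw [dist_eq_norm]
  have : w - (w.re:ℂ) = w.im * I := by apply Complex.ext <;> simp
  rw [this, norm_mul, Complex.norm_I, mul_one, Complex.norm_real]
  change |w.im| ≤ δ
  have : η * (w.re * (1 - w.re)) ≤ η * 1 := by gcongr; nlinarith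
  linarith

lemma lens_mono {η η' : ℝ} (h : η ≤ η') : lens η ⊆ lens η' := fun w hw =>
  ⟨hw.1, hw.2.1, hw.2.2.trans_le (by have := hw.1; have := hw.2.1; gcongr)⟩

lemma lens_side {η σ : ℝ} (hσ : σ = 1 ∨ σ = -1) (hη : 0 ≤ η) : Convex ℝ (lens η ∩ {w | 0 < σ * w.im}) := by
  have : lens η ∩ {w | 0 < σ * w.im} = {w : ℂ | 0 < w.re ∧ w.re < 1 ∧ 0 < σ * w.im ∧ σ * w.im < η * (w.re * (1 - w.re))} := by
    ext w
    simp only [lens, mem_inter_iff, mem_ofPred_eq]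
    constructor
    · rintro ⟨⟨h1, h2, h3⟩, h4⟩
      refine ⟨h1, h2, h4, ?_⟩
      rw [abs_lt] at h3
      rcases hσ with rfl | rfl <;> linarith
    · rintro ⟨h1, h2, h3, h4⟩
      refine ⟨⟨h1, h2, ?_⟩, h3⟩
      rw [abs_lt]
      rcases hσ with rfl | rfl <;> constructor <;> linarith
  rw [this]
  intro x hx y hy s t hs ht hst
  obtain ⟨h1, h2, h3, h4⟩ := hx
  obtain ⟨k1, k2, k3, k4⟩ := hy
  have comb : ∀ {a b c d : ℝ}, a < b → c < d → s * a + t * c < s * b + t * d := by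
    intro a b c d hab hcd
    rcases hs.eq_or_lt with h | h
    · subst h; simp at hst; subst hst; linarith
    · have := mul_lt_mul_of_pos_left hab h
      have := mul_le_mul_of_nonneg_left hcd.le ht
      linarith
  have e1 := comb h1 k1
  have e2 := comb h2 k2
  have e3 := comb h3 k3
  have e4 := comb h4 k4
  simp only [mem_ofPred_eq, Complex.add_re, Complex.add_im, Complex.smul_re, Complex.smul_im, smul_eq_mul]
  refine ⟨by linarith, by linarith, by linarith, ?_⟩
  have hc : s * (x.re * (1 - x.re)) + t * (y.re * (1 - y.re)) ≤ (s * x.re + t * y.re) * (1 - (s * x.re + t * y.re)) := by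
    have : t = 1 - s := by linarith
    subst this
    nlinarith [mul_nonneg (mul_nonneg hs ht) (sq_nonneg (x.re - y.re))]
  have := mul_le_mul_of_nonneg_left hc hη
  linarith

/-- data of the exterior sector at the end `e` of an arc, seen in the lower half of the lens. -/
structure LEnd (O : Set ℂ) (lam : ℝ) (T : ℂ → ℂ) (η : ℝ) (e : ℂ) (ext A c ρ : ℝ) : Prop where
  lam_le : lam ≤ ext
  lt_two : ext < 2
  A_pos : 0 < A
  ρ_pos : 0 < ρ
  out : ∀ w : ℂ, Real.exp w.re < ρ → |w.im| < ext * Real.pi / 2 - A * Real.exp w.re → T e + cexp (c * I) * cexp w ∈ O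
  marg : ∀ μ > 0, ∃ ψ > 0, ∃ ε > 0, ∀ w ∈ lens η, ‖w - e‖ < ε → μ * (w.re * (1 - w.re)) ≤ -w.im →
    ∃ ω, T w = T e + cexp (c * I) * cexp ω ∧ |ω.im| ≤ ext * Real.pi / 2 - ψ

/-- a boundary arc with its two-sided lens. -/
structure LArc (G O F : Set ℂ) (lam : ℝ) (T : ℂ → ℂ) (U : Set ℂ) (η : ℝ) : Prop where
  arc : Arc T U
  η_pos : 0 < η
  η_le : η ≤ 1
  sub : lens η ⊆ U
  bil : ∃ c > 0, ∃ C > 0, ∀ z ∈ lens η ∪ Complex.ofReal '' Icc (0 : ℝ) 1, ∀ w ∈ lens η ∪ Complex.ofReal '' Icc (0 : ℝ) 1,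
    c * ‖z - w‖ ≤ ‖T z - T w‖ ∧ ‖T z - T w‖ ≤ C * ‖z - w‖
  bd : ∀ t ∈ Icc (0:ℝ) 1, T t ∈ frontier G
  dst : ∃ c > 0, ∀ w ∈ lens η, ∀ p ∈ frontier G, c * |w.im| ≤ ‖T w - p‖
  far : ∃ d > 0, ∀ w ∈ lens η, ∀ z ∈ F, d ≤ ‖T w - z‖
  up : ∀ w ∈ lens η, 0 < w.im → T w ∈ G
  dn : ∀ w ∈ lens η, w.im < 0 → T w ∈ O
  e0 : ∃ ext A c ρ, LEnd O lam T η 0 ext A c ρ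
  e1 : ∃ ext A c ρ, LEnd O lam T η 1 ext A c ρ

lemma L_sep {L P : Set ℂ} {T : ℂ → ℂ} {U : Set ℂ} (h : Arc T U) (h0 : SepEnd L T) (h1 : SepEnd L (fun w => T (1 - w)))
    (hP : IsClosed P) (hLP : ∀ p ∈ L, (∃ t' ∈ Icc (0:ℝ) 1, p = T t') ∨ p ∈ P) (hTP : ∀ t ∈ Ioo (0:ℝ) 1, T t ∉ P) :
    ∃ c > 0, ∀ t ∈ Icc (0:ℝ) 1, ∀ p ∈ L, (∃ t' ∈ Icc (0:ℝ) 1, p = T t') ∨ c * (t * (1 - t)) ≤ ‖T t - p‖ := by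
  obtain ⟨c0, hc0, r0, hr0, h0⟩ := h0
  obtain ⟨c1, hc1, r1, hr1, h1⟩ := h1
  set r := min (min r0 r1) (1/2)
  have hr : 0 < r := by positivity
  have hTc : ContinuousOn (fun t : ℝ => T t) (Icc 0 1) :=
    h.diff.continuousOn.comp continuous_ofReal.continuousOn (fun t ht => h.mem ht)
  have hI : Icc r (1 - r) ⊆ Icc 0 1 := Icc_subset_Icc hr.le (by linarith)
  obtain ⟨d, hd, hdd⟩ := exists_pos_forall_lt_edist (isCompact_Icc.image_of_continuousOn (hTc.mono hI)) hP (by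
    rw [Set.disjoint_left]
    rintro _ ⟨t, ht, rfl⟩
    exact hTP t ⟨by linarith [ht.1], by linarith [ht.2]⟩)
  refine ⟨min (min c0 c1) d, by positivity, fun t ht p hp => ?_⟩
  have hk : 0 ≤ t * (1 - t) := mul_nonneg ht.1 (by linarith [ht.2])
  have m1 : min (min c0 c1) (d:ℝ) ≤ c0 := (min_le_left _ _).trans (min_le_left _ _)
  have m2 : min (min c0 c1) (d:ℝ) ≤ c1 := (min_le_left _ _).trans (min_le_right _ _)
  have m3 : min (min c0 c1) (d:ℝ) ≤ d := min_le_right _ _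
  rcases lt_or_ge t r with h2 | h2
  · refine (h0 t ht.1 (h2.trans_le ((min_le_left _ _).trans (min_le_left _ _))) p hp).imp id fun h3 => le_trans ?_ h3
    exact mul_le_mul m1 (by nlinarith [ht.1]) hk hc0.le
  rcases lt_or_ge (1 - r) t with h3 | h3
  · rcases h1 (1 - t) (by linarith [ht.2]) (lt_of_lt_of_le (by linarith) ((min_le_left _ _).trans (min_le_right _ _))) p hp with ⟨t', ht', e⟩ | h4
    · exact Or.inl ⟨1 - t', ⟨by linarith [ht'.2], by linarith [ht'.1]⟩, by rw [e]; push_cast; rfl⟩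
    · right
      simp only at h4
      rw [show (1:ℂ) - ((1 - t : ℝ):ℂ) = t by push_cast; ring] at h4
      exact le_trans (mul_le_mul m2 (by nlinarith [ht.2]) hk hc1.le) h4
  · refine (hLP p hp).imp id fun h4 => ?_
    have := hdd _ ⟨t, ⟨h2, h3⟩, rfl⟩ p h4
    rw [edist_nndist, ENNReal.coe_lt_coe, ← NNReal.coe_lt_coe, coe_nndist, dist_eq_norm] at this
    simp only at this
    have : min (min c0 c1) (d:ℝ) * (t * (1 - t)) ≤ d * 1 := mul_le_mul m3 (by nlinarith [ht.1, ht.2]) hk d.2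
    linarith

lemma L_core {L P F : Set ℂ} {T : ℂ → ℂ} {U : Set ℂ} (h : Arc T U) (h0 : SepEnd L T) (h1 : SepEnd L (fun w => T (1 - w)))
    (hP : IsClosed P) (hLP : ∀ p ∈ L, (∃ t' ∈ Icc (0:ℝ) 1, p = T t') ∨ p ∈ P) (hTP : ∀ t ∈ Ioo (0:ℝ) 1, T t ∉ P)
    (hL : IsClosed L) (hF : IsCompact F) (hFL : Disjoint F L) (hbd : ∀ t ∈ Icc (0:ℝ) 1, T t ∈ L) {η1 : ℝ} (hη1 : 0 < η1) :
    ∃ η, 0 < η ∧ η ≤ η1 ∧ lens η ⊆ U ∧ (∃ c > 0, ∃ C > 0, ∀ z ∈ lens η ∪ Complex.ofReal '' Icc (0 : ℝ) 1,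
      ∀ w ∈ lens η ∪ Complex.ofReal '' Icc (0 : ℝ) 1, c * ‖z - w‖ ≤ ‖T z - T w‖ ∧ ‖T z - T w‖ ≤ C * ‖z - w‖) ∧
      (∃ c > 0, ∀ w ∈ lens η, ∀ p ∈ L, c * |w.im| ≤ ‖T w - p‖) ∧ (∃ d > 0, ∀ w ∈ lens η, ∀ z ∈ F, d ≤ ‖T w - z‖) := by
  obtain ⟨c, hc, hsep⟩ := L_sep h h0 h1 hP hLP hTP
  obtain ⟨δ, hδ, c', hc', C, hC, hsub, hbil⟩ := h.bil
  obtain ⟨d, hd, hdd⟩ := exists_pos_forall_lt_edist hF hL hFL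
  have hd : 0 < (d:ℝ) := hd
  set η := min (min η1 δ) (min (c / (C + 1)) (d / (2 * C)))
  have hη : 0 < η := by positivity
  have i1 : η ≤ η1 := (min_le_left _ _).trans (min_le_left _ _)
  have i2 : η ≤ δ := (min_le_left _ _).trans (min_le_right _ _)
  have i3 : η * (C + 1) ≤ c := by rw [← le_div_iff₀ (by positivity)]; exact (min_le_right _ _).trans (min_le_left _ _)
  have i4 : η * (2 * C) ≤ d := by rw [← le_div_iff₀ (by positivity)]; exact (min_le_right _ _).trans (min_le_right _ _)
  have hu : lens η ∪ Complex.ofReal '' Icc (0 : ℝ) 1 ⊆ cthickening δ (Complex.ofReal '' Icc (0 : ℝ) 1) :=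
    union_subset (lens_sub hη i2) (self_subset_cthickening _)
  have hTw : ∀ w ∈ lens η, w.re ∈ Icc (0:ℝ) 1 ∧ ‖T w - T w.re‖ ≤ C * |w.im| ∧ |w.im| ≤ η := by
    intro w hw
    have hm : w.re ∈ Icc (0:ℝ) 1 := ⟨hw.1.le, hw.2.1.le⟩
    have := (hbil w (hu (Or.inl hw)) w.re (hu (Or.inr ⟨_, hm, rfl⟩))).2
    have e : w - (w.re:ℂ) = w.im * I := by apply Complex.ext <;> simp
    rw [e, norm_mul, Complex.norm_I, mul_one, Complex.norm_real] at this
    refine ⟨hm, this, hw.2.2.le.trans ?_⟩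
    have : η * (w.re * (1 - w.re)) ≤ η * 1 := by gcongr; nlinarith [hw.1, hw.2.1]
    linarith
  refine ⟨η, hη, i1, (lens_sub hη i2).trans hsub, ⟨c', hc', C, hC, fun z hz w hw => hbil z (hu hz) w (hu hw)⟩,
    ⟨min c' 1, by positivity, fun w hw p hp => ?_⟩, d / 2, by positivity, fun w hw z hz => ?_⟩
  · obtain ⟨hm, hT, -⟩ := hTw w hw
    rcases hsep w.re hm p hp with ⟨t', ht', rfl⟩ | h2
    · have h3 := (hbil w (hu (Or.inl hw)) t' (hu (Or.inr ⟨_, ht', rfl⟩))).1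
      have h4 := Complex.abs_im_le_norm (w - t')
      simp only [Complex.sub_im, Complex.ofReal_im, sub_zero] at h4
      have : min c' 1 ≤ c' := min_le_left _ _
      nlinarith [abs_nonneg w.im]
    · have h3 : ‖T w.re - p‖ ≤ ‖T w - T w.re‖ + ‖T w - p‖ := by
        rw [norm_sub_rev (T w)]; exact norm_sub_le_norm_sub_add_norm_sub _ _ _
      have h4 := hw.2.2
      have hk : 0 ≤ w.re * (1 - w.re) := mul_nonneg hm.1 (by linarith [hm.2])
      have : (C + 1) * |w.im| ≤ c * (w.re * (1 - w.re)) := by nlinarith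
      have : min c' 1 ≤ 1 := min_le_right _ _
      nlinarith [abs_nonneg w.im]
  · obtain ⟨hm, hT, hi⟩ := hTw w hw
    have := hdd z hz _ (hbd _ hm)
    rw [edist_nndist, ENNReal.coe_lt_coe, ← NNReal.coe_lt_coe, coe_nndist, dist_eq_norm] at this
    have h3 : ‖z - T w.re‖ ≤ ‖T w - z‖ + ‖T w - T w.re‖ := by
      rw [norm_sub_rev (T w) z]; exact norm_sub_le_norm_sub_add_norm_sub _ _ _
    nlinarith

lemma lens_open (η : ℝ) : IsOpen (lens η) := by
  apply IsOpen.inter (isOpen_lt continuous_const Complex.continuous_re)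
  apply IsOpen.inter (isOpen_lt Complex.continuous_re continuous_const)
  exact isOpen_lt (f := fun w : ℂ => |w.im|) (g := fun w : ℂ => η * (w.re * (1 - w.re))) (by fun_prop) (by fun_prop)

lemma lens_flip {η : ℝ} {w : ℂ} (h : w ∈ lens η) : 1 - w ∈ lens η := by
  refine ⟨by simpa using h.2.1, by simpa using h.1, ?_⟩
  simp only [Complex.sub_im, Complex.one_im, zero_sub, abs_neg, Complex.sub_re, Complex.one_re, sub_sub_cancel]
  rw [mul_comm (1 - w.re)]; exact h.2.2

lemma L_meet {G : Set ℂ} {lam : ℝ} {S : ℂ → ℂ} {σ ext A c ρ : ℝ} (h : EndP G lam S σ ext A c ρ) (hlam : 0 < lam) {η : ℝ} (hη : 0 < η)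
    (hη1 : η ≤ 1) (hηs : η ≤ Real.sin (min lam 1)) (hc : ContinuousAt S 0) {r : ℝ} (hr : 0 < r) :
    ∃ w ∈ lens η, ‖w‖ < r ∧ σ * w.im = η / 4 * w.re ∧ ∃ ω, S w = S 0 + cexp (c * I) * cexp ω ∧ Real.exp ω.re < ρ ∧
      |ω.im| < ext * Real.pi / 2 - A * Real.exp ω.re := by
  obtain ⟨ψ, hψ, ε, hε, hm⟩ := C_margin h hlam (μ := η / 4) (ν := η) (by positivity) hηs
  have hA := h.A_pos
  have hρ := h.ρ_pos
  obtain ⟨ε2, hε2, hS⟩ := Metric.continuousAt_iff.1 hc (min ρ (ψ / A)) (by positivity)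
  set x := min (1/2) (min r (min ε ε2) / 4) with hx
  have hx0 : 0 < x := by positivity
  have hx1 : x ≤ 1/2 := min_le_left _ _
  have hx2 : x ≤ min r (min ε ε2) / 4 := min_le_right _ _
  set w : ℂ := ⟨x, σ * (η / 4 * x)⟩ with hw
  have hσ2 : σ * σ = 1 := by rcases h.sgn with rfl | rfl <;> norm_num
  have hσ1 : |σ| = 1 := by rcases h.sgn with rfl | rfl <;> norm_num
  have him : |w.im| = η / 4 * x := by
    simp only [hw]; rw [abs_mul, hσ1, one_mul, abs_of_pos (by positivity)]
  have hn : ‖w‖ < min r (min ε ε2) := by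
    have := Complex.norm_le_abs_re_add_abs_im w
    rw [him, show w.re = x from rfl, abs_of_pos hx0] at this
    have h5 : 0 < min r (min ε ε2) := by positivity
    nlinarith
  have hσi : σ * w.im = η / 4 * w.re := by
    simp only [hw]; rw [← mul_assoc, hσ2, one_mul]
  rw [lt_min_iff, lt_min_iff] at hn
  refine ⟨w, ⟨hx0, by change x < 1; linarith, ?_⟩, hn.1, hσi, ?_⟩
  · rw [him]; change _ < η * (x * (1 - x)); nlinarith [mul_pos hη hx0]
  obtain ⟨ω, h1, h2⟩ := hm w hx0 hn.2.1 hσi.ge (by rw [hσi]; change η / 4 * x ≤ η * x; nlinarith)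
  have h3 := hS (x := w) (by simpa using hn.2.2)
  rw [dist_eq_norm, h1, add_sub_cancel_left, norm_mul, Complex.norm_exp_ofReal_mul_I, one_mul, Complex.norm_exp, lt_min_iff,
    lt_div_iff₀ hA] at h3
  exact ⟨ω, h1, h3.1, by linarith [h3.2]⟩

lemma L_main {G P F : Set ℂ} (hG : IsOpen G) {T : ℂ → ℂ} {U : Set ℂ} (h : Arc T U) (h0 : SepEnd (frontier G) T)
    (h1 : SepEnd (frontier G) (fun w => T (1 - w)))
    (hP : IsClosed P) (hLP : ∀ p ∈ frontier G, (∃ t' ∈ Icc (0:ℝ) 1, p = T t') ∨ p ∈ P) (hTP : ∀ t ∈ Ioo (0:ℝ) 1, T t ∉ P)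
    (hF : IsCompact F) (hFG : F ⊆ G) (hbd : ∀ t ∈ Icc (0:ℝ) 1, T t ∈ frontier G) {lam : ℝ} (hlam : 0 < lam)
    {σ0 ext0 A0 c0 ρ0 σ1 ext1 A1 c1 ρ1 : ℝ} (E0 : EndP G lam T σ0 ext0 A0 c0 ρ0) (E1 : EndP G lam (fun w => T (1 - w)) σ1 ext1 A1 c1 ρ1) :
    σ0 ≠ σ1 ∧ (σ0 = -1 → σ1 = 1 → ∃ η, LArc G (closure G)ᶜ F lam T U η ∧ LEnd (closure G)ᶜ lam T η 0 ext0 A0 c0 ρ0 ∧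
      LEnd (closure G)ᶜ lam T η 1 ext1 A1 c1 ρ1) := by
  have hs0 : 0 < Real.sin (min lam 1) := Real.sin_pos_of_pos_of_lt_pi (by positivity) (by linarith [min_le_right lam 1, Real.pi_gt_three])
  have hGL : ∀ z ∈ frontier G, z ∉ G := fun z hz hz' => by
    rw [frontier, hG.interior_eq] at hz; exact hz.2 hz'
  obtain ⟨η, hη, hη1, hsub, hbil, hdst, hfar⟩ := L_core h h0 h1 hP hLP hTP isClosed_frontier hF
    (Set.disjoint_left.2 fun z hz hz' => hGL z hz' (hFG hz)) hbd (lt_min one_pos hs0)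
  have hη2 : η ≤ 1 := hη1.trans (min_le_left _ _)
  have hη3 : η ≤ Real.sin (min lam 1) := hη1.trans (min_le_right _ _)
  have hopen := (A_inv (lens_open η) (h.diff.mono hsub) (h.inj.mono hsub)).choose_spec.2.1
  have hside : ∀ σ : ℝ, (σ = 1 ∨ σ = -1) → (∀ w ∈ lens η, 0 < σ * w.im → T w ∈ G) ∨ (∀ w ∈ lens η, 0 < σ * w.im → T w ∉ closure G) := by
    intro σ hσ
    have hpc := (lens_side hσ hη.le).isPreconnected.image T ((h.diff.mono hsub).continuousOn.mono inter_subset_left)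
    obtain ⟨cd, hcd, hcdd⟩ := hdst
    have hs : T '' (lens η ∩ {w | 0 < σ * w.im}) ⊆ G ∪ (closure G)ᶜ := by
      rintro _ ⟨w, ⟨hw, hw2⟩, rfl⟩
      by_contra h
      rw [mem_union, not_or, notMem_compl_iff] at h
      have := hcdd w hw (T w) (by rw [frontier, hG.interior_eq]; exact ⟨h.2, h.1⟩)
      rw [sub_self, norm_zero] at this
      have h3 : w.im ≠ 0 := by rintro h3; simp [h3] at hw2
      have := mul_pos hcd (abs_pos.2 h3)
      linarith
    rcases hpc.subset_or_subset hG isClosed_closure.isOpen_compl (disjoint_compl_right.mono_left subset_closure) hs with h | h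
    · exact Or.inl fun w h1 h2 => h ⟨w, ⟨h1, h2⟩, rfl⟩
    · exact Or.inr fun w h1 h2 => h ⟨w, ⟨h1, h2⟩, rfl⟩
  have mz : (0:ℂ) ∈ U := by have := h.mem (t := 0) (by simp); simpa using this
  have mo : (1:ℂ) ∈ U := by have := h.mem (t := 1) (by simp); simpa using this
  have ct0 : ContinuousAt T 0 := (h.diff.differentiableAt (h.opn.mem_nhds mz)).continuousAt
  have ct1 : ContinuousAt (fun w => T (1 - w)) 0 :=
    ContinuousAt.comp (f := fun w : ℂ => 1 - w) (x := (0:ℂ)) (g := T) (by simpa using (h.diff.differentiableAt (h.opn.mem_nhds mo)).continuousAt)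
      (by fun_prop)
  obtain ⟨w0, hw0, -, hw0i, ω0, e0, e0', e0''⟩ := L_meet E0 hlam hη hη2 hη3 ct0 one_pos
  obtain ⟨w1, hw1, -, hw1i, ω1, e1, e1', e1''⟩ := L_meet E1 hlam hη hη2 hη3 ct1 one_pos
  have o0 : ∀ w ∈ lens η, 0 < σ0 * w.im → T w ∉ closure G := by
    rcases hside σ0 E0.sgn with h | h
    · have := h w0 hw0 (by rw [hw0i]; have := hw0.1; positivity)
      have h3 := E0.out ω0 e0' e0''
      rw [← e0] at h3; exact absurd (subset_closure this) h3
    · exact h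
  have hs1' : -σ1 = 1 ∨ -σ1 = -1 := by rcases E1.sgn with h | h <;> simp [h]
  have o1 : ∀ w ∈ lens η, 0 < -σ1 * w.im → T w ∉ closure G := by
    rcases hside (-σ1) hs1' with h | h
    · have := h (1 - w1) (lens_flip hw1) (by
        rw [show -σ1 * (1 - w1).im = σ1 * w1.im by simp, hw1i]; have := hw1.1; positivity)
      have h3 := E1.out ω1 e1' e1''
      rw [← e1] at h3; exact absurd (subset_closure this) h3
    · exact h
  have hhalf : T (1/2) ∈ closure G := by
    have := hbd (1/2) (by constructor <;> norm_num)
    push_cast at this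
    exact frontier_subset_closure this
  obtain ⟨_, ⟨w2, hw2, rfl⟩, hw2G⟩ := mem_closure_iff.1 hhalf _ hopen ⟨1/2, by
    refine ⟨by norm_num, by norm_num, ?_⟩
    norm_num; exact hη, rfl⟩
  have hw2i : w2.im ≠ 0 := by
    intro h3
    have : w2 = (w2.re : ℂ) := by apply Complex.ext <;> simp [h3]
    rw [this] at hw2G
    exact hGL _ (hbd _ ⟨hw2.1.le, hw2.2.1.le⟩) hw2G
  have hw2c := subset_closure hw2G
  refine ⟨?_, ?_⟩
  · rintro rfl
    have a := mt (o0 w2 hw2) (not_not.2 hw2c)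
    have b := mt (o1 w2 hw2) (not_not.2 hw2c)
    rcases E0.sgn with rfl | rfl
    · apply hw2i; linarith
    · apply hw2i; linarith
  rintro rfl rfl
  have upG : ∀ w ∈ lens η, 0 < w.im → T w ∈ G := by
    rcases hside 1 (Or.inl rfl) with h | h
    · intro w hw hi; exact h w hw (by linarith)
    · exfalso
      have a := mt (o0 w2 hw2) (not_not.2 hw2c)
      have b := mt (h w2 hw2) (not_not.2 hw2c)
      apply hw2i; linarith
  have L0 : LEnd (closure G)ᶜ lam T η 0 ext0 A0 c0 ρ0 := by
    refine ⟨E0.lam_le, E0.lt_two, E0.A_pos, E0.ρ_pos, E0.out, fun μ hμ => ?_⟩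
    obtain ⟨ψ, hψ, ε, hε, hm⟩ := C_margin E0 hlam (μ := μ / 2) (ν := η) (by positivity) hη3
    refine ⟨ψ, hψ, min ε (1/2), by positivity, fun w hw hwε hwi => ?_⟩
    rw [sub_zero, lt_min_iff] at hwε
    have hre := (Complex.re_le_norm w).trans hwε.2.le
    have hw3 := hw.2.2
    rw [abs_lt] at hw3
    refine hm w hw.1 hwε.1 ?_ ?_
    · nlinarith [mul_pos hμ hw.1]
    · nlinarith [mul_pos hη hw.1, hw.1]
  have L1 : LEnd (closure G)ᶜ lam T η 1 ext1 A1 c1 ρ1 := by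
    have e10 : T (1 - 0) = T 1 := by rw [sub_zero]
    refine ⟨E1.lam_le, E1.lt_two, E1.A_pos, E1.ρ_pos, by rw [← e10]; exact E1.out, fun μ hμ => ?_⟩
    obtain ⟨ψ, hψ, ε, hε, hm⟩ := C_margin E1 hlam (μ := μ / 2) (ν := η) (by positivity) hη3
    refine ⟨ψ, hψ, min ε (1/2), by positivity, fun w hw hwε hwi => ?_⟩
    rw [norm_sub_rev, lt_min_iff] at hwε
    have hre := (Complex.re_le_norm (1 - w)).trans hwε.2.le
    have hw3 := hw.2.2
    rw [abs_lt] at hw3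
    have hr : (1 - w).re = 1 - w.re := by simp
    have hi : (1 - w).im = -w.im := by simp
    have p := hw.1
    have q : 0 < 1 - w.re := by linarith [hw.2.1]
    rw [hr] at hre
    obtain ⟨ω, e1, e2⟩ := hm (1 - w) (by rw [hr]; exact q) hwε.1 (by rw [hr, hi]; nlinarith [mul_pos hμ q])
      (by rw [hr, hi]; nlinarith [mul_pos hη q])
    simp only [sub_sub_cancel, e10] at e1
    exact ⟨ω, e1, e2⟩
  exact ⟨η, ⟨h, hη, hη2, hsub, hbil, hbd, hdst, hfar, upG, fun w hw hi => o0 w hw (by linarith), ⟨_, _, _, _, L0⟩, ⟨_, _, _, _, L1⟩⟩, L0, L1⟩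

lemma LArc.cont {G O F : Set ℂ} {lam η : ℝ} {T : ℂ → ℂ} {U : Set ℂ} (h : LArc G O F lam T U η) :
    ContinuousOn (fun t : ℝ => T t) (Icc 0 1) :=
  h.arc.diff.continuousOn.comp continuous_ofReal.continuousOn (fun _ ht => h.arc.mem ht)

lemma LArc.meet {G O F : Set ℂ} {lam η : ℝ} {T : ℂ → ℂ} {U : Set ℂ} (h : LArc G O F lam T U η) {e : ℂ} (he : e = 0 ∨ e = 1)
    {ext A c ρ : ℝ} (hE : ∃ O', LEnd O' lam T η e ext A c ρ) : ∃ w ∈ lens η, w.im < 0 ∧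
    ∃ ω, T w = T e + cexp (c * I) * cexp ω ∧ Real.exp ω.re < ρ ∧ |ω.im| < ext * Real.pi / 2 - A * Real.exp ω.re := by
  obtain ⟨O', hE⟩ := hE
  have hη := h.η_pos
  have hA := hE.A_pos
  have hρ := hE.ρ_pos
  obtain ⟨ψ, hψ, ε, hε, hm⟩ := hE.marg (η / 2) (by positivity)
  obtain ⟨c1, hc1, C, hC, hb⟩ := h.bil
  set t := min (1/2) (min (ε / 3) (min (ρ / (3 * C)) (ψ / (3 * C * A)))) with ht
  have ht0 : 0 < t := by positivity
  have t1 : t ≤ 1/2 := min_le_left _ _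
  have t2 : t ≤ ε / 3 := (min_le_right _ _).trans (min_le_left _ _)
  have t3 : t ≤ ρ / (3 * C) := (min_le_right _ _).trans ((min_le_right _ _).trans (min_le_left _ _))
  have t4 : t ≤ ψ / (3 * C * A) := (min_le_right _ _).trans ((min_le_right _ _).trans (min_le_right _ _))
  clear_value t
  rw [le_div_iff₀ (by positivity)] at t3 t4
  obtain ⟨x, hx0, hx1, hxe, hxt⟩ : ∃ x : ℝ, 0 < x ∧ x < 1 ∧ ‖(x:ℂ) - e‖ = t ∧ x * (1 - x) = t * (1 - t) := by
    rcases he with rfl | rfl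
    · exact ⟨t, ht0, by linarith, by simp [abs_of_pos ht0], rfl⟩
    · refine ⟨1 - t, by linarith, by linarith, ?_, by ring⟩
      push_cast
      rw [show (1:ℂ) - t - 1 = -t by ring, norm_neg]; simp [abs_of_pos ht0]
  have hd : 0 < x * (1 - x) := by nlinarith
  set w : ℂ := ⟨x, -(η / 2 * (x * (1 - x)))⟩ with hw
  have hwl : w ∈ lens η := by
    refine ⟨hx0, hx1, ?_⟩
    change |-(η / 2 * (x * (1 - x)))| < η * (x * (1 - x))
    rw [abs_neg, abs_of_pos (by positivity)]
    nlinarith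
  have hwe : ‖w - e‖ < 3 * t := by
    have : w - e = (x - e) + ((-(η / 2 * (x * (1 - x))) : ℝ) : ℂ) * I := by
      apply Complex.ext <;> simp [hw]; ring
    rw [this]
    refine (norm_add_le _ _).trans_lt ?_
    rw [hxe, norm_mul, norm_I, mul_one, norm_real, norm_neg, Real.norm_of_nonneg (by positivity), hxt]
    have := h.η_le
    nlinarith [mul_pos ht0 (show (0:ℝ) < 1 - t by linarith), mul_pos hη ht0]
  obtain ⟨ω, hω1, hω2⟩ := hm w hwl (by linarith) (by simp [hw])
  have hr : Real.exp ω.re = ‖T w - T e‖ := by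
    rw [hω1, add_sub_cancel_left, norm_mul, Complex.norm_exp_ofReal_mul_I, one_mul, Complex.norm_exp]
  have he' : e ∈ lens η ∪ Complex.ofReal '' Icc (0 : ℝ) 1 := by
    rcases he with rfl | rfl
    · exact Or.inr ⟨0, by simp, by simp⟩
    · exact Or.inr ⟨1, by simp, by simp⟩
  have h3 : ‖T w - T e‖ < C * (3 * t) := ((hb w (Or.inl hwl) e he').2).trans_lt (by gcongr)
  refine ⟨w, hwl, by simp only [hw]; linarith [mul_pos hη hd], ω, hω1, by rw [hr]; linarith, hω2.trans_lt ?_⟩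
  rw [hr]
  nlinarith [mul_lt_mul_of_pos_left h3 hA]

lemma C_sec_pre {ext A ρ : ℝ} (hA : 0 < A) (z0 c : ℂ) : IsPreconnected ((fun w => z0 + c * cexp w) '' {w : ℂ | Real.exp w.re < ρ ∧
    |w.im| < ext - A * Real.exp w.re}) := by
  have : {w : ℂ | Real.exp w.re < ρ ∧ |w.im| < ext - A * Real.exp w.re} =
      {w : ℂ | Real.exp w.re < ρ ∧ -ext + A * Real.exp w.re < w.im ∧ w.im < ext - A * Real.exp w.re} := by
    ext w; simp only [mem_ofPred_eq, abs_lt]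
    constructor <;> rintro ⟨h1, h2, h3⟩ <;> exact ⟨h1, by linarith, h3⟩
  rw [this]
  exact (C_conv hA.le).isPreconnected.image _ (by fun_prop)

lemma LArc.low_pre {G O F : Set ℂ} {lam η : ℝ} {T : ℂ → ℂ} {U : Set ℂ} (h : LArc G O F lam T U η) :
    IsPreconnected (T '' (lens η ∩ {w | w.im < 0})) := by
  have := (lens_side (σ := -1) (Or.inr rfl) h.η_pos.le).isPreconnected.image T
    (h.arc.diff.continuousOn.mono (inter_subset_left.trans h.sub))
  simpa using this

/-- change of the outer set. -/
lemma LArc.toY {G O F Y : Set ℂ} {lam η : ℝ} {T : ℂ → ℂ} {U : Set ℂ} (h : LArc G O F lam T U η)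
    (hY : ∀ S ⊆ O, IsPreconnected S → (S ∩ Y).Nonempty → S ⊆ Y) (hne : (T '' (lens η ∩ {w | w.im < 0}) ∩ Y).Nonempty) :
    LArc G Y F lam T U η ∧ ∀ e : ℂ, (e = 0 ∨ e = 1) → ∀ ext A c ρ, LEnd O lam T η e ext A c ρ → LEnd Y lam T η e ext A c ρ := by
  have hdn := hY _ (by rintro _ ⟨w, hw, rfl⟩; exact h.dn w hw.1 hw.2) h.low_pre hne
  have key : ∀ e : ℂ, (e = 0 ∨ e = 1) → ∀ ext A c ρ, LEnd O lam T η e ext A c ρ → LEnd Y lam T η e ext A c ρ := by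
    intro e he ext A c ρ hE
    refine ⟨hE.lam_le, hE.lt_two, hE.A_pos, hE.ρ_pos, fun w h1 h2 => ?_, hE.marg⟩
    refine hY _ ?_ (C_sec_pre (ext := ext * Real.pi / 2) (ρ := ρ) hE.A_pos (T e) (cexp (c * I))) ?_ ⟨w, ⟨h1, h2⟩, rfl⟩
    · rintro _ ⟨w, hw, rfl⟩; exact hE.out w hw.1 hw.2
    · obtain ⟨w, hw, hw0, ω, hω, h3⟩ := h.meet he ⟨O, hE⟩
      exact ⟨T w, ⟨ω, h3, hω.symm⟩, hdn ⟨w, ⟨hw, hw0⟩, rfl⟩⟩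
  obtain ⟨x1, x2, x3, x4, e0⟩ := h.e0
  obtain ⟨y1, y2, y3, y4, e1⟩ := h.e1
  exact ⟨⟨h.arc, h.η_pos, h.η_le, h.sub, h.bil, h.bd, h.dst, h.far, h.up, fun w hw hw0 => hdn ⟨w, ⟨hw, hw0⟩, rfl⟩,
    ⟨_, _, _, _, key 0 (Or.inl rfl) _ _ _ _ e0⟩, ⟨_, _, _, _, key 1 (Or.inr rfl) _ _ _ _ e1⟩⟩, key⟩

lemma LEnd.adj {G O F Y : Set ℂ} {lam η η' : ℝ} {T T' : ℂ → ℂ} {U U' : Set ℂ} (h : LArc G O F lam T U η) (h' : LArc G O F lam T' U' η')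
    (hY : ∀ S ⊆ O, IsPreconnected S → (S ∩ Y).Nonempty → S ⊆ Y) {e e' : ℂ} (he : e = 0 ∨ e = 1) (he' : e' = 0 ∨ e' = 1)
    {ext A c ρ : ℝ} (hE : LEnd O lam T η e ext A c ρ) (hE' : LEnd O lam T' η' e' ext A c ρ) (hee : T e = T' e')
    (hne : (T '' (lens η ∩ {w | w.im < 0}) ∩ Y).Nonempty) : (T' '' (lens η' ∩ {w | w.im < 0}) ∩ Y).Nonempty := by
  obtain ⟨w, hw, hw0, ω, hω, h3⟩ := h'.meet he' ⟨O, hE'⟩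
  refine ⟨T' w, ⟨w, ⟨hw, hw0⟩, rfl⟩, ?_⟩
  rw [hω, ← hee]
  exact (((h.toY hY hne).2 e he _ _ _ _ hE)).out ω h3.1 h3.2

/-- a boundary arc `γ [a,b]` with its lens parametrization. -/
structure DArc (D : JordanDomain) (O F : Set ℂ) (lam a b : ℝ) (T : ℂ → ℂ) (U : Set ℂ) (η : ℝ) : Prop where
  lt : a < b
  la : LArc D.G O F lam T U η
  img : (fun t : ℝ => T t) '' Icc (0:ℝ) 1 = D.γ '' Icc a b
  inr : ∀ t ∈ Ioo (0:ℝ) 1, ∃ u ∈ Ioo a b, T t = D.γ u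
  chord : ∃ c > 0, ∀ s ∈ Icc a b, ∀ t ∈ Icc a b, c * |s - t| ≤ ‖D.γ s - D.γ t‖

lemma B_inr {D : JordanDomain} {a b : ℝ} {T : ℂ → ℂ} {U : Set ℂ} (h : CleanArc D a b T U) :
    ∀ t ∈ Ioo (0:ℝ) 1, ∃ u ∈ Ioo a b, T t = D.γ u := by
  intro t ht
  have hm : ∀ x ∈ Icc (0:ℝ) 1, (x:ℂ) ∈ U := fun x hx => h.seg ⟨x, hx, rfl⟩
  have : T t ∈ D.γ '' Icc a b := by rw [← h.img]; exact ⟨t, ⟨ht.1.le, ht.2.le⟩, rfl⟩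
  obtain ⟨u, hu, hut⟩ := this
  refine ⟨u, ⟨lt_of_le_of_ne hu.1 ?_, lt_of_le_of_ne hu.2 ?_⟩, hut.symm⟩
  · rintro rfl
    rw [← h.left] at hut
    have := h.inj (by simpa using hm 0 (by simp)) (hm t ⟨ht.1.le, ht.2.le⟩) hut
    exact ht.1.ne (by exact_mod_cast this)
  · rintro rfl
    rw [← h.right] at hut
    have := h.inj (by simpa using hm 1 (by simp)) (hm t ⟨ht.1.le, ht.2.le⟩) hut
    exact ht.2.ne (by exact_mod_cast this.symm)

lemma B_arcs (D : JordanDomain) (B : PiecewiseAnalyticBoundary D) {lam : ℝ} (hlam0 : 0 < lam) (hmin : ∀ i, lam ≤ B.extAngle i)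
    {F : Set ℂ} (hF : IsCompact F) (hFG : F ⊆ D.G) : ∃ (K : ℕ) (s : ℕ → ℝ), 0 < K ∧ StrictMono s ∧ s K = s 0 + D.l ∧
    ∃ (T : ℕ → ℂ → ℂ) (U : ℕ → Set ℂ) (η : ℕ → ℝ), (∀ k, DArc D (closure D.G)ᶜ F lam (s k) (s (k + 1)) (T k) (U k) (η k)) ∧
      ∀ k, ∃ e e' : ℂ, (e = 0 ∨ e = 1) ∧ (e' = 0 ∨ e' = 1) ∧ T k e = T (k + 1) e' ∧ ∃ ext A c ρ,
        LEnd (closure D.G)ᶜ lam (T k) (η k) e ext A c ρ ∧ LEnd (closure D.G)ᶜ lam (T (k + 1)) (η (k + 1)) e' ext A c ρ := by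
  obtain ⟨s, K, hK, hs, hcor, hgap, hper⟩ := B_corners D B
  have h2 : ∀ k, s (k + 2) ≤ s k + D.l := fun k => by rw [← hper]; exact hs.monotone (by omega)
  have hlt : ∀ k, s k < s (k + 1) := fun k => hs (by omega)
  choose T U hT using fun k => B_arc D B (hlt k) ((hlt (k + 1)).trans_le (h2 k)) (hcor k) (hcor (k + 1)) (hgap k)
  have hA : ∀ k, Arc (T k) (U k) := fun k => ⟨(hT k).opn, (hT k).seg, (hT k).diff, (hT k).inj⟩
  have hflip : ∀ k (w : ℂ), T k (1 - (1 - w)) = T k w := fun k w => by rw [sub_sub_cancel]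
  have hJ : ∀ k, ∃ ext A c ρ σ, EndP D.G lam (fun w => T k (1 - w)) σ ext A c ρ ∧ EndP D.G lam (T (k + 1)) (-σ) ext A c ρ ∧
      SepEnd (frontier D.G) (fun w => T k (1 - w)) ∧ SepEnd (frontier D.G) (T (k + 1)) := by
    intro k
    obtain ⟨i, hi⟩ := hcor (k + 1)
    have hc : IsClosed (D.γ '' Icc (s (k + 2)) (s k + D.l)) := (isCompact_Icc.image D.γ_cont).isClosed
    have hz : D.γ (s (k + 1)) ∉ D.γ '' Icc (s (k + 2)) (s k + D.l) := by
      rintro ⟨u, hu, h⟩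
      have h1 := hlt k
      have h3 := hlt (k + 1)
      have := D.inj_lt h.symm (by rw [abs_lt]; constructor <;> linarith [hu.1, hu.2])
      linarith [hu.1]
    obtain ⟨r, hr, hb⟩ := Metric.isOpen_iff.1 hc.isOpen_compl _ hz
    have hang := B.extAngle_spec i
    rw [← hi] at hang
    refine ⟨B.extAngle i, C_junction D.isOpen (hmin i) (B.extAngle_mem i).1 (B.extAngle_mem i).2 hang (hA k).flip (hA (k + 1))
      (by simp [(hT k).right]) (hT (k + 1)).left hr fun z hz hzr => ?_⟩
    obtain ⟨u, hu, rfl⟩ := D.exists_param hz (s k)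
    rcases le_total u (s (k + 1)) with h | h
    · have : D.γ u ∈ D.γ '' Icc (s k) (s (k + 1)) := ⟨u, ⟨hu.1, h⟩, rfl⟩
      rw [← (hT k).img] at this
      obtain ⟨t, ht, h⟩ := this
      exact ⟨1 - t, ⟨by linarith [ht.2], by linarith [ht.1]⟩, Or.inl (by push_cast; rw [hflip]; exact h.symm)⟩
    rcases le_total u (s (k + 2)) with h' | h'
    · have : D.γ u ∈ D.γ '' Icc (s (k + 1)) (s (k + 1 + 1)) := ⟨u, ⟨h, h'⟩, rfl⟩
      rw [← (hT (k + 1)).img] at this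
      obtain ⟨t, ht, h⟩ := this
      exact ⟨t, ht, Or.inr h.symm⟩
    · exact absurd ⟨u, ⟨h', hu.2.le⟩, rfl⟩ (hb (by rwa [mem_ball, dist_eq_norm]))
  choose ext A c ρ σ hE1 hE2 hS1 hS2 using hJ
  have hfin : ∀ k, ∃ (T' : ℂ → ℂ) (U' : Set ℂ) (η : ℝ) (e e' : ℂ), DArc D (closure D.G)ᶜ F lam (s (k + 1)) (s (k + 1 + 1)) T' U' η ∧
      (e = 0 ∨ e = 1) ∧ T' e = D.γ (s (k + 1)) ∧ LEnd (closure D.G)ᶜ lam T' η e (ext k) (A k) (c k) (ρ k) ∧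
      (e' = 0 ∨ e' = 1) ∧ T' e' = D.γ (s (k + 1 + 1)) ∧
        LEnd (closure D.G)ᶜ lam T' η e' (ext (k + 1)) (A (k + 1)) (c (k + 1)) (ρ (k + 1)) := by
    intro k
    set P := D.γ '' Icc (s (k + 2)) (s (k + 1) + D.l)
    have hP : IsClosed P := (isCompact_Icc.image D.γ_cont).isClosed
    have hLP : ∀ p ∈ frontier D.G, (∃ t' ∈ Icc (0:ℝ) 1, p = T (k + 1) t') ∨ p ∈ P := by
      intro p hp
      obtain ⟨u, hu, rfl⟩ := D.exists_param hp (s (k + 1))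
      rcases le_total u (s (k + 2)) with h | h
      · have : D.γ u ∈ D.γ '' Icc (s (k + 1)) (s (k + 1 + 1)) := ⟨u, ⟨hu.1, h⟩, rfl⟩
        rw [← (hT (k + 1)).img] at this
        obtain ⟨t, ht, h⟩ := this
        exact Or.inl ⟨t, ht, h.symm⟩
      · exact Or.inr ⟨u, ⟨h, hu.2.le⟩, rfl⟩
    have hinr := B_inr (hT (k + 1))
    have hTP : ∀ t ∈ Ioo (0:ℝ) 1, T (k + 1) t ∉ P := by
      rintro t ht ⟨v, hv, hvt⟩
      obtain ⟨u, hu, hut⟩ := hinr t ht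
      rw [hut] at hvt
      have h3 : u < s (k + 2) := hu.2
      have := D.inj_lt hvt.symm (by rw [abs_lt]; constructor <;> linarith [hu.1, hv.1, hv.2])
      linarith [hv.1]
    have hbd : ∀ t ∈ Icc (0:ℝ) 1, T (k + 1) t ∈ frontier D.G := by
      intro t ht
      have : T (k + 1) t ∈ D.γ '' Icc (s (k + 1)) (s (k + 1 + 1)) := by rw [← (hT (k + 1)).img]; exact ⟨t, ht, rfl⟩
      obtain ⟨u, -, hu⟩ := this
      rw [← hu]; exact D.mem_L u
    have fl : ∀ t : ℝ, T (k + 1) (1 - t) = T (k + 1) ((1 - t : ℝ) : ℂ) := fun t => by push_cast; rfl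
    have hmm : ∀ t ∈ Icc (0:ℝ) 1, 1 - t ∈ Icc (0:ℝ) 1 := fun t ht => ⟨by linarith [ht.2], by linarith [ht.1]⟩
    have hS1' : SepEnd (frontier D.G) (fun w => T (k + 1) (1 - (1 - w))) := by simp only [hflip]; exact hS2 k
    have hE2' : EndP D.G lam (fun w => T (k + 1) (1 - (1 - w))) (-σ k) (ext k) (A k) (c k) (ρ k) := by simp only [hflip]; exact hE2 k
    obtain ⟨hne, m1⟩ := L_main D.isOpen (hA (k + 1)) (hS2 k) (hS1 (k + 1)) hP hLP hTP hF hFG hbd hlam0 (hE2 k) (hE1 (k + 1))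
    rcases (hE1 (k + 1)).sgn with h1 | h1
    · have h0 : -σ k = -1 := by
        rcases (hE2 k).sgn with h | h
        · exact absurd (h.trans h1.symm) hne
        · exact h
      obtain ⟨η, a1, a2, a3⟩ := m1 h0 h1
      exact ⟨_, _, η, 0, 1, ⟨hlt _, a1, (hT (k + 1)).img, hinr, (hT (k + 1)).chord⟩, Or.inl rfl, (hT (k + 1)).left, a2,
        Or.inr rfl, (hT (k + 1)).right, a3⟩
    · have h0 : -σ k = 1 := by
        rcases (hE2 k).sgn with h | h
        · exact h
        · exact absurd (h.trans h1.symm) hne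
      obtain ⟨η, a1, a2, a3⟩ := (L_main D.isOpen (hA (k + 1)).flip (hS1 (k + 1)) hS1' hP (fun p hp => (hLP p hp).imp_left (by
        rintro ⟨t, ht, rfl⟩; exact ⟨1 - t, hmm t ht, by push_cast; rw [hflip]⟩)) (fun t ht => by
        rw [fl]; exact hTP _ ⟨by linarith [ht.2], by linarith [ht.1]⟩) hF hFG (fun t ht => by rw [fl]; exact hbd _ (hmm t ht)) hlam0
        (hE1 (k + 1)) hE2').2 h1 h0
      refine ⟨_, _, η, 1, 0, ⟨hlt _, a1, ?_, fun t ht => ?_, (hT (k + 1)).chord⟩, Or.inr rfl, by simp [(hT (k + 1)).left], a3,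
        Or.inl rfl, by simp [(hT (k + 1)).right], a2⟩
      · rw [← (hT (k + 1)).img]
        apply Subset.antisymm
        · rintro _ ⟨t, ht, rfl⟩; exact ⟨1 - t, hmm t ht, by push_cast; rfl⟩
        · rintro _ ⟨t, ht, rfl⟩; exact ⟨1 - t, hmm t ht, by push_cast; rw [hflip]⟩
      · simp only [fl]
        exact hinr _ ⟨by linarith [ht.2], by linarith [ht.1]⟩
  choose T' U' η e e' hD he1 he2 he3 he1' he2' he3' using hfin
  refine ⟨K, fun k => s (k + 1), by omega, fun i j h => hs (by omega), ?_, T', U', η, hD, fun k =>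
    ⟨e' k, e (k + 1), he1' k, he1 (k + 1), by rw [he2', he2], _, _, _, _, he3' k, he3 (k + 1)⟩⟩
  change s (K + 1) = s (0 + 1) + D.l
  rw [← hper]; congr 1; omega

lemma B_cover {D : JordanDomain} {K : ℕ} {s : ℕ → ℝ} {O F : Set ℂ} {lam : ℝ} {T : ℕ → ℂ → ℂ} {U : ℕ → Set ℂ} {η : ℕ → ℝ}
    (hs : StrictMono s) (hK : s K = s 0 + D.l) (h : ∀ k, DArc D O F lam (s k) (s (k + 1)) (T k) (U k) (η k)) :
    (∀ p ∈ frontier D.G, ∃ k < K, ∃ t ∈ Icc (0:ℝ) 1, p = T k t) ∧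
    ∀ j < K, ∀ k < K, j ≠ k → ∀ t ∈ Ioo (0:ℝ) 1, ∀ t' ∈ Icc (0:ℝ) 1, T k t ≠ T j t' := by
  constructor
  · intro p hp
    obtain ⟨u, hu, rfl⟩ := D.exists_param hp (s 0)
    rw [← hK] at hu
    have : ∀ n, u < s n → ∃ k < n, u ∈ Icc (s k) (s (k + 1)) := by
      intro n
      induction n with
      | zero => intro h; linarith [hu.1]
      | succ n ih =>
        intro h
        rcases lt_or_ge u (s n) with h' | h'
        · obtain ⟨k, hk, h⟩ := ih h'; exact ⟨k, by omega, h⟩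
        · exact ⟨n, by omega, h', h.le⟩
    obtain ⟨k, hk, hku⟩ := this K hu.2
    have : D.γ u ∈ D.γ '' Icc (s k) (s (k + 1)) := ⟨u, hku, rfl⟩
    rw [← (h k).img] at this
    obtain ⟨t, ht, h⟩ := this
    exact ⟨k, hk, t, ht, h.symm⟩
  · intro j hj k hk hjk t ht t' ht' heq
    obtain ⟨u, hu, hut⟩ := (h k).inr t ht
    have : T j t' ∈ D.γ '' Icc (s j) (s (j + 1)) := by rw [← (h j).img]; exact ⟨t', ht', rfl⟩
    obtain ⟨v, hv, hvt⟩ := this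
    have m1 := hs.monotone (Nat.zero_le k)
    have m2 := hs.monotone (Nat.zero_le j)
    have m3 := hs.monotone (show k + 1 ≤ K by omega)
    have m4 := hs.monotone (show j + 1 ≤ K by omega)
    have := D.inj_lt (hut.symm.trans (heq.trans hvt.symm)) (by rw [abs_lt]; constructor <;> linarith [hu.1, hu.2, hv.1, hv.2])
    subst this
    rcases lt_or_gt_of_ne hjk with h | h
    · linarith [hs.monotone (show j + 1 ≤ k by omega), hu.1, hv.2]
    · linarith [hs.monotone (show k + 1 ≤ j by omega), hu.2, hv.1]

lemma B_dec (D : JordanDomain) (B : PiecewiseAnalyticBoundary D) {lam : ℝ} (hlam0 : 0 < lam) (hmin : ∀ i, lam ≤ B.extAngle i)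
    {F : Set ℂ} (hF : IsCompact F) (hFG : F ⊆ D.G) : ∃ (K : ℕ) (s : ℕ → ℝ), 0 < K ∧ StrictMono s ∧ s K = s 0 + D.l ∧
    ∃ (T : ℕ → ℂ → ℂ) (U : ℕ → Set ℂ) (η : ℕ → ℝ) (Y : Set ℂ), (∀ k, DArc D Y F lam (s k) (s (k + 1)) (T k) (U k) (η k)) ∧
      IsOpen Y ∧ IsPreconnected Y ∧ Y ⊆ (closure D.G)ᶜ ∧ ∃ R, ∀ z : ℂ, R < ‖z‖ → z ∈ Y := by
  obtain ⟨K, s, hK, hs, hsK, T, U, η, hD, hlink⟩ := B_arcs D B hlam0 hmin hF hFG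
  obtain ⟨hcov, -⟩ := B_cover hs hsK hD
  obtain ⟨R, hR1, hR⟩ := D.bounded.closure.subset_closedBall_lt 0 (0:ℂ)
  have hR' : (closedBall (0:ℂ) R)ᶜ ⊆ (closure D.G)ᶜ := compl_subset_compl.2 hR
  have hRc : IsPreconnected (closedBall (0:ℂ) R)ᶜ := by
    have : (closedBall (0:ℂ) R)ᶜ = cexp '' {w : ℂ | Real.log R < w.re} := by
      ext z
      simp only [mem_compl_iff, mem_closedBall, dist_zero_right, not_le, mem_image, mem_ofPred_eq]
      constructor
      · intro h
        exact ⟨Complex.log z, by rw [Complex.log_re]; exact Real.log_lt_log hR1 h, Complex.exp_log (by rw [← norm_pos_iff]; linarith)⟩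
      · rintro ⟨w, hw, rfl⟩
        rw [Complex.norm_exp, ← Real.log_lt_iff_lt_exp hR1]; exact hw
    rw [this]
    exact (convex_halfSpace_re_gt _).isPreconnected.image _ (by fun_prop)
  set x : ℂ := ((|R| + 1 : ℝ) : ℂ)
  have hxR : x ∈ (closedBall (0:ℂ) R)ᶜ := by
    simp only [mem_compl_iff, mem_closedBall, dist_zero_right, x, norm_real, Real.norm_eq_abs, not_le]
    rw [abs_of_nonneg (by positivity)]; linarith [le_abs_self R]
  set Y := connectedComponentIn (closure D.G)ᶜ x
  have hYo : IsOpen Y := isClosed_closure.isOpen_compl.connectedComponentIn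
  have hYs : Y ⊆ (closure D.G)ᶜ := connectedComponentIn_subset _ _
  have hY : ∀ S ⊆ (closure D.G)ᶜ, IsPreconnected S → (S ∩ Y).Nonempty → S ⊆ Y := by
    rintro S hS hSp ⟨y, hyS, hyY⟩
    rw [show Y = connectedComponentIn (closure D.G)ᶜ y from connectedComponentIn_eq hyY]
    exact hSp.subset_connectedComponentIn hyS hS
  have hstep : ∀ k, (T k '' (lens (η k) ∩ {w | w.im < 0}) ∩ Y).Nonempty ↔
      (T (k + 1) '' (lens (η (k + 1)) ∩ {w | w.im < 0}) ∩ Y).Nonempty := by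
    intro k
    obtain ⟨e, e', he, he', hee, _, _, _, _, h1, h2⟩ := hlink k
    exact ⟨LEnd.adj (hD k).la (hD (k + 1)).la hY he he' h1 h2 hee, LEnd.adj (hD (k + 1)).la (hD k).la hY he' he h2 h1 hee.symm⟩
  have hall : ∀ k, (T k '' (lens (η k) ∩ {w | w.im < 0}) ∩ Y).Nonempty ↔ (T 0 '' (lens (η 0) ∩ {w | w.im < 0}) ∩ Y).Nonempty := by
    intro k
    induction k with
    | zero => rfl
    | succ k ih => rw [← hstep, ih]
  have h0 : (T 0 '' (lens (η 0) ∩ {w | w.im < 0}) ∩ Y).Nonempty := by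
    by_contra hno
    set Z : Set ℂ := (fun k => T k 0) '' (Finset.range K : Set ℕ) ∪ (fun k => T k 1) '' (Finset.range K : Set ℕ)
    have hZf : Z.Finite := (Finset.finite_toSet _).image _ |>.union ((Finset.finite_toSet _).image _)
    have hZc : IsPreconnected Zᶜ := (hZf.countable.isConnected_compl_of_one_lt_rank (by
      rw [Complex.rank_real_complex]; norm_num)).isPreconnected
    have hZL : Z ⊆ frontier D.G := by
      rintro _ (⟨k, -, rfl⟩ | ⟨k, -, rfl⟩)
      · simpa using (hD k).la.bd 0 (by simp)
      · simpa using (hD k).la.bd 1 (by simp)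
    have hGf : ∀ z ∈ frontier D.G, z ∉ D.G := fun z hz hz' => by
      rw [frontier, D.isOpen.interior_eq] at hz; exact hz.2 hz'
    have hsub : Zᶜ ⊆ Y := by
      refine hZc.subset_of_closure_inter_subset hYo ⟨x, fun hx => ?_, mem_connectedComponentIn (hR' hxR)⟩ ?_
      · exact hR' hxR (frontier_subset_closure (hZL hx))
      · rintro p ⟨hpc, hpZ⟩
        by_contra hpY
        have hp1 : p ∈ closure D.G := by
          by_contra hp
          obtain ⟨q, hq1, hq2⟩ := mem_closure_iff.1 hpc _ (isClosed_closure.isOpen_compl.connectedComponentIn (x := p)) (mem_connectedComponentIn hp)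
          exact hpY (hY _ (connectedComponentIn_subset _ _) isPreconnected_connectedComponentIn ⟨q, hq1, hq2⟩ (mem_connectedComponentIn hp))
        have hp2 : p ∉ D.G := fun hp => by
          obtain ⟨q, hq1, hq2⟩ := mem_closure_iff.1 hpc _ D.isOpen hp
          exact hYs hq2 (subset_closure hq1)
        obtain ⟨k, hk, t, ht, rfl⟩ := hcov p (by rw [frontier, D.isOpen.interior_eq]; exact ⟨hp1, hp2⟩)
        have hkm : k ∈ (Finset.range K : Set ℕ) := by simpa using hk
        have ht' : t ∈ Ioo (0:ℝ) 1 := ⟨lt_of_le_of_ne ht.1 fun h => hpZ (Or.inl ⟨k, hkm, by simp [← h]⟩),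
          lt_of_le_of_ne ht.2 fun h => hpZ (Or.inr ⟨k, hkm, by simp [h]⟩)⟩
        have hl := (hD k).la
        obtain ⟨S, -, hop, -⟩ := A_inv (lens_open (η k)) (hl.arc.diff.mono hl.sub) (hl.arc.inj.mono hl.sub)
        have hη := hl.η_pos
        obtain ⟨_, ⟨w, hw, rfl⟩, hq2⟩ := mem_closure_iff.1 hpc _ hop ⟨t, ⟨ht'.1, ht'.2, by
          have := ht'.1; have : 0 < 1 - t := by linarith [ht'.2]
          simp only [ofReal_im, abs_zero, ofReal_re]; positivity⟩, rfl⟩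
        rcases lt_trichotomy w.im 0 with h | h | h
        · exact hno ((hall k).1 ⟨T k w, ⟨w, ⟨hw, h⟩, rfl⟩, hq2⟩)
        · have : w = (w.re : ℂ) := by apply Complex.ext <;> simp [h]
          rw [this] at hq2
          exact hYs hq2 (frontier_subset_closure (hl.bd _ ⟨hw.1.le, hw.2.1.le⟩))
        · exact hYs hq2 (subset_closure (hl.up w hw h))
    obtain ⟨z, hz⟩ := D.nonempty
    exact hYs (hsub fun h => hGf z (hZL h) hz) (subset_closure hz)
  refine ⟨K, s, hK, hs, hsK, T, U, η, Y, fun k => ?_, hYo, isPreconnected_connectedComponentIn, hYs, R, fun z hz => ?_⟩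
  · exact ⟨(hD k).lt, ((hD k).la.toY hY ((hall k).2 h0)).1, (hD k).img, (hD k).inr, (hD k).chord⟩
  · exact hRc.subset_connectedComponentIn hxR hR' (by simpa using hz)

lemma K_phi {G : Set ℂ} (hG : IsOpen G) {φ : ℂ → ℂ} {ζ : ℂ} (hζ : ζ ∈ G) (h : ConformalOnto G φ ζ) :
    (∀ p ∈ frontier G, Tendsto (fun z => ‖φ z‖) (nhdsWithin p G) (nhds 1)) ∧
    (∀ R, (∀ z ∈ G, ‖z - ζ‖ < R) → ∀ z ∈ G, ‖z - ζ‖ ≤ R * ‖φ z‖) ∧ IntegrableOn (fun z => ‖deriv φ z‖ ^ 2) G := by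
  have hd : DifferentiableOn ℂ φ G := fun z hz => (h.differentiable z hz).differentiableWithinAt
  obtain ⟨S, hS, -, hSd⟩ := A_inv hG hd h.bijOn.injOn
  have hSd' : DifferentiableOn ℂ S (ball 0 1) := by
    intro w hw
    obtain ⟨z, hz, rfl⟩ := h.bijOn.surjOn hw
    exact (hSd z hz).differentiableAt.differentiableWithinAt
  refine ⟨fun p hp => ?_, fun R hR z hz => ?_, ?_⟩
  · rw [Metric.tendsto_nhds]
    intro ε hε
    have hK : IsCompact (S '' closedBall 0 (1 - ε)) := (isCompact_closedBall 0 _).image_of_continuousOn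
      (hSd'.continuousOn.mono (closedBall_subset_ball (by linarith)))
    have hp' : p ∉ S '' closedBall 0 (1 - ε) := by
      rintro ⟨w, hw, rfl⟩
      obtain ⟨z, hz, rfl⟩ := h.bijOn.surjOn (closedBall_subset_ball (by linarith) hw)
      rw [hS z hz, frontier, hG.interior_eq] at hp
      exact hp.2 hz
    filter_upwards [self_mem_nhdsWithin, mem_nhdsWithin_of_mem_nhds (hK.isClosed.isOpen_compl.mem_nhds hp')] with z hz hz'
    have h1 := h.bijOn.mapsTo hz
    rw [mem_ball_zero_iff] at h1
    have h2 : ¬ ‖φ z‖ ≤ 1 - ε := fun h => hz' ⟨φ z, by simpa using h, hS z hz⟩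
    rw [Real.dist_eq, abs_lt]; constructor <;> linarith
  · have h1 := Complex.dist_le_div_mul_dist_of_mapsTo_ball (c := 0) (R₁ := 1) (R₂ := R) hSd' (by
      intro w hw
      obtain ⟨z, hz, rfl⟩ := h.bijOn.surjOn hw
      rw [hS z hz, ← h.map_center, hS ζ hζ, mem_closedBall, dist_eq_norm]
      exact (hR z hz).le) (h.bijOn.mapsTo hz)
    rwa [hS z hz, ← h.map_center, hS ζ hζ, h.map_center, dist_zero_right, dist_eq_norm, div_one] at h1
  · have h1 := lintegral_abs_det_fderiv_eq_addHaar_image volume hG.measurableSet (f := φ)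
      (f' := fun z => (fderiv ℂ φ z).restrictScalars ℝ)
      (fun z hz => ((h.differentiable z hz).hasFDerivAt.restrictScalars ℝ).hasFDerivWithinAt) h.bijOn.injOn
    have h2 : ∀ z, |((fderiv ℂ φ z).restrictScalars ℝ).det| = ‖deriv φ z‖ ^ 2 := by
      intro z
      change |LinearMap.det (((fderiv ℂ φ z) : ℂ →ₗ[ℂ] ℂ).restrictScalars ℝ)| = _
      rw [LinearMap.det_restrictScalars, Algebra.norm_complex_apply, LinearMap.det_ring, abs_of_nonneg (normSq_nonneg _), normSq_eq_norm_sq]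
      rfl
    simp only [h2] at h1
    refine ⟨?_, ?_⟩
    · exact ((hd.deriv hG).continuousOn.norm.pow 2).aestronglyMeasurable hG.measurableSet
    · rw [hasFiniteIntegral_iff_ofReal (Eventually.of_forall fun z => by positivity), h1, h.bijOn.image_eq]
      exact measure_ball_lt_top

lemma lens_end {η : ℝ} (hη : η ≤ 1) {w : ℂ} (hw : w ∈ lens η) : (0 < w.re * (1 - w.re) ∧ w.re * (1 - w.re) ≤ 1) ∧
    (∀ e : ℂ, (e = 0 ∨ e = 1) → w.re * (1 - w.re) ≤ ‖w - e‖) ∧ ∃ e : ℂ, (e = 0 ∨ e = 1) ∧ ‖w - e‖ ≤ 4 * (w.re * (1 - w.re)) := by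
  obtain ⟨h1, h2, h3⟩ := hw
  have hd : 0 < w.re * (1 - w.re) := by nlinarith
  refine ⟨⟨hd, by nlinarith⟩, ?_, ?_⟩
  · rintro e (rfl | rfl)
    · rw [sub_zero]; nlinarith [Complex.re_le_norm w]
    · have := Complex.abs_re_le_norm (w - 1)
      rw [sub_re, one_re, abs_sub_comm, abs_of_pos (by linarith)] at this
      nlinarith
  · rcases le_total w.re (1/2) with h | h
    · refine ⟨0, Or.inl rfl, ?_⟩
      have := Complex.norm_le_abs_re_add_abs_im w
      rw [abs_of_pos h1] at this
      rw [sub_zero]; nlinarith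
    · refine ⟨1, Or.inr rfl, ?_⟩
      have := Complex.norm_le_abs_re_add_abs_im (w - 1)
      rw [sub_re, one_re, abs_sub_comm, abs_of_pos (by linarith), sub_im, one_im, sub_zero] at this
      nlinarith

lemma LArc.endmem {e : ℂ} (he : e = 0 ∨ e = 1) (η : ℝ) : e ∈ lens η ∪ Complex.ofReal '' Icc (0 : ℝ) 1 := by
  rcases he with rfl | rfl
  · exact Or.inr ⟨0, by simp, by simp⟩
  · exact Or.inr ⟨1, by simp, by simp⟩

lemma LArc.inv {G O F : Set ℂ} {lam η : ℝ} {T : ℂ → ℂ} {U : Set ℂ} (h : LArc G O F lam T U η) : ∃ S : ℂ → ℂ, ∃ c > 0,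
    (∀ w ∈ lens η, S (T w) = w) ∧ IsOpen (T '' lens η) ∧ ∀ w ∈ lens η, HasDerivAt S (deriv T w)⁻¹ (T w) ∧ ‖(deriv T w)⁻¹‖ ≤ c := by
  obtain ⟨S, h1, h2, h3⟩ := A_inv (lens_open η) (h.arc.diff.mono h.sub) (h.arc.inj.mono h.sub)
  obtain ⟨c, hc, _, _, hb⟩ := h.bil
  refine ⟨S, c⁻¹, by positivity, h1, h2, fun w hw => ⟨h3 w hw, (h3 w hw).le_of_lip' (by positivity) ?_⟩⟩
  filter_upwards [h2.mem_nhds ⟨w, hw, rfl⟩]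
  rintro _ ⟨w', hw', rfl⟩
  rw [h1 w hw, h1 w' hw', ← div_eq_inv_mul, le_div_iff₀ hc, mul_comm]
  exact (hb w' (Or.inl hw') w (Or.inl hw)).1

lemma K_far {G F : Set ℂ} (hb : Bornology.IsBounded G) (hG : IsOpen G) (hFG : F ⊆ G) {d : ℝ} (hd : 0 < d) : ∃ M > 0, ∀ ζ ∈ F, ∀ φ,
    ConformalOnto G φ ζ → ∀ z ∈ G, d ≤ ‖z - ζ‖ → Real.exp (-M) ≤ ‖φ z‖ := by
  obtain ⟨R, hR0, hR⟩ := hb.subset_closedBall_lt 0 (0:ℂ)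
  refine ⟨|Real.log (d / (3 * R))| + 1, by positivity, fun ζ hζ φ hφ z hz hdz => ?_⟩
  have hR' : ∀ z ∈ G, ‖z‖ ≤ R := fun z hz => by simpa using hR hz
  have := (K_phi hG (hFG hζ) hφ).2.1 (3 * R) (fun z hz => by
    have := norm_sub_le z ζ; have := hR' z hz; have := hR' ζ (hFG hζ); linarith) z hz
  calc _ ≤ Real.exp (Real.log (d / (3 * R))) := Real.exp_le_exp.2 (by linarith [neg_abs_le (Real.log (d / (3 * R)))])
    _ = d / (3 * R) := Real.exp_log (by positivity)
    _ ≤ _ := by rw [div_le_iff₀ (by positivity)]; linarith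

lemma K_corner {G O F : Set ℂ} (hb : Bornology.IsBounded G) (hG : IsOpen G) (hF : IsCompact F) (hFG : F ⊆ G) (hO : O ⊆ (closure G)ᶜ) {lam η : ℝ}
    (hlam : 0 < lam) {T : ℂ → ℂ} {e : ℂ} (hz : T e ∈ frontier G) {ext A c ρ : ℝ} (h : LEnd O lam T η e ext A c ρ) :
    ∃ C > 0, ∃ r > 0, ∀ ζ ∈ F, ∀ φ, ConformalOnto G φ ζ → ∀ z ∈ G, ‖z - T e‖ < r → -Real.log ‖φ z‖ ≤ C * ‖z - T e‖ ^ (1 / (2 - lam)) := by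
  have hzG : T e ∉ G := fun h => by rw [frontier, hG.interior_eq] at hz; exact hz.2 h
  obtain ⟨r, hr, hrF⟩ := Metric.isOpen_iff.1 hF.isClosed.isOpen_compl (T e) fun h => hzG (hFG h)
  obtain ⟨M, hM, hfar⟩ := K_far hb hG hFG (d := r / 2) (by positivity)
  have h1 := h.lam_le
  have h2 := h.lt_two
  have hρ := h.ρ_pos
  obtain ⟨C, hC, r', hr', hc⟩ := A_corner_int (α := 2 - ext) (ρ := min ρ (r / 2)) (c := c) (by linarith) (by linarith) h.A_pos (by positivity) hG hzG
    (fun w hw1 hw2 hw3 => hO (h.out w (hw1.trans_le (min_le_left _ _)) (by rwa [sub_sub_cancel] at hw2)) (subset_closure hw3)) M hM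
  refine ⟨C, hC, min r' 1, by positivity, fun ζ hζ φ hφ z hz hzr => ?_⟩
  refine (hc φ (fun z hz => (hφ.differentiable z hz).differentiableWithinAt) (K_phi hG (hFG hζ) hφ).1 (fun z hz => ?_) z
    ⟨hz, by rw [mem_ball, dist_eq_norm]; exact hzr.trans_le (min_le_left _ _)⟩).trans ?_
  · refine hfar ζ hζ φ hφ z hz.1 ?_
    have h3 : r ≤ dist ζ (T e) := not_lt.1 fun h => hrF h hζ
    have h4 := (mem_ball.1 hz.2).trans_le (min_le_right _ _)
    have := dist_triangle ζ z (T e)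
    rw [← dist_eq_norm, dist_comm]; linarith
  · refine mul_le_mul_of_nonneg_left (Real.rpow_le_rpow_of_exponent_ge ?_ (hzr.le.trans (min_le_right _ _)) ?_) hC.le
    · rw [norm_pos_iff, sub_ne_zero]; rintro rfl; exact hzG hz
    · exact one_div_le_one_div_of_le (by linarith) (by linarith)

lemma K_u {G O F : Set ℂ} (hb : Bornology.IsBounded G) (hG : IsOpen G) (hF : IsCompact F) (hFG : F ⊆ G) (hO : O ⊆ (closure G)ᶜ) {lam η : ℝ}
    (hlam : 0 < lam) (hlam2 : lam < 2) {T : ℂ → ℂ} {U : Set ℂ} (h : LArc G O F lam T U η) : ∃ C > 0, ∀ ζ ∈ F, ∀ φ, ConformalOnto G φ ζ →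
    ∀ w ∈ lens η, 0 < w.im → -Real.log ‖φ (T w)‖ ≤ C * (w.re * (1 - w.re)) ^ (1 / (2 - lam)) := by
  set κ := 1 / (2 - lam)
  have hκ : 0 < κ := one_div_pos.2 (by linarith)
  obtain ⟨d, hd, hfar⟩ := h.far
  obtain ⟨M, hM, hfar'⟩ := K_far hb hG hFG hd
  obtain ⟨_, -, C, hC, hbil⟩ := h.bil
  have key : ∀ e : ℂ, (e = 0 ∨ e = 1) → ∃ C > 0, ∃ r > 0, ∀ ζ ∈ F, ∀ φ, ConformalOnto G φ ζ → ∀ z ∈ G, ‖z - T e‖ < r →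
      -Real.log ‖φ z‖ ≤ C * ‖z - T e‖ ^ κ := by
    rintro e (rfl | rfl)
    · obtain ⟨_, _, _, _, hE⟩ := h.e0
      exact K_corner hb hG hF hFG hO hlam (by simpa using h.bd 0 (by simp)) hE
    · obtain ⟨_, _, _, _, hE⟩ := h.e1
      exact K_corner hb hG hF hFG hO hlam (by simpa using h.bd 1 (by simp)) hE
  obtain ⟨C0, hC0, r0, hr0, h0⟩ := key 0 (Or.inl rfl)
  obtain ⟨C1, hC1, r1, hr1, h1⟩ := key 1 (Or.inr rfl)
  set r := min r0 r1 / (4 * C)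
  have hr : 0 < r := by positivity
  refine ⟨(C0 + C1) * (4 * C) ^ κ + M * r⁻¹ ^ κ, by positivity, fun ζ hζ φ hφ w hw hw0 => ?_⟩
  obtain ⟨⟨hd0, -⟩, -, e, he, hed⟩ := lens_end h.η_le hw
  set δ := w.re * (1 - w.re)
  have hG' := h.up w hw hw0
  rw [add_mul]
  rcases lt_or_ge δ r with hδ | hδ
  · have hTe : ‖T w - T e‖ ≤ 4 * C * δ := ((hbil w (Or.inl hw) e (LArc.endmem he η)).2).trans (by nlinarith)
    have hlt : ‖T w - T e‖ < min r0 r1 := by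
      rw [lt_div_iff₀ (by positivity)] at hδ; linarith
    have h3 : -Real.log ‖φ (T w)‖ ≤ (C0 + C1) * ‖T w - T e‖ ^ κ := by
      rcases he with rfl | rfl
      · refine (h0 ζ hζ φ hφ _ hG' (hlt.trans_le (min_le_left _ _))).trans ?_
        gcongr; linarith
      · refine (h1 ζ hζ φ hφ _ hG' (hlt.trans_le (min_le_right _ _))).trans ?_
        gcongr; linarith
    have h4 : ‖T w - T e‖ ^ κ ≤ (4 * C) ^ κ * δ ^ κ := by
      rw [← Real.mul_rpow (by positivity) hd0.le]
      exact Real.rpow_le_rpow (norm_nonneg _) hTe hκ.le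
    have : 0 ≤ M * r⁻¹ ^ κ * δ ^ κ := by positivity
    nlinarith [mul_le_mul_of_nonneg_left h4 (add_pos hC0 hC1).le]
  · have h3 : -Real.log ‖φ (T w)‖ ≤ M := by
      rw [neg_le]
      exact (Real.le_log_iff_exp_le ((Real.exp_pos _).trans_le (hfar' ζ hζ φ hφ _ hG' (hfar w hw ζ hζ)))).2 (hfar' ζ hζ φ hφ _ hG' (hfar w hw ζ hζ))
    have h4 : 1 ≤ r⁻¹ ^ κ * δ ^ κ := by
      rw [← Real.mul_rpow (by positivity) hd0.le]
      exact Real.one_le_rpow (by rw [← div_eq_inv_mul, one_le_div hr]; exact hδ) hκ.le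
    have : 0 ≤ (C0 + C1) * (4 * C) ^ κ * δ ^ κ := by positivity
    nlinarith

lemma lens_convex {η : ℝ} (hη : 0 ≤ η) : Convex ℝ (lens η) := by
  rintro z ⟨z1, z2, z3⟩ w ⟨w1, w2, w3⟩ a b ha hb hab
  rw [abs_lt] at z3 w3
  have hA : a * z.re + b * w.re = 1 - (a * (1 - z.re) + b * (1 - w.re)) := by linear_combination hab
  have key : a * (z.re * (1 - z.re)) + b * (w.re * (1 - w.re)) ≤ (a * z.re + b * w.re) * (1 - (a * z.re + b * w.re)) := by
    obtain rfl : b = 1 - a := by linarith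
    nlinarith [mul_nonneg (mul_nonneg ha hb) (sq_nonneg (z.re - w.re))]
  have hp : ∀ x y : ℝ, 0 < x → 0 < y → 0 < a * x + b * y := fun x y hx hy => by
    rcases ha.eq_or_lt with h | h
    · subst h; have : b = 1 := by linarith
      subst this; linarith
    · have := mul_pos h hx; have := mul_nonneg hb hy.le; linarith
  simp only [lens, mem_ofPred_eq, add_re, real_smul, mul_re, ofReal_re, ofReal_im, zero_mul, sub_zero, add_im, mul_im, add_zero]
  refine ⟨hp _ _ z1 w1, ?_, ?_⟩
  · linarith [hp (1 - z.re) (1 - w.re) (by linarith) (by linarith)]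
  · have hk := mul_le_mul_of_nonneg_left key hη
    rw [abs_lt]
    constructor
    · linarith [hp (z.im + η * (z.re * (1 - z.re))) (w.im + η * (w.re * (1 - w.re))) (by linarith) (by linarith)]
    · linarith [hp (η * (z.re * (1 - z.re)) - z.im) (η * (w.re * (1 - w.re)) - w.im) (by linarith) (by linarith)]

lemma lens_conj {η : ℝ} {w : ℂ} (h : w ∈ lens η) : (starRingEnd ℂ) w ∈ lens η := by
  simpa [lens] using h

lemma lens_ball {η : ℝ} (hη : 0 < η) (hη1 : η ≤ 1) {w z : ℂ} (hw : w ∈ lens (η / 2)) (hz : z ∈ ball w (η * (w.re * (1 - w.re)) / 8)) :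
    z ∈ lens η ∧ z.re * (1 - z.re) ≤ 2 * (w.re * (1 - w.re)) := by
  obtain ⟨h1, h2, h3⟩ := hw
  have hd : 0 < w.re * (1 - w.re) := by nlinarith
  set d := w.re * (1 - w.re) with hdd
  rw [mem_ball, dist_eq_norm] at hz
  have hr := (Complex.abs_re_le_norm (z - w)).trans_lt hz
  have hi := (Complex.abs_im_le_norm (z - w)).trans_lt hz
  rw [sub_re, abs_lt] at hr
  rw [sub_im, abs_lt] at hi
  rw [abs_lt] at h3
  have hηd : η * d ≤ d := by nlinarith
  have hx : |z.re * (1 - z.re) - d| ≤ d / 8 := by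
    rw [show z.re * (1 - z.re) - d = (z.re - w.re) * (1 - w.re - z.re) by rw [hdd]; ring, abs_mul]
    have e1 : |z.re - w.re| ≤ d / 8 := abs_le.2 ⟨by linarith, by linarith⟩
    have e2 : |1 - w.re - z.re| ≤ 1 := abs_le.2 ⟨by nlinarith, by nlinarith⟩
    nlinarith [abs_nonneg (z.re - w.re), abs_nonneg (1 - w.re - z.re)]
  rw [abs_le] at hx
  have hη' := mul_le_mul_of_nonneg_left hx.1 hη.le
  refine ⟨⟨by nlinarith, by nlinarith, ?_⟩, by linarith⟩
  rw [abs_lt]; constructor <;> nlinarith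

lemma K_s {G O F : Set ℂ} (hb : Bornology.IsBounded G) (hG : IsOpen G) (hF : IsCompact F) (hFG : F ⊆ G) (hO : O ⊆ (closure G)ᶜ) {lam η : ℝ}
    (hlam : 0 < lam) (hlam2 : lam < 2) {T : ℂ → ℂ} {U : Set ℂ} (h : LArc G O F lam T U η) : ∃ C > 0, ∀ ζ ∈ F, ∀ φ g, ConformalOnto G φ ζ →
    DifferentiableOn ℂ g G → (∀ z ∈ G, g z ^ 2 = deriv φ z) → ∃ s, DifferentiableOn ℂ s (lens η) ∧ (∀ w ∈ lens η, 0 < w.im → s w = g (T w)) ∧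
      ∀ w ∈ lens (η / 2), ‖s w‖ ≤ C * (w.re * (1 - w.re)) ^ ((1 / (2 - lam) - 1) / 2) := by
  obtain ⟨C, hC, hu⟩ := K_u hb hG hF hFG hO hlam hlam2 h
  set κ := 1 / (2 - lam)
  have hκ : 0 < κ := one_div_pos.2 (by linarith)
  have hη := h.η_pos
  have hη1 := h.η_le
  obtain ⟨S, c, hc, -, -, hS⟩ := h.inv
  obtain ⟨d0, hd0, hfar⟩ := h.far
  have hTd : DifferentiableOn ℂ T (lens η) := h.arc.diff.mono h.sub
  set B := c * (2 * (2 * (C * 2 ^ κ)) / (η / 8) * Real.exp C)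
  have hB : 0 < B := by positivity
  refine ⟨Real.sqrt B, Real.sqrt_pos.2 hB, fun ζ hζ φ g hφ hg hgφ => ?_⟩
  have hup : MapsTo T (lens η ∩ {w | 0 < w.im}) G := fun w hw => h.up w hw.1 hw.2
  have hφd : DifferentiableOn ℂ φ G := fun z hz => (hφ.differentiable z hz).differentiableWithinAt
  have hφ1 : ∀ z ∈ G, ‖φ z‖ < 1 := fun z hz => by simpa using hφ.bijOn.mapsTo hz
  obtain ⟨s, fl, s1, s2, s3, s4, s5, s6⟩ := A_ext (lens_open η) (lens_convex hη.le) ⟨⟨1/2, η / 8⟩, by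
      refine ⟨⟨by norm_num, by norm_num, ?_⟩, by change 0 < η / 8; positivity⟩
      simp only
      rw [abs_of_pos (by positivity)]; linarith⟩ (fun w hw => lens_conj hw) hTd
    (fun w hw => A_deriv_ne_zero h.arc.opn h.arc.diff h.arc.inj (h.sub hw))
    (F := fun w => φ (T w)) (r := fun w => g (T w)) (hφd.comp (hTd.mono inter_subset_left) hup)
    (hφ.bijOn.injOn.comp (h.arc.inj.mono (inter_subset_left.trans h.sub)) hup)
    (fun w hw => ⟨fun h0 => by
      have := hφ.bijOn.injOn (hup hw) (hFG hζ) (h0.trans hφ.map_center.symm)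
      have h3 := hfar w hw.1 ζ hζ
      rw [this, sub_self, norm_zero] at h3; linarith, hφ1 _ (hup hw)⟩)
    (fun p hp hp0 => ((K_phi hG (hFG hζ) hφ).1 (T p) (by
      have : p = (p.re : ℂ) := by apply Complex.ext <;> simp [hp0]
      rw [this]; exact h.bd _ ⟨hp.1.le, hp.2.1.le⟩)).comp (tendsto_nhdsWithin_of_tendsto_nhds_of_eventually_within _
        ((hTd.continuousOn.continuousWithinAt hp).mono inter_subset_left) (by filter_upwards [self_mem_nhdsWithin] with w hw using hup hw)))
    (hg.continuousOn.comp (hTd.continuousOn.mono inter_subset_left) hup)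
    (fun w hw => by
      have e1 := (hφ.differentiable _ (hup hw)).hasDerivAt.comp w (hTd.differentiableAt ((lens_open η).mem_nhds hw.1)).hasDerivAt
      rw [hgφ _ (hup hw)]; exact e1.deriv.symm)
  refine ⟨s, s1, s3, fun w hw => ?_⟩
  have hwl : w ∈ lens η := lens_mono (by linarith) hw
  obtain ⟨⟨hd, hd1⟩, -⟩ := lens_end hη1 hwl
  set d := w.re * (1 - w.re) with hdd
  have hfl : ∀ z ∈ lens η, |(fl z).im| ≤ C * (z.re * (1 - z.re)) ^ κ := by
    have hpos : ∀ z ∈ lens η, 0 < z.im → |(fl z).im| ≤ C * (z.re * (1 - z.re)) ^ κ := fun z hz hz0 => by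
      rw [s4 z hz hz0, abs_of_nonneg]
      · exact hu ζ hζ φ hφ z hz hz0
      · exact neg_nonneg.2 (Real.log_nonpos (norm_nonneg _) (hφ1 _ (h.up z hz hz0)).le)
    intro z hz
    rcases lt_trichotomy z.im 0 with h0 | h0 | h0
    · have := hpos _ (lens_conj hz) (by simpa using h0)
      rw [s5 z hz] at this; simpa using this
    · have h1 := s5 z hz
      rw [Complex.conj_eq_iff_im.2 h0] at h1
      have : (fl z).im = 0 := Complex.conj_eq_iff_im.1 h1.symm
      obtain ⟨⟨h2, -⟩, -⟩ := lens_end hη1 hz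
      rw [this, abs_zero]; positivity
    · exact hpos z hz h0
  have hflw := hfl w hwl
  have hd2 : d ^ κ ≤ 2 ^ κ * d ^ κ := le_mul_of_one_le_left (by positivity) (Real.one_le_rpow one_le_two hκ.le)
  have h1 := A_deriv_bound (R := η * d / 8) (M := 2 * (C * 2 ^ κ * d ^ κ)) (f := fl) (w := w) (by positivity) (by positivity)
    (s2.mono fun z hz => (lens_ball hη hη1 hw hz).1) (fun z hz => by
      obtain ⟨hz1, hz2⟩ := lens_ball hη hη1 hw hz
      have e1 := hfl z hz1
      obtain ⟨⟨hz3, -⟩, -⟩ := lens_end hη1 hz1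
      have e2 : (z.re * (1 - z.re)) ^ κ ≤ 2 ^ κ * d ^ κ := by
        rw [← Real.mul_rpow (by norm_num) hd.le]; exact Real.rpow_le_rpow hz3.le hz2 hκ.le
      have := mul_le_mul_of_nonneg_left e2 hC.le
      have := mul_le_mul_of_nonneg_left hd2 hC.le
      have := neg_abs_le (fl z).im
      have := le_abs_self (fl w).im
      linarith)
  have h2 : Real.exp (-(fl w).im) ≤ Real.exp C := by
    apply Real.exp_le_exp.2
    have : C * d ^ κ ≤ C * 1 := by gcongr; exact Real.rpow_le_one hd.le hd1 hκ.le
    linarith [neg_abs_le (fl w).im]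
  have hT0 := A_deriv_ne_zero h.arc.opn h.arc.diff h.arc.inj (h.sub hwl)
  have h3 : ‖s w‖ ^ 2 ≤ B * d ^ (κ - 1) := by
    calc ‖s w‖ ^ 2 = ‖(deriv T w)⁻¹‖ * (‖s w‖ ^ 2 * ‖deriv T w‖) := by
          rw [norm_inv]; field_simp [norm_ne_zero_iff.2 hT0]
      _ ≤ c * (2 * (2 * (C * 2 ^ κ * d ^ κ)) / (η * d / 8) * Real.exp C) := by
          rw [s6 w hwl]; gcongr; exact (hS w hwl).2
      _ = B * d ^ (κ - 1) := by
          rw [Real.rpow_sub_one hd.ne']; simp only [B]; field_simp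
  refine (abs_le_of_sq_le_sq' ?_ (by positivity)).2
  rw [mul_pow, Real.sq_sqrt hB.le, ← Real.rpow_natCast (d ^ _), ← Real.rpow_mul hd.le]
  rwa [show (κ - 1) / 2 * ((2:ℕ):ℝ) = κ - 1 by push_cast; ring]

lemma Q_bump : ∃ b : ℂ → ℂ, ∃ K > 0, ContDiff ℝ 1 b ∧ (∀ w, ‖w‖ ≤ 1 → b w = 1) ∧ (∀ w, 2 ≤ ‖w‖ → b w = 0) ∧ (∀ w, ‖b w‖ ≤ 1) ∧
    ∀ w, ‖fderiv ℝ b w‖ ≤ K := by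
  obtain ⟨χ, h1, h2⟩ : ∃ χ : ContDiffBump (0:ℂ), χ.rIn = 1 ∧ χ.rOut = 2 := ⟨⟨1, 2, by norm_num, by norm_num⟩, rfl, rfl⟩
  have hc : ContDiff ℝ 1 (fun w => ((χ w : ℝ) : ℂ)) := ofRealCLM.contDiff.comp χ.contDiff
  have hs : HasCompactSupport (fun w => ((χ w : ℝ) : ℂ)) := χ.hasCompactSupport.comp_left (g := ofReal) ofReal_zero
  obtain ⟨K, hK⟩ := (hc.continuous_fderiv one_ne_zero).bounded_above_of_compact_support (hs.fderiv (𝕜 := ℝ))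
  refine ⟨fun w => ((χ w : ℝ) : ℂ), |K| + 1, by positivity, hc, fun w hw => ?_, fun w hw => ?_, fun w => ?_, fun w => (hK w).trans (by linarith [le_abs_self K])⟩
  · simp only [χ.one_of_mem_closedBall (by simpa [h1] using hw), ofReal_one]
  · simp only [χ.zero_of_le_dist (by simpa [h2] using hw), ofReal_zero]
  · rw [norm_real, Real.norm_of_nonneg χ.nonneg]; exact χ.le_one

lemma dbar_le (f : ℂ → ℂ) (z : ℂ) : ‖dbar f z‖ ≤ ‖fderiv ℝ f z‖ := by
  rw [dbar, norm_div]
  have h1 := (fderiv ℝ f z).le_opNorm 1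
  have h2 := (fderiv ℝ f z).le_opNorm I
  have h3 := norm_add_le (fderiv ℝ f z 1) (I * fderiv ℝ f z I)
  rw [norm_mul, norm_I] at h3
  rw [norm_I] at h2; rw [norm_one] at h1
  rw [Complex.norm_ofNat, div_le_iff₀ (by norm_num)]; linarith

lemma dbar_mul {f g : ℂ → ℂ} {z : ℂ} (hf : DifferentiableAt ℝ f z) (hg : DifferentiableAt ℝ g z) :
    dbar (fun w => f w * g w) z = f z * dbar g z + g z * dbar f z := by
  simp only [dbar, fderiv_fun_mul hf hg, add_apply, smul_apply, smul_eq_mul]; ring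

lemma dbar_congr {f g : ℂ → ℂ} {z : ℂ} (h : f =ᶠ[nhds z] g) : dbar f z = dbar g z := by
  simp only [dbar, h.fderiv_eq]

lemma Q_pompeiu {Z : Finset ℂ} {f : ℂ → ℂ} (hf : ∀ w ∉ Z, ContDiffAt ℝ 1 f w) (hs : HasCompactSupport f)
    (h4 : ∀ z0 ∈ Z, Integrable (fun w => ‖f w‖ / ‖w - z0‖)) {z : ℂ} (hz : z ∉ Z) (hi : Integrable (fun w => dbar f w / (w - z))) :
    ∫ w, dbar f w / (w - z) = -(Real.pi : ℂ) * f z := by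
  obtain ⟨b, K, hK, hb, hb1, hb2, hb3, hb4⟩ := Q_bump
  set q : ℂ → ℕ → ℂ → ℂ := fun z0 n w => b ((n:ℝ) • (w - z0)) with hq
  set P : ℕ → ℂ → ℂ := fun n w => 1 - ∑ z0 ∈ Z, q z0 n w with hP
  have hqc : ∀ z0 n, ContDiff ℝ 1 (q z0 n) := fun z0 n => hb.comp (by fun_prop : ContDiff ℝ 1 fun w : ℂ => (n:ℝ) • (w - z0))
  have hPc : ∀ n, ContDiff ℝ 1 (P n) := fun n => contDiff_const.sub (ContDiff.sum fun z0 _ => hqc z0 n)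
  have hnorm : ∀ (n : ℕ) (w : ℂ), ‖(n:ℝ) • w‖ = n * ‖w‖ := fun n w => by rw [norm_smul, Real.norm_of_nonneg (Nat.cast_nonneg n)]
  have hev : ∀ w : ℂ, ∀ᶠ n : ℕ in atTop, ∀ z0 ∈ Z, w ≠ z0 → 4 < n * ‖w - z0‖ := fun w => by
    rw [Filter.eventually_all_finset]
    intro z0 _
    by_cases h : w = z0
    · exact Eventually.of_forall fun n h' => absurd h h'
    · filter_upwards [(tendsto_natCast_atTop_atTop (R := ℝ)).atTop_mul_const (norm_pos_iff.2 (sub_ne_zero.2 h)) |>.eventually_gt_atTop 4] with n hn _ using hn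
  have hq0 : ∀ (w z0 : ℂ) (n : ℕ), 4 < n * ‖w - z0‖ → ∀ᶠ y in nhds w, q z0 n y = 0 := fun w z0 n h => by
    have : ContinuousAt (fun y : ℂ => n * ‖y - z0‖) w := by fun_prop
    filter_upwards [this.eventually_const_lt h] with y hy
    exact hb2 _ (by rw [hnorm]; linarith)
  have hP1 : ∀ w ∉ Z, ∀ᶠ n in atTop, P n =ᶠ[nhds w] fun _ => 1 := fun w hw => by
    filter_upwards [hev w] with n hn
    have : ∀ᶠ y in nhds w, ∀ z0 ∈ Z, q z0 n y = 0 := by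
      rw [Filter.eventually_all_finset]
      exact fun z0 h0 => hq0 w z0 n (hn z0 h0 fun h => hw (h ▸ h0))
    filter_upwards [this] with y hy
    simp only [hP, Finset.sum_eq_zero hy, sub_zero]
  have hC : ∀ᶠ n in atTop, ContDiff ℝ 1 (fun w => f w * P n w) := by
    have : ∀ᶠ n : ℕ in atTop, ∀ z0 ∈ Z, ∀ z1 ∈ Z, z0 ≠ z1 → 4 < n * ‖z0 - z1‖ := by
      rw [Filter.eventually_all_finset]; exact fun z0 _ => hev z0
    filter_upwards [this, eventually_gt_atTop 0] with n hn hn0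
    have hn0' : (0:ℝ) < n := Nat.cast_pos.2 hn0
    rw [contDiff_iff_contDiffAt]
    intro w
    by_cases hw : w ∈ Z
    · have h1 : ∀ᶠ y in nhds w, ∀ z1 ∈ Z.erase w, q z1 n y = 0 := by
        rw [Filter.eventually_all_finset]
        exact fun z1 h1 => hq0 w z1 n (hn w hw z1 (Finset.mem_of_mem_erase h1) (Finset.ne_of_mem_erase h1).symm)
      refine (contDiffAt_const (c := (0:ℂ))).congr_of_eventuallyEq ?_
      filter_upwards [h1, Metric.ball_mem_nhds w (show (0:ℝ) < 1 / n by positivity)] with y hy hy2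
      rw [mem_ball, dist_eq_norm, lt_div_iff₀ hn0'] at hy2
      simp only [hP, ← Finset.add_sum_erase Z _ hw, Finset.sum_eq_zero hy]
      rw [hq]; simp only; rw [hb1 _ (by rw [hnorm]; linarith)]; ring
    · exact (hf w hw).mul (hPc n).contDiffAt
  have hlim : Tendsto (fun n : ℕ => ∫ w, dbar (fun w => f w * P n w) w / (w - z)) atTop (nhds (∫ w, dbar f w / (w - z))) := by
    refine tendsto_integral_filter_of_dominated_convergence (fun w => (1 + Z.card) * ‖dbar f w / (w - z)‖ +
      ∑ z0 ∈ Z, 4 * K / ‖z - z0‖ * (‖f w‖ / ‖w - z0‖)) ?_ ?_ ?_ ?_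
    · filter_upwards [hC] with n hn
      have := hn.continuous_fderiv one_ne_zero
      have h1 : Continuous (dbar fun w => f w * P n w) := by unfold dbar; fun_prop
      exact (h1.measurable.div (by fun_prop)).aestronglyMeasurable
    · filter_upwards [hev z, eventually_gt_atTop 0] with n hn hn0
      have hn0' : (0:ℝ) < n := Nat.cast_pos.2 hn0
      filter_upwards [Z.finite_toSet.countable.ae_notMem volume] with w hw
      rw [dbar_mul ((hf w hw).differentiableAt one_ne_zero) ((hPc n).contDiffAt.differentiableAt one_ne_zero), add_comm, add_div]
      refine (norm_add_le _ _).trans (add_le_add ?_ ?_)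
      · rw [mul_div_assoc, norm_mul]
        gcongr
        refine (norm_sub_le _ _).trans ?_
        rw [norm_one]
        gcongr
        refine (norm_sum_le _ _).trans ((Finset.sum_le_card_nsmul _ _ 1 fun z0 _ => hb3 _).trans ?_)
        simp
      · rw [norm_div, norm_mul]
        have h1 : fderiv ℝ (P n) w = - ∑ z0 ∈ Z, fderiv ℝ (q z0 n) w := by
          simp only [hP]
          rw [fderiv_const_sub, fderiv_fun_sum fun z0 _ => (hqc z0 n).contDiffAt.differentiableAt one_ne_zero]
        have h2 : ‖dbar (P n) w‖ ≤ ∑ z0 ∈ Z, ‖fderiv ℝ (q z0 n) w‖ := by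
          refine (dbar_le _ _).trans ?_
          rw [h1, norm_neg]; exact norm_sum_le _ _
        calc _ ≤ ‖f w‖ * (∑ z0 ∈ Z, ‖fderiv ℝ (q z0 n) w‖) / ‖w - z‖ := by gcongr
          _ = ∑ z0 ∈ Z, ‖f w‖ * (‖fderiv ℝ (q z0 n) w‖ / ‖w - z‖) := by rw [Finset.mul_sum, Finset.sum_div]; simp only [mul_div_assoc]
          _ ≤ _ := Finset.sum_le_sum fun z0 h0 => by
            have hwz : 0 < ‖w - z0‖ := norm_pos_iff.2 (sub_ne_zero.2 fun h => hw (by rw [h]; exact h0))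
            have hzz := hn z0 h0 fun h => hz (by rw [h]; exact h0)
            have hz0 : 0 < ‖z - z0‖ := by by_contra h; nlinarith [norm_nonneg (z - z0)]
            suffices ‖fderiv ℝ (q z0 n) w‖ / ‖w - z‖ ≤ 4 * K / ‖z - z0‖ / ‖w - z0‖ by
              calc _ ≤ ‖f w‖ * (4 * K / ‖z - z0‖ / ‖w - z0‖) := by gcongr
                _ = _ := by ring
            rcases lt_or_ge 2 (n * ‖w - z0‖) with h | h
            · have : q z0 n =ᶠ[nhds w] fun _ => 0 := by
                have hc : ContinuousAt (fun y : ℂ => n * ‖y - z0‖) w := by fun_prop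
                filter_upwards [hc.eventually_const_lt h] with y hy
                exact hb2 _ (by rw [hnorm]; exact hy.le)
              rw [this.fderiv_eq]; simp; positivity
            · have h5 : ‖fderiv ℝ (q z0 n) w‖ ≤ K * n := by
                have h6 : HasFDerivAt (q z0 n) ((fderiv ℝ b ((n:ℝ) • (w - z0))).comp ((n:ℝ) • ContinuousLinearMap.id ℝ ℂ)) w :=
                  (hb.contDiffAt.differentiableAt one_ne_zero).hasFDerivAt.comp w (((hasFDerivAt_id (𝕜 := ℝ) w).sub_const z0).fun_const_smul (n:ℝ))
                rw [h6.fderiv]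
                refine (ContinuousLinearMap.opNorm_comp_le _ _).trans ?_
                gcongr
                · exact hb4 _
                · rw [norm_smul, Real.norm_of_nonneg hn0'.le]; exact mul_le_of_le_one_right hn0'.le ContinuousLinearMap.norm_id_le
              have h7 : ‖z - z0‖ / 2 ≤ ‖w - z‖ := by
                have := norm_sub_le_norm_sub_add_norm_sub z w z0
                rw [norm_sub_rev z w] at this
                nlinarith
              rw [div_div, div_le_div_iff₀ (by linarith) (by positivity)]
              calc _ ≤ K * n * (‖z - z0‖ * ‖w - z0‖) := by gcongr
                _ = K * ‖z - z0‖ * (n * ‖w - z0‖) := by ring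
                _ ≤ K * ‖z - z0‖ * 2 := by gcongr
                _ ≤ _ := by nlinarith
    · exact (hi.norm.const_mul _).add (integrable_finsetSum _ fun z0 h0 => (h4 z0 h0).const_mul _)
    · filter_upwards [Z.finite_toSet.countable.ae_notMem volume] with w hw
      refine tendsto_const_nhds.congr' ?_
      filter_upwards [hP1 w hw] with n hn
      congr 1
      apply dbar_congr
      filter_upwards [hn] with y hy
      rw [hy, mul_one]
  refine tendsto_nhds_unique hlim (tendsto_const_nhds.congr' ?_)
  filter_upwards [hC, hP1 z hz] with n hn hn1
  rw [A_pompeiu hn (hs.mul_right), hn1.self_of_nhds, mul_one]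

lemma LArc.near {G O F : Set ℂ} {lam : ℝ} {T : ℂ → ℂ} {U : Set ℂ} {η : ℝ} (h : LArc G O F lam T U η) :
    ∃ c > 0, ∃ C > 0, ∀ w ∈ lens η, ∀ e : ℂ, (e = 0 ∨ e = 1) → c * (w.re * (1 - w.re)) ≤ ‖T w - T e‖ ∧
      (‖w - e‖ ≤ 4 * (w.re * (1 - w.re)) → ‖T w - T e‖ ≤ C * (w.re * (1 - w.re))) := by
  obtain ⟨c, hc, C, hC, hb⟩ := h.bil
  refine ⟨c, hc, 4 * C, by positivity, fun w hw e he => ?_⟩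
  obtain ⟨h1, h2⟩ := hb w (Or.inl hw) e (LArc.endmem he η)
  exact ⟨(mul_le_mul_of_nonneg_left ((lens_end h.η_le hw).2.1 e he) hc.le).trans h1, fun h3 => by nlinarith⟩

lemma P_q {η : ℝ} {w : ℂ} (hη : 0 < η) (hη1 : η ≤ 1) (hw : w ∈ lens η) :
    ∃ L : ℂ →L[ℝ] ℂ, HasFDerivAt (fun w : ℂ => ((8 / η * (w.im / (w.re * (1 - w.re))) : ℝ) : ℂ)) L w ∧ ‖L‖ ≤ 32 / η / (w.re * (1 - w.re)) := by
  obtain ⟨h0, h1, h2⟩ := hw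
  have hd : 0 < w.re * (1 - w.re) := mul_pos h0 (by linarith)
  have hr := reCLM.hasFDerivAt (x := w)
  have h3 : HasFDerivAt (fun w : ℂ => w.re * (1 - w.re)) ((1 - 2 * w.re) • reCLM) w := by
    refine (hr.mul (hr.const_sub 1)).congr_fderiv ?_
    ext <;> simp <;> ring
  have h4 := ofRealCLM.hasFDerivAt.comp w (((imCLM.hasFDerivAt (x := w)).fun_mul ((hasDerivAt_inv hd.ne').comp_hasFDerivAt w h3)).const_mul (8 / η))
  refine ⟨_, h4, ContinuousLinearMap.opNorm_le_bound _ (by positivity) fun v => ?_⟩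
  simp only [ContinuousLinearMap.comp_apply, ofRealCLM_apply, norm_real, smul_apply, add_apply, smul_eq_mul, reCLM_apply, imCLM_apply, Real.norm_eq_abs]
  have h5 := abs_re_le_norm v
  have h6 := abs_im_le_norm v
  rw [abs_mul, abs_of_pos (by positivity : 0 < 8 / η)]
  set d := w.re * (1 - w.re)
  have h7 : |w.im * (-(d ^ 2)⁻¹ * ((1 - 2 * w.re) * v.re)) + d⁻¹ * v.im| ≤ 2 / d * ‖v‖ := by
    refine (abs_add_le _ _).trans ?_
    rw [abs_mul, abs_mul, abs_mul, abs_mul, abs_neg, abs_of_pos (by positivity : 0 < (d^2)⁻¹), abs_of_pos (by positivity : 0 < d⁻¹)]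
    have h8 : |1 - 2 * w.re| ≤ 1 := abs_le.2 ⟨by linarith, by linarith⟩
    have h9 : |w.im| ≤ d := by nlinarith
    calc _ ≤ d * ((d^2)⁻¹ * (1 * ‖v‖)) + d⁻¹ * ‖v‖ := by gcongr
      _ = _ := by field_simp; ring
  calc _ ≤ 8 / η * (2 / d * ‖v‖) := by gcongr; exact h7
    _ ≤ _ := by rw [← mul_assoc]; gcongr; rw [div_mul_div_comm, div_div]; gcongr; norm_num

lemma dbar_hol {f : ℂ → ℂ} {z : ℂ} (h : DifferentiableAt ℂ f z) : dbar f z = 0 := by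
  have := (fderiv ℂ f z).map_smul I 1
  simp only [smul_eq_mul, mul_one] at this
  rw [dbar, (h.hasFDerivAt.restrictScalars ℝ).fderiv]
  simp only [ContinuousLinearMap.coe_restrictScalars']
  rw [this, ← mul_assoc, I_mul_I]; ring

lemma P_arc {G O F : Set ℂ} {lam : ℝ} {T : ℂ → ℂ} {U : Set ℂ} {η β : ℝ} (h : LArc G O F lam T U η) (hβ : -(1/4) ≤ β) : ∃ K > 0, ∃ P : Set ℂ,
    IsCompact P ∧ P ⊆ T '' lens η ∪ {T 0, T 1} ∧ ∀ (s : ℂ → ℂ) (M : ℝ), 0 ≤ M → DifferentiableOn ℂ s (lens η) →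
    (∀ w ∈ lens (η / 2), ‖s w‖ ≤ M * (w.re * (1 - w.re)) ^ β) → ∃ f : ℂ → ℂ, (∀ z, z ≠ T 0 → z ≠ T 1 → ContDiffAt ℝ 1 f z) ∧
    (∀ z ∉ P, f z = 0) ∧ (∀ w ∈ lens η, |w.im| ≤ η / 8 * (w.re * (1 - w.re)) → f (T w) = s w) ∧
    (∀ z, ‖f z‖ ≤ K * M * (‖z - T 0‖ ^ (-(1/4):ℝ) + ‖z - T 1‖ ^ (-(1/4):ℝ))) ∧
    ∀ z, z ≠ T 0 → z ≠ T 1 → dbar f z ≠ 0 → ∃ w ∈ lens (η / 2), T w = z ∧ η / 8 * (w.re * (1 - w.re)) ≤ |w.im| ∧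
      ‖dbar f z‖ ≤ K * M * (w.re * (1 - w.re)) ^ (β - 1) := by
  obtain ⟨b, B, hB, hb, hb1, hb2, hb3, hb4⟩ := Q_bump
  obtain ⟨S, c1, hc1, hS, hTo, hSd⟩ := h.inv
  obtain ⟨c, hc, C, hC, hn⟩ := h.near
  have hη := h.η_pos
  have hη1 := h.η_le
  set q : ℂ → ℂ := fun w => ((8 / η * (w.im / (w.re * (1 - w.re))) : ℝ) : ℂ) with hq
  have hqn : ∀ w ∈ lens η, ∀ t, ‖q w‖ = 8 / η * (|w.im| / (w.re * (1 - w.re))) ∧ (‖q w‖ ≤ t ↔ |w.im| ≤ η / 8 * t * (w.re * (1 - w.re))) := by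
    intro w hw t
    have hd := (lens_end hη1 hw).1.1
    have : ‖q w‖ = 8 / η * (|w.im| / (w.re * (1 - w.re))) := by
      rw [hq, norm_real, Real.norm_eq_abs, abs_mul, abs_div w.im, abs_of_pos hd, abs_of_pos (by positivity)]
    refine ⟨this, ?_⟩
    rw [this, mul_div_assoc', div_le_iff₀ hd, div_mul_eq_mul_div, div_le_iff₀ hη]
    constructor <;> intro <;> linarith
  set E : Set ℂ := {w | 0 ≤ w.re ∧ w.re ≤ 1 ∧ |w.im| ≤ η / 4 * (w.re * (1 - w.re))} with hE
  have hEs : ∀ w ∈ E, w ∈ lens η ∨ w = 0 ∨ w = 1 := by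
    rintro w ⟨h0, h1, h2⟩
    have hi : w.re * (1 - w.re) = 0 → w.im = 0 := fun h => by rw [h, mul_zero] at h2; exact abs_nonpos_iff.1 h2
    rcases h0.eq_or_lt with h0 | h0
    · exact Or.inr (Or.inl (Complex.ext h0.symm (hi (by rw [← h0]; simp))))
    rcases h1.eq_or_lt with h1 | h1
    · exact Or.inr (Or.inr (Complex.ext h1 (hi (by rw [h1]; simp))))
    have := mul_pos h0 (sub_pos.2 h1)
    exact Or.inl ⟨h0, h1, by nlinarith⟩
  have hEU : E ⊆ U := fun w hw => by
    rcases hEs w hw with h' | rfl | rfl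
    · exact h.sub h'
    · simpa using h.arc.mem (t := 0) (by simp)
    · simpa using h.arc.mem (t := 1) (by simp)
  have hEc : IsCompact E := by
    refine (isCompact_closedBall (0:ℂ) 2).of_isClosed_subset ?_ ?_
    · exact (isClosed_le continuous_const continuous_re).inter ((isClosed_le continuous_re continuous_const).inter
        (isClosed_le (continuous_abs.comp continuous_im) (continuous_const.mul (continuous_re.mul (continuous_const.sub continuous_re)))))
    · rintro w ⟨h0, h1, h2⟩
      rw [mem_closedBall_zero_iff]
      have := norm_le_abs_re_add_abs_im w
      rw [abs_of_nonneg h0] at this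
      have : w.re * (1 - w.re) ≤ 1 := by nlinarith
      nlinarith [mul_nonneg h0 (sub_nonneg.2 h1)]
  refine ⟨B * (32 / η) * c1 + C ^ (1/4:ℝ), by positivity, T '' E, hEc.image_of_continuousOn (h.arc.diff.continuousOn.mono hEU), ?_, ?_⟩
  · rintro _ ⟨w, hw, rfl⟩
    rcases hEs w hw with h' | rfl | rfl
    · exact Or.inl ⟨w, h', rfl⟩
    · simp
    · simp
  intro s M hM hs hsb
  classical
  set f : ℂ → ℂ := fun z => if z ∈ T '' lens η then b (q (S z)) * s (S z) else 0 with hf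
  have hfT : ∀ w ∈ lens η, f (T w) = b (q w) * s w := fun w hw => by
    rw [hf]; simp only; rw [if_pos ⟨w, hw, rfl⟩, hS w hw]
  have hfe : ∀ w ∈ lens η, f =ᶠ[nhds (T w)] fun z => b (q (S z)) * s (S z) := fun w hw => by
    filter_upwards [hTo.mem_nhds ⟨w, hw, rfl⟩] with z hz using if_pos hz
  have hf0 : ∀ z ∉ T '' E, f z = 0 := by
    intro z hz
    by_cases hz' : z ∈ T '' lens η
    · obtain ⟨w, hw, rfl⟩ := hz'
      have hd := (lens_end hη1 hw).1.1
      rw [hfT w hw, hb2, zero_mul]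
      by_contra hlt
      exact hz ⟨w, ⟨hw.1.le, hw.2.1.le, by linarith [((hqn w hw 2).2).1 (not_le.1 hlt).le]⟩, rfl⟩
    · exact if_neg hz'
  have hfoff : ∀ z, z ∉ T '' lens η → z ≠ T 0 → z ≠ T 1 → f =ᶠ[nhds z] fun _ => 0 := by
    intro z hz h0 h1
    have : z ∉ T '' E := by
      rintro ⟨w, hw, rfl⟩
      rcases hEs w hw with h' | rfl | rfl
      · exact hz ⟨w, h', rfl⟩
      · exact h0 rfl
      · exact h1 rfl
    filter_upwards [(hEc.image_of_continuousOn (h.arc.diff.continuousOn.mono hEU)).isClosed.isOpen_compl.mem_nhds this] with y hy using hf0 y hy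
  have hSc : ∀ w ∈ lens η, DifferentiableAt ℂ (fun z => s (S z)) (T w) := fun w hw => by
    have := hs.differentiableAt ((lens_open η).mem_nhds hw)
    rw [← hS w hw] at this
    exact this.comp (T w) (hSd w hw).1.differentiableAt
  have hSD : DifferentiableOn ℂ S (T '' lens η) := by
    rintro _ ⟨w, hw, rfl⟩; exact (hSd w hw).1.differentiableAt.differentiableWithinAt
  have hsD : DifferentiableOn ℂ (fun z => s (S z)) (T '' lens η) := by
    rintro _ ⟨w, hw, rfl⟩; exact (hSc w hw).differentiableWithinAt
  have hlen : ∀ w ∈ lens η, ‖q w‖ ≤ 2 → w ∈ lens (η / 2) := fun w hw h2 => by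
    have hd := (lens_end hη1 hw).1.1
    exact ⟨hw.1, hw.2.1, by nlinarith [((hqn w hw 2).2).1 h2]⟩
  refine ⟨f, ?_, hf0, ?_, ?_, ?_⟩
  · intro z h0 h1
    by_cases hz : z ∈ T '' lens η
    · obtain ⟨w, hw, rfl⟩ := hz
      refine ContDiffAt.congr_of_eventuallyEq ?_ (hfe w hw)
      have hm := hTo.mem_nhds ⟨w, hw, rfl⟩
      refine ContDiffAt.mul ?_ (((hsD.contDiffOn hTo).contDiffAt hm).restrict_scalars ℝ)
      refine (hb.contDiffAt.comp (S (T w)) ?_).comp (T w) (((hSD.contDiffOn hTo).contDiffAt hm).restrict_scalars ℝ)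
      rw [hS w hw]
      refine ofRealCLM.contDiff.contDiffAt.comp w (contDiffAt_const.mul (imCLM.contDiff.contDiffAt.div ?_ (lens_end hη1 hw).1.1.ne'))
      exact reCLM.contDiff.contDiffAt.mul (contDiffAt_const.sub reCLM.contDiff.contDiffAt)
    · exact contDiffAt_const.congr_of_eventuallyEq (hfoff z hz h0 h1)
  · intro w hw h1
    rw [hfT w hw, hb1 _ (((hqn w hw 1).2).2 (by linarith)), one_mul]
  · intro z
    by_cases hz : z ∈ T '' lens η
    · obtain ⟨w, hw, rfl⟩ := hz
      rw [hfT w hw]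
      rcases le_or_gt 2 ‖q w‖ with h2 | h2
      · rw [hb2 _ h2, zero_mul, norm_zero]; positivity
      obtain ⟨⟨hd, hd1⟩, -, e, he, hne⟩ := lens_end hη1 hw
      set d := w.re * (1 - w.re)
      have h3 := (hn w hw e he).2 hne
      have h5 : 0 < ‖T w - T e‖ := (by positivity : 0 < c * d).trans_le (hn w hw e he).1
      have h4 : d ^ β ≤ C ^ (1/4:ℝ) * ‖T w - T e‖ ^ (-(1/4):ℝ) := by
        calc d ^ β ≤ d ^ (-(1/4):ℝ) := Real.rpow_le_rpow_of_exponent_ge hd hd1 hβ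
          _ ≤ (‖T w - T e‖ / C) ^ (-(1/4):ℝ) := Real.rpow_le_rpow_of_nonpos (by positivity) (by rwa [div_le_iff₀' hC]) (by norm_num)
          _ = _ := by rw [Real.div_rpow h5.le hC.le, Real.rpow_neg hC.le, div_inv_eq_mul, mul_comm]
      have h6 : ‖T w - T e‖ ^ (-(1/4):ℝ) ≤ ‖T w - T 0‖ ^ (-(1/4):ℝ) + ‖T w - T 1‖ ^ (-(1/4):ℝ) := by
        rcases he with rfl | rfl
        · exact le_add_of_nonneg_right (by positivity)
        · exact le_add_of_nonneg_left (by positivity)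
      calc _ ≤ 1 * (M * d ^ β) := by rw [norm_mul]; gcongr; exacts [hb3 _, hsb w (hlen w hw h2.le)]
        _ ≤ M * (C ^ (1/4:ℝ) * (‖T w - T 0‖ ^ (-(1/4):ℝ) + ‖T w - T 1‖ ^ (-(1/4):ℝ))) := by
            rw [one_mul]; gcongr; exact h4.trans (by gcongr)
        _ ≤ _ := by rw [← mul_assoc, mul_comm M]; gcongr; exact le_add_of_nonneg_left (by positivity)
    · rw [hf]; simp only; rw [if_neg hz, norm_zero]; positivity
  · intro z h0 h1 hne
    by_cases hz : z ∈ T '' lens η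
    swap
    · exact absurd (by rw [dbar_congr (hfoff z hz h0 h1), dbar]; simp) hne
    obtain ⟨w, hw, rfl⟩ := hz
    have hd := (lens_end hη1 hw).1.1
    obtain ⟨L, hL, hLb⟩ := P_q hη hη1 hw
    rw [← hS w hw] at hL
    have h2 := ((hb.contDiffAt.differentiableAt one_ne_zero).hasFDerivAt.comp _ hL).comp (T w) ((hSd w hw).1.hasFDerivAt.restrictScalars ℝ)
    rw [hS w hw] at h2
    change HasFDerivAt (fun z => b (q (S z))) ((fderiv ℝ b (q w) ∘SL L) ∘SL _) (T w) at h2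
    have h4 : dbar f (T w) = s w * dbar (fun z => b (q (S z))) (T w) := by
      rw [dbar_congr (hfe w hw), dbar_mul h2.differentiableAt ((hSc w hw).restrictScalars ℝ), dbar_hol (hSc w hw), hS w hw, mul_zero, zero_add]
    have h5 : 1 ≤ ‖q w‖ ∧ ‖q w‖ ≤ 2 := by
      by_contra hcon
      apply hne
      have hz : fderiv ℝ b (q w) = 0 := by
        rw [not_and_or, not_le, not_le] at hcon
        rcases hcon with hc | hc
        · have : b =ᶠ[nhds (q w)] fun _ => 1 := by
            filter_upwards [continuous_norm.continuousAt.eventually_lt_const hc] with y hy using hb1 y hy.le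
          rw [this.fderiv_eq]; simp
        · have : b =ᶠ[nhds (q w)] fun _ => 0 := by
            filter_upwards [continuous_norm.continuousAt.eventually_const_lt hc] with y hy using hb2 y hy.le
          rw [this.fderiv_eq]; simp
      have h6 := h2.fderiv
      rw [hz] at h6
      have h7 : fderiv ℝ (fun z => b (q (S z))) (T w) = 0 := h6.trans (by ext <;> simp)
      rw [h4, dbar, h7]; simp
    refine ⟨w, hlen w hw h5.2, rfl, ?_, ?_⟩
    · by_contra hlt
      have := (hqn w hw 1).1
      rw [this, mul_div_assoc', le_div_iff₀ hd, div_mul_eq_mul_div, le_div_iff₀ hη] at h5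
      nlinarith [h5.1]
    · rw [h4, norm_mul, Real.rpow_sub_one hd.ne']
      have h6 : ‖dbar (fun z => b (q (S z))) (T w)‖ ≤ B * (32 / η / (w.re * (1 - w.re))) * c1 := by
        refine (dbar_le _ _).trans ?_
        have h7 : fderiv ℝ (fun z => b (q (S z))) (T w) = _ := h2.fderiv
        rw [h7]
        refine (ContinuousLinearMap.opNorm_comp_le _ _).trans ?_
        gcongr
        · refine (ContinuousLinearMap.opNorm_comp_le _ _).trans ?_
          gcongr; exact hb4 _
        · refine le_trans (le_of_eq ?_) (hSd w hw).2
          simp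
      calc _ ≤ M * (w.re * (1 - w.re)) ^ β * (B * (32 / η / (w.re * (1 - w.re))) * c1) := by gcongr; exact hsb w (hlen w hw h5.2)
        _ = B * (32 / η) * c1 * M * ((w.re * (1 - w.re)) ^ β / (w.re * (1 - w.re))) := by field_simp
        _ ≤ _ := by gcongr; exact le_add_of_nonneg_right (by positivity)

lemma P_div {t r : ℝ} (hr : 0 < r) (u : ℝ) (hu : 0 < u) : t ≤ u ^ (-(1/4):ℝ) → 0 ≤ t → t / r ≤ u ^ (-(5/4):ℝ) + r ^ (-(5/4):ℝ) := by
  intro ht h0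
  rw [div_eq_mul_inv, ← Real.rpow_neg_one]
  rcases le_total u r with h | h
  · refine le_trans ?_ (le_add_of_nonneg_right (by positivity))
    calc _ ≤ u ^ (-(1/4):ℝ) * u ^ (-1:ℝ) := by gcongr ?_ * ?_; exact Real.rpow_le_rpow_of_nonpos hu h (by norm_num)
      _ = _ := by rw [← Real.rpow_add hu]; norm_num
  · refine le_trans ?_ (le_add_of_nonneg_left (by positivity))
    calc _ ≤ r ^ (-(1/4):ℝ) * r ^ (-1:ℝ) := by gcongr; exact ht.trans (Real.rpow_le_rpow_of_nonpos hr h (by norm_num))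
      _ = _ := by rw [← Real.rpow_add hr]; norm_num

lemma P_div4 {t r : ℝ} (hr : 0 < r) (ht : 0 ≤ t) : t / r ≤ t ^ 4 + r ^ (-(4/3):ℝ) := by
  rw [div_eq_mul_inv, ← Real.rpow_neg_one]
  rcases le_total t (r ^ (-(1/3):ℝ)) with h | h
  · refine le_trans ?_ (le_add_of_nonneg_left (by positivity))
    calc _ ≤ r ^ (-(1/3):ℝ) * r ^ (-1:ℝ) := by gcongr
      _ = _ := by rw [← Real.rpow_add hr]; norm_num
  · refine le_trans ?_ (le_add_of_nonneg_right (by positivity))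
    calc _ ≤ t * t ^ 3 := by
          gcongr
          calc r ^ (-1:ℝ) = (r ^ (-(1/3):ℝ)) ^ 3 := by rw [← Real.rpow_mul_natCast hr.le]; norm_num
            _ ≤ _ := by gcongr
      _ = _ := by ring

lemma P_glue (D : JordanDomain) {O F : Set ℂ} {lam : ℝ} {K : ℕ} {s : ℕ → ℝ} {T : ℕ → ℂ → ℂ} {U : ℕ → Set ℂ} {η : ℕ → ℝ} (hs : StrictMono s)
    (hK : s K = s 0 + D.l) (h : ∀ k, DArc D O F lam (s k) (s (k+1)) (T k) (U k) (η k)) (hF : IsCompact F) (hFG : F ⊆ D.G)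
    (hO : O ⊆ (closure D.G)ᶜ) (hlam : 0 < lam) (hlam2 : lam < 2) {Z : Finset ℂ} (hZ : ∀ z, z ∈ Z ↔ ∃ k < K, z = T k 0 ∨ z = T k 1) :
    ∃ C > 0, ∀ ζ ∈ F, ∀ φ g, ConformalOnto D.G φ ζ → DifferentiableOn ℂ g D.G → (∀ z ∈ D.G, g z ^ 2 = deriv φ z) → ∃ f : ℂ → ℂ,
      (∀ z ∉ Z, ContDiffAt ℝ 1 f z) ∧ HasCompactSupport f ∧ (∀ z0, Integrable (fun w => ‖f w‖ / ‖w - z0‖)) ∧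
      (∀ z ∉ Z, dbar f z ≠ 0 → ∃ k < K, ∃ w ∈ lens (η k / 2), T k w = z ∧ η k / 8 * (w.re * (1 - w.re)) ≤ -w.im ∧
        ‖dbar f z‖ ≤ C * (w.re * (1 - w.re)) ^ ((1 / (2 - lam) - 1) / 2 - 1)) ∧
      ∀ k < K, ∀ t ∈ Ioo (0:ℝ) 1, Tendsto (fun ε : ℝ => g (T k (t + ε * I))) (nhdsWithin 0 (Ioi 0)) (nhds (f (T k t))) := by
  set β := (1 / (2 - lam) - 1) / 2
  have hβ : -(1/4) ≤ β := by
    have : 1 / 2 ≤ 1 / (2 - lam) := one_div_le_one_div_of_le (by linarith) (by linarith)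
    simp only [β]; linarith
  have h1 := fun k => K_s D.bounded D.isOpen hF hFG hO hlam hlam2 (h k).la
  choose M hM hs1 using h1
  have h2 := fun k => P_arc (h k).la hβ
  choose C hC P hPc hP hf using h2
  obtain ⟨hcov, hdis⟩ := B_cover hs hK h
  have hZf : ∀ z ∉ Z, ∀ k < K, z ≠ T k 0 ∧ z ≠ T k 1 := fun z hz k hk => ⟨fun e => hz ((hZ z).2 ⟨k, hk, Or.inl e⟩), fun e => hz ((hZ z).2 ⟨k, hk, Or.inr e⟩)⟩
  have hfr : ∀ z ∈ frontier D.G, z ∉ D.G ∧ z ∉ O := fun z hz => by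
    rw [D.isOpen.frontier_eq] at hz
    exact ⟨hz.2, fun h' => hO h' hz.1⟩
  have hre : ∀ k, ∀ w ∈ lens (η k), T k w ∈ frontier D.G → ∃ t ∈ Ioo (0:ℝ) 1, w = t := fun k w hw hz => by
    rcases lt_trichotomy w.im 0 with h' | h' | h'
    · exact absurd ((h k).la.dn w hw h') (hfr _ hz).2
    · exact ⟨w.re, ⟨hw.1, hw.2.1⟩, Complex.ext (by simp) (by simp [h'])⟩
    · exact absurd ((h k).la.up w hw h') (hfr _ hz).1
  have htl : ∀ k, ∀ t ∈ Ioo (0:ℝ) 1, (t:ℂ) ∈ lens (η k) := fun k t ht =>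
    ⟨by simpa using ht.1, by simpa using ht.2, by simpa using mul_pos (h k).la.η_pos (mul_pos ht.1 (sub_pos.2 ht.2))⟩
  have hPn : ∀ k < K, ∀ t ∈ Ioo (0:ℝ) 1, ∀ j < K, j ≠ k → T k t ∉ P j := fun k hk t ht j hj hjk hp => by
    have := hdis j hj k hk hjk t ht
    rcases hP j hp with ⟨w, hw, he⟩ | he | he
    · obtain ⟨t', ht', rfl⟩ := hre j w hw (by rw [he]; exact (h k).la.bd t ⟨ht.1.le, ht.2.le⟩)
      exact this t' ⟨ht'.1.le, ht'.2.le⟩ he.symm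
    · exact this 0 (by simp) (by simpa using he)
    · exact this 1 (by simp) (by simpa using he)
  have hCM : ∀ k < K, C k * M k ≤ ∑ j ∈ Finset.range K, C j * M j := fun k hk =>
    Finset.single_le_sum (f := fun j => C j * M j) (fun j _ => mul_nonneg (hC j).le (hM j).le) (Finset.mem_range.2 hk)
  refine ⟨1 + (K:ℝ) * ∑ k ∈ Finset.range K, C k * M k, add_pos_of_pos_of_nonneg one_pos (mul_nonneg (Nat.cast_nonneg K) (Finset.sum_nonneg fun j _ => mul_nonneg (hC j).le (hM j).le)), ?_⟩
  intro ζ hζ φ g hφ hg hgsq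
  have h3 := fun k => hs1 k ζ hζ φ g hφ hg hgsq
  choose S hSd hSe hSb using h3
  have h4 := fun k => hf k (S k) (M k) (hM k).le (hSd k) (hSb k)
  choose f hfc hf0 hfS hfb hfd using h4
  classical
  set f' : ℂ → ℂ := fun z => if z ∈ D.G then g z else ∑ k ∈ Finset.range K, f k z with hf'
  have hin : ∀ z ∈ D.G, f' =ᶠ[nhds z] g := fun z hz => by
    filter_upwards [D.isOpen.mem_nhds hz] with y hy using if_pos hy
  have hout : ∀ z ∉ closure D.G, f' =ᶠ[nhds z] fun y => ∑ k ∈ Finset.range K, f k y := fun z hz => by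
    filter_upwards [isClosed_closure.isOpen_compl.mem_nhds hz] with y hy using if_neg fun h => hy (subset_closure h)
  have hbd : ∀ z ∉ Z, ∀ k < K, ∀ t ∈ Ioo (0:ℝ) 1, z = T k t → f' =ᶠ[nhds z] f k := by
    rintro z hz k hk t ht rfl
    obtain ⟨V, _, _, hV, hVo, hVd⟩ := (h k).la.inv
    have htk := htl k t ht
    have hVc := (hVd t htk).1.continuousAt
    have e1 : ∀ᶠ y in nhds (T k t), |(V y).im| < η k / 8 * ((V y).re * (1 - (V y).re)) := by
      refine ContinuousAt.eventually_lt (by fun_prop) (by fun_prop) ?_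
      rw [hV t htk]
      simpa using mul_pos (div_pos (h k).la.η_pos (by norm_num : (0:ℝ) < 8)) (mul_pos ht.1 (sub_pos.2 ht.2))
    have e2 : ∀ᶠ y in nhds (T k t), ∀ j ∈ Finset.range K, j ≠ k → f j y = 0 := by
      rw [Filter.eventually_all_finset]
      intro j hj
      have hj := Finset.mem_range.1 hj
      by_cases hjk : j = k
      · exact Eventually.of_forall fun _ h' => absurd hjk h'
      filter_upwards [(hPc j).isClosed.isOpen_compl.mem_nhds (hPn k hk t ht j hj hjk)] with y hy _ using hf0 j y hy
    filter_upwards [e1, e2, hVo.mem_nhds ⟨_, htk, rfl⟩] with y h5 h6 h7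
    obtain ⟨w, hw, rfl⟩ := h7
    rw [hV w hw] at h5
    by_cases hy : T k w ∈ D.G
    · rw [hf']; simp only; rw [if_pos hy, hfS k w hw h5.le, hSe k w hw]
      by_contra hle
      rcases (not_lt.1 hle).eq_or_lt with h' | h'
      · have h8 := (h k).la.bd w.re ⟨hw.1.le, hw.2.1.le⟩
        rw [show ((w.re : ℝ) : ℂ) = w from Complex.ext (by simp) (by simp [h'])] at h8
        exact (hfr _ h8).1 hy
      · exact hO ((h k).la.dn w hw h') (subset_closure hy)
    · rw [hf']; simp only; rw [if_neg hy]
      exact Finset.sum_eq_single_of_mem k (Finset.mem_range.2 hk) h6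
  have hcs : ∀ z ∉ Z, z ∈ D.G ∨ z ∉ closure D.G ∨ z ∈ frontier D.G ∧ ∃ k < K, ∃ t ∈ Ioo (0:ℝ) 1, z = T k t := fun z hz => by
    by_cases h5 : z ∈ D.G
    · exact Or.inl h5
    by_cases h6 : z ∈ closure D.G
    · have h7 : z ∈ frontier D.G := by rw [D.isOpen.frontier_eq]; exact ⟨h6, h5⟩
      obtain ⟨k, hk, t, ht, he⟩ := hcov z h7
      refine Or.inr (Or.inr ⟨h7, k, hk, t, ⟨ht.1.lt_of_ne ?_, ht.2.lt_of_ne ?_⟩, he⟩)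
      · rintro rfl; exact (hZf z hz k hk).1 (by simpa using he)
      · rintro rfl; exact (hZf z hz k hk).2 (by simpa using he)
    · exact Or.inr (Or.inl h6)
  have hsm : ∀ z ∉ Z, ContDiffAt ℝ 1 f' z := fun z hz => by
    rcases hcs z hz with h5 | h5 | ⟨-, k, hk, t, ht, he⟩
    · exact (((hg.contDiffOn D.isOpen).contDiffAt (D.isOpen.mem_nhds h5)).restrict_scalars ℝ).congr_of_eventuallyEq (hin z h5)
    · exact (ContDiffAt.sum fun k hk => have := hZf z hz k (Finset.mem_range.1 hk); hfc k z this.1 this.2).congr_of_eventuallyEq (hout z h5)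
    · exact (hfc k z (hZf z hz k hk).1 (hZf z hz k hk).2).congr_of_eventuallyEq (hbd z hz k hk t ht he)
  obtain ⟨R, hR⟩ : ∃ R, D.G ∪ ⋃ k ∈ Finset.range K, P k ⊆ ball 0 R := by
    have : Bornology.IsBounded (D.G ∪ ⋃ k ∈ Finset.range K, P k) := D.bounded.union
      ((Finset.range K).isCompact_biUnion fun k _ => hPc k).isBounded
    exact this.subset_ball 0
  have hf0' : ∀ z ∉ ball (0:ℂ) R, f' z = 0 := fun z hz => by
    rw [hf']; simp only; rw [if_neg fun h' => hz (hR (Or.inl h'))]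
    exact Finset.sum_eq_zero fun k hk => hf0 k z fun h' => hz (hR (Or.inr (mem_biUnion hk h')))
  refine ⟨f', hsm, HasCompactSupport.intro (isCompact_closedBall (0:ℂ) R) fun z hz => hf0' z fun h' => hz (ball_subset_closedBall h'), ?_, ?_, ?_⟩
  · intro z0
    have hloc : ∀ a > -2, ∀ z1 : ℂ, IntegrableOn (fun z : ℂ => ‖z - z1‖ ^ (a:ℝ)) (ball 0 R) := fun a ha z1 =>
      (A_radial_loc ha z1 (R + ‖z1‖)).mono_set (ball_subset_ball' (by rw [dist_zero_left]))
    have hi1 : IntegrableOn (fun w => ‖deriv φ w‖ ^ 2 + ‖w - z0‖ ^ (-(4/3):ℝ)) D.G :=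
      (K_phi D.isOpen (hFG hζ) hφ).2.2.add ((hloc _ (by norm_num) z0).mono_set fun w hw => hR (Or.inl hw))
    have hi2 : IntegrableOn (fun w => ∑ k ∈ Finset.range K, C k * M k * ((‖w - T k 0‖ ^ (-(5/4):ℝ) + ‖w - z0‖ ^ (-(5/4):ℝ)) +
        (‖w - T k 1‖ ^ (-(5/4):ℝ) + ‖w - z0‖ ^ (-(5/4):ℝ)))) (ball 0 R) := by
      have h54 := fun z1 => hloc (-(5/4)) (by norm_num) z1
      exact integrable_finsetSum _ fun k _ => (((h54 _).add (h54 _)).add ((h54 _).add (h54 _))).const_mul _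
    refine Integrable.mono' ((hi1.integrable_indicator D.isOpen.measurableSet).add (hi2.integrable_indicator measurableSet_ball)) ?_ ?_
    · have hZc : ((Z : Set ℂ)ᶜ : Set ℂ) =ᵐ[volume] univ := by
        rw [ae_eq_univ, compl_compl]; exact Z.finite_toSet.measure_zero _
      have : AEStronglyMeasurable f' (volume.restrict (Z : Set ℂ)ᶜ) :=
        ContinuousOn.aestronglyMeasurable (fun z hz => (hsm z hz).continuousAt.continuousWithinAt) Z.finite_toSet.measurableSet.compl
      rw [Measure.restrict_congr_set hZc, Measure.restrict_univ] at this
      exact (this.norm.aemeasurable.div (by fun_prop)).aestronglyMeasurable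
    · filter_upwards [Z.finite_toSet.countable.ae_notMem volume, (countable_singleton z0).ae_notMem volume] with w hw hw0
      have hr : 0 < ‖w - z0‖ := norm_pos_iff.2 (sub_ne_zero.2 hw0)
      rw [Real.norm_of_nonneg (by positivity), Pi.add_apply]
      have hn2 : 0 ≤ (ball (0:ℂ) R).indicator (fun w => ∑ k ∈ Finset.range K, C k * M k * ((‖w - T k 0‖ ^ (-(5/4):ℝ) + ‖w - z0‖ ^ (-(5/4):ℝ)) +
        (‖w - T k 1‖ ^ (-(5/4):ℝ) + ‖w - z0‖ ^ (-(5/4):ℝ)))) w := indicator_nonneg (fun w _ => Finset.sum_nonneg fun k _ =>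
          mul_nonneg (mul_nonneg (hC k).le (hM k).le) (by positivity)) w
      by_cases hwG : w ∈ D.G
      · rw [indicator_of_mem hwG]
        refine le_add_of_le_of_nonneg ?_ hn2
        rw [← hgsq w hwG, (hin w hwG).self_of_nhds, norm_pow, ← pow_mul]
        exact P_div4 hr (norm_nonneg _)
      · rw [indicator_of_notMem hwG, zero_add]
        by_cases hwR : w ∈ ball (0:ℂ) R
        · rw [indicator_of_mem hwR, hf']
          simp only
          rw [if_neg hwG, div_le_iff₀ hr, Finset.sum_mul]
          refine (norm_sum_le _ _).trans (Finset.sum_le_sum fun k hk => ?_)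
          rw [← div_le_iff₀ hr]
          have hp : ∀ z1, w ≠ z1 → ‖w - z1‖ ^ (-(1/4):ℝ) / ‖w - z0‖ ≤ ‖w - z1‖ ^ (-(5/4):ℝ) + ‖w - z0‖ ^ (-(5/4):ℝ) := fun z1 h1 =>
            P_div hr _ (norm_pos_iff.2 (sub_ne_zero.2 h1)) le_rfl (by positivity)
          have hZk := hZf w hw k (Finset.mem_range.1 hk)
          calc _ ≤ C k * M k * (‖w - T k 0‖ ^ (-(1/4):ℝ) + ‖w - T k 1‖ ^ (-(1/4):ℝ)) / ‖w - z0‖ := by gcongr; exact hfb k w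
            _ = C k * M k * (‖w - T k 0‖ ^ (-(1/4):ℝ) / ‖w - z0‖ + ‖w - T k 1‖ ^ (-(1/4):ℝ) / ‖w - z0‖) := by ring
            _ ≤ _ := mul_le_mul_of_nonneg_left (add_le_add (hp _ hZk.1) (hp _ hZk.2)) (mul_nonneg (hC k).le (hM k).le)
        · rw [indicator_of_notMem hwR, hf0' w hwR, norm_zero, zero_div]
  · intro z hz hne
    rcases hcs z hz with h5 | h5 | ⟨h7, k, hk, t, ht, he⟩
    · exact absurd (by rw [dbar_congr (hin z h5)]; exact dbar_hol (hg.differentiableAt (D.isOpen.mem_nhds h5))) hne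
    · have hsum : dbar f' z = ∑ k ∈ Finset.range K, dbar (f k) z := by
        rw [dbar_congr (hout z h5)]
        simp only [dbar]
        rw [fderiv_fun_sum fun k hk => have := hZf z hz k (Finset.mem_range.1 hk); (hfc k z this.1 this.2).differentiableAt one_ne_zero]
        simp only [sum_apply, ← Finset.sum_div, Finset.sum_add_distrib, Finset.mul_sum]
      have hKn : (Finset.range K).Nonempty := by
        rw [Finset.nonempty_iff_ne_empty]; intro h0; rw [hsum, h0] at hne; simp at hne
      obtain ⟨k, hk, hmax⟩ := Finset.exists_max_image (Finset.range K) (fun k => ‖dbar (f k) z‖) hKn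
      have hle : ‖dbar f' z‖ ≤ K * ‖dbar (f k) z‖ := by
        rw [hsum]
        refine (norm_sum_le _ _).trans ((Finset.sum_le_card_nsmul _ _ _ hmax).trans ?_)
        simp
      have hk' := Finset.mem_range.1 hk
      obtain ⟨w, hw, he, hi, hb⟩ := hfd k z (hZf z hz k hk').1 (hZf z hz k hk').2 fun h0 => by
        rw [h0] at hle; simp at hle; exact hne hle
      have hw' : w ∈ lens (η k) := lens_mono (by linarith [(h k).la.η_pos] : η k / 2 ≤ η k) hw
      have hd := (lens_end (h k).la.η_le hw').1.1
      refine ⟨k, hk', w, hw, he, ?_, ?_⟩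
      · rwa [abs_of_nonpos] at hi
        by_contra h0
        exact h5 (subset_closure (by rw [← he]; exact (h k).la.up w hw' (not_le.1 h0)))
      · calc _ ≤ K * (C k * M k * (w.re * (1 - w.re)) ^ (β - 1)) := hle.trans (by gcongr)
          _ ≤ K * ((∑ j ∈ Finset.range K, C j * M j) * (w.re * (1 - w.re)) ^ (β - 1)) := by gcongr; exact hCM k hk'
          _ ≤ _ := by rw [← mul_assoc]; gcongr; linarith
    · rw [dbar_congr (hbd z hz k hk t ht he)] at hne
      obtain ⟨w, hw, he', hi, -⟩ := hfd k z (hZf z hz k hk).1 (hZf z hz k hk).2 hne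
      have hw' : w ∈ lens (η k) := lens_mono (by linarith [(h k).la.η_pos] : η k / 2 ≤ η k) hw
      have hd := (lens_end (h k).la.η_le hw').1.1
      obtain ⟨t', -, rfl⟩ := hre k w hw' (by rw [he']; exact h7)
      have := (h k).la.η_pos
      rw [ofReal_im, abs_zero] at hi
      exact absurd hi (not_le.2 (by positivity))
  · intro k hk t ht
    have htk := htl k t ht
    have hd := mul_pos ht.1 (sub_pos.2 ht.2)
    have hη := (h k).la.η_pos
    have hz : f' (T k t) = S k t := by
      have : T k t ∉ D.G := (hfr _ ((h k).la.bd t ⟨ht.1.le, ht.2.le⟩)).1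
      rw [hf']; simp only; rw [if_neg this]
      rw [← hfS k t htk (by simp; positivity)]
      refine Finset.sum_eq_single_of_mem k (Finset.mem_range.2 hk) fun j hj hjk => hf0 j _ (hPn k hk t ht j (Finset.mem_range.1 hj) hjk)
    rw [hz]
    have hc : Tendsto (fun ε : ℝ => (t + ε * I : ℂ)) (nhdsWithin 0 (Ioi 0)) (nhds t) := by
      have : ContinuousAt (fun ε : ℝ => (t + ε * I : ℂ)) 0 := by fun_prop
      have h0 := this.tendsto
      simp only [ofReal_zero, zero_mul, add_zero] at h0
      exact h0.mono_left nhdsWithin_le_nhds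
    refine (((hSd k).differentiableAt ((lens_open _).mem_nhds htk)).continuousAt.tendsto.comp hc).congr' ?_
    filter_upwards [hc.eventually ((lens_open _).mem_nhds htk), self_mem_nhdsWithin] with ε h5 h6
    exact hSe k _ h5 (by simpa using h6)

lemma H_pos (D : JordanDomain) {z : ℂ} (hz : z ∉ frontier D.G) : 0 < infDist z (frontier D.G) ∧ (∀ s, infDist z (frontier D.G) ≤ ‖z - D.γ s‖) ∧
    ∀ s, z - D.γ s ≠ 0 := by
  have h1 : ∀ s, infDist z (frontier D.G) ≤ ‖z - D.γ s‖ := fun s => by rw [← dist_eq_norm]; exact infDist_le_dist_of_mem (D.mem_L s)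
  have h0 := (isClosed_frontier.notMem_iff_infDist_pos ⟨_, D.mem_L 0⟩).1 hz
  exact ⟨h0, h1, fun s => norm_pos_iff.1 (h0.trans_le (h1 s))⟩

lemma H_ker (D : JordanDomain) {O F : Set ℂ} {lam : ℝ} {K : ℕ} {s : ℕ → ℝ} {T : ℕ → ℂ → ℂ} {U : ℕ → Set ℂ} {η : ℕ → ℝ}
    (hK : s K = s 0 + D.l) (h : ∀ k, DArc D O F lam (s k) (s (k+1)) (T k) (U k) (η k)) :
    ∃ C > 0, ∀ z ∉ frontier D.G, ∫ t in Ioc 0 D.l, (‖z - D.γ t‖ ^ 2)⁻¹ ≤ C / infDist z (frontier D.G) := by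
  have h1 := fun k => (h k).chord
  choose c hc hch using h1
  have hn : 0 ≤ ∑ k ∈ Finset.range K, 4 * Real.pi / c k := Finset.sum_nonneg fun k _ => div_nonneg (by positivity) (hc k).le
  refine ⟨1 + ∑ k ∈ Finset.range K, 4 * Real.pi / c k, by positivity, fun z hz => ?_⟩
  obtain ⟨h0, h1, h2⟩ := H_pos D hz
  have hcont : Continuous fun t => (‖z - D.γ t‖ ^ 2)⁻¹ :=
    ((continuous_const.sub D.γ_cont).norm.pow 2).inv₀ fun t => pow_ne_zero _ (norm_ne_zero_iff.2 (h2 t))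
  have hper : Function.Periodic (fun t => (‖z - D.γ t‖ ^ 2)⁻¹) D.l := fun t => by simp only [D.γ_periodic t]
  rw [← intervalIntegral.integral_of_le D.l_pos.le]
  have h3 := hper.intervalIntegral_add_eq 0 (s 0)
  rw [zero_add, ← hK, ← intervalIntegral.sum_integral_adjacent_intervals fun k _ => hcont.intervalIntegrable _ _] at h3
  rw [h3, add_div, Finset.sum_div]
  refine (Finset.sum_le_sum fun k _ => ?_).trans (le_add_of_nonneg_left (by positivity))
  rw [intervalIntegral.integral_of_le (h k).lt.le, ← integral_Icc_eq_integral_Ioc, div_div]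
  exact A_kernel (h k).lt.le D.γ_cont.continuousOn (hc k) h0 (hch k) fun t _ => h1 t

lemma H_int (D : JordanDomain) {H k : ℝ → ℂ} (hH : MemLp H 2 (volume.restrict (Ioc 0 D.l))) (hk : Continuous k) :
    IntegrableOn (fun t => H t * k t) (Ioc 0 D.l) :=
  IntegrableOn.mul_continuousOn_of_subset (hH.integrable (by norm_num)) (hk.continuousOn (s := Icc 0 D.l)) measurableSet_Ioc isCompact_Icc Ioc_subset_Icc_self

lemma H_cs (D : JordanDomain) {C : ℝ} {H k : ℝ → ℂ} (hC : 0 < C)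
    (hk : ∀ z ∉ frontier D.G, ∫ t in Ioc 0 D.l, (‖z - D.γ t‖ ^ 2)⁻¹ ≤ C ^ 2 / infDist z (frontier D.G))
    (hH : MemLp H 2 (volume.restrict (Ioc 0 D.l))) (hH1 : ∫ t in Ioc 0 D.l, ‖H t‖ ^ 2 ≤ 1) {z : ℂ} (hz : z ∉ frontier D.G) {q : ℝ} (hq : 0 ≤ q)
    (hkc : Continuous k) (hkb : ∀ t, ‖k t‖ ≤ q * ‖z - D.γ t‖⁻¹) :
    ∫ t in Ioc 0 D.l, ‖H t * k t‖ ≤ q * (C * infDist z (frontier D.G) ^ (-(1/2):ℝ)) := by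
  obtain ⟨h0, h1, h2⟩ := H_pos D hz
  set A := C * infDist z (frontier D.G) ^ (-(1/2):ℝ) with hA
  have hA0 : 0 < A := by positivity
  have hA2 : C ^ 2 / infDist z (frontier D.G) = A ^ 2 := by
    rw [hA, mul_pow, ← Real.rpow_mul_natCast h0.le]; norm_num [Real.rpow_neg_one]; rfl
  have hcont : Continuous fun t => (‖z - D.γ t‖ ^ 2)⁻¹ :=
    ((continuous_const.sub D.γ_cont).norm.pow 2).inv₀ fun t => pow_ne_zero _ (norm_ne_zero_iff.2 (h2 t))
  have hi1 : IntegrableOn (fun t => (‖z - D.γ t‖ ^ 2)⁻¹) (Ioc 0 D.l) := (hcont.integrableOn_Icc (a := 0) (b := D.l)).mono_set Ioc_subset_Icc_self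
  have hi2 : IntegrableOn (fun t => ‖H t‖ ^ 2) (Ioc 0 D.l) := hH.integrable_norm_pow two_ne_zero
  calc _ ≤ ∫ t in Ioc 0 D.l, q * (1/2 * (A * ‖H t‖ ^ 2 + A⁻¹ * (‖z - D.γ t‖ ^ 2)⁻¹)) := by
        refine integral_mono (H_int D hH hkc).norm ((((hi2.const_mul _).add (hi1.const_mul _)).const_mul _).const_mul _) fun t => ?_
        simp only [norm_mul]
        refine (mul_le_mul_of_nonneg_left (hkb t) (norm_nonneg _)).trans ?_
        rw [mul_left_comm, ← inv_pow]
        refine mul_le_mul_of_nonneg_left ?_ hq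
        set b := ‖z - D.γ t‖⁻¹
        have : 0 ≤ A⁻¹ * (A * ‖H t‖ - b) ^ 2 := by positivity
        have e : A⁻¹ * (A * ‖H t‖ - b) ^ 2 = A * ‖H t‖ ^ 2 + A⁻¹ * b ^ 2 - 2 * (‖H t‖ * b) := by field_simp; ring
        linarith
    _ ≤ q * (1/2 * (A * 1 + A⁻¹ * A ^ 2)) := by
        rw [integral_const_mul, integral_const_mul, integral_add (hi2.const_mul _) (hi1.const_mul _), integral_const_mul, integral_const_mul, ← hA2]
        gcongr; exact hk z hz
    _ = q * A := by field_simp; ring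

/-- the admissible densities. -/
def HH (D : JordanDomain) (n : ℕ) (H : ℝ → ℂ) : Prop := MemLp H 2 (volume.restrict (Ioc 0 D.l)) ∧ ∫ t in Ioc 0 D.l, ‖H t‖ ^ 2 ≤ 1 ∧
  ∀ m ≤ n, ∫ t in Ioc 0 D.l, H t * D.γ t ^ m = 0

/-- Cauchy transform. -/
noncomputable def hat (D : JordanDomain) (H : ℝ → ℂ) (z : ℂ) : ℂ := ∫ t in Ioc 0 D.l, H t * (z - D.γ t)⁻¹

lemma hat_cont (D : JordanDomain) {z : ℂ} (hz : z ∉ frontier D.G) : Continuous fun t => (z - D.γ t)⁻¹ :=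
  (continuous_const.sub D.γ_cont).inv₀ (H_pos D hz).2.2

lemma hat_diff (D : JordanDomain) {H : ℝ → ℂ} (hH : MemLp H 2 (volume.restrict (Ioc 0 D.l))) : DifferentiableOn ℂ (hat D H) (frontier D.G)ᶜ := by
  intro z hz
  obtain ⟨h0, h1, h2⟩ := H_pos D hz
  set r := infDist z (frontier D.G)
  have hb : ∀ x ∈ ball z (r / 2), ∀ t, r / 2 ≤ ‖x - D.γ t‖ := fun x hx t => by
    rw [mem_ball, dist_eq_norm] at hx
    have := norm_sub_le_norm_sub_add_norm_sub z x (D.γ t)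
    rw [norm_sub_rev z x] at this
    linarith [h1 t]
  have := hasDerivAt_integral_of_dominated_loc_of_deriv_le (μ := volume.restrict (Ioc 0 D.l)) (F := fun x t => H t * (x - D.γ t)⁻¹) (x₀ := z)
    (F' := fun x t => H t * (-1 / (x - D.γ t) ^ 2)) (bound := fun t => ‖H t‖ * ((r / 2) ^ 2)⁻¹) (ball_mem_nhds z (half_pos h0))
    (Eventually.of_forall fun x => hH.1.mul (by have := D.γ_cont.measurable; exact (by fun_prop : Measurable fun t => (x - D.γ t)⁻¹).aestronglyMeasurable))
    (H_int D hH (hat_cont D hz))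
    (hH.1.mul (by have := D.γ_cont.measurable; exact (by fun_prop : Measurable fun t => -1 / (z - D.γ t) ^ 2).aestronglyMeasurable))
    (Eventually.of_forall fun t x hx => by
      rw [norm_mul, norm_div, norm_neg, norm_one, norm_pow, one_div]; gcongr; exact hb x hx t)
    ((hH.integrable (by norm_num)).norm.mul_const _)
    (Eventually.of_forall fun t x hx => by
      refine HasDerivAt.const_mul _ (((hasDerivAt_id x).sub_const _).fun_inv ?_)
      exact norm_pos_iff.1 ((half_pos h0).trans_le (hb x hx t)))
  exact this.2.differentiableAt.differentiableWithinAt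

lemma hat_far (D : JordanDomain) {H : ℝ → ℂ} {n : ℕ} (hH : HH D n H) {z : ℂ} (hz : z ∉ frontier D.G) (hz0 : z ≠ 0) :
    hat D H z = ∫ t in Ioc 0 D.l, H t * ((D.γ t / z) ^ (n + 1) * (z - D.γ t)⁻¹) := by
  have h2 := (H_pos D hz).2.2
  have hc := D.γ_cont
  have hi : ∀ m : ℕ, IntegrableOn (fun t => H t * D.γ t ^ m) (Ioc 0 D.l) := fun m => H_int D hH.1 (hc.pow m)
  have hi2 : IntegrableOn (fun t => H t * ((D.γ t / z) ^ (n + 1) * (z - D.γ t)⁻¹)) (Ioc 0 D.l) :=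
    H_int D hH.1 (((hc.div_const z).pow _).mul (hat_cont D hz))
  have h3 : ∀ t, H t * (z - D.γ t)⁻¹ = (∑ m ∈ Finset.range (n + 1), (H t * D.γ t ^ m) * (z ^ (m + 1))⁻¹) + H t * ((D.γ t / z) ^ (n + 1) * (z - D.γ t)⁻¹) := fun t => by
    have h4 := mul_neg_geom_sum (D.γ t / z) (n + 1)
    have h5 : (z - D.γ t)⁻¹ = (∑ m ∈ Finset.range (n + 1), D.γ t ^ m * (z ^ (m + 1))⁻¹) + (D.γ t / z) ^ (n + 1) * (z - D.γ t)⁻¹ := by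
      have h6 : ∑ m ∈ Finset.range (n + 1), D.γ t ^ m * (z ^ (m + 1))⁻¹ = z⁻¹ * ∑ m ∈ Finset.range (n + 1), (D.γ t / z) ^ m := by
        rw [Finset.mul_sum]; exact Finset.sum_congr rfl fun m _ => by rw [div_pow, pow_succ]; field_simp
      have h7 : (D.γ t / z) ^ (n + 1) = 1 - (1 - D.γ t / z) * ∑ m ∈ Finset.range (n + 1), (D.γ t / z) ^ m := by rw [h4]; ring
      have := h2 t
      rw [h6, h7]; field_simp; ring
    simp only [mul_assoc, ← Finset.mul_sum, ← mul_add, ← h5]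
  rw [hat, integral_congr_ae (Eventually.of_forall h3), integral_add (integrable_finsetSum _ fun m _ => (hi m).mul_const _) hi2,
    integral_finsetSum _ fun m _ => (hi m).mul_const _, Finset.sum_eq_zero fun m hm => ?_, zero_add]
  rw [integral_mul_const, hH.2.2 m (by rw [Finset.mem_range] at hm; omega), zero_mul]

lemma H_end {G Y L F U : Set ℂ} {lam η : ℝ} {T : ℂ → ℂ} {e : ℂ} (h : LArc G Y F lam T U η) (hlam : 0 < lam) (he : e = 0 ∨ e = 1)
    (hend : ∃ ext A c ρ, LEnd Y lam T η e ext A c ρ) (hYo : IsOpen Y) (hYL : Disjoint Y L) (hL : L.Nonempty) {𝓕 : Set ((ℂ → ℂ) × ℕ)}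
    (hd : ∀ p ∈ 𝓕, DifferentiableOn ℂ p.1 Y) (hb : ∀ p ∈ 𝓕, ∀ z ∈ Y, ‖p.1 z‖ ≤ infDist z L ^ (-(1/2) : ℝ))
    (hK : ∀ K ⊆ Y, IsCompact K → ∃ C : ℝ, 0 < C ∧ ∃ q ∈ Ioo (0:ℝ) 1, ∀ p ∈ 𝓕, ∀ w ∈ K, ‖p.1 w‖ ≤ C * q ^ p.2) :
    ∃ ε > 0, ∃ C > 0, ∃ c > 0, ∀ p ∈ 𝓕, 0 < p.2 → ∀ w ∈ lens η, ‖w - e‖ < ε → η / 8 * (w.re * (1 - w.re)) ≤ -w.im →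
      ‖p.1 (T w)‖ ≤ C * (‖T w - T e‖ ^ (-(1/2):ℝ) * Real.exp (-c * p.2 * ‖T w - T e‖ ^ (1 / lam))) := by
  obtain ⟨ext, A, a, ρ, E⟩ := hend
  have hext : 0 < ext := hlam.trans_le E.lam_le
  obtain ⟨ψ, hψ, ε, hε, hm⟩ := E.marg (η / 8) (div_pos h.η_pos (by norm_num))
  obtain ⟨C, hC, c, hc, ρ', hρ', hx⟩ := A_corner_ext hext E.lt_two E.A_pos E.ρ_pos hYo E.out hYL hL 𝓕 hd hb hK ψ hψ
  obtain ⟨_, _, B, hB, hbil⟩ := h.bil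
  refine ⟨min ε (min ρ' 1 / B), by positivity, C, hC, c, hc, fun p hp hn w hw hwe hwi => ?_⟩
  obtain ⟨ω, hω, hωi⟩ := hm w hw (hwe.trans_le (min_le_left _ _)) hwi
  have h1 : ‖T w - T e‖ = Real.exp ω.re := by rw [hω, add_sub_cancel_left, norm_mul, norm_exp_ofReal_mul_I, one_mul, norm_exp]
  have h2 : Real.exp ω.re < min ρ' 1 := by
    rw [← h1]
    refine (hbil w (Or.inl hw) e (LArc.endmem he η)).2.trans_lt ?_
    rw [← lt_div_iff₀' hB]
    exact hwe.trans_le (min_le_right _ _)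
  have h3 := hx p hp hn ω (h2.trans_le (min_le_left _ _)) hωi
  rw [← hω] at h3
  rw [h1, ← mul_assoc]
  refine h3.trans ?_
  have h4 : Real.exp ω.re ^ (1 / lam) ≤ Real.exp ω.re ^ (1 / ext) :=
    Real.rpow_le_rpow_of_exponent_ge (Real.exp_pos _) (h2.trans_le (min_le_right _ _)).le (one_div_le_one_div_of_le hlam E.lam_le)
  have h5 : 0 ≤ c * p.2 := by positivity
  gcongr C * _ * Real.exp ?_
  nlinarith

lemma H_arc {G Y L F U : Set ℂ} {lam η : ℝ} {T : ℂ → ℂ} (h : LArc G Y F lam T U η) (hlam : 0 < lam)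
    (hYo : IsOpen Y) (hYL : Disjoint Y L) (hL : L.Nonempty) {𝓕 : Set ((ℂ → ℂ) × ℕ)}
    (hd : ∀ p ∈ 𝓕, DifferentiableOn ℂ p.1 Y) (hb : ∀ p ∈ 𝓕, ∀ z ∈ Y, ‖p.1 z‖ ≤ infDist z L ^ (-(1/2) : ℝ))
    (hK : ∀ K ⊆ Y, IsCompact K → ∃ C : ℝ, 0 < C ∧ ∃ q ∈ Ioo (0:ℝ) 1, ∀ p ∈ 𝓕, ∀ w ∈ K, ‖p.1 w‖ ≤ C * q ^ p.2) :
    ∃ C > 0, ∃ c > 0, ∀ p ∈ 𝓕, 0 < p.2 → ∀ w ∈ lens (η / 2), η / 8 * (w.re * (1 - w.re)) ≤ -w.im → ∃ e : ℂ, (e = 0 ∨ e = 1) ∧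
      ‖w - e‖ ≤ 4 * (w.re * (1 - w.re)) ∧
      ‖p.1 (T w)‖ ≤ C * (‖T w - T e‖ ^ (-(1/2):ℝ) * Real.exp (-c * p.2 * ‖T w - T e‖ ^ (1 / lam))) := by
  obtain ⟨ε0, hε0, C0, hC0, c0, hc0, H0⟩ := H_end h hlam (Or.inl rfl) h.e0 hYo hYL hL hd hb hK
  obtain ⟨ε1, hε1, C1, hC1, c1, hc1, H1⟩ := H_end h hlam (Or.inr rfl) h.e1 hYo hYL hL hd hb hK
  have hη := h.η_pos
  set δ := min ε0 ε1 / 8 with hδ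
  have hδ0 : 0 < δ := by positivity
  set E : Set ℂ := {w | (0 ≤ w.re ∧ w.re ≤ 1) ∧ δ ≤ w.re * (1 - w.re) ∧ |w.im| ≤ η / 2 * (w.re * (1 - w.re)) ∧ η / 8 * (w.re * (1 - w.re)) ≤ -w.im}
  have hEl : ∀ w ∈ E, w ∈ lens η ∧ w.im < 0 := by
    rintro w ⟨⟨h1, h2⟩, h3, h4, h5⟩
    have h6 : 0 < w.re * (1 - w.re) := hδ0.trans_le h3
    refine ⟨⟨h1.lt_of_ne fun h0 => ?_, h2.lt_of_ne fun h0 => ?_, by nlinarith⟩, by nlinarith [mul_pos hη h6]⟩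
    · rw [← h0] at h6; simp at h6
    · rw [h0] at h6; simp at h6
  have hEc : IsCompact E := by
    have hdc : Continuous fun w : ℂ => w.re * (1 - w.re) := continuous_re.mul (continuous_const.sub continuous_re)
    refine (isCompact_closedBall (0:ℂ) 2).of_isClosed_subset ?_ fun w hw => ?_
    · exact ((isClosed_le continuous_const continuous_re).inter (isClosed_le continuous_re continuous_const)).inter
        ((isClosed_le continuous_const hdc).inter ((isClosed_le (continuous_abs.comp continuous_im) (continuous_const.mul hdc)).inter
        (isClosed_le (continuous_const.mul hdc) continuous_im.neg)))
    · have h1 := (hEl w hw).1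
      have h2 := (lens_end h.η_le h1).1
      have h3 := h1.2.2
      have := norm_le_abs_re_add_abs_im w
      rw [abs_of_pos h1.1] at this
      rw [mem_closedBall_zero_iff]
      nlinarith [h1.2.1, h.η_le]
  obtain ⟨C2, hC2, q, hq, H2⟩ := hK (T '' E) (by rintro _ ⟨w, hw, rfl⟩; exact h.dn w (hEl w hw).1 (hEl w hw).2)
    (hEc.image_of_continuousOn (h.arc.diff.continuousOn.mono fun w hw => h.sub (hEl w hw).1))
  obtain ⟨b, hbp, B, hB, hn⟩ := h.near
  have hlq : 0 < -Real.log q := neg_pos.2 (Real.log_neg hq.1 hq.2)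
  set c2 := -Real.log q / B ^ (1 / lam)
  have hc2 : 0 < c2 := by positivity
  refine ⟨C0 + C1 + C2 * B ^ (1/2:ℝ), by positivity, min (min c0 c1) c2, by positivity, fun p hp hn0 w hw hwi => ?_⟩
  have hw' : w ∈ lens η := lens_mono (by linarith : η / 2 ≤ η) hw
  obtain ⟨⟨hd0, hd1⟩, -, e, he, hne⟩ := lens_end h.η_le hw'
  refine ⟨e, he, hne, ?_⟩
  have hmono : ∀ C' c', C' ≤ C0 + C1 + C2 * B ^ (1/2:ℝ) → min (min c0 c1) c2 ≤ c' → ‖p.1 (T w)‖ ≤ C' * (‖T w - T e‖ ^ (-(1/2):ℝ) * Real.exp (-c' * p.2 * ‖T w - T e‖ ^ (1 / lam))) →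
      ‖p.1 (T w)‖ ≤ (C0 + C1 + C2 * B ^ (1/2:ℝ)) * (‖T w - T e‖ ^ (-(1/2):ℝ) * Real.exp (-min (min c0 c1) c2 * p.2 * ‖T w - T e‖ ^ (1 / lam))) := by
    intro C' c' h1 h2 h3
    refine h3.trans ?_
    gcongr
  have hp2 : 0 < C2 * B ^ (1/2:ℝ) := by positivity
  rcases lt_or_ge (w.re * (1 - w.re)) δ with h1 | h1
  · have h2 : ‖w - e‖ < min ε0 ε1 := by rw [hδ] at h1; linarith [lt_min hε0 hε1]
    rcases he with rfl | rfl
    · exact hmono C0 c0 (by linarith) ((min_le_left _ _).trans (min_le_left _ _)) (H0 p hp hn0 w hw' (h2.trans_le (min_le_left _ _)) hwi)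
    · exact hmono C1 c1 (by linarith) ((min_le_left _ _).trans (min_le_right _ _)) (H1 p hp hn0 w hw' (h2.trans_le (min_le_right _ _)) hwi)
  · refine hmono _ c2 (le_add_of_nonneg_left (by positivity)) (min_le_right _ _) ?_
    have h2 := H2 p hp (T w) ⟨w, ⟨⟨hw.1.le, hw.2.1.le⟩, h1, hw.2.2.le, hwi⟩, rfl⟩
    have h3 : ‖T w - T e‖ ≤ B := ((hn w hw' e he).2 hne).trans (by nlinarith)
    have h4 : 0 < ‖T w - T e‖ := lt_of_lt_of_le (by positivity) (hn w hw' e he).1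
    have h5 : 1 ≤ B ^ (1/2:ℝ) * ‖T w - T e‖ ^ (-(1/2):ℝ) := by
      rw [Real.rpow_neg h4.le, ← div_eq_mul_inv, one_le_div (by positivity)]; gcongr
    have h6 : q ^ p.2 ≤ Real.exp (-c2 * p.2 * ‖T w - T e‖ ^ (1 / lam)) := by
      rw [← Real.rpow_natCast, Real.rpow_def_of_pos hq.1]
      apply Real.exp_le_exp.2
      have h7 : c2 * ‖T w - T e‖ ^ (1 / lam) ≤ c2 * B ^ (1 / lam) := by gcongr
      rw [div_mul_cancel₀ _ (by positivity : B ^ (1 / lam) ≠ 0)] at h7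
      nlinarith [(Nat.cast_nonneg p.2 : (0:ℝ) ≤ p.2)]
    calc _ ≤ C2 * 1 * q ^ p.2 := by rw [mul_one]; exact h2
      _ ≤ C2 * (B ^ (1/2:ℝ) * ‖T w - T e‖ ^ (-(1/2):ℝ)) * Real.exp (-c2 * p.2 * ‖T w - T e‖ ^ (1 / lam)) := by
        have := pow_nonneg hq.1.le p.2
        gcongr
      _ = _ := by ring

lemma H_decay (D : JordanDomain) {Y F : Set ℂ} {lam : ℝ} {K : ℕ} {s : ℕ → ℝ} {T : ℕ → ℂ → ℂ} {U : ℕ → Set ℂ} {η : ℕ → ℝ}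
    (h : ∀ k, DArc D Y F lam (s k) (s (k+1)) (T k) (U k) (η k)) (hlam : 0 < lam) (hYo : IsOpen Y) (hYc : IsPreconnected Y)
    (hY : Y ⊆ (closure D.G)ᶜ) {R : ℝ} (hR : ∀ z : ℂ, R < ‖z‖ → z ∈ Y) {C0 : ℝ} (hC0 : 0 < C0)
    (hk : ∀ z ∉ frontier D.G, ∫ t in Ioc 0 D.l, (‖z - D.γ t‖ ^ 2)⁻¹ ≤ C0 ^ 2 / infDist z (frontier D.G)) :
    ∃ C > 0, ∃ c > 0, ∀ n > 0, ∀ H, HH D n H → ∀ k < K, ∀ w ∈ lens (η k / 2), η k / 8 * (w.re * (1 - w.re)) ≤ -w.im → ∃ e : ℂ, (e = 0 ∨ e = 1) ∧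
      ‖w - e‖ ≤ 4 * (w.re * (1 - w.re)) ∧
      ‖hat D H (T k w)‖ ≤ C * (‖T k w - T k e‖ ^ (-(1/2):ℝ) * Real.exp (-c * n * ‖T k w - T k e‖ ^ (1 / lam))) := by
  have hYL : ∀ z ∈ Y, z ∉ frontier D.G := fun z hz h' => hY hz (frontier_subset_closure h')
  set 𝓕 : Set ((ℂ → ℂ) × ℕ) := {p | ∃ H, HH D p.2 H ∧ p.1 = fun z => (C0:ℂ)⁻¹ * hat D H z} with h𝓕
  have hb' : ∀ p ∈ 𝓕, ∀ z ∉ frontier D.G, ∀ q : ℝ, 0 ≤ q → ∀ k : ℝ → ℂ, Continuous k → (∀ t, ‖k t‖ ≤ q * ‖z - D.γ t‖⁻¹) → 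
      ∀ H, HH D p.2 H → ‖(C0:ℂ)⁻¹ * ∫ t in Ioc 0 D.l, H t * k t‖ ≤ q * infDist z (frontier D.G) ^ (-(1/2) : ℝ) := by
    intro p _ z hz q hq k hkc hkb H hH
    rw [norm_mul, norm_inv, norm_real, Real.norm_of_nonneg hC0.le, inv_mul_le_iff₀ hC0]
    refine (norm_integral_le_integral_norm _).trans ((H_cs D hC0 hk hH.1 hH.2.1 hz hq hkc hkb).trans_eq (by ring))
  have hb : ∀ p ∈ 𝓕, ∀ z ∈ Y, ‖p.1 z‖ ≤ infDist z (frontier D.G) ^ (-(1/2) : ℝ) := by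
    intro p hp z hz
    obtain ⟨H, hH, hpe⟩ := id hp
    rw [hpe, ← one_mul (infDist _ _ ^ _)]
    exact hb' p hp z (hYL z hz) 1 zero_le_one _ (hat_cont D (hYL z hz)) (fun t => by rw [norm_inv, one_mul]) H hH
  have hd : ∀ p ∈ 𝓕, DifferentiableOn ℂ p.1 Y := by
    rintro p ⟨H, hH, hpe⟩
    rw [hpe]
    exact ((hat_diff D hH.1).mono hYL).const_mul _
  have hK : ∀ K ⊆ Y, IsCompact K → ∃ C : ℝ, 0 < C ∧ ∃ q ∈ Ioo (0:ℝ) 1, ∀ p ∈ 𝓕, ∀ w ∈ K, ‖p.1 w‖ ≤ C * q ^ p.2 := by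
    refine A_propagate hYo hYc 𝓕 hd (fun K hKY hKc => ?_) ?_
    · obtain ⟨M, hM⟩ := hKc.exists_bound_of_continuousOn (f := fun z => infDist z (frontier D.G) ^ (-(1/2) : ℝ)) fun z hz =>
        ((continuous_infDist_pt _).continuousAt.rpow_const (Or.inl (H_pos D (hYL z (hKY hz))).1.ne')).continuousWithinAt
      exact ⟨M, fun p hp z hz => (hb p hp z (hKY hz)).trans ((le_abs_self _).trans (hM z hz))⟩
    · obtain ⟨R1, hR1⟩ := (isCompact_of_isClosed_isBounded isClosed_frontier (D.bounded.closure.subset frontier_subset_closure)).isBounded.exists_norm_le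
      set R2 := |R| + |R1| + 1
      have hR2 : 1 ≤ R2 := by simp only [R2]; linarith [abs_nonneg R, abs_nonneg R1]
      have hγ : ∀ t, ‖D.γ t‖ ≤ R2 := fun t => (hR1 _ (D.mem_L t)).trans (by simp only [R2]; linarith [abs_nonneg R, le_abs_self R1])
      have hRR : R < R2 := by simp only [R2]; linarith [abs_nonneg R1, le_abs_self R]
      have hz : ‖((3 * R2 : ℝ) : ℂ)‖ = 3 * R2 := by rw [norm_real, Real.norm_of_nonneg (by linarith)]
      refine ⟨(3 * R2 : ℝ), hR _ (by rw [hz]; linarith), 1, one_pos, 1, 1/2, ⟨by norm_num, by norm_num⟩, fun p hp w hw => ?_⟩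
      rw [mem_ball, dist_eq_norm] at hw
      have h1 : 2 * R2 ≤ ‖w‖ := by
        have := norm_sub_le_norm_sub_add_norm_sub ((3 * R2 : ℝ) : ℂ) w 0
        rw [norm_sub_rev _ w, sub_zero, sub_zero, hz] at this; linarith
      have hw0 : 0 < ‖w‖ := by linarith
      have hwY : w ∈ Y := hR w (by linarith)
      have h2 : 1 ≤ infDist w (frontier D.G) := by
        refine (le_infDist ⟨_, D.mem_L 0⟩).2 fun y hy => ?_
        rw [dist_eq_norm]
        have h3 := hR1 y hy
        have := norm_sub_norm_le w y
        simp only [R2] at h1; linarith [abs_nonneg R, le_abs_self R1]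
      obtain ⟨H, hH, hpe⟩ := id hp
      rw [hpe]
      simp only
      rw [hat_far D hH (hYL w hwY) (norm_pos_iff.1 hw0)]
      refine (hb' p hp w (hYL w hwY) ((1/2) ^ p.2) (by positivity) _ (((D.γ_cont.div_const w).pow _).mul (hat_cont D (hYL w hwY))) (fun t => ?_) H hH).trans ?_
      · change ‖(D.γ t / w) ^ (p.2 + 1) * (w - D.γ t)⁻¹‖ ≤ _
        rw [norm_mul, norm_inv]
        gcongr
        rw [norm_pow, norm_div]
        have h3 : ‖D.γ t‖ / ‖w‖ ≤ 1 / 2 := by rw [div_le_iff₀ hw0]; linarith [hγ t]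
        calc _ ≤ (1/2 : ℝ) ^ (p.2 + 1) := by gcongr
          _ ≤ _ := pow_le_pow_of_le_one (by norm_num) (by norm_num) (Nat.le_succ _)
      · rw [one_mul]
        exact mul_le_of_le_one_right (by positivity) (Real.rpow_le_one_of_one_le_of_nonpos h2 (by norm_num))
  have h1 := fun k => H_arc (h k).la hlam hYo (disjoint_left.2 hYL) ⟨_, D.mem_L 0⟩ hd hb hK
  choose C hC c hc hm using h1
  have hs1 : ∀ k < K, C k ≤ ∑ j ∈ Finset.range K, C j := fun k hk => Finset.single_le_sum (fun j _ => (hC j).le) (Finset.mem_range.2 hk)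
  have hs2 : ∀ k < K, (c k)⁻¹ ≤ ∑ j ∈ Finset.range K, (c j)⁻¹ := fun k hk =>
    Finset.single_le_sum (f := fun j => (c j)⁻¹) (fun j _ => (inv_pos.2 (hc j)).le) (Finset.mem_range.2 hk)
  have hp1 : 0 ≤ ∑ j ∈ Finset.range K, C j := Finset.sum_nonneg fun j _ => (hC j).le
  have hp2 : 0 ≤ ∑ j ∈ Finset.range K, (c j)⁻¹ := Finset.sum_nonneg fun j _ => (inv_pos.2 (hc j)).le
  refine ⟨C0 * (1 + ∑ j ∈ Finset.range K, C j), by positivity, (1 + ∑ j ∈ Finset.range K, (c j)⁻¹)⁻¹, by positivity, fun n hn H hH k hk w hw hwi => ?_⟩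
  obtain ⟨e, he, hne, hbd⟩ := hm k (fun z => (C0:ℂ)⁻¹ * hat D H z, n) ⟨H, hH, rfl⟩ hn w hw hwi
  refine ⟨e, he, hne, ?_⟩
  simp only at hbd
  rw [norm_mul, norm_inv, norm_real, Real.norm_of_nonneg hC0.le, inv_mul_le_iff₀ hC0] at hbd
  refine hbd.trans ?_
  rw [mul_assoc C0]
  gcongr
  · linarith [hs1 k hk]
  · exact inv_le_of_inv_le₀ (hc k) (by linarith [hs2 k hk])

lemma F_proj (D : JordanDomain) (n : ℕ) {u : ℝ → ℂ} (hu : MemLp u 2 (volume.restrict (Ioc 0 D.l))) :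
    ∃ Q : Polynomial ℂ, Q.natDegree ≤ n ∧ ∃ N : ℝ, 0 ≤ N ∧ D.bnorm (fun s => u s - Q.eval (D.γ s)) = √(1 / D.l) * N ∧
      (N = 0 ∨ ∃ H, HH D n H ∧ ∫ t in Ioc 0 D.l, H t * u t = N) := by
  set μ := volume.restrict (Ioc 0 D.l)
  have hm : ∀ j : ℕ, MemLp (fun t => D.γ t ^ j) 2 μ := fun j => by
    obtain ⟨M, hM⟩ := (isCompact_Icc (a := 0) (b := D.l)).exists_bound_of_continuousOn (D.γ_cont.pow j).continuousOn
    exact MemLp.of_bound (D.γ_cont.pow j).aestronglyMeasurable M (ae_restrict_of_forall_mem measurableSet_Ioc fun t ht => hM t (Ioc_subset_Icc_self ht))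
  set m : Fin (n+1) → Lp ℂ 2 μ := fun j => (hm j).toLp
  set S := Submodule.span ℂ (range m)
  have : FiniteDimensional ℂ S := FiniteDimensional.span_of_finite ℂ (finite_range m)
  set x := hu.toLp
  obtain ⟨c, hc⟩ := (Submodule.mem_span_range_iff_exists_fun ℂ).1 (S.starProjection_apply_mem x)
  set r := x - S.starProjection x with hr
  have hor : ∀ v ∈ S, inner ℂ r v = 0 := fun v hv => Submodule.inner_left_of_mem_orthogonal hv (S.sub_starProjection_mem_orthogonal x)
  have hin : ∀ v : ℝ → ℂ, ∀ hv : MemLp v 2 μ, ∫ t, (starRingEnd ℂ) (r t) * v t ∂μ = inner ℂ r hv.toLp := fun v hv => by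
    rw [L2.inner_def]
    refine integral_congr_ae ?_
    filter_upwards [hv.coeFn_toLp] with t ht
    rw [ht, RCLike.inner_apply, mul_comm]
  have hre : (r : ℝ → ℂ) =ᵐ[μ] fun s => u s - (∑ j, Polynomial.C (c j) * Polynomial.X ^ (j:ℕ)).eval (D.γ s) := by
    rw [hr, ← hc]
    have h1 : ∀ᵐ s ∂μ, ∀ j, m j s = D.γ s ^ (j:ℕ) := ae_all_iff.2 fun j => (hm j).coeFn_toLp
    have h2 : ∀ᵐ s ∂μ, ∀ j, (c j • m j : Lp ℂ 2 μ) s = c j * m j s := ae_all_iff.2 fun j => Lp.coeFn_smul _ _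
    filter_upwards [Lp.coeFn_sub x (∑ j, c j • m j), hu.coeFn_toLp, h1, h2, Lp.coeFn_finsetSum Finset.univ (fun j => c j • m j)] with s h3 h4 h5 h6 h7
    rw [h3, Pi.sub_apply, h4, h7]
    simp [Polynomial.eval_finsetSum, h5, h6]
  have hN : ∫ t, ‖r t‖ ^ 2 ∂μ = ‖r‖ ^ 2 := by
    have := hin _ (Lp.memLp r)
    rw [Lp.toLp_coeFn, inner_self_eq_norm_sq_to_K] at this
    have h2 : ((∫ t, ‖r t‖ ^ 2 ∂μ : ℝ) : ℂ) = ((‖r‖ ^ 2 : ℝ) : ℂ) := by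
      rw [← integral_complex_ofReal]; push_cast; refine Eq.trans ?_ this
      congr 1; ext t; rw [conj_mul']
    exact_mod_cast h2
  refine ⟨∑ j, Polynomial.C (c j) * Polynomial.X ^ (j:ℕ), ?_, ‖r‖, norm_nonneg _, ?_, or_iff_not_imp_left.2 fun h0 => ⟨fun t => (‖r‖ : ℂ)⁻¹ * (starRingEnd ℂ) (r t), ⟨?_, ?_, fun j hj => ?_⟩, ?_⟩⟩
  · exact Polynomial.natDegree_sum_le_of_forall_le _ _ fun j _ => (Polynomial.natDegree_C_mul_X_pow_le _ _).trans (by omega)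
  · rw [JordanDomain.bnorm, intervalIntegral.integral_of_le D.l_pos.le, Real.sqrt_mul (by have := D.l_pos; positivity)]
    congr 1
    rw [← Real.sqrt_sq (norm_nonneg r), ← hN]
    congr 1
    refine integral_congr_ae ?_
    filter_upwards [hre] with s hs
    rw [hs]
  · exact (Lp.memLp r).star.const_mul _
  · simp only [norm_mul, norm_inv, RCLike.norm_conj, mul_pow, norm_real, norm_norm]
    rw [integral_const_mul, hN, inv_pow, inv_mul_cancel₀ (by positivity)]
  · simp only [mul_assoc]
    rw [integral_const_mul, hin _ (hm j), hor _ (Submodule.subset_span ⟨⟨j, by omega⟩, rfl⟩), mul_zero]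
  · simp only [mul_assoc]
    rw [integral_const_mul, hin _ hu]
    have : hu.toLp = r + S.starProjection x := by rw [hr]; simp [x]
    rw [this, inner_add_right, hor _ (S.starProjection_apply_mem x), inner_self_eq_norm_sq_to_K, add_zero]
    change (‖r‖:ℂ)⁻¹ * (‖r‖:ℂ) ^ 2 = _
    rw [sq, inv_mul_cancel_left₀ (by exact_mod_cast h0)]

lemma F_bdy {D : JordanDomain} {Y F : Set ℂ} {lam : ℝ} {K : ℕ} {T : ℕ → ℂ → ℂ} {U : ℕ → Set ℂ} {η : ℕ → ℝ} {Z : Finset ℂ}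
    (h : ∀ k, LArc D.G Y F lam (T k) (U k) (η k)) (hc : ∀ p ∈ frontier D.G, ∃ k < K, ∃ t ∈ Icc (0:ℝ) 1, p = T k t)
    (hZ : ∀ z, z ∈ Z ↔ ∃ k < K, z = T k 0 ∨ z = T k 1) {f g : ℂ → ℂ} {gb : ℝ → ℂ}
    (hf : ∀ k < K, ∀ t ∈ Ioo (0:ℝ) 1, Tendsto (fun ε:ℝ => g (T k (t+ε*I))) (nhdsWithin 0 (Ioi 0)) (nhds (f (T k t))))
    (hgb : ∀ᵐ s ∂(volume.restrict (Ioc (0 : ℝ) D.l)), NTLim D.G g (D.γ s) (gb s)) :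
    ∀ᵐ s ∂(volume.restrict (Ioc (0 : ℝ) D.l)), D.γ s ∉ Z ∧ gb s = f (D.γ s) := by
  have hfin : (Ioc 0 D.l ∩ D.γ ⁻¹' Z).Finite := by
    refine Set.Finite.of_finite_image (f := D.γ) (Z.finite_toSet.subset (by rintro _ ⟨s, hs, rfl⟩; exact hs.2)) fun a ha b hb hab => ?_
    exact D.inj_lt hab (by rw [abs_lt]; constructor <;> linarith [ha.1.1, ha.1.2, hb.1.1, hb.1.2])
  filter_upwards [hgb, ae_restrict_of_ae (hfin.countable.ae_notMem volume), ae_restrict_mem measurableSet_Ioc] with s h1 h2 h3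
  have h4 : D.γ s ∉ Z := fun h' => h2 ⟨h3, h'⟩
  refine ⟨h4, ?_⟩
  obtain ⟨k, hk, t, ht, he⟩ := hc _ (D.mem_L s)
  have ht' : t ∈ Ioo (0:ℝ) 1 := by
    refine ⟨ht.1.lt_of_ne fun h0 => h4 ((hZ _).2 ⟨k, hk, Or.inl ?_⟩), ht.2.lt_of_ne fun h0 => h4 ((hZ _).2 ⟨k, hk, Or.inr ?_⟩)⟩
    · rw [he, ← h0, ofReal_zero]
    · rw [he, h0, ofReal_one]
  obtain ⟨b, hb, B, hB, hbil⟩ := (h k).bil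
  obtain ⟨c, hc', hdst⟩ := (h k).dst
  have hev : ∀ᶠ ε : ℝ in nhdsWithin 0 (Ioi 0), 0 < ε ∧ ((t:ℂ) + ε * I) ∈ lens (η k) := by
    have hp : 0 < η k * (t * (1 - t)) := mul_pos (h k).η_pos (mul_pos ht'.1 (by linarith [ht'.2]))
    filter_upwards [Ioo_mem_nhdsGT hp] with ε hε
    refine ⟨hε.1, ?_⟩
    simp only [lens, mem_ofPred_eq]
    simp only [add_re, ofReal_re, mul_re, I_re, mul_zero, ofReal_im, I_im, mul_one, sub_self, add_zero, add_im, mul_im, zero_add]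
    exact ⟨ht'.1, ht'.2, by rw [abs_of_pos hε.1]; exact hε.2⟩
  have hbd : ∀ᶠ ε : ℝ in nhdsWithin 0 (Ioi 0), ‖T k (t + ε * I) - D.γ s‖ ≤ B * ε := by
    filter_upwards [hev] with ε hε
    have := (hbil _ (Or.inl hε.2) t (Or.inr ⟨t, ht, rfl⟩)).2
    rwa [add_sub_cancel_left, norm_mul, norm_I, mul_one, norm_real, Real.norm_of_nonneg hε.1.le, ← he] at this
  have hT : Tendsto (fun ε : ℝ => T k (t + ε * I)) (nhdsWithin 0 (Ioi 0))
      (nhdsWithin (D.γ s) {z | z ∈ D.G ∧ ‖z - D.γ s‖ ≤ (B / c + 2) * infDist z (frontier D.G)}) := by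
    refine tendsto_nhdsWithin_iff.2 ⟨?_, ?_⟩
    · refine tendsto_iff_norm_sub_tendsto_zero.2 (squeeze_zero' (Eventually.of_forall fun _ => norm_nonneg _) hbd ?_)
      exact (Continuous.tendsto' (by fun_prop) 0 0 (by simp)).mono_left nhdsWithin_le_nhds
    · filter_upwards [hev, hbd] with ε hε h5
      have hi : ((t:ℂ) + ε * I).im = ε := by simp
      refine ⟨(h k).up _ hε.2 (by rw [hi]; exact hε.1), h5.trans ?_⟩
      have h6 : c * ε ≤ infDist (T k (t + ε * I)) (frontier D.G) := by
        refine (le_infDist ⟨_, D.mem_L s⟩).2 fun p hp => ?_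
        have := hdst _ hε.2 p hp
        rwa [hi, abs_of_pos hε.1, ← dist_eq_norm] at this
      calc B * ε = B / c * (c * ε) := by field_simp
        _ ≤ (B / c + 2) * infDist (T k (t + ε * I)) (frontier D.G) := by
          have := hε.1
          gcongr; linarith
  rw [he]
  exact tendsto_nhds_unique ((h1 (B / c + 2) (by have := div_pos hB hc'; linarith)).comp hT) (hf k hk t ht')

lemma F_pt {D : JordanDomain} {Y F U : Set ℂ} {lam η : ℝ} {T : ℂ → ℂ} (h : LArc D.G Y F lam T U η) (β : ℝ) :
    ∃ C > 0, ∀ w ∈ lens (η / 2), η / 8 * (w.re * (1 - w.re)) ≤ -w.im → T w ∉ frontier D.G ∧ ∀ e : ℂ, (e = 0 ∨ e = 1) → ‖w - e‖ ≤ 4 * (w.re * (1 - w.re)) →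
      0 < ‖T w - T e‖ ∧ (w.re * (1 - w.re)) ^ β ≤ C * ‖T w - T e‖ ^ β ∧ infDist (T w) (frontier D.G) ^ (-(1/2):ℝ) ≤ C * ‖T w - T e‖ ^ (-(1/2):ℝ) := by
  obtain ⟨b, hb, B, hB, hn⟩ := h.near
  obtain ⟨c, hc, hdst⟩ := h.dst
  have hη := h.η_pos
  set a := c * (η / 8) / B with ha
  have ha0 : 0 < a := by positivity
  refine ⟨b ^ (-β) + B ^ (-β) + a ^ (-(1/2):ℝ), by positivity, fun w hw hwi => ?_⟩
  have hw' : w ∈ lens η := lens_mono (by linarith : η / 2 ≤ η) hw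
  obtain ⟨⟨hd0, hd1⟩, -⟩ := lens_end h.η_le hw'
  set d := w.re * (1 - w.re)
  have him : 0 < -w.im := lt_of_lt_of_le (by positivity) hwi
  have hdd : ∀ p ∈ frontier D.G, c * (η / 8) * d ≤ ‖T w - p‖ := fun p hp => by
    refine le_trans ?_ (hdst w hw' p hp)
    rw [abs_of_neg (by linarith), mul_assoc]; gcongr
  refine ⟨fun h' => ?_, fun e he hne => ?_⟩
  · have := hdd _ h'
    rw [sub_self, norm_zero] at this
    exact absurd this (not_le.2 (by positivity))
  obtain ⟨h1, h2⟩ := hn w hw' e he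
  have h2 := h2 hne
  set ρ := ‖T w - T e‖
  have hρ : 0 < ρ := lt_of_lt_of_le (by positivity) h1
  refine ⟨hρ, ?_, ?_⟩
  · have h3 : d ^ β ≤ (b ^ (-β) + B ^ (-β)) * ρ ^ β := by
      rcases le_total 0 β with h0 | h0
      · have : d ≤ b⁻¹ * ρ := by rw [← div_eq_inv_mul, le_div_iff₀' hb]; exact h1
        calc d ^ β ≤ (b⁻¹ * ρ) ^ β := by gcongr
          _ = b ^ (-β) * ρ ^ β := by rw [Real.mul_rpow (by positivity) hρ.le, Real.inv_rpow hb.le, Real.rpow_neg hb.le]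
          _ ≤ _ := by gcongr; exact le_add_of_nonneg_right (by positivity)
      · have : B⁻¹ * ρ ≤ d := by rw [← div_eq_inv_mul, div_le_iff₀' hB]; exact h2
        calc d ^ β ≤ (B⁻¹ * ρ) ^ β := Real.rpow_le_rpow_of_nonpos (by positivity) this h0
          _ = B ^ (-β) * ρ ^ β := by rw [Real.mul_rpow (by positivity) hρ.le, Real.inv_rpow hB.le, Real.rpow_neg hB.le]
          _ ≤ _ := by gcongr; exact le_add_of_nonneg_left (by positivity)
    exact h3.trans (mul_le_mul_of_nonneg_right (le_add_of_nonneg_right (by positivity)) (by positivity))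
  · have h4 : a * ρ ≤ infDist (T w) (frontier D.G) := by
      refine (le_infDist ⟨_, D.mem_L 0⟩).2 fun p hp => ?_
      rw [dist_eq_norm]
      refine le_trans ?_ (hdd p hp)
      rw [ha, div_mul_eq_mul_div, div_le_iff₀ hB, mul_assoc _ d B, mul_comm d]
      gcongr
    calc _ ≤ (a * ρ) ^ (-(1/2):ℝ) := Real.rpow_le_rpow_of_nonpos (by positivity) h4 (by norm_num)
      _ = a ^ (-(1/2):ℝ) * ρ ^ (-(1/2):ℝ) := Real.mul_rpow ha0.le hρ.le
      _ ≤ _ := by gcongr; exact le_add_of_nonneg_left (by positivity)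

lemma F_dual (D : JordanDomain) {Z : Finset ℂ} {f : ℂ → ℂ} {a A M C0 : ℝ} {n : ℕ} {H : ℝ → ℂ} {E : ℂ → ℂ → ℝ}
    (hf : ∀ z ∉ Z, ContDiffAt ℝ 1 f z) (hs : HasCompactSupport f) (h4 : ∀ z0, Integrable (fun w => ‖f w‖ / ‖w - z0‖)) (hH : HH D n H) (ha : -2 < a) (hA : 0 < A)
    (hdec : ∀ z ∉ Z, dbar f z ≠ 0 → z ∉ frontier D.G ∧ ∃ z0 ∈ Z, ‖dbar f z‖ * infDist z (frontier D.G) ^ (-(1/2):ℝ) ≤ A * ‖z - z0‖ ^ a ∧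
      ‖dbar f z‖ * ‖hat D H z‖ ≤ A * E z0 z) (hE0 : ∀ z0 z, 0 ≤ E z0 z) (hE : ∀ z0, Integrable (E z0) ∧ ∫ z, E z0 z ≤ M)
    (hγ : ∀ᵐ s ∂volume.restrict (Ioc 0 D.l), D.γ s ∉ Z) (hC0 : 0 < C0)
    (hk : ∀ z ∉ frontier D.G, ∫ t in Ioc 0 D.l, (‖z - D.γ t‖ ^ 2)⁻¹ ≤ C0 ^ 2 / infDist z (frontier D.G)) :
    ‖∫ s in Ioc 0 D.l, H s * f (D.γ s)‖ ≤ A * (Z.card * M) := by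
  set μ := volume.restrict (Ioc 0 D.l) with hμ
  have hZ0 : ∀ᵐ z : ℂ, z ∉ Z := Z.countable_toSet.ae_notMem volume
  have hdm : Measurable (dbar f) := ((measurable_fderiv_apply_const ℝ f 1).add ((measurable_fderiv_apply_const ℝ f I).const_mul I)).div_const 2
  have hsup : ∀ z, dbar f z ≠ 0 → z ∈ tsupport f := fun z hz => by
    by_contra h0
    refine hz ?_
    rw [dbar, fderiv_of_notMem_tsupport ℝ h0]; simp
  set Φ : ℂ × ℝ → ℂ := fun q => dbar f q.1 * (H q.2 * (q.1 - D.γ q.2)⁻¹) with hΦ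
  have hsm : AEStronglyMeasurable Φ (volume.prod μ) := by
    refine (hdm.comp measurable_fst).aestronglyMeasurable.mul (hH.1.1.comp_snd.mul ?_)
    exact ((measurable_fst.sub (D.γ_cont.measurable.comp measurable_snd)).inv).aestronglyMeasurable
  have hΦn : ∀ z, ∫ s, ‖Φ (z, s)‖ ∂μ = ‖dbar f z‖ * ∫ s, ‖H s * (z - D.γ s)⁻¹‖ ∂μ := fun z => by
    rw [← integral_const_mul]; simp only [hΦ, norm_mul]
  have hΦi : Integrable Φ (volume.prod μ) := by
    refine (integrable_prod_iff hsm).2 ⟨?_, ?_⟩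
    · filter_upwards [hZ0] with z hz
      by_cases h0 : dbar f z = 0
      · simp [hΦ, h0]
      · exact (H_int D hH.1 (hat_cont D (hdec z hz h0).1)).const_mul (dbar f z)
    · have hi : IntegrableOn (fun z => A * C0 * ∑ z0 ∈ Z, ‖z - z0‖ ^ a) (tsupport f) := by
        refine (integrable_finsetSum _ fun z0 _ => ?_).const_mul _
        obtain ⟨r, hr⟩ := hs.isCompact.isBounded.subset_ball z0
        exact (A_radial_loc ha z0 r).mono_set hr
      refine (hi.integrable_indicator (isClosed_tsupport f).measurableSet).mono' hsm.norm.integral_prod_right' ?_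
      filter_upwards [hZ0] with z hz
      rw [Real.norm_of_nonneg (integral_nonneg fun _ => norm_nonneg _), hΦn]
      have hsn : 0 ≤ ∑ z0 ∈ Z, ‖z - z0‖ ^ a := Finset.sum_nonneg fun _ _ => by positivity
      by_cases h0 : dbar f z = 0
      · rw [h0, norm_zero, zero_mul]; exact indicator_nonneg (fun w _ => mul_nonneg (by positivity) (Finset.sum_nonneg fun _ _ => by positivity)) _
      · obtain ⟨h1, z0, hz0, h2, -⟩ := hdec z hz h0
        rw [indicator_of_mem (hsup z h0)]
        have h3 := H_cs D hC0 hk hH.1 hH.2.1 h1 zero_le_one (hat_cont D h1) (fun t => by rw [norm_inv, one_mul])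
        calc _ ≤ ‖dbar f z‖ * (1 * (C0 * infDist z (frontier D.G) ^ (-(1/2):ℝ))) := by gcongr
          _ = C0 * (‖dbar f z‖ * infDist z (frontier D.G) ^ (-(1/2):ℝ)) := by ring
          _ ≤ C0 * (A * ‖z - z0‖ ^ a) := by gcongr
          _ ≤ C0 * (A * ∑ z0 ∈ Z, ‖z - z0‖ ^ a) := by
            gcongr; exact Finset.single_le_sum (f := fun z0 => ‖z - z0‖ ^ a) (fun _ _ => by positivity) hz0
          _ = _ := by ring
  have h5 : ∫ s, (∫ z, Φ (z, s)) ∂μ = ∫ z, dbar f z * hat D H z := by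
    rw [← integral_integral_swap (f := fun z s => Φ (z, s)) hΦi]
    refine integral_congr_ae (Eventually.of_forall fun z => ?_)
    simp only [hΦ, hat]; rw [integral_const_mul]
  have h6 : ∫ s, (∫ z, Φ (z, s)) ∂μ = -(Real.pi:ℂ) * ∫ s, H s * f (D.γ s) ∂μ := by
    rw [← integral_const_mul]
    refine integral_congr_ae ?_
    filter_upwards [hγ, hΦi.prod_left_ae] with s h1 h2
    by_cases h0 : H s = 0
    · simp [hΦ, h0]
    · have he : (fun z => Φ (z, s)) = fun z => H s * (dbar f z / (z - D.γ s)) := by ext z; simp only [hΦ]; ring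
      rw [he] at h2 ⊢
      have h3 := h2.const_mul (H s)⁻¹
      simp only [inv_mul_cancel_left₀ h0] at h3
      rw [integral_const_mul, Q_pompeiu hf hs (fun z0 _ => h4 z0) h1 h3]; ring
  have h7 : ‖∫ z, dbar f z * hat D H z‖ ≤ ∫ z, A * ∑ z0 ∈ Z, E z0 z := by
    refine norm_integral_le_of_norm_le ((integrable_finsetSum _ fun z0 _ => (hE z0).1).const_mul _) ?_
    filter_upwards [hZ0] with z hz
    rw [norm_mul]
    by_cases h0 : dbar f z = 0
    · rw [h0, norm_zero, zero_mul]; exact mul_nonneg hA.le (Finset.sum_nonneg fun _ _ => hE0 _ _)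
    · obtain ⟨_, z0, hz0, _, h2⟩ := hdec z hz h0
      refine h2.trans ?_
      gcongr; exact Finset.single_le_sum (f := fun z0 => E z0 z) (fun _ _ => hE0 _ _) hz0
  rw [← h5, h6, norm_mul, norm_neg, norm_real, Real.norm_of_nonneg Real.pi_pos.le, integral_const_mul, integral_finsetSum _ fun z0 _ => (hE z0).1] at h7
  refine le_trans ?_ (h7.trans ?_)
  · exact le_mul_of_one_le_left (norm_nonneg _) (by linarith [Real.pi_gt_three])
  · gcongr
    exact (Finset.sum_le_card_nsmul _ _ _ fun z0 _ => (hE z0).2).trans_eq (nsmul_eq_mul _ _)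

set_option maxHeartbeats 1000000 in
theorem sqrt_deriv_polynomial_approx_rate
    (D : JordanDomain) (B : PiecewiseAnalyticBoundary D)
    (lam : ℝ) (hlam0 : 0 < lam) (hlam2 : lam < 2)
    (hmin : ∀ i, lam ≤ B.extAngle i) (hattained : ∃ i, B.extAngle i = lam)
    (F : Set ℂ) (hF : IsCompact F) (hFG : F ⊆ D.G)
    (φ : ℂ → ℂ → ℂ) (hφ : ∀ ζ ∈ F, ConformalOnto D.G (φ ζ) ζ)
    (g : ℂ → ℂ → ℂ)
    (hgd : ∀ ζ ∈ F, DifferentiableOn ℂ (g ζ) D.G)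
    (hgsq : ∀ ζ ∈ F, ∀ z ∈ D.G, g ζ z ^ 2 = deriv (φ ζ) z)
    (hgζ : ∀ ζ ∈ F, ∃ c : ℝ, 0 < c ∧ g ζ ζ = (c : ℂ))
    (gb : ℂ → ℝ → ℂ)
    (hgb : ∀ ζ ∈ F, ∀ᵐ s ∂(volume.restrict (Ioc (0 : ℝ) D.l)),
      NTLim D.G (g ζ) (D.γ s) (gb ζ s)) :
    ∃ C : ℝ, 0 < C ∧ ∀ ζ ∈ F, ∀ n : ℕ, 0 < n →
      ∃ Q : Polynomial ℂ, Q.natDegree ≤ n ∧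
        D.bnorm (fun s => gb ζ s - Q.eval (D.γ s)) ≤
          C * (n : ℝ) ^ (-(lam / (4 - 2 * lam))) := by
  classical
  obtain ⟨K, s, -, hs, hK, T, U, η, Y, h, hYo, hYc, hY, R, hR⟩ := B_dec D B hlam0 hmin hF hFG
  have hcov := (B_cover hs hK h).1
  set Z : Finset ℂ := (Finset.range K).image (fun k => T k 0) ∪ (Finset.range K).image (fun k => T k 1) with hZd
  have hZ : ∀ z, z ∈ Z ↔ ∃ k < K, z = T k 0 ∨ z = T k 1 := fun z => by
    simp only [hZd, Finset.mem_union, Finset.mem_image, Finset.mem_range]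
    constructor
    · rintro (⟨k, hk, rfl⟩ | ⟨k, hk, rfl⟩)
      exacts [⟨k, hk, Or.inl rfl⟩, ⟨k, hk, Or.inr rfl⟩]
    · rintro ⟨k, hk, rfl | rfl⟩
      exacts [Or.inl ⟨k, hk, rfl⟩, Or.inr ⟨k, hk, rfl⟩]
  obtain ⟨C1, hC1, hglue⟩ := P_glue D hs hK h hF hFG hY hlam0 hlam2 hZ
  obtain ⟨C, hC, hker⟩ := H_ker D hK h
  rw [← Real.sq_sqrt hC.le] at hker
  have hC0 := Real.sqrt_pos.2 hC
  obtain ⟨C2, hC2, c, hc, hdecay⟩ := H_decay (K := K) D h hlam0 hYo hYc hY hR hC0 hker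
  set β := (1 / (2 - lam) - 1) / 2 with hβd
  have hβ : -(1/4) ≤ β := by
    have : 1 / 2 ≤ 1 / (2 - lam) := one_div_le_one_div_of_le (by linarith) (by linarith)
    simp only [β]; linarith
  have h1 := fun k => F_pt (h k).la (β - 1)
  choose P hP hpt using h1
  obtain ⟨M, hM, hrad⟩ := A_radial (a := β - 3/2) (by linarith) hc (one_div_pos.2 hlam0)
  have hexp : (β - 3/2 + 2) / (1 / lam) = lam / (4 - 2 * lam) := by
    have : 2 - lam ≠ 0 := by linarith
    have : 4 - 2 * lam ≠ 0 := by linarith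
    rw [hβd]; field_simp; ring
  set P0 := ∑ k ∈ Finset.range K, P k
  have hP0 : 0 ≤ P0 := Finset.sum_nonneg fun k _ => (hP k).le
  have hPk : ∀ k < K, P k ≤ P0 := fun k hk => Finset.single_le_sum (fun j _ => (hP j).le) (Finset.mem_range.2 hk)
  set A := C1 * (P0 + 1) * (P0 + C2) with hAd
  have hA : 0 < A := by positivity
  have hW : 0 ≤ √(1 / D.l) * (A * (Z.card * M)) := mul_nonneg (Real.sqrt_nonneg _) (mul_nonneg hA.le (mul_nonneg (Nat.cast_nonneg _) hM.le))
  refine ⟨√(1 / D.l) * (A * (Z.card * M)) + 1, add_pos_of_nonneg_of_pos hW one_pos, fun ζ hζ n hn => ?_⟩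
  have hn0 : 0 ≤ (n:ℝ) ^ (-(lam / (4 - 2 * lam))) := Real.rpow_nonneg (Nat.cast_nonneg _) _
  have hW' := mul_nonneg (add_nonneg hW zero_le_one) hn0
  obtain ⟨f, hf1, hf2, hf3, hf4, hf5⟩ := hglue ζ hζ (φ ζ) (g ζ) (hφ ζ hζ) (hgd ζ hζ) (hgsq ζ hζ)
  have hbd := F_bdy (fun k => (h k).la) hcov hZ hf5 (hgb ζ hζ)
  have hfm : AEStronglyMeasurable (gb ζ) (volume.restrict (Ioc 0 D.l)) := by
    have ho : IsOpen {s | D.γ s ∉ Z} := (Z.finite_toSet.isClosed.preimage D.γ_cont).isOpen_compl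
    have h2 : AEStronglyMeasurable (fun s => f (D.γ s)) ((volume.restrict (Ioc 0 D.l)).restrict {s | D.γ s ∉ Z}) :=
      ContinuousOn.aestronglyMeasurable (fun s hs => ((hf1 _ hs).continuousAt.comp D.γ_cont.continuousAt).continuousWithinAt) ho.measurableSet
    rw [Measure.restrict_eq_self_of_ae_mem (s := {s | D.γ s ∉ Z}) (hbd.mono fun s hs => hs.1)] at h2
    exact h2.congr (hbd.mono fun s hs => hs.2.symm)
  by_cases hL2 : MemLp (gb ζ) 2 (volume.restrict (Ioc 0 D.l))
  · obtain ⟨Q, hQ, N, hN, hbn, hN'⟩ := F_proj D n hL2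
    refine ⟨Q, hQ, ?_⟩
    rw [hbn]
    rcases hN' with rfl | ⟨H, hH, hHN⟩
    · rwa [mul_zero]
    have hdec : ∀ z ∉ Z, dbar f z ≠ 0 → z ∉ frontier D.G ∧ ∃ z0 ∈ Z, ‖dbar f z‖ * infDist z (frontier D.G) ^ (-(1/2):ℝ) ≤ A * ‖z - z0‖ ^ (β - 3/2) ∧
        ‖dbar f z‖ * ‖hat D H z‖ ≤ A * (‖z - z0‖ ^ (β - 3/2) * Real.exp (-c * n * ‖z - z0‖ ^ (1 / lam))) := by
      intro z hz h0
      obtain ⟨k, hk, w, hw, rfl, hwi, hb⟩ := hf4 z hz h0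
      obtain ⟨e, he, hne, hh⟩ := hdecay n hn H hH k hk w hw hwi
      obtain ⟨h2, h3⟩ := hpt k w hw hwi
      obtain ⟨h4, h5, h6⟩ := h3 e he hne
      refine ⟨h2, T k e, (hZ _).2 ⟨k, hk, he.imp (fun h => by rw [h]) fun h => by rw [h]⟩, ?_⟩
      set ρ := ‖T k w - T k e‖
      have h7 : ‖dbar f (T k w)‖ ≤ C1 * (P0 + 1) * ρ ^ (β - 1) := by
        refine hb.trans ?_
        rw [mul_assoc]
        gcongr
        refine h5.trans ?_
        gcongr; linarith [hPk k hk]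
      have h8 : ρ ^ (β - 3/2) = ρ ^ (β - 1) * ρ ^ (-(1/2):ℝ) := by rw [← Real.rpow_add h4]; congr 1; ring
      constructor
      · calc _ ≤ C1 * (P0 + 1) * ρ ^ (β - 1) * ((P0 + C2) * ρ ^ (-(1/2):ℝ)) := by
              gcongr
              · exact Real.rpow_nonneg infDist_nonneg _
              · refine h6.trans ?_
                gcongr; linarith [hPk k hk]
          _ = _ := by rw [h8]; ring
      · calc _ ≤ C1 * (P0 + 1) * ρ ^ (β - 1) * ((P0 + C2) * (ρ ^ (-(1/2):ℝ) * Real.exp (-c * n * ρ ^ (1 / lam)))) := by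
              gcongr
              refine hh.trans ?_
              gcongr; linarith
          _ = _ := by rw [h8]; ring
    have hfi := F_dual D (E := fun z0 z => ‖z - z0‖ ^ (β - 3/2) * Real.exp (-c * n * ‖z - z0‖ ^ (1 / lam))) hf1 hf2 hf3 hH (by linarith) hA hdec
      (fun _ _ => by positivity) (fun z0 => hrad z0 n hn) (hbd.mono fun s hs => hs.1) hC0 hker
    rw [← integral_congr_ae (hbd.mono fun s hs => congrArg (H s * ·) hs.2), hHN, norm_real, Real.norm_of_nonneg hN, hexp] at hfi
    calc _ ≤ √(1 / D.l) * (A * (Z.card * (M * (n:ℝ) ^ (-(lam / (4 - 2 * lam)))))) := mul_le_mul_of_nonneg_left hfi (Real.sqrt_nonneg _)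
      _ = √(1 / D.l) * (A * (Z.card * M)) * (n:ℝ) ^ (-(lam / (4 - 2 * lam))) := by ring
      _ ≤ _ := mul_le_mul_of_nonneg_right (le_add_of_nonneg_right zero_le_one) hn0
  · refine ⟨0, by simp, ?_⟩
    have h2 : D.bnorm (fun s => gb ζ s - (0 : Polynomial ℂ).eval (D.γ s)) = 0 := by
      simp only [Polynomial.eval_zero, sub_zero]
      rw [JordanDomain.bnorm, intervalIntegral.integral_of_le D.l_pos.le, integral_undef (fun h' => hL2 ((memLp_two_iff_integrable_sq_norm hfm).2 h')), mul_zero, Real.sqrt_zero]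
    rwa [h2]
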